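/- Let p > 3 be a prime. If p ≡ 1 (mod 3), write p = x^2 + 3y^2 with integers x, y; then Σ_{k=0}^{p−1} k^2·C(2k,k)^2·C(3k,k)/1458^k ≡ (56/1125)x^2 − (14/1125)(2 + (−1)^{(p−1)/2})p − 7p^2/(2250x^2) (mod p^3) and Σ_{k=0}^{p−1} k^3·C(2k,k)^2·C(3k,k)/1458^k ≡ (1/84375)·(904x^2 − (452 − 524(−1)^{(p−1)/2})p − 113p^2/(2x^2)) (mod p^3). If p ≡ 2 (mod 3) and p ≠ 5, then Σ_{k=0}^{p−1} k^2·C(2k,k)^2·C(3k,k)/1458^k ≡ (8/75)R_3(p) − (14/1125)(−1)^{(p−1)/2}·p (mod p^2) and Σ_{k=0}^{p−1} k^3·C(2k,k)^2·C(3k,k)/1458^k ≡ (8/625)R_3(p) + (524/84375)(−1)^{(p−1)/2}·p (mod p^2). Moreover, Σ_{k=0}^{p−1} (15k+2)·C(2k,k)^2·C(3k,k)/1458^k ≡ 2(−1)^{(p−1)/2}·p − (10/9)p^3·E_{p−3} (mod p^4). -/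

import Mathlib

/-- `a ≡ b (mod p^r)` for rationals: the numerator of `a - b` in lowest terms
is divisible by `p^r`. -/
def ratCongr (p r : ℕ) (a b : ℚ) : Prop := (p : ℤ)^r ∣ (a - b).num
/-- `R_3(p)`. -/
def R3 (p : ℕ) : ℚ :=
  (1 + 2*(p:ℚ) + 4/3*(2^(p-1) - 1) - 3/2*(3^(p-1) - 1)) *
    (((p-1)/2).choose (p/6) : ℚ)^2
/-- Euler numbers: `E_0 = 1`, `E_n = -∑_{k=1}^{⌊n/2⌋} C(n,2k)·E_{n-2k}` for `n ≥ 1`. -/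
def eulerE : ℕ → ℚ
  | 0 => 1
  | (n+1) => -∑ j ∈ Finset.range ((n+1)/2),
      ((n+1).choose (2*(j+1)) : ℚ) * eulerE (n - 1 - 2*j)
  decreasing_by omega

open Finset
set_option linter.unusedSectionVars false
set_option linter.style.longLine false
set_option linter.unusedVariables false
set_option linter.unusedSimpArgs false

/-- `M p r a`: the rational `a` is divisible by `p^r` in the ring of `p`-integral rationals. -/
def M (p r : ℕ) (a : ℚ) : Prop := padicNorm p a ≤ ((p:ℚ)^r)⁻¹

section
variable {p : ℕ} [hp : Fact p.Prime]

lemma p_pos' : (0:ℚ) < p := by exact_mod_cast hp.out.pos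

lemma M_zero (r : ℕ) : M p r 0 := by
  unfold M; rw [padicNorm.zero]; have := p_pos' (p := p); positivity

lemma M.add {r : ℕ} {a b : ℚ} (ha : M p r a) (hb : M p r b) : M p r (a+b) :=
  (padicNorm.nonarchimedean).trans (max_le ha hb)

lemma M.neg {r : ℕ} {a : ℚ} (ha : M p r a) : M p r (-a) := by
  unfold M at *; rwa [padicNorm.neg]

lemma M.sub {r : ℕ} {a b : ℚ} (ha : M p r a) (hb : M p r b) : M p r (a-b) := by
  rw [sub_eq_add_neg]; exact ha.add hb.neg

lemma M.mul {r s : ℕ} {a b : ℚ} (ha : M p r a) (hb : M p s b) : M p (r+s) (a*b) := by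
  unfold M at *
  rw [padicNorm.mul, pow_add, mul_inv]
  have := p_pos' (p := p)
  exact mul_le_mul ha hb (padicNorm.nonneg _) (by positivity)

lemma M.mono {r s : ℕ} {a : ℚ} (ha : M p r a) (h : s ≤ r) : M p s a := by
  unfold M at *
  refine ha.trans ?_
  have := p_pos' (p := p)
  have h1 : (1:ℚ) ≤ p := by exact_mod_cast hp.out.one_le
  gcongr

lemma M.z {r : ℕ} {a : ℚ} (ha : M p r a) : M p 0 a := ha.mono (Nat.zero_le _)

lemma M.mulr {r : ℕ} {a b : ℚ} (ha : M p r a) (hb : M p 0 b) : M p r (a*b) := by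
  simpa using ha.mul hb
lemma M.mull {r : ℕ} {a b : ℚ} (ha : M p 0 a) (hb : M p r b) : M p r (a*b) := by
  simpa using ha.mul hb

lemma M_int (z : ℤ) : M p 0 (z:ℚ) := by
  unfold M; simpa using padicNorm.of_int z
lemma M_nat (z : ℕ) : M p 0 (z:ℚ) := by exact_mod_cast M_int (p := p) (z:ℤ)
lemma M_one : M p 0 (1:ℚ) := by simpa using M_nat (p := p) 1

lemma M_p : M p 1 (p:ℚ) := by
  unfold M; rw [padicNorm.padicNorm_p_of_prime]; simp

lemma M.pow0 {a : ℚ} (ha : M p 0 a) (n : ℕ) : M p 0 (a^n) := by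
  induction n with
  | zero => simpa using M_one
  | succ n ih => rw [pow_succ]; exact ih.mul ha

lemma M.pow {r : ℕ} {a : ℚ} (ha : M p r a) (n : ℕ) : M p (r*n) (a^n) := by
  induction n with
  | zero => simpa using M_one
  | succ n ih => rw [pow_succ, Nat.mul_succ]; exact ih.mul ha

lemma M_ppow (n : ℕ) : M p n ((p:ℚ)^n) := by simpa using (M_p (p := p)).pow n

lemma M_sum {ι : Type*} {r : ℕ} (s : Finset ι) (f : ι → ℚ) (h : ∀ i ∈ s, M p r (f i)) :
    M p r (∑ i ∈ s, f i) := by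
  classical
  induction s using Finset.induction_on with
  | empty => simpa using M_zero r
  | insert a s ha ih =>
    rw [sum_insert ha]
    exact (h a (by simp)).add (ih fun i hi => h i (by simp [hi]))

lemma M_prod {ι : Type*} (s : Finset ι) (f : ι → ℚ) (h : ∀ i ∈ s, M p 0 (f i)) :
    M p 0 (∏ i ∈ s, f i) := by
  classical
  induction s using Finset.induction_on with
  | empty => simpa using M_one
  | insert a s ha ih =>
    rw [prod_insert ha]
    exact (h a (by simp)).mul (ih fun i hi => h i (by simp [hi]))

/-- `U p a`: `a` is a `p`-adic unit. -/
def U (p : ℕ) (a : ℚ) : Prop := padicNorm p a = 1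

lemma U.m0 {a : ℚ} (h : U p a) : M p 0 a := by unfold U at h; unfold M; simp [h]
lemma U.ne {a : ℚ} (h : U p a) : a ≠ 0 := by
  rintro rfl; unfold U at h; simp at h
lemma U.inv {a : ℚ} (h : U p a) : U p a⁻¹ := by
  unfold U at *
  have := padicNorm.mul (p := p) a a⁻¹
  rw [mul_inv_cancel₀ (U.ne h), h] at this; simpa using this.symm
lemma U.mul {a b : ℚ} (h : U p a) (h' : U p b) : U p (a*b) := by
  unfold U at *; rw [padicNorm.mul, h, h', one_mul]
lemma U_one : U p 1 := by unfold U; simp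
lemma U.neg {a : ℚ} (h : U p a) : U p (-a) := by unfold U at *; rwa [padicNorm.neg]
lemma U.pow {a : ℚ} (h : U p a) (n : ℕ) : U p (a^n) := by
  induction n with
  | zero => simpa using U_one
  | succ n ih => rw [pow_succ]; exact ih.mul h
lemma U.div {a b : ℚ} (h : U p a) (h' : U p b) : U p (a/b) := by
  rw [div_eq_mul_inv]; exact h.mul h'.inv
lemma M.div {r : ℕ} {a b : ℚ} (h : M p r a) (h' : U p b) : M p r (a/b) := by
  rw [div_eq_mul_inv]; exact h.mulr h'.inv.m0
lemma U_prod {ι : Type*} (s : Finset ι) (f : ι → ℚ) (h : ∀ i ∈ s, U p (f i)) :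
    U p (∏ i ∈ s, f i) := by
  classical
  induction s using Finset.induction_on with
  | empty => simpa using U_one
  | insert a s ha ih =>
    rw [prod_insert ha]
    exact (h a (by simp)).mul (ih fun i hi => h i (by simp [hi]))

lemma U_int {z : ℤ} (h : ¬ (p:ℤ) ∣ z) : U p (z:ℚ) := by
  unfold U; rwa [padicNorm.int_eq_one_iff]
lemma U_nat {z : ℕ} (h : ¬ p ∣ z) : U p (z:ℚ) := by
  unfold U; rwa [padicNorm.nat_eq_one_iff]
lemma U_of_lt {z : ℕ} (h0 : 0 < z) (h : z < p) : U p (z:ℚ) :=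
  U_nat (fun hd => absurd (Nat.le_of_dvd h0 hd) (by omega))

lemma U_factorial {n : ℕ} (h : n < p) : U p (n.factorial : ℚ) :=
  U_nat (fun hd => by rw [hp.out.dvd_factorial] at hd; omega)

lemma U.cancel {r : ℕ} {a b : ℚ} (h : U p a) (h' : M p r (a*b)) : M p r b := by
  have := h'.mulr h.inv.m0
  rwa [mul_comm a b, mul_assoc, mul_inv_cancel₀ h.ne, mul_one] at this

lemma U.congr {a b : ℚ} (h : U p a) (h' : M p 1 (b - a)) : U p b := by
  unfold U at *; unfold M at h'
  have hlt : padicNorm p (b - a) < padicNorm p a := by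
    rw [h]; refine h'.trans_lt ?_
    have h1 : (1:ℚ) < p := by exact_mod_cast hp.out.one_lt
    rw [pow_one]; exact inv_lt_one_of_one_lt₀ h1
  have := padicNorm.add_eq_max_of_ne (p := p) (q := b - a) (r := a) hlt.ne
  rw [sub_add_cancel, max_eq_right hlt.le, h] at this; exact this

lemma norm_ppow (r : ℕ) : padicNorm p ((p:ℚ)^r) = ((p:ℚ)^r)⁻¹ := by
  induction r with
  | zero => simp
  | succ n ih => rw [pow_succ, padicNorm.mul, ih, padicNorm.padicNorm_p_of_prime, mul_inv]

lemma M.exists {r : ℕ} {a : ℚ} (h : M p r a) : ∃ c, M p 0 c ∧ a = p^r * c := by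
  have hp0 := p_pos' (p := p)
  refine ⟨a / p^r, ?_, by field_simp⟩
  unfold M at *
  rw [padicNorm.div, norm_ppow, pow_zero, inv_one]
  rw [div_le_one (by positivity)]
  simpa using h

lemma M_of_eq {r : ℕ} {a c : ℚ} (hc : M p 0 c) (h : a = p^r * c) : M p r a := by
  rw [h]; exact (M_ppow r).mulr hc

lemma M.pcancel {r s : ℕ} {a : ℚ} (h : M p (s+r) (p^s * a)) : M p r a := by
  obtain ⟨c, hc, h⟩ := h.exists
  have hp0 := p_pos' (p := p)
  refine M_of_eq hc ?_
  rw [pow_add, mul_assoc] at h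
  exact mul_left_cancel₀ (by positivity) h

lemma M_iff_int {r : ℕ} {z : ℤ} : M p r (z:ℚ) ↔ (p:ℤ)^r ∣ z := by
  unfold M
  have := padicNorm.dvd_iff_norm_le (p := p) (n := r) (z := z)
  push_cast at this
  rw [this]; simp

lemma not_U_of_M {a : ℚ} (h : M p 1 a) : ¬ U p a := by
  unfold M U at *
  intro h'; rw [h', pow_one] at h
  have h1 : (1:ℚ) < p := by exact_mod_cast hp.out.one_lt
  have := inv_lt_one_of_one_lt₀ h1
  linarith

lemma U_or_M {a : ℚ} (h : M p 0 a) : U p a ∨ M p 1 a := by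
  by_cases h0 : a = 0
  · right; rw [h0]; exact M_zero _
  unfold M U at *
  have h1 : (1:ℚ) < p := by exact_mod_cast hp.out.one_lt
  rcases eq_or_lt_of_le h with h | h
  · left; simpa using h
  · right
    rw [padicNorm.eq_zpow_of_nonzero h0] at *
    simp at h
    rw [pow_one, ← zpow_neg_one]
    apply zpow_le_zpow_right₀ h1.le
    have h' : (p:ℚ)^(-padicValRat p a) < (p:ℚ)^(0:ℤ) := by simpa using h
    have := (zpow_lt_zpow_iff_right₀ h1).1 h'
    omega

lemma M_num {r : ℕ} {a : ℚ} (h : M p r a) : (p:ℤ)^r ∣ a.num := by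
  rw [← M_iff_int (p := p)]
  have := h.mulr (M_nat (p := p) a.den)
  rwa [Rat.mul_den_eq_num] at this

/-- transitivity -/
lemma M.tr {r : ℕ} {a b c : ℚ} (h : M p r (a-b)) (h' : M p r (b-c)) : M p r (a-c) := by
  have := h.add h'; rwa [sub_add_sub_cancel] at this
lemma M.sy {r : ℕ} {a b : ℚ} (h : M p r (a-b)) : M p r (b-a) := by
  have := h.neg; rwa [neg_sub] at this
lemma M.cmul {r : ℕ} {a b c d : ℚ} (h : M p r (a-b)) (h' : M p r (c-d)) (ha : M p 0 a) (hd : M p 0 d) :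
    M p r (a*c-b*d) := by
  have := (ha.mull h').add (h.mulr hd)
  convert this using 1; ring
lemma M.of0 {r : ℕ} {a b : ℚ} (h : M p r (a-b)) (h' : M p 0 b) : M p 0 a := by
  have := h.z.add h'; rwa [sub_add_cancel] at this
lemma M.cast {r : ℕ} {a b : ℚ} (h : M p r a) (e : b = a) : M p r b := e ▸ h
lemma M.m0 {a b : ℚ} (ha : M p 0 a) (hb : M p 0 b) : M p 0 (a*b) := ha.mulr hb
end
attribute [irreducible] U

/-- falling factorial -/
def ff (x : ℚ) (n : ℕ) : ℚ := ∏ i ∈ range n, (x - i)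
lemma ff_zero (x : ℚ) : ff x 0 = 1 := by simp [ff]
lemma ff_succ (x : ℚ) (n : ℕ) : ff x (n+1) = ff x n * (x - n) := by simp [ff, prod_range_succ]
lemma ff_succ' (x : ℚ) (n : ℕ) : ff x (n+1) = x * ff (x-1) n := by
  unfold ff; rw [prod_range_succ', mul_comm]; simp
  left; apply prod_congr rfl; intros; ring
lemma ff_nat (n k : ℕ) : ff (n:ℚ) k = (n.choose k : ℚ) * k.factorial := by
  induction k with
  | zero => simp [ff]
  | succ k ih =>
    rw [ff_succ, ih]
    by_cases h : k ≤ n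
    · have := Nat.choose_succ_right_eq n k
      have h2 : ((n.choose (k+1) : ℚ)) * (k+1) = n.choose k * (n - k) := by
        rw [← Nat.cast_sub h]; exact_mod_cast this
      rw [Nat.factorial_succ]; push_cast; linear_combination -(k.factorial:ℚ) * h2
    · rw [Nat.choose_eq_zero_of_lt (by omega), Nat.choose_eq_zero_of_lt (by omega)]; simp

/-- `(2i)!/i!^4` -/
def dc (i : ℕ) : ℚ := (2*i).factorial / (i.factorial:ℚ)^4
lemma dc_zero : dc 0 = 1 := by simp [dc]
lemma dc_succ (i : ℕ) : dc (i+1) = dc i * (2*(2*i+1)) / (i+1)^3 := by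
  unfold dc
  rw [show 2*(i+1) = 2*i+1+1 by ring, Nat.factorial_succ, Nat.factorial_succ, Nat.factorial_succ]
  have := Nat.factorial_ne_zero i
  push_cast; field_simp; ring
/-- Domb numbers -/
def Domb (n : ℕ) : ℚ := ∑ k ∈ range (n+1), (n.factorial:ℚ)^2 * dc k * dc (n-k)

lemma Domb_rec (N : ℕ) : ((N:ℚ)+2)^3 * Domb (N+2) - 2*(2*N+3)*(5*(N+1)^2+5*(N+1)+2)*Domb (N+1)
    + 64*(N+1)^3*Domb N = 0 := by
  have key : ∀ K ≤ N+1, ∑ k ∈ range K, (((N:ℚ)+2)^3 * (((N+2).factorial:ℚ)^2 * dc k * dc (N+2-k))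
      - 2*(2*N+3)*(5*(N+1)^2+5*(N+1)+2)*(((N+1).factorial:ℚ)^2 * dc k * dc (N+1-k))
    + 64*(N+1)^3*((N.factorial:ℚ)^2 * dc k * dc (N-k))) =
    (K:ℚ)^3 * (8*K^3-(36*(N+1)+24)*K^2+(52*(N+1)^2+74*(N+1)+22)*K
      +(-24*(N+1)^3-52*(N+1)^2-32*(N+1)-4)) * ((N+1).factorial:ℚ)^2 * dc K * dc (N+2-K)/(2*(2*(N+1-K)+1)) := by
    intro K
    induction K with
    | zero => intro; simp
    | succ K ih =>
      intro hK
      rw [sum_range_succ, ih (by omega)]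
      obtain ⟨m, rfl⟩ : ∃ m, N = K + m := ⟨N-K, by omega⟩
      rw [show K+m+2-K = m+1+1 by omega, show K+m+1-K = m+1 by omega, show K+m-K = m by omega,
        show K+m+2-(K+1) = m+1 by omega, dc_succ (m+1), dc_succ m, dc_succ K,
        show (K+m+2).factorial = (K+m+2)*((K+m+1)*(K+m).factorial) by
          rw [Nat.factorial_succ, Nat.factorial_succ],
        show (K+m+1).factorial = ((K+m+1)*(K+m).factorial) by
          rw [Nat.factorial_succ]]
      have h1 : (2*((m:ℚ)+1)+1) ≠ 0 := by positivity
      have h2 : (2*((m:ℚ))+1) ≠ 0 := by positivity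
      have h3 : (((K + m : ℕ) : ℚ) + 1 - (K:ℕ)) = m + 1 := by push_cast; ring
      have h4 : (((K + m : ℕ) : ℚ) + 1 - ((K+1:ℕ):ℚ)) = m := by push_cast; ring
      rw [h3, h4]
      push_cast
      field_simp
      ring
  have h := key (N+1) le_rfl
  have e2 : Domb (N+2) = ∑ k ∈ range (N+1), (((N+2).factorial:ℚ)^2 * dc k * dc (N+2-k))
      + ((N+2).factorial:ℚ)^2 * dc (N+1) * dc 1 + ((N+2).factorial:ℚ)^2 * dc (N+2) * dc 0 := by
    unfold Domb; rw [sum_range_succ, sum_range_succ, show N+2-(N+1) = 1 by omega, show N+2-(N+2) = 0 by omega]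
  have e1 : Domb (N+1) = ∑ k ∈ range (N+1), (((N+1).factorial:ℚ)^2 * dc k * dc (N+1-k))
      + ((N+1).factorial:ℚ)^2 * dc (N+1) * dc 0 := by
    unfold Domb; rw [sum_range_succ, show N+1-(N+1) = 0 by omega]
  have e0 : Domb N = ∑ k ∈ range (N+1), ((N.factorial:ℚ)^2 * dc k * dc (N-k)) := rfl
  rw [sum_add_distrib, sum_sub_distrib, ← mul_sum, ← mul_sum, ← mul_sum] at h
  rw [e2, e1, e0]
  rw [show N+2-(N+1) = 0+1 by omega, dc_succ 0, dc_zero] at h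
  have hd : dc (N+2) * (N+2)^3 = dc (N+1) * (2*(2*(N+1)+1)) := by
    rw [dc_succ (N+1)]; push_cast; field_simp; ring
  have hf : ((N+2).factorial : ℚ) = (N+2) * (N+1).factorial := by
    rw [Nat.factorial_succ]; push_cast; ring
  rw [show dc 1 = 2 by rw [show 1=0+1 by rfl, dc_succ, dc_zero]; norm_num, dc_zero]
  have h4 : ((N : ℚ) + 1 - ((N+1:ℕ):ℚ)) = 0 := by push_cast; ring
  rw [h4] at h
  generalize ∑ x ∈ range (N + 1), (((N+2).factorial:ℚ)^2 * dc x * dc (N+2-x)) = S2 at *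
  generalize ∑ x ∈ range (N + 1), (((N+1).factorial:ℚ)^2 * dc x * dc (N+1-x)) = S1 at *
  generalize ∑ x ∈ range (N + 1), (((N).factorial:ℚ)^2 * dc x * dc (N-x)) = S0 at *
  rw [hf]
  push_cast at h
  linear_combination h + ((N:ℚ)+2)^2 * ((N+1).factorial:ℚ)^2 * hd

/-- terms of first representation -/
def t1 (N : ℚ) (k : ℕ) : ℚ := (2*k).factorial / (k.factorial:ℚ)^5 * ff (N+k) (3*k) / 16^k
def G1c (N : ℚ) : ℕ → ℚ
  | 0 => 0
  | (k+1) => -48*(3*N+1)*(k+1)^4*((2*(k+1)).factorial / ((k+1).factorial:ℚ)^5) * ff (N+k) (3*k+1)/16^(k+1)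

lemma t1_zero (N : ℚ) : t1 N 0 = 1 := by simp [t1, ff]
lemma t1_tel (N : ℚ) (k : ℕ) : 4*(N+1)^3*t1 (N+1) k - 2*(2*N+1)*(5*N^2+5*N+2)*t1 N k
    + 16*N^3*t1 (N-1) k = G1c N (k+1) - G1c N k := by
  cases k with
  | zero => simp [t1, ff, G1c]; ring
  | succ k =>
    simp only [t1, G1c]
    have a1 : ff (N+1+((k+1:ℕ):ℚ)) (3*(k+1)) = (N+k+2)*(N+k+1)*ff (N+k) (3*k+1) := by
      rw [show 3*(k+1) = 3*k+1+1+1 by ring, ff_succ', ff_succ']; push_cast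
      rw [show N+1+((k:ℚ)+1)-1-1 = N+k by ring]; ring
    have a2 : ff (N+((k+1:ℕ):ℚ)) (3*(k+1)) = (N+k+1)*(N-2*k-1)*ff (N+k) (3*k+1) := by
      rw [show 3*(k+1) = 3*k+1+1+1 by ring, ff_succ', ff_succ]; push_cast
      rw [show N+((k:ℚ)+1)-1 = N+k by ring]; ring
    have a3 : ff (N-1+((k+1:ℕ):ℚ)) (3*(k+1)) = (N-2*k-1)*(N-2*k-2)*ff (N+k) (3*k+1) := by
      rw [show 3*(k+1) = 3*k+1+1+1 by ring, ff_succ, ff_succ]; push_cast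
      rw [show N-1+((k:ℚ)+1) = N+k by ring]; ring
    have a4 : ff (N+((k+1:ℕ):ℚ)) (3*(k+1)+1) = (N+k+1)*(N-2*k-1)*(N-2*k-2)*ff (N+k) (3*k+1) := by
      rw [ff_succ, a2]; push_cast; ring
    have f1 : (2*(k+1+1)).factorial = (2*(k+1)+2)*((2*(k+1)+1)*(2*(k+1)).factorial) := by
      rw [show 2*(k+1+1) = 2*(k+1)+1+1 by ring, Nat.factorial_succ, Nat.factorial_succ]
    have f2 : (k+1+1).factorial = (k+1+1)*(k+1).factorial := Nat.factorial_succ _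
    rw [a1, a2, a3, a4, f1, f2]
    have := Nat.factorial_ne_zero (k+1)
    push_cast
    generalize ff (N+k) (3*k+1) = P
    generalize (((2*(k+1)).factorial:ℕ):ℚ) = Q
    have h5 : (((k+1).factorial:ℕ):ℚ) ≠ 0 := by exact_mod_cast this
    generalize (((k+1).factorial:ℕ):ℚ) = S at *
    rw [show (16:ℚ)^(k+1+1) = 16*(16^(k+1)) by ring]
    generalize (16:ℚ)^(k+1) = z
    field_simp
    ring

lemma t1_rec (N : ℚ) (K : ℕ) : 4*(N+1)^3*(∑ k ∈ range K, t1 (N+1) k)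
   - 2*(2*N+1)*(5*N^2+5*N+2)*(∑ k ∈ range K, t1 N k)
    + 16*N^3*(∑ k ∈ range K, t1 (N-1) k) = G1c N K := by
  rw [mul_sum, mul_sum, mul_sum, ← sum_sub_distrib, ← sum_add_distrib,
    sum_congr rfl (fun k _ => t1_tel N k), sum_range_sub]
  simp [G1c]

lemma ff_nat_zero {n k : ℕ} (h : n < k) : ff (n:ℚ) k = 0 := by
  rw [ff_nat, Nat.choose_eq_zero_of_lt h]; simp

lemma rep1 (n K : ℕ) (h : n < 2*K) : Domb n = 4^n * ∑ k ∈ range K, t1 n k := by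
  have stab : ∀ n K : ℕ, n < 2*K → ∑ k ∈ range K, t1 (n:ℚ) k = ∑ k ∈ range (n+1), t1 (n:ℚ) k := by
    intro n K h
    have : ∀ k : ℕ, n < 2*k → t1 (n:ℚ) k = 0 := by
      intro k hk
      unfold t1
      rw [show (n:ℚ)+k = ((n+k:ℕ):ℚ) by push_cast; ring, ff_nat_zero (by omega)]; simp
    rcases le_total K (n+1) with h1 | h1
    · refine sum_subset (by intro x; simp; omega) ?_
      intro k _ hk; apply this; simp at hk; omega
    · symm
      refine sum_subset (by intro x; simp; omega) ?_
      intro k _ hk; apply this; simp at hk; omega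
  have main : ∀ n, (Domb n = 4^n * ∑ k ∈ range (n+1), t1 n k) ∧
      (Domb (n+1) = 4^(n+1) * ∑ k ∈ range (n+1+1), t1 ((n+1:ℕ):ℚ) k) := by
    intro n
    induction n with
    | zero =>
      constructor
      · simp [Domb, dc, t1, ff]
      · simp [Domb, dc, t1, ff, sum_range_succ, prod_range_succ, Nat.factorial]; norm_num
    | succ n ih =>
      refine ⟨ih.2, ?_⟩
      have hr := t1_rec ((n:ℚ)+1) (n+3)
      have hg : G1c ((n:ℚ)+1) (n+3) = 0 := by
        simp only [G1c]
        rw [show (n:ℚ)+1+((n+2:ℕ):ℚ) = ((n+1+(n+2):ℕ):ℚ) by push_cast; ring, ff_nat_zero (by omega)]; simp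
      rw [hg] at hr
      have hD := Domb_rec n
      have a0 := ih.1
      have a1 := ih.2
      rw [← stab n (n+3) (by omega)] at a0
      rw [← stab (n+1) (n+3) (by omega)] at a1
      rw [show (n:ℚ)+1-1 = n by ring] at hr
      rw [show n+1+1+1 = n+3 by ring]
      push_cast at a1 ⊢
      rw [a0, a1] at hD
      have h2 : ((n:ℚ)+2)^3 ≠ 0 := by positivity
      apply mul_left_cancel₀ h2
      rw [show (n:ℚ)+1+1 = n+2 by ring] at hr ⊢
      linear_combination hD - 4^(n+1)*hr
  rw [(main n).1, stab n K h]

lemma rep2 (n K : ℕ) (h : n < K) : Domb n = 16^n * ∑ k ∈ range K, t1 (-1-n) k := by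
  have van : ∀ (n k : ℕ) (j:ℕ), n + 1 ≤ k → k ≤ n+j → ff (-1-(n:ℚ)+k) j = 0 := by
    intro n k j h h2
    rw [show -1-(n:ℚ)+k = ((k-1-n:ℕ):ℚ) by
      rw [Nat.sub_sub, Nat.cast_sub (by omega)]; push_cast; ring]
    exact ff_nat_zero (by omega)
  have stab : ∀ n K : ℕ, n < K → ∑ k ∈ range K, t1 (-1-(n:ℚ)) k = ∑ k ∈ range (n+1), t1 (-1-(n:ℚ)) k := by
    intro n K h
    have : ∀ k : ℕ, n < k → t1 (-1-(n:ℚ)) k = 0 := by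
      intro k hk
      unfold t1
      rw [van n k _ (by omega) (by omega)]; simp
    symm
    refine sum_subset (by intro x; simp; omega) ?_
    intro k _ hk; apply this; simp at hk; omega
  have main : ∀ n, (Domb n = 16^n * ∑ k ∈ range (n+1), t1 (-1-n) k) ∧
      (Domb (n+1) = 16^(n+1) * ∑ k ∈ range (n+1+1), t1 (-1-((n+1:ℕ):ℚ)) k) := by
    intro n
    induction n with
    | zero =>
      constructor
      · simp [Domb, dc, t1, ff]
      · simp [Domb, dc, t1, ff, sum_range_succ, prod_range_succ, Nat.factorial]; norm_num
    | succ n ih =>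
      refine ⟨ih.2, ?_⟩
      have hr := t1_rec (-1-((n:ℚ)+1)) (n+3)
      have hg : G1c (-1-((n:ℚ)+1)) (n+3) = 0 := by
        simp only [G1c]
        have := van (n+1) (n+2) (3*(n+2)+1) (by omega) (by omega)
        push_cast at this ⊢
        rw [this]; simp
      rw [hg] at hr
      have hD := Domb_rec n
      have a0 := ih.1
      have a1 := ih.2
      rw [← stab n (n+3) (by omega)] at a0
      rw [← stab (n+1) (n+3) (by omega)] at a1
      rw [show n+1+1+1 = n+3 by ring]
      push_cast at a1 ⊢
      rw [a0, a1] at hD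
      have h2 : ((n:ℚ)+2)^3 ≠ 0 := by positivity
      apply mul_left_cancel₀ h2
      rw [show -1-((n:ℚ)+1)-1 = -1-((n:ℚ)+1+1) by ring, show -1-((n:ℚ)+1)+1 = -1-n by ring] at hr
      linear_combination hD + 16^(n+1)*hr
  rw [(main n).1, stab n K h]

lemma Domb_eq (n : ℕ) : Domb n = ∑ k ∈ range (n+1), ((n.choose k : ℚ))^2 * ((2*k).choose k) * ((2*(n-k)).choose (n-k)) := by
  unfold Domb
  apply sum_congr rfl
  intro k hk
  have hk' : k ≤ n := by simp at hk; omega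
  unfold dc
  rw [Nat.cast_choose ℚ hk', Nat.cast_choose ℚ (show k ≤ 2*k by omega), Nat.cast_choose ℚ (show n-k ≤ 2*(n-k) by omega),
    show 2*k-k = k by omega, show 2*(n-k)-(n-k) = n-k by omega]
  have h1 := Nat.factorial_ne_zero k
  have h2 := Nat.factorial_ne_zero (n-k)
  field_simp

section
variable {p : ℕ} [hp : Fact p.Prime]

lemma M0_iff {a : ℚ} : M p 0 a ↔ ‖(a:ℚ_[p])‖ ≤ 1 := by
  unfold M; rw [Padic.eq_padicNorm]; simp; norm_cast

open Classical in
/-- the `p`-adic integer attached to a `p`-integral rational -/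
noncomputable def zl (p : ℕ) [hp : Fact p.Prime] (a : ℚ) : ℤ_[p] :=
  if h : ∃ z : ℤ_[p], (z:ℚ_[p]) = a then h.choose else 0

lemma zl_coe {a : ℚ} (h : M p 0 a) : ((zl p a : ℤ_[p]) : ℚ_[p]) = a := by
  rw [M0_iff] at h
  have h' : ∃ z : ℤ_[p], (z:ℚ_[p]) = a := ⟨⟨(a:ℚ_[p]), h⟩, rfl⟩
  unfold zl; rw [dif_pos h']; exact h'.choose_spec

lemma zl_add {a b : ℚ} (ha : M p 0 a) (hb : M p 0 b) : zl p (a+b) = zl p a + zl p b := by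
  apply PadicInt.ext
  rw [PadicInt.coe_add, zl_coe ha, zl_coe hb, zl_coe (ha.add hb)]; push_cast; rfl
lemma zl_mul {a b : ℚ} (ha : M p 0 a) (hb : M p 0 b) : zl p (a*b) = zl p a * zl p b := by
  apply PadicInt.ext
  rw [PadicInt.coe_mul, zl_coe ha, zl_coe hb, zl_coe (ha.mul hb)]; push_cast; rfl
lemma zl_nat (n : ℕ) : zl p (n:ℚ) = n := by
  apply PadicInt.ext
  rw [PadicInt.coe_natCast, zl_coe (M_nat n)]; push_cast; rfl

/-- reduction mod `p` -/
noncomputable def rd (p : ℕ) [hp : Fact p.Prime] (a : ℚ) : ZMod p := PadicInt.toZMod (zl p a)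

lemma rd_add {a b : ℚ} (ha : M p 0 a) (hb : M p 0 b) : rd p (a+b) = rd p a + rd p b := by
  unfold rd; rw [zl_add ha hb, map_add]
lemma rd_mul {a b : ℚ} (ha : M p 0 a) (hb : M p 0 b) : rd p (a*b) = rd p a * rd p b := by
  unfold rd; rw [zl_mul ha hb, map_mul]
lemma rd_nat (n : ℕ) : rd p (n:ℚ) = n := by
  unfold rd; rw [zl_nat, map_natCast]
lemma rd_zero : rd p 0 = 0 := by simpa using rd_nat (p := p) 0
lemma rd_one : rd p 1 = 1 := by simpa using rd_nat (p := p) 1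
lemma rd_neg {a : ℚ} (ha : M p 0 a) : rd p (-a) = - rd p a := by
  have := rd_add ha ha.neg
  rw [add_neg_cancel, rd_zero] at this
  exact (neg_eq_of_add_eq_zero_right this.symm).symm
lemma rd_sub {a b : ℚ} (ha : M p 0 a) (hb : M p 0 b) : rd p (a-b) = rd p a - rd p b := by
  rw [sub_eq_add_neg, rd_add ha hb.neg, rd_neg hb, sub_eq_add_neg]
lemma rd_inv {a : ℚ} (ha : U p a) : rd p a⁻¹ = (rd p a)⁻¹ := by
  have := rd_mul ha.m0 ha.inv.m0
  rw [mul_inv_cancel₀ ha.ne, rd_one] at this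
  exact eq_inv_of_mul_eq_one_right this.symm
lemma rd_sum {ι : Type*} (s : Finset ι) (f : ι → ℚ) (h : ∀ i ∈ s, M p 0 (f i)) :
    rd p (∑ i ∈ s, f i) = ∑ i ∈ s, rd p (f i) := by
  classical
  induction s using Finset.induction_on with
  | empty => simpa using rd_zero
  | insert a s ha ih =>
    rw [sum_insert ha, sum_insert ha, rd_add (h a (by simp)) (M_sum _ _ (fun i hi => h i (by simp [hi]))),
      ih (fun i hi => h i (by simp [hi]))]
lemma rd_prod {ι : Type*} (s : Finset ι) (f : ι → ℚ) (h : ∀ i ∈ s, M p 0 (f i)) :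
    rd p (∏ i ∈ s, f i) = ∏ i ∈ s, rd p (f i) := by
  classical
  induction s using Finset.induction_on with
  | empty => simpa using rd_one
  | insert a s ha ih =>
    rw [prod_insert ha, prod_insert ha, rd_mul (h a (by simp)) (M_prod _ _ (fun i hi => h i (by simp [hi]))),
      ih (fun i hi => h i (by simp [hi]))]
lemma rd_pow {a : ℚ} (ha : M p 0 a) (n : ℕ) : rd p (a^n) = (rd p a)^n := by
  induction n with
  | zero => simpa using rd_one
  | succ n ih => rw [pow_succ, pow_succ, rd_mul (ha.pow0 n) ha, ih]
lemma rd_eq_zero {a : ℚ} (ha : M p 0 a) : rd p a = 0 ↔ M p 1 a := by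
  constructor
  · intro h
    rcases U_or_M ha with hu | hm
    · exfalso
      have := rd_mul hu.m0 hu.inv.m0
      rw [mul_inv_cancel₀ hu.ne, rd_one, h, zero_mul] at this
      exact one_ne_zero this
    · exact hm
  · intro h
    obtain ⟨c, hc, rfl⟩ := h.exists
    rw [pow_one, rd_mul (M_nat p) hc, rd_nat]; simp
lemma rd_eq_iff {a b : ℚ} (ha : M p 0 a) (hb : M p 0 b) : rd p a = rd p b ↔ M p 1 (a-b) := by
  rw [← rd_eq_zero (ha.sub hb), rd_sub ha hb, sub_eq_zero]

lemma sum_range_zmod {R : Type*} [AddCommMonoid R] (f : ZMod p → R) : ∑ i ∈ range p, f (i:ZMod p) = ∑ x, f x := by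
  refine sum_bij' (fun i _ => (i:ZMod p)) (fun x _ => x.val) ?_ ?_ ?_ ?_ ?_
  · intros; simp
  · intro x _; simp [ZMod.val_lt]
  · intro i hi; simp at hi; simp [ZMod.val_natCast, Nat.mod_eq_of_lt hi]
  · intro x _; simp
  · intros; rfl

lemma U_range {i : ℕ} (h : i < p) (h0 : i ≠ 0) : U p (i:ℚ) := U_of_lt (by omega) h

/-- `∑ 1/i^k ≡ 0 (mod p)` -/
lemma sum_inv_pow (k : ℕ) (h0 : 0 < k) (h : k < p - 1) : M p 1 (∑ i ∈ range p, ((i:ℚ)⁻¹)^k) := by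
  have hm : ∀ i ∈ range p, M p 0 (((i:ℚ)⁻¹)^k) := by
    intro i hi
    by_cases h1 : i = 0
    · subst h1; simp [h0.ne']; exact M_zero _
    · exact ((U_range (by simpa using hi) h1).inv.pow k).m0
  rw [← rd_eq_zero (M_sum _ _ hm), rd_sum _ _ hm]
  have : ∀ i ∈ range p, rd p (((i:ℚ)⁻¹)^k) = (i:ZMod p)^(p-1-k) := by
    intro i hi
    by_cases h1 : i = 0
    · subst h1; simp [h0.ne', rd_zero]; rw [zero_pow (by omega)]
    · have hu := U_range (p := p) (by simpa using hi) h1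
      rw [rd_pow hu.inv.m0, rd_inv hu, rd_nat]
      have hne : (i:ZMod p) ≠ 0 := by
        intro hz; rw [ZMod.natCast_eq_zero_iff] at hz
        have := Nat.le_of_dvd (by omega) hz; simp at hi; omega
      have hf := ZMod.pow_card_sub_one_eq_one hne
      rw [inv_pow]
      exact inv_eq_of_mul_eq_one_right (by rw [← pow_add, Nat.add_sub_cancel' (by omega), hf])
  rw [sum_congr rfl this, sum_range_zmod (fun x => x^(p-1-k))]
  apply FiniteField.sum_pow_lt_card_sub_one
  rw [ZMod.card]; omega
end

section
variable {p : ℕ} [hp : Fact p.Prime]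

lemma U_two (h3 : 3 < p) : U p 2 := by exact_mod_cast U_of_lt (p := p) (z := 2) (by omega) (by omega)
lemma U_three (h3 : 3 < p) : U p 3 := by exact_mod_cast U_of_lt (p := p) (z := 3) (by omega) (by omega)
lemma U_four (h3 : 3 < p) : U p 4 := by have := (U_two h3).mul (U_two h3); norm_num at this; exact this
lemma M_inv (i : ℕ) (h : i < p) : M p 0 ((i:ℚ)⁻¹) := by
  by_cases h0 : i = 0
  · subst h0; simpa using M_zero _
  · exact (U_range h h0).inv.m0

lemma prod_exp {ι : Type*} (h3 : 3 < p) {x : ℚ} (hx : M p 1 x) (s : Finset ι) (c : ι → ℚ) (hc : ∀ i ∈ s, M p 0 (c i)) :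
    M p 3 (∏ i ∈ s, (1 + x * c i) - (1 + x * ∑ i ∈ s, c i + x^2 * (((∑ i ∈ s, c i)^2 - ∑ i ∈ s, (c i)^2)/2))) := by
  classical
  induction s using Finset.induction_on with
  | empty => simpa using M_zero 3
  | insert a s ha ih =>
    have ih := ih (fun i hi => hc i (by simp [hi]))
    have ca := hc a (by simp)
    rw [prod_insert ha, sum_insert ha, sum_insert ha]
    have h1 : M p 0 (∑ i ∈ s, c i) := M_sum _ _ (fun i hi => hc i (by simp [hi]))
    have h2 : M p 0 (∑ i ∈ s, (c i)^2) := M_sum _ _ (fun i hi => (hc i (by simp [hi])).pow0 2)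
    have e2 : M p 0 (((∑ i ∈ s, c i)^2 - ∑ i ∈ s, (c i)^2)/2) := ((h1.pow0 2).sub h2).div (U_two h3)
    have k1 := (M_one.add (hx.z.m0 ca)).mull ih
    have k2 : M p 3 (x^3 * (c a * (((∑ i ∈ s, c i)^2 - ∑ i ∈ s, (c i)^2)/2))) := (hx.pow 3).mulr (ca.m0 e2)
    refine (k1.add k2).cast ?_
    ring

lemma harm_two (h3 : 3 < p) : M p 1 (∑ i ∈ range p, ((i:ℚ)⁻¹)^2) := sum_inv_pow 2 (by omega) (by omega)

lemma harm_one (h3 : 3 < p) : M p 2 (∑ i ∈ range p, ((i:ℚ)⁻¹)) := by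
  -- reflect
  obtain ⟨q, rfl⟩ : ∃ q, p = q + 1 := ⟨p-1, by omega⟩
  have hs : ∑ i ∈ range (q+1), ((i:ℚ)⁻¹) = ∑ i ∈ range q, (((i+1:ℕ):ℚ)⁻¹) := by
    rw [sum_range_succ']; simp
  have hs2 : ∑ i ∈ range (q+1), ((i:ℚ)⁻¹)^2 = ∑ i ∈ range q, (((i+1:ℕ):ℚ)⁻¹)^2 := by
    rw [sum_range_succ']; simp
  have h2 := harm_two h3
  rw [hs2] at h2
  rw [hs]
  have hr : ∑ i ∈ range q, (((i+1:ℕ):ℚ)⁻¹) = ∑ i ∈ range q, (((q-i:ℕ):ℚ)⁻¹) := by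
    rw [← sum_range_reflect]
    apply sum_congr rfl; intro i hi; simp at hi
    rw [show q-1-i+1 = q-i by omega]
  have key : M (q+1) 2 (∑ i ∈ range q, ((((i+1:ℕ):ℚ)⁻¹) + (((q-i:ℕ):ℚ)⁻¹)) + ((q+1:ℕ):ℚ) * ∑ i ∈ range q, (((i+1:ℕ):ℚ)⁻¹)^2) := by
    rw [mul_sum, ← sum_add_distrib]
    apply M_sum
    intro i hi; simp at hi
    have u1 : U (q+1) (((i+1:ℕ):ℚ)) := U_of_lt (by omega) (by omega)
    have u2 : U (q+1) (((q-i:ℕ):ℚ)) := U_of_lt (by omega) (by omega)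
    have : ((((i+1:ℕ):ℚ)⁻¹) + (((q-i:ℕ):ℚ)⁻¹)) + ((q+1:ℕ):ℚ) * (((i+1:ℕ):ℚ)⁻¹)^2
        = ((q+1:ℕ):ℚ)^2 * ((((i+1:ℕ):ℚ)⁻¹)^2 * (((q-i:ℕ):ℚ)⁻¹)) := by
      have e : ((q-i:ℕ):ℚ) = ((q+1:ℕ):ℚ) - ((i+1:ℕ):ℚ) := by
        rw [Nat.cast_sub (by omega)]; push_cast; ring
      have n1 := u1.ne
      have n2 := u2.ne
      rw [e] at n2 ⊢
      field_simp; ring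
    rw [this]
    exact (M_ppow 2).mulr ((u1.inv.m0.pow0 2).mul u2.inv.m0)
  rw [sum_add_distrib, ← hr] at key
  have k2 := (M_p (p := q+1)).mul h2
  have := key.sub k2
  rw [add_sub_cancel_right, ← two_mul] at this
  exact (U_two h3).cancel this

lemma wol_prod (h3 : 3 < p) {x : ℚ} (hx : M p 1 x) : M p 3 (∏ i ∈ range p, (1 + x * (i:ℚ)⁻¹) - 1) := by
  have h := prod_exp h3 hx (range p) (fun i => (i:ℚ)⁻¹) (fun i hi => M_inv i (by simpa using hi))
  have h1 := harm_one h3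
  have h2 := harm_two h3
  have a1 := hx.mul h1
  have a2 := (hx.pow 2).mul ((((h1.pow 2).mono (show 1 ≤ 2*2 by omega)).sub h2).div (U_two h3))
  exact ((h.add a1).add a2).cast (by ring)

/-- `(pa)! = p^a a! (p-1)!^a fr a`, `fr a ≡ 1 (mod p^3)` -/
lemma fr_ex (h3 : 3 < p) (a : ℕ) : ∃ f : ℚ, M p 3 (f - 1) ∧ ((p*a).factorial:ℚ) = p^a * a.factorial * ((p-1).factorial:ℚ)^a * f := by
  induction a with
  | zero => exact ⟨1, by simpa using M_zero 3, by simp⟩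
  | succ a ih =>
    obtain ⟨f, hf, e⟩ := ih
    have hw := wol_prod h3 (x := (p:ℚ)*a) (M_p.mulr (M_nat a))
    refine ⟨f * ∏ i ∈ range p, (1 + (p:ℚ)*a * (i:ℚ)⁻¹), ?_, ?_⟩
    · exact ((hf.mulr (hw.of0 M_one)).add hw).cast (by ring)
    · obtain ⟨q, hq⟩ : ∃ q, p = q + 1 := ⟨p-1, by omega⟩
      have key : ∀ r, ((p*a+r).factorial:ℚ) = (p*a).factorial * r.factorial * ∏ i ∈ range (r+1), (1 + (p:ℚ)*a * (i:ℚ)⁻¹) := by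
        intro r
        induction r with
        | zero => simp
        | succ r ih =>
          rw [← add_assoc, Nat.factorial_succ, Nat.factorial_succ, prod_range_succ]
          push_cast at ih ⊢
          rw [ih]
          have : (r:ℚ)+1 ≠ 0 := by positivity
          field_simp; ring
      have k := key q
      have e2 : ((p*(a+1)).factorial:ℚ) = p*(a+1) * (p*a+q).factorial := by
        rw [show p*(a+1) = p*a+q+1 by rw [mul_add, mul_one]; omega, Nat.factorial_succ,
          show p*a+q+1 = p*(a+1) by rw [mul_add, mul_one]; omega]; push_cast; ring
      rw [e2, k, e, ← hq, show p-1 = q by omega, Nat.factorial_succ]; push_cast; ring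

lemma U1 {f : ℚ} {r : ℕ} (h : M p (r+1) (f-1)) : U p f := U_one.congr (h.mono (by omega))

lemma choose_p (h3 : 3 < p) (a b : ℕ) : M p 3 (((p*a).choose (p*b) : ℚ) - a.choose b) := by
  by_cases h : b ≤ a
  · obtain ⟨c, rfl⟩ := Nat.exists_eq_add_of_le h
    obtain ⟨f1, m1, e1⟩ := fr_ex h3 (b+c)
    obtain ⟨f2, m2, e2⟩ := fr_ex h3 b
    obtain ⟨f3, m3, e3⟩ := fr_ex h3 c
    have u2 := U1 m2
    have u3 := U1 m3
    have hh : ((p*(b+c)).choose (p*b) : ℚ) = (b+c).choose b * (f1/(f2*f3)) := by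
      rw [Nat.cast_choose ℚ (Nat.mul_le_mul_left p h), Nat.cast_choose ℚ h, e1, e2,
        show p*(b+c)-p*b = p*c by rw [mul_add]; omega, e3, show b+c-b = c by omega]
      have := u2.ne
      have := u3.ne
      have := Nat.factorial_ne_zero b
      have := Nat.factorial_ne_zero c
      have := (p_pos' (p := p)).ne'
      have := Nat.factorial_ne_zero (p-1)
      field_simp; ring
    have : M p 3 (f1/(f2*f3) - 1) := by
      have := ((m1.sub m2).sub (m3.mulr u2.m0)).div (u2.mul u3)
      refine this.cast ?_
      have := u2.ne
      have := u3.ne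
      field_simp; ring
    rw [hh]
    exact ((M_nat _).mull this).cast (by ring)
  · rw [Nat.choose_eq_zero_of_lt (by omega : a < b), Nat.choose_eq_zero_of_lt]
    · simpa using M_zero 3
    · exact Nat.mul_lt_mul_of_pos_left (by omega) hp.out.pos

lemma M_dvd {n : ℕ} (h : p ∣ n) : M p 1 (n:ℚ) := by
  obtain ⟨c, rfl⟩ := h; push_cast; exact M_p.mulr (M_nat c)

lemma dvd_choose_mul (m k : ℕ) (h : ¬ p ∣ k) : p ∣ (p*m).choose k := by
  have := Choose.choose_modEq_choose_mod_mul_choose_div_nat (n := p*m) (k := k) (p := p)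
  rw [Nat.mul_mod_right, Nat.choose_eq_zero_of_lt (Nat.pos_of_ne_zero (fun h0 => h (Nat.dvd_of_mod_eq_zero h0))), zero_mul] at this
  exact (Nat.modEq_zero_iff_dvd).1 this

lemma dvd_central (k : ℕ) (h : p < 2*(k%p)) : p ∣ (2*k).choose k := by
  have := Choose.choose_modEq_choose_mod_mul_choose_div_nat (n := 2*k) (k := k) (p := p)
  have hlt := Nat.mod_lt k hp.out.pos
  have : (2*k) % p = 2*(k%p) - p := by
    rw [Nat.mul_mod, Nat.mod_eq_sub_mod, Nat.mod_eq_of_lt]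
    · rcases hp.out.eq_two_or_odd with h2 | h2
      · rw [h2] at hlt h; omega
      · have : 2 % p = 2 := Nat.mod_eq_of_lt (by have := hp.out.two_le; omega)
        rw [this]
    · rcases hp.out.eq_two_or_odd with h2 | h2
      · rw [h2] at hlt h; omega
      · have : 2 % p = 2 := Nat.mod_eq_of_lt (by have := hp.out.two_le; omega)
        rw [this]; omega
    · rcases hp.out.eq_two_or_odd with h2 | h2
      · rw [h2] at hlt h; omega
      · have : 2 % p = 2 := Nat.mod_eq_of_lt (by have := hp.out.two_le; omega)
        rw [this]; omega
  rename_i hL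
  rw [this, Nat.choose_eq_zero_of_lt (show 2*(k%p)-p < k % p by omega), zero_mul] at hL
  exact (Nat.modEq_zero_iff_dvd).1 hL

lemma sum_blocks (m : ℕ) (f : ℕ → ℚ) : ∑ k ∈ range (p*m), f k = ∑ j ∈ range m, ∑ i ∈ range p, f (p*j+i) := by
  induction m with
  | zero => simp
  | succ m ih => rw [mul_add, mul_one, sum_range_add, ih, sum_range_succ]

lemma Domb_p (h3 : 3 < p) (m : ℕ) : M p 3 (Domb (p*m) - Domb m) := by
  rw [Domb_eq, Domb_eq, sum_range_succ, sum_range_succ, sum_blocks]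
  obtain ⟨q, hq⟩ : ∃ q, p = q + 1 := ⟨p-1, by omega⟩
  have last : M p 3 (((p*m).choose (p*m) : ℚ)^2 * ((2*(p*m)).choose (p*m)) * ((2*(p*m-p*m)).choose (p*m-p*m))
     - ((m).choose (m) : ℚ)^2 * ((2*(m)).choose (m)) * ((2*(m-m)).choose (m-m))) := by
    have := choose_p h3 (2*m) m
    rw [show p*(2*m) = 2*(p*m) by ring] at this
    simpa using this
  have main : M p 3 (∑ j ∈ range m, ∑ i ∈ range p, ((p*m).choose (p*j+i) : ℚ)^2 * ((2*(p*j+i)).choose (p*j+i)) * ((2*(p*m-(p*j+i))).choose (p*m-(p*j+i)))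
     - ∑ j ∈ range m, ((m).choose j : ℚ)^2 * ((2*j).choose j) * ((2*(m-j)).choose (m-j))) := by
    rw [← sum_sub_distrib]
    apply M_sum
    intro j hj
    have hj : j < m := by simpa using hj
    conv => arg 3; rw [hq, sum_range_succ', ← hq]
    rw [add_sub_assoc]
    apply M.add
    · apply M_sum
      intro i hi
      have hi : i < q := by simpa using hi
      have hd : ¬ p ∣ p*j+(i+1) := by
        rw [Nat.dvd_add_right (dvd_mul_right p j)]
        intro hd; have := Nat.le_of_dvd (by omega) hd; omega
      have d1 := (M_dvd (dvd_choose_mul m _ hd)).pow 2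
      have hodd : p % 2 = 1 := by rcases hp.out.eq_two_or_odd with h2 | h2 <;> omega
      by_cases hb : p < 2*(i+1)
      · have d2 := M_dvd (p := p) (dvd_central (p*j+(i+1)) (by
          rw [Nat.mul_add_mod, Nat.mod_eq_of_lt (by omega)]; exact hb))
        exact (d1.mul d2).mulr (M_nat _)
      · have e : p*m-(p*j+(i+1)) = p*(m-j-1) + (p-(i+1)) := by
          obtain ⟨c, rfl⟩ : ∃ c, m = j+1+c := ⟨m-j-1, by omega⟩
          rw [show j+1+c-j-1 = c by omega]
          simp only [mul_add, mul_one]; omega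
        have d2 := M_dvd (p := p) (dvd_central (p*m-(p*j+(i+1))) (by
          rw [e, Nat.mul_add_mod, Nat.mod_eq_of_lt (by omega)]; omega))
        exact ((d1.mulr (M_nat _)).mul d2)
    · have c1 := choose_p h3 m j
      have c2 := choose_p h3 (2*j) j
      have c3 := choose_p h3 (2*(m-j)) (m-j)
      rw [show p*(2*j) = 2*(p*j) by ring] at c2
      rw [show p*(2*(m-j)) = 2*(p*m-p*j) by rw [← Nat.mul_sub]; ring, Nat.mul_sub p m j] at c3
      rw [add_zero]
      refine (((c1.cmul c1 (M_nat _) (M_nat _)).cmul c2 ((M_nat _).m0 (M_nat _)) (M_nat _)).cmul c3 (((M_nat _).m0 (M_nat _)).m0 (M_nat _)) (M_nat _)).cast ?_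
      ring
  refine (main.add last).cast ?_
  ring
end

/-- `f (m,j)` is a quadratic polynomial in `pm, pj` modulo `p^3`. -/
def Q3 (p : ℕ) (f : ℤ → ℤ → ℚ) : Prop := ∃ a b c d e g : ℚ, M p 0 a ∧ M p 0 b ∧ M p 0 c ∧ M p 0 d ∧ M p 0 e ∧ M p 0 g ∧
  ∀ m j : ℤ, M p 3 (f m j - (a + p*(b*m+c*j) + p^2*(d*m^2+e*m*j+g*j^2)))

section
variable {p : ℕ} [hp : Fact p.Prime]

lemma Q3.lin {a b c : ℚ} (ha : M p 0 a) (hb : M p 0 b) (hc : M p 0 c) : Q3 p (fun m j => a + p*(b*m+c*j)) :=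
  ⟨a, b, c, 0, 0, 0, ha, hb, hc, M_zero _, M_zero _, M_zero _, fun m j => (M_zero 3).cast (by ring)⟩

lemma Q3.const {a : ℚ} (ha : M p 0 a) : Q3 p (fun _ _ => a) :=
  ⟨a, 0, 0, 0, 0, 0, ha, M_zero _, M_zero _, M_zero _, M_zero _, M_zero _, fun m j => (M_zero 3).cast (by ring)⟩

lemma Q3.congr {f g : ℤ → ℤ → ℚ} (h : Q3 p f) (e : ∀ m j, g m j = f m j) : Q3 p g := by
  have : g = f := by funext m j; exact e m j
  rwa [this]

lemma Q3.congrM {f g : ℤ → ℤ → ℚ} (h : Q3 p f) (e : ∀ m j, M p 3 (g m j - f m j)) : Q3 p g := by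
  obtain ⟨a, b, c, d, e', k, ha, hb, hc, hd, he, hk, h⟩ := h
  exact ⟨a, b, c, d, e', k, ha, hb, hc, hd, he, hk, fun m j => (e m j).tr (h m j)⟩

lemma Q3.add {f g : ℤ → ℤ → ℚ} (hf : Q3 p f) (hg : Q3 p g) : Q3 p (fun m j => f m j + g m j) := by
  obtain ⟨a, b, c, d, e, k, ha, hb, hc, hd, he, hk, h⟩ := hf
  obtain ⟨a', b', c', d', e', k', ha', hb', hc', hd', he', hk', h'⟩ := hg
  exact ⟨a+a', b+b', c+c', d+d', e+e', k+k', ha.add ha', hb.add hb', hc.add hc', hd.add hd', he.add he', hk.add hk',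
    fun m j => ((h m j).add (h' m j)).cast (by ring)⟩

lemma M_lin {b c : ℚ} (hb : M p 0 b) (hc : M p 0 c) (m j : ℤ) : M p 0 (b*m+c*j) :=
  (hb.m0 (M_int m)).add (hc.m0 (M_int j))
lemma M_quad {d e g : ℚ} (hd : M p 0 d) (he : M p 0 e) (hg : M p 0 g) (m j : ℤ) : M p 0 (d*m^2+e*m*j+g*j^2) :=
  ((hd.m0 ((M_int m).pow0 2)).add ((he.m0 (M_int m)).m0 (M_int j))).add (hg.m0 ((M_int j).pow0 2))
lemma M_full {a b c d e g : ℚ} (ha : M p 0 a) (hb : M p 0 b) (hc : M p 0 c) (hd : M p 0 d) (he : M p 0 e) (hg : M p 0 g) (m j : ℤ) :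
    M p 0 (a + p*(b*m+c*j) + p^2*(d*m^2+e*m*j+g*j^2)) :=
  (ha.add ((M_nat p).m0 (M_lin hb hc m j))).add (((M_nat p).pow0 2).m0 (M_quad hd he hg m j))

lemma Q3.m0 {f : ℤ → ℤ → ℚ} (hf : Q3 p f) (m j : ℤ) : M p 0 (f m j) := by
  obtain ⟨a, b, c, d, e, k, ha, hb, hc, hd, he, hk, h⟩ := hf
  exact (h m j).of0 (M_full ha hb hc hd he hk m j)

lemma Q3.mul {f g : ℤ → ℤ → ℚ} (hf : Q3 p f) (hg : Q3 p g) : Q3 p (fun m j => f m j * g m j) := by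
  have hg0 := hg.m0
  obtain ⟨a, b, c, d, e, k, ha, hb, hc, hd, he, hk, h⟩ := hf
  obtain ⟨a', b', c', d', e', k', ha', hb', hc', hd', he', hk', h'⟩ := hg
  refine ⟨a*a', a*b'+b*a', a*c'+c*a', a*d'+b*b'+d*a', a*e'+b*c'+c*b'+e*a', a*k'+c*c'+k*a', ha.m0 ha', (ha.m0 hb').add (hb.m0 ha'),
    (ha.m0 hc').add (hc.m0 ha'), ((ha.m0 hd').add (hb.m0 hb')).add (hd.m0 ha'),
    (((ha.m0 he').add (hb.m0 hc')).add (hc.m0 hb')).add (he.m0 ha'), ((ha.m0 hk').add (hc.m0 hc')).add (hk.m0 ha'), ?_⟩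
  intro m j
  have k1 := (h m j).mulr (hg0 m j)
  have k2 := (M_full ha hb hc hd he hk m j).mull (h' m j)
  have L := M_lin hb hc m j
  have L' := M_lin hb' hc' m j
  have Q := M_quad hd he hk m j
  have Q' := M_quad hd' he' hk' m j
  have k3 : M p 3 ((p:ℚ)^3 * ((b*m+c*j)*(d'*m^2+e'*m*j+k'*j^2) + (b'*m+c'*j)*(d*m^2+e*m*j+k*j^2)
      + p*((d*m^2+e*m*j+k*j^2)*(d'*m^2+e'*m*j+k'*j^2)))) :=
    (M_ppow 3).mulr (((L.m0 Q').add (L'.m0 Q)).add ((M_nat p).m0 (Q.m0 Q')))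
  exact ((k1.add k2).add k3).cast (by ring)

lemma Q3.neg {f : ℤ → ℤ → ℚ} (hf : Q3 p f) : Q3 p (fun m j => - f m j) :=
  ((Q3.const (a := -1) (by simpa using M_one.neg)).mul hf).congr (fun m j => by ring)
lemma Q3.sub {f g : ℤ → ℤ → ℚ} (hf : Q3 p f) (hg : Q3 p g) : Q3 p (fun m j => f m j - g m j) :=
  (hf.add hg.neg).congr (fun m j => by ring)

lemma Q3.sum {ι : Type*} (s : Finset ι) (f : ι → ℤ → ℤ → ℚ) (h : ∀ i ∈ s, Q3 p (f i)) : Q3 p (fun m j => ∑ i ∈ s, f i m j) := by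
  classical
  induction s using Finset.induction_on with
  | empty => exact (Q3.const (M_zero _)).congr (fun m j => by simp)
  | insert a s ha ih =>
    exact ((h a (by simp)).add (ih fun i hi => h i (by simp [hi]))).congr (fun m j => by rw [sum_insert ha])
lemma Q3.prod {ι : Type*} (s : Finset ι) (f : ι → ℤ → ℤ → ℚ) (h : ∀ i ∈ s, Q3 p (f i)) : Q3 p (fun m j => ∏ i ∈ s, f i m j) := by
  classical
  induction s using Finset.induction_on with
  | empty => exact (Q3.const M_one).congr (fun m j => by simp)
  | insert a s ha ih =>
    exact ((h a (by simp)).mul (ih fun i hi => h i (by simp [hi]))).congr (fun m j => by rw [prod_insert ha])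
lemma Q3.pow {f : ℤ → ℤ → ℚ} (hf : Q3 p f) (n : ℕ) : Q3 p (fun m j => f m j ^ n) := by
  induction n with
  | zero => exact (Q3.const M_one).congr (fun m j => by simp)
  | succ n ih => exact (ih.mul hf).congr (fun m j => by rw [pow_succ])

lemma Q3.inv {f : ℤ → ℤ → ℚ} (hf : Q3 p f) (hu : U p (f 0 0)) : Q3 p (fun m j => (f m j)⁻¹) := by
  have hf0 := hf.m0
  obtain ⟨a, b, c, d, e, k, ha, hb, hc, hd, he, hk, h⟩ := hf
  have h00 := h 0 0
  have ua : U p a := hu.congr (((h00.mono (show 1 ≤ 3 by omega)).sy).cast (by simp))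
  have uf : ∀ m j, U p (f m j) := by
    intro m j
    apply ua.congr
    have := (M_p (p := p)).mulr ((M_lin hb hc m j).add ((M_nat p).m0 (M_quad hd he hk m j)))
    exact (((h m j).mono (show 1 ≤ 3 by omega)).add this).cast (by ring)
  have ia := ua.inv.m0
  refine ⟨a⁻¹, -(b*a⁻¹^2), -(c*a⁻¹^2), b^2*a⁻¹^3 - d*a⁻¹^2, 2*b*c*a⁻¹^3 - e*a⁻¹^2, c^2*a⁻¹^3-k*a⁻¹^2, ia,
    (hb.m0 (ia.pow0 2)).neg, (hc.m0 (ia.pow0 2)).neg, ((hb.pow0 2).m0 (ia.pow0 3)).sub (hd.m0 (ia.pow0 2)),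
    ((((M_nat 2).m0 hb).m0 hc).m0 (ia.pow0 3)).sub (he.m0 (ia.pow0 2)), ((hc.pow0 2).m0 (ia.pow0 3)).sub (hk.m0 (ia.pow0 2)), ?_⟩
  intro m j
  apply (uf m j).cancel
  have hne := (uf m j).ne
  have hane := ua.ne
  have L := M_lin hb hc m j
  have Q := M_quad hd he hk m j
  rw [mul_sub, mul_inv_cancel₀ hne]
  have k1 : M p 0 (a⁻¹ - (p:ℚ)*(b*m+c*j)*a⁻¹^2 + p^2*((b*m+c*j)^2*a⁻¹^3-(d*m^2+e*m*j+k*j^2)*a⁻¹^2)) :=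
    (ia.sub (((M_nat p).m0 L).m0 (ia.pow0 2))).add (((M_nat p).pow0 2).m0 (((L.pow0 2).m0 (ia.pow0 3)).sub (Q.m0 (ia.pow0 2))))
  have k2 := (h m j).mulr k1
  have k3 : M p 3 ((p:ℚ)^3 * ((b*m+c*j)*((b*m+c*j)^2*a⁻¹^3-(d*m^2+e*m*j+k*j^2)*a⁻¹^2) - (d*m^2+e*m*j+k*j^2)*((b*m+c*j)*a⁻¹^2)
     + p*(d*m^2+e*m*j+k*j^2)*((b*m+c*j)^2*a⁻¹^3-(d*m^2+e*m*j+k*j^2)*a⁻¹^2))) :=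
    (M_ppow 3).mulr (((L.m0 (((L.pow0 2).m0 (ia.pow0 3)).sub (Q.m0 (ia.pow0 2)))).sub (Q.m0 (L.m0 (ia.pow0 2)))).add
      (((M_nat p).m0 Q).m0 (((L.pow0 2).m0 (ia.pow0 3)).sub (Q.m0 (ia.pow0 2)))))
  refine ((k2.add k3).neg).cast ?_
  generalize f m j = F at *
  field_simp
  ring

lemma zpow_exp (h3 : 3 < p) {v : ℚ} (hv : M p 0 v) (t : ℤ) : M p 3 ((1+p*v)^t - (1 + p*(v*t) + p^2*(v^2*(t*(t-1)/2)))) := by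
  have hu : U p (1+p*v) := U_one.congr ((M_p.mulr hv).cast (by ring))
  have hne := hu.ne
  have h2 := U_two h3
  have hb : ∀ t : ℤ, M p 0 (((t:ℚ)*(t-1))/2) := fun t => ((M_int t).m0 (((M_int t).sub M_one))).div h2
  have step : ∀ t : ℤ, M p 3 ((1 + p*(v*(t+1:ℤ)) + p^2*(v^2*((t+1:ℤ)*((t+1:ℤ)-1)/2))) - (1+p*v)*(1 + p*(v*t) + p^2*(v^2*(t*(t-1)/2)))) := by
    intro t
    have : M p 3 ((p:ℚ)^3*(v^3*(((t:ℚ)*(t-1))/2))) := (M_ppow 3).mulr ((hv.pow0 3).m0 (hb t))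
    refine this.neg.cast ?_
    push_cast; ring
  induction t using Int.induction_on with
  | zero => refine (M_zero 3).cast ?_; simp
  | succ t ih =>
    have k := step t
    rw [zpow_add_one₀ hne]
    refine ((hu.m0.mull ih).sub k).cast ?_
    ring
  | pred t ih =>
    have k := step (-t-1)
    apply hu.cancel
    have e : (1+p*v)^(-(t:ℤ)) = (1+p*v) * (1+p*v)^(-(t:ℤ)-1) := by
      have := zpow_add_one₀ hne (-(t:ℤ)-1)
      rw [sub_add_cancel] at this; rw [this]; exact mul_comm _ _
    rw [mul_sub, ← e]
    refine (ih.add k).cast ?_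
    push_cast; ring

lemma Q3.zpow (h3 : 3 < p) {w : ℚ} (hw : M p 1 (w-1)) (x y : ℤ) : Q3 p (fun m j => w^(x*m+y*j)) := by
  obtain ⟨v, hv, e⟩ := hw.exists
  have e : w = 1+p*v := by linear_combination e
  rw [e]
  have h2 := (U_two h3).inv.m0
  refine ((((Q3.lin M_one (hv.m0 (M_int x)) (hv.m0 (M_int y)))).add ((((Q3.lin (M_zero 0) (hv.m0 (M_int x)) (hv.m0 (M_int y)))).mul
    (Q3.lin (hv.neg.m0 (M_nat p)) (hv.m0 (M_int x)) (hv.m0 (M_int y)))).mul (Q3.const h2)))).congrM (fun m j => ?_)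
  refine (zpow_exp h3 hv (x*m+y*j)).cast ?_
  push_cast
  ring

/-- `f(m)`-version: value at `(m,0)` determined by three points -/
lemma Q3.det1 (h3 : 3 < p) {f : ℤ → ℤ → ℚ} (hf : Q3 p f) (x y : ℤ) (hxy : U p ((x:ℚ)*y*(x-y))) (h0 : M p 3 (f 0 0)) (h1 : M p 3 (f x 0)) (h2 : M p 3 (f y 0)) (m : ℤ) :
    M p 3 (f m 0) := by
  obtain ⟨a, b, c, d, e, k, ha, hb, hc, hd, he, hk, h⟩ := hf
  have q0 : M p 3 a := (h0.sub (h 0 0)).cast (by push_cast; ring)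
  have q1 : M p 3 (p*b*x+p^2*d*x^2) := ((h1.sub (h x 0)).sub q0).cast (by push_cast; ring)
  have q2 : M p 3 (p*b*y+p^2*d*y^2) := ((h2.sub (h y 0)).sub q0).cast (by push_cast; ring)
  have q3 : M p 3 (p^2*d) := hxy.cancel ((((M_int y).mull q1).sub ((M_int x).mull q2)).cast (by ring))
  have q4 : M p 3 (p*b) := hxy.cancel (((((M_int x).pow0 2).mull q2).sub (((M_int y).pow0 2).mull q1)).cast (by ring))
  exact ((((h m 0).add q0).add (q3.mulr ((M_int m).pow0 2))).add (q4.mulr (M_int m))).cast (by push_cast; ring)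

lemma Q3.det2 (h3 : 3 < p) {f : ℤ → ℤ → ℚ} (hf : Q3 p f) (hm : ∀ m, M p 3 (f m 0)) (hj : ∀ j, M p 3 (f (2*j) j)) (h31 : M p 3 (f 3 1)) (m j : ℤ) :
    M p 3 (f m j) := by
  have u2 := U_two h3
  obtain ⟨a, b, c, d, e, k, ha, hb, hc, hd, he, hk, h⟩ := hf
  have q0 : M p 3 a := ((hm 0).sub (h 0 0)).cast (by push_cast; ring)
  have q1 : M p 3 (p*b+p^2*d) := (((hm 1).sub (h 1 0)).sub q0).cast (by push_cast; ring)
  have q2 : M p 3 (p*b*2+p^2*d*4) := (((hm 2).sub (h 2 0)).sub q0).cast (by push_cast; ring)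
  have q3 : M p 3 (p^2*d) := u2.cancel ((q2.sub (q1.add q1)).cast (by ring))
  have q4 : M p 3 (p*b) := (q1.sub q3).cast (by ring)
  have r1 : M p 3 (p*c+p^2*(2*e+k)) := (((((((hj 1).sub (h 2 1)).sub q0).sub q4).sub q4).sub (q3.mulr (M_nat 4)))).cast (by push_cast; ring)
  have r2 : M p 3 (p*c*2+p^2*(2*e+k)*4) := ((((((hj 2).sub (h 4 2)).sub q0).sub (q4.mulr (M_nat 4))).sub (q3.mulr (M_nat 16)))).cast (by push_cast; ring)
  have r3 : M p 3 (p^2*(2*e+k)) := u2.cancel ((r2.sub (r1.add r1)).cast (by ring))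
  have r4 : M p 3 (p*c) := (r1.sub r3).cast (by ring)
  have s1 : M p 3 (p^2*(3*e+k)) := ((((((h31.sub (h 3 1)).sub q0).sub (q4.mulr (M_nat 3))).sub (q3.mulr (M_nat 9)))).sub r4).cast (by push_cast; ring)
  have s2 : M p 3 (p^2*e) := (s1.sub r3).cast (by ring)
  have s3 : M p 3 (p^2*k) := ((r3.sub s2).sub s2).cast (by ring)
  exact (((((((h m j).add q0).add (q3.mulr ((M_int m).pow0 2))).add (q4.mulr (M_int m))).add (r4.mulr (M_int j))).add
    (s2.mulr ((M_int m).m0 (M_int j)))).add (s3.mulr ((M_int j).pow0 2))).cast (by push_cast; ring)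
end

/-- ratio of consecutive terms of `t1` -/
def rr (N K : ℚ) : ℚ := (2*K+1)*(N+K+1)*(N-2*K)*(N-2*K-1)/(8*(K+1)^4)

lemma t1_succ (N : ℚ) (k : ℕ) : t1 N (k+1) = t1 N k * rr N k := by
  unfold t1 rr
  have h1 : ff (N+(k+1:ℕ)) (3*(k+1)) = (N+k+1)*(ff (N+k) (3*k) * (N-2*k)*(N-2*k-1)) := by
    rw [show 3*(k+1) = (3*k+1+1)+1 by ring, ff_succ', ff_succ, ff_succ]
    push_cast
    rw [show N + ((k:ℚ)+1) - 1 = N + k by ring]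
    ring
  rw [h1, show 2*(k+1) = 2*k+1+1 by ring, Nat.factorial_succ, Nat.factorial_succ, Nat.factorial_succ]
  have := Nat.factorial_ne_zero k
  push_cast
  field_simp
  ring

lemma t1_add (N : ℚ) (k i : ℕ) : t1 N (k+i) = t1 N k * ∏ l ∈ range i, rr N (k+l) := by
  induction i with
  | zero => simp
  | succ i ih => rw [← add_assoc, t1_succ, ih, prod_range_succ]; push_cast; ring

def phi (p : ℕ) (i : ℕ) (m j : ℤ) : ℚ := ∏ l ∈ range i, rr (p*m) (p*j+l)
def Phi (p : ℕ) (m j : ℤ) : ℚ := ∑ i ∈ range p, phi p i m j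
/-- the same for `-1-N` -/
def psi (p : ℕ) (i : ℕ) (m j : ℤ) : ℚ := ∏ l ∈ range i, rr (-1-p*m) (p*j+l)
def Psi (p : ℕ) (m j : ℤ) : ℚ := ∑ i ∈ range p, psi p i m j

/-- `A_k` -/
def AA (k : ℕ) : ℚ := ((2*k).choose k : ℚ)^2 * ((3*k).choose k : ℚ)

lemma AA_eq (k : ℕ) : AA k = (2*k).factorial * (3*k).factorial / (k.factorial:ℚ)^5 := by
  unfold AA
  have e1 : ((2*k).choose k : ℚ) * (k.factorial:ℚ)^2 = (2*k).factorial := by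
    have := Nat.choose_mul_factorial_mul_factorial (n := 2*k) (k := k) (by omega)
    rw [show 2*k-k = k by omega] at this
    rw [← this]; push_cast; ring
  have e2 : ((3*k).choose k : ℚ) * (k.factorial:ℚ) * (2*k).factorial = (3*k).factorial := by
    have := Nat.choose_mul_factorial_mul_factorial (n := 3*k) (k := k) (by omega)
    rw [show 3*k-k = 2*k by omega] at this
    exact_mod_cast this
  have := Nat.factorial_ne_zero k
  rw [← e2, ← e1]
  field_simp

lemma t1_nat (N k : ℕ) : t1 N k = AA k * ((N+k).choose (3*k)) / 16^k := by
  unfold t1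
  rw [AA_eq, show (N:ℚ)+k = ((N+k:ℕ):ℚ) by push_cast; ring, ff_nat]
  ring

section
variable {p : ℕ} [hp : Fact p.Prime]

lemma rr_zero {N K : ℚ} (h : N = 2*K) : rr N K = 0 := by unfold rr; rw [h]; ring

lemma U_eight (h3 : 3 < p) : U p 8 := by have := (U_four h3).mul (U_two h3); norm_num at this; exact this

lemma Q3.rr (h3 : 3 < p) {l : ℕ} (hl : l + 1 < p) (a : ℤ) (b : ℤ) : Q3 p (fun m j => rr (a + b*(p*m)) (p*j+l)) := by
  have c2 : M p 0 (2:ℚ) := M_nat 2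
  have f1 : Q3 p (fun m j => 2*(p*j+l)+1) := (Q3.lin (a := 2*l+1) (b := 0) (c := 2) ((c2.m0 (M_nat l)).add M_one) (M_zero 0) c2).congr (fun m j => by ring)
  have f2 : Q3 p (fun m j => (a+b*(p*m)) + (p*j+l)+1) := (Q3.lin (a := a+l+1) (b := b) (c := 1) (((M_int a).add (M_nat l)).add M_one) (M_int b) M_one).congr (fun m j => by ring)
  have f3 : Q3 p (fun m j => (a+b*(p*m)) - 2*(p*j+l)) := (Q3.lin (a := a-2*l) (b := b) (c := -2) ((M_int a).sub (c2.m0 (M_nat l))) (M_int b) c2.neg).congr (fun m j => by ring)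
  have f4 : Q3 p (fun m j => (a+b*(p*m)) - 2*(p*j+l)-1) := (f3.sub (Q3.const M_one))
  have f5 : Q3 p (fun m j => 8*((p*j+l)+1)^4) := ((Q3.const (a := 8) (M_nat 8)).mul ((Q3.lin (a := l+1) (b := 0) (c := 1) ((M_nat l).add M_one) (M_zero 0) M_one).pow 4)).congr (fun m j => by ring)
  have u5 : U p (8*((p*(0:ℤ)+l)+1)^4) := by
    have : U p ((l+1:ℕ):ℚ) := U_of_lt (by omega) hl
    have := (U_eight h3).mul (this.pow 4)
    push_cast at *; simpa using this
  exact ((((f1.mul f2).mul f3).mul f4).mul (f5.inv u5)).congr (fun m j => by unfold _root_.rr; rw [div_eq_mul_inv])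

lemma Q3_phi (h3 : 3 < p) {i : ℕ} (hi : i < p) : Q3 p (phi p i) :=
  (Q3.prod (range i) (fun l m j => rr (p*m) (p*j+l)) (fun l hl => (Q3.rr h3 (l := l) (by have := mem_range.1 hl; omega) 0 1).congr (fun m j => by simp))).congr (fun _ _ => rfl)
lemma Q3_psi (h3 : 3 < p) {i : ℕ} (hi : i < p) : Q3 p (psi p i) :=
  (Q3.prod (range i) (fun l m j => rr (-1-p*m) (p*j+l)) (fun l hl => (Q3.rr h3 (l := l) (by have := mem_range.1 hl; omega) (-1) (-1)).congr (fun m j => by push_cast; congr 1; ring))).congr (fun _ _ => rfl)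
lemma Q3_Phi (h3 : 3 < p) : Q3 p (Phi p) := Q3.sum (range p) (fun i => phi p i) (fun i hi => Q3_phi h3 (mem_range.1 hi))
lemma Q3_Psi (h3 : 3 < p) : Q3 p (Psi p) := Q3.sum (range p) (fun i => psi p i) (fun i hi => Q3_psi h3 (mem_range.1 hi))

lemma block_t1 (m : ℤ) (j : ℕ) : ∑ i ∈ range p, t1 (p*m) (p*j+i) = t1 (p*m) (p*j) * Phi p m j := by
  unfold Phi phi
  rw [mul_sum]; apply sum_congr rfl; intro i _
  rw [t1_add]; push_cast; rfl
lemma block_t1' (m : ℤ) (j : ℕ) : ∑ i ∈ range p, t1 (-1-p*m) (p*j+i) = t1 (-1-p*m) (p*j) * Psi p m j := by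
  unfold Psi psi
  rw [mul_sum]; apply sum_congr rfl; intro i _
  rw [t1_add]; push_cast; rfl

lemma sum_one_of {f : ℕ → ℚ} (h : ∀ i, i ≠ 0 → f i = 0) (h0 : f 0 = 1) : ∑ i ∈ range p, f i = 1 := by
  rw [sum_eq_single 0]
  · exact h0
  · intro i _ hi; exact h i hi
  · intro h; exact absurd (mem_range.2 hp.out.pos) h

lemma Phi_diag (j : ℤ) : Phi p (2*j) j = 1 := by
  apply sum_one_of
  · intro i hi
    exact prod_eq_zero (mem_range.2 (Nat.pos_of_ne_zero hi)) (rr_zero (by push_cast; ring))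
  · simp [phi]
lemma Psi_diag (j : ℤ) : Psi p j j = 1 := by
  apply sum_one_of
  · intro i hi
    apply prod_eq_zero (mem_range.2 (Nat.pos_of_ne_zero hi))
    unfold rr; push_cast; ring
  · simp [psi]

lemma AA_p (h3 : 3 < p) (j : ℕ) : M p 3 (AA (p*j) - AA j) := by
  unfold AA
  have a := choose_p h3 (2*j) j
  have b := choose_p h3 (3*j) j
  rw [show p*(2*j) = 2*(p*j) by ring] at a
  rw [show p*(3*j) = 3*(p*j) by ring] at b
  have a2 := a.cmul a (M_nat _) (M_nat _)
  have := a2.cmul b ((M_nat _).m0 (M_nat _)) (M_nat _)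
  exact this.cast (by ring)

lemma AA_1 : AA 1 = 12 := by unfold AA; norm_num [Nat.choose]
lemma AA_0 : AA 0 = 1 := by unfold AA; norm_num [Nat.choose]
lemma AA_2 : AA 2 = 540 := by unfold AA; norm_num [Nat.choose]

lemma Domb_1 : Domb 1 = 4 := by rw [Domb_eq]; norm_num [sum_range_succ, Nat.choose]
lemma Domb_2 : Domb 2 = 28 := by rw [Domb_eq]; norm_num [sum_range_succ, Nat.choose]
lemma Domb_3 : Domb 3 = 256 := by rw [Domb_eq]; norm_num [sum_range_succ, Nat.choose]

lemma fermat_U {a : ℚ} (h : U p a) : M p 1 (a^(p-1) - 1) := by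
  have h0 := h.m0
  rw [← rd_eq_iff (h0.pow0 _) M_one, rd_pow h0, rd_one]
  apply ZMod.pow_card_sub_one_eq_one
  intro h1
  exact not_U_of_M ((rd_eq_zero h0).1 h1) h

lemma w_eq {a : ℚ} : a^p = a * a^(p-1) := by
  rw [← pow_succ', Nat.sub_add_cancel hp.out.one_le]

lemma Phi_eq (h3 : 3 < p) (m j : ℤ) : M p 3 (Phi p m j - ((4:ℚ)^(p-1))^(2*j-m)) := by
  have u4 := U_four h3
  have hw := fermat_U u4
  have uw := (U_four h3).pow (p-1)
  have hne := uw.ne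
  have e4 : (4:ℚ)^p = 4 * 4^(p-1) := w_eq
  have e16 : (16:ℚ)^p = 16 * (4^(p-1))^2 := by
    rw [show (16:ℚ) = 4^2 by norm_num, ← pow_mul, mul_comm 2 p, pow_mul, e4]; ring
  have hf : Q3 p (fun m j => Phi p m j - ((4:ℚ)^(p-1))^(2*j-m)) :=
    (Q3_Phi h3).sub ((Q3.zpow h3 hw (-1) 2).congr (fun m j => by congr 1; ring))
  have d1 : M p 3 (Phi p 1 0 - ((4:ℚ)^(p-1))^(2*0-1:ℤ)) := by
    have h := rep1 p p (by omega)
    have hb := block_t1 (p := p) 1 0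
    have hD := Domb_p h3 1
    simp only [mul_zero, zero_add, t1_zero, one_mul, Int.cast_one, mul_one, Nat.cast_zero] at hb
    rw [hb] at h
    rw [mul_one, Domb_1] at hD
    simp only [mul_zero, zero_sub, zpow_neg, zpow_one]
    apply (u4.pow p).cancel
    refine hD.cast ?_
    rw [h, e4]; field_simp
  have d2 : M p 3 (Phi p 2 0 - ((4:ℚ)^(p-1))^(2*0-2:ℤ)) := by
    have h := rep1 (2*p) (p*2) (by omega)
    rw [sum_blocks] at h
    have hb := block_t1 (p := p) 2 0
    have hb' := block_t1 (p := p) 2 1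
    have hD := Domb_p h3 2
    have hA := AA_p h3 1
    rw [mul_one, AA_1] at hA
    have ht : t1 (p*(2:ℤ)) (p*1) = AA p / 16^p := by
      have := t1_nat (2*p) p
      rw [show 2*p+p = 3*p by ring, Nat.choose_self] at this
      push_cast at *
      rw [mul_one, mul_comm, this]; ring
    have hd := Phi_diag (p := p) 1
    norm_num at hd
    simp only [sum_range_succ, range_zero, sum_empty, zero_add] at h
    have hc : ((2*p:ℕ):ℚ) = p*(2:ℤ) := by push_cast; ring
    rw [hc, hb, hb', ht] at h
    simp only [mul_zero, t1_zero, one_mul, Nat.cast_one, Nat.cast_zero] at h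
    simp only [hd] at h
    rw [Domb_2, mul_comm p 2] at hD
    rw [show ((4:ℚ)^(p-1))^(2*0-2:ℤ) = (((4:ℚ)^(p-1))^2)⁻¹ by norm_num [zpow_neg]]
    apply (((u4.pow 2).pow p)).cancel
    refine (hD.sub hA).cast ?_
    rw [h, pow_mul, show (4:ℚ)^2 = 16 by norm_num, e16]; field_simp; ring
  have d0 : M p 3 (Phi p 0 0 - ((4:ℚ)^(p-1))^(2*0-0:ℤ)) := by
    have := Phi_diag (p := p) 0
    norm_num at this
    simpa [this] using M_zero 3
  have hm : ∀ m : ℤ, M p 3 (Phi p m 0 - ((4:ℚ)^(p-1))^(2*0-m:ℤ)) := by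
    intro m
    refine hf.det1 h3 1 2 ?_ d0 d1 d2 m
    have := (U_two h3).neg
    norm_num; exact this
  have hj : ∀ j : ℤ, M p 3 (Phi p (2*j) j - ((4:ℚ)^(p-1))^(2*j-2*j:ℤ)) := by
    intro j; rw [Phi_diag]; simpa using M_zero 3
  have d31 : M p 3 (Phi p 3 1 - ((4:ℚ)^(p-1))^(2*1-3:ℤ)) := by
    have h := rep1 (3*p) (p*2) (by have := hp.out.pos; omega)
    rw [sum_blocks] at h
    have hb := block_t1 (p := p) 3 0
    have hb' := block_t1 (p := p) 3 1
    have hD := Domb_p h3 3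
    have hA := AA_p h3 1
    rw [mul_one, AA_1] at hA
    have hC := choose_p h3 4 3
    have ht : t1 (p*(3:ℤ)) (p*1) = AA p * ((p*4).choose (p*3)) / 16^p := by
      have := t1_nat (3*p) p
      rw [show 3*p+p = p*4 by ring, show 3*p = p*3 by ring] at this
      push_cast at *
      rw [mul_one, this]
    simp only [sum_range_succ, range_zero, sum_empty, zero_add] at h
    have hc : ((3*p:ℕ):ℚ) = p*(3:ℤ) := by push_cast; ring
    rw [hc, hb, hb', ht] at h
    simp only [mul_zero, t1_zero, one_mul, Nat.cast_one, Nat.cast_zero] at h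
    rw [Domb_3, mul_comm p 3] at hD
    have h30 := hm 3
    rw [show ((4:ℚ)^(p-1))^(2*0-3:ℤ) = (((4:ℚ)^(p-1))^3)⁻¹ by norm_num [zpow_neg]] at h30
    rw [show ((4:ℚ)^(p-1))^(2*1-3:ℤ) = (((4:ℚ)^(p-1)))⁻¹ by norm_num]
    have hAC := hA.cmul hC (M_nat _ |>.pow0 2 |>.m0 (M_nat _)) (M_nat _)
    rw [show (Nat.choose 4 3 :ℚ) = 4 by norm_num [Nat.choose]] at hAC
    have c48 : U p (48:ℚ) := by
      have := ((U_three h3).mul u4).mul u4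
      norm_num at this; exact this
    have P0 : M p 0 (Phi p 3 1) := (Q3_Phi h3).m0 3 1
    apply (c48.mul u4).cancel
    apply uw.cancel
    have k1 := hAC.mulr P0
    have k2 := hD
    have k3 := ((((u4.pow 3).pow p)).m0).mull h30
    have uwn := uw.m0
    -- D/(4^{3p}) relations multiplied out
    refine ((k2.sub k3).sub (((M_nat (4)).m0 uwn).mull k1)).cast ?_
    rw [h, pow_mul, show (4:ℚ)^3 = 16*4 by norm_num, mul_pow, e16, e4]; push_cast; field_simp; ring
  exact hf.det2 h3 hm hj d31 m j

lemma Psi_eq (h3 : 3 < p) (m : ℤ) : M p 3 (Psi p m 0 - ((16:ℚ)^(p-1))^(-m)) := by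
  have u4 := U_four h3
  have u16 : U p (16:ℚ) := by have := u4.mul u4; norm_num at this; exact this
  have hw := fermat_U u16
  have uw := u16.pow (p-1)
  have hne := uw.ne
  have e16 : (16:ℚ)^p = 16 * 16^(p-1) := w_eq
  have hf : Q3 p (fun m j => Psi p m j - ((16:ℚ)^(p-1))^(-m)) :=
    (Q3_Psi h3).sub ((Q3.zpow h3 hw (-1) 0).congr (fun m j => by congr 1; ring))
  refine hf.det1 h3 1 (-1) ?_ ?_ ?_ ?_ m
  · have := (U_two h3).neg
    norm_num; exact this
  · have := Psi_diag (p := p) 0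
    simpa [this] using M_zero 3
  · have h := rep2 p (p*2) (by have := hp.out.pos; omega)
    rw [sum_blocks] at h
    have hb := block_t1' (p := p) 1 0
    have hb' := block_t1' (p := p) 1 1
    have hD := Domb_p h3 1
    have hA := AA_p h3 1
    rw [mul_one, AA_1] at hA
    rw [mul_one, Domb_1] at hD
    have ht : t1 (-1-p*(1:ℤ)) (p*1) = - (AA p / 16^p) := by
      unfold t1
      have : ff (-1-p*(1:ℤ)+(p*1:ℕ)) (3*(p*1)) = -((3*p).factorial:ℚ) := by
        rw [mul_one]
        have key : ∀ n : ℕ, ff (-1) n = (-1)^n * n.factorial := by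
          intro n
          induction n with
          | zero => simp [ff_zero]
          | succ n ih => rw [ff_succ, ih, Nat.factorial_succ]; push_cast; ring
        rw [show (-1-p*(1:ℤ)+(p:ℕ):ℚ) = -1 by push_cast; ring, key]
        have : Odd (3*p) := (by decide : Odd 3).mul (hp.out.odd_of_ne_two (by omega))
        rw [this.neg_one_pow]; ring
      rw [this, AA_eq, mul_one]; ring
    have hd := Psi_diag (p := p) 1
    simp only [sum_range_succ, range_zero, sum_empty, zero_add] at h
    have hc : (-1-(p:ℚ)) = -1-p*(1:ℤ) := by push_cast; ring
    rw [hc, hb, hb', ht] at h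
    simp only [mul_zero, t1_zero, one_mul, Nat.cast_one, Nat.cast_zero] at h
    simp only [hd] at h
    rw [zpow_neg, zpow_one]
    apply (u16.pow p).cancel
    refine (hD.add hA).cast ?_
    rw [h, e16]; field_simp; ring
  · have h1 := rep1 (p-1) p (by have := hp.out.pos; omega)
    have h2 := rep2 (p-1) p (by have := hp.out.pos; omega)
    have hb := block_t1' (p := p) (-1) 0
    have hb' := block_t1 (p := p) (-1) 0
    have ep : ((p-1:ℕ):ℚ) = p - 1 := by rw [Nat.cast_sub hp.out.one_le]; simp
    have a1 : (p:ℚ)-1 = -1-p*((-1:ℤ):ℚ) := by push_cast; ring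
    have a2 : -1-((p:ℚ)-1) = p*((-1:ℤ):ℚ) := by push_cast; ring
    simp only [mul_zero, zero_add, t1_zero, one_mul, Nat.cast_zero] at hb hb'
    rw [ep, a2, hb'] at h2
    rw [ep, a1, hb, h2] at h1
    have hP := Phi_eq h3 (-1) 0
    rw [show ((4:ℚ)^(p-1))^(2*0-(-1):ℤ) = (((4:ℚ)^(p-1))) by norm_num] at hP
    rw [show ((16:ℚ)^(p-1))^(-(-1:ℤ)) = (((16:ℚ)^(p-1))) by norm_num]
    apply (u4.pow (p-1)).cancel
    refine (uw.m0.mull hP).cast ?_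
    rw [mul_sub, ← h1]; push_cast; ring
end

/-- `f ≡ exp(a) + b` to second order -/
def LG (p : ℕ) (f a b : ℚ) : Prop := M p 1 a ∧ M p 2 b ∧ M p 3 (f - (1 + a + a^2/2 + b))

section
variable {p : ℕ} [hp : Fact p.Prime]

lemma M.m11 {a b : ℚ} (h : M p 1 a) (h' : M p 1 b) : M p 2 (a*b) := h.mul h'
lemma M.m12 {a b : ℚ} (h : M p 1 a) (h' : M p 2 b) : M p 3 (a*b) := h.mul h'
lemma M.m22 {a b : ℚ} (h : M p 2 a) (h' : M p 2 b) : M p 3 (a*b) := (h.mul h').mono (by omega)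
lemma M.sq1 {a : ℚ} (h : M p 1 a) : M p 2 (a^2) := (h.m11 h).cast (by ring)
lemma LG.ma {f a b : ℚ} (h : LG p f a b) : M p 1 a := h.1
lemma LG.mb {f a b : ℚ} (h : LG p f a b) : M p 2 b := h.2.1
lemma LG.one : LG p 1 0 0 := ⟨M_zero _, M_zero _, (M_zero _).cast (by ring)⟩
lemma LG.congr {f a b f' a' b' : ℚ} (h : LG p f a b) (e : f' = f) (ea : a' = a) (eb : b' = b) : LG p f' a' b' := by
  subst e ea eb; exact h
lemma LG.congrM {f a b b' : ℚ} (h : LG p f a b) (eb : M p 3 (b' - b)) : LG p f a b' :=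
  ⟨h.1, ((eb.mono (by omega)).add h.2.1).cast (by ring), (h.2.2.sub eb).cast (by ring)⟩
lemma LG.congrF {f f' a b : ℚ} (h : LG p f a b) (eb : M p 3 (f' - f)) : LG p f' a b :=
  ⟨h.1, h.2.1, (h.2.2.add eb).cast (by ring)⟩
lemma LG.m0 (h3 : 3 < p) {f a b : ℚ} (h : LG p f a b) : M p 0 f :=
  h.2.2.of0 (((M_one.add h.1.z).add ((h.1.z.pow0 2).div (U_two h3))).add h.2.1.z)
lemma LG.sub1 (h3 : 3 < p) {f a b : ℚ} (h : LG p f a b) : M p 1 (f - 1) := by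
  have k := (h.2.2.mono (show 1 ≤ 3 by omega))
  have k2 : M p 1 (a^2) := (h.1.mulr h.1.z).cast (by ring)
  exact (((k.add h.1).add (k2.div (U_two h3))).add (h.2.1.mono (by omega))).cast (by ring)
lemma LG.u (h3 : 3 < p) {f a b : ℚ} (h : LG p f a b) : U p f := U_one.congr (h.sub1 h3)

lemma LG.mul (h3 : 3 < p) {f a b f' a' b' : ℚ} (h : LG p f a b) (h' : LG p f' a' b') : LG p (f*f') (a+a') (b+b') := by
  refine ⟨h.1.add h'.1, h.2.1.add h'.2.1, ?_⟩
  have u2 := U_two h3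
  have e1 : M p 0 (1 + a + a^2/2 + b) := ((M_one.add h.1.z).add ((h.1.z.pow0 2).div (U_two h3))).add h.2.1.z
  have k := h.2.2.cmul h'.2.2 (h.m0 h3) (((M_one.add h'.1.z).add ((h'.1.z.pow0 2).div (U_two h3))).add h'.2.1.z)
  have a3 : M p 3 ((a+a')*(a*a')) := (h.1.add h'.1).m12 (h.1.m11 h'.1)
  have ab : M p 3 (a*b') := h.1.m12 h'.2.1
  have ab' : M p 3 (a'*b) := h'.1.m12 h.2.1
  have bb : M p 3 (b*(b' + a'^2/2)) := h.2.1.m22 (h'.2.1.add (h'.1.sq1.div u2))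
  have bb2 : M p 3 (b'*(a^2/2)) := h'.2.1.m22 (h.1.sq1.div u2)
  have aa : M p 3 (a^2/2*(a'^2/2)) := (h.1.sq1.div u2).m22 (h'.1.sq1.div u2)
  exact ((((((k.add (a3.div u2)).add ab).add ab').add bb).add bb2).add aa).cast (by ring)

lemma LG.inv (h3 : 3 < p) {f a b : ℚ} (h : LG p f a b) : LG p f⁻¹ (-a) (-b) := by
  have u2 := U_two h3
  have hu := h.u h3
  refine ⟨h.1.neg, h.2.1.neg, ?_⟩
  have hg : LG p (1 + (-a) + (-a)^2/2 + (-b)) (-a) (-b) := ⟨h.1.neg, h.2.1.neg, (M_zero 3).cast (by ring)⟩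
  have := (h.mul h3 hg).2.2
  apply hu.cancel
  refine this.neg.cast ?_
  rw [mul_sub, mul_inv_cancel₀ hu.ne]; ring

lemma LG.div (h3 : 3 < p) {f a b f' a' b' : ℚ} (h : LG p f a b) (h' : LG p f' a' b') : LG p (f/f') (a-a') (b-b') :=
  (h.mul h3 (h'.inv h3)).congr (div_eq_mul_inv _ _) (sub_eq_add_neg _ _) (sub_eq_add_neg _ _)

lemma LG.pow (h3 : 3 < p) {f a b : ℚ} (h : LG p f a b) (n : ℕ) : LG p (f^n) (n*a) (n*b) := by
  induction n with
  | zero => simpa using LG.one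
  | succ n ih => exact (ih.mul h3 h).congr (pow_succ _ _) (by push_cast; ring) (by push_cast; ring)

lemma LG.zpow (h3 : 3 < p) {f a b : ℚ} (h : LG p f a b) (n : ℤ) : LG p (f^n) (n*a) (n*b) := by
  cases n with
  | ofNat n => exact (h.pow h3 n).congr (by simp) (by simp) (by simp)
  | negSucc n => exact ((h.pow h3 (n+1)).inv h3).congr (by rw [zpow_negSucc]) (by push_cast; ring) (by push_cast; ring)

lemma LG.sub' {f a b f' b' : ℚ} (h : LG p f a b) (h' : LG p f' a b') : M p 3 (f - f' - (b - b')) :=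
  (h.2.2.sub h'.2.2).cast (by ring)
/-- two functions with equal logarithms -/
lemma LG.eq' {f a b f' : ℚ} (h : LG p f a b) (h' : LG p f' a b) : M p 3 (f - f') :=
  (h.sub' h').cast (by ring)

lemma LG_prod (h3 : 3 < p) {ι : Type*} {x : ℚ} (hx : M p 1 x) (s : Finset ι) (c : ι → ℚ) (hc : ∀ i ∈ s, M p 0 (c i)) :
    LG p (∏ i ∈ s, (1 + x * c i)) (x * ∑ i ∈ s, c i) (-(x^2/2) * ∑ i ∈ s, (c i)^2) := by
  have h := prod_exp h3 hx s c hc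
  refine ⟨hx.mulr (M_sum _ _ hc), (((hx.sq1.div (U_two h3)).neg).mulr (M_sum _ _ fun i hi => (hc i hi).pow0 2)), h.cast ?_⟩
  ring

end

/-- Pochhammer symbol -/
def pc (a : ℚ) (r : ℕ) : ℚ := ∏ l ∈ range r, (a + l)
lemma pc_zero (a : ℚ) : pc a 0 = 1 := by simp [pc]
lemma pc_succ (a : ℚ) (r : ℕ) : pc a (r+1) = pc a r * (a + r) := by simp [pc, prod_range_succ]
lemma pc_succ' (a : ℚ) (r : ℕ) : pc a (r+1) = a * pc (a+1) r := by
  unfold pc; rw [prod_range_succ', mul_comm]; congr 1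
  · simp
  · apply prod_congr rfl; intros; push_cast; ring
lemma pc_ne {a : ℚ} (h : ∀ l : ℕ, a + l ≠ 0) (r : ℕ) : pc a r ≠ 0 := prod_ne_zero_iff.2 fun l _ => h l

lemma sum_choose_succ (n : ℕ) (g : ℕ → ℚ) : ∑ r ∈ range (n+2), ((n+1).choose r : ℚ) * g r
    = ∑ r ∈ range (n+1), (n.choose r : ℚ) * (g r + g (r+1)) := by
  rw [sum_range_succ']
  simp only [Nat.choose_succ_succ, Nat.cast_add, add_mul, sum_add_distrib, mul_add]
  have : ∑ r ∈ range (n+1), (n.choose r : ℚ) * g r = ∑ r ∈ range (n+1), (n.choose (r+1) : ℚ) * g (r+1) + g 0 := by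
    rw [sum_range_succ', sum_range_succ (fun r => (n.choose (r+1) : ℚ) * g (r+1)), Nat.choose_succ_self]; simp
  rw [this]; simp; ring

lemma chu (n : ℕ) : ∀ (b c : ℚ) (hc : ∀ l : ℕ, c + l ≠ 0),
    ∑ r ∈ range (n+1), (n.choose r : ℚ) * ((-1)^r * pc b r / pc c r) = pc (c-b) n / pc c n := by
  induction n with
  | zero => intro b c hc; simp [pc_zero]
  | succ n ih =>
    intro b c hc
    have hc' : ∀ l : ℕ, c + 1 + l ≠ 0 := fun l => by have := hc (l+1); push_cast at this; rwa [add_assoc, add_comm 1]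
    have h0 : c ≠ 0 := by simpa using hc 0
    rw [sum_choose_succ]
    simp only [mul_add, sum_add_distrib]
    have e : ∑ r ∈ range (n+1), (n.choose r : ℚ) * ((-1)^(r+1) * pc b (r+1) / pc c (r+1))
       = -(b/c) * ∑ r ∈ range (n+1), (n.choose r : ℚ) * ((-1)^r * pc (b+1) r / pc (c+1) r) := by
      rw [mul_sum]; apply sum_congr rfl; intro r _
      rw [pc_succ', pc_succ']
      have := pc_ne hc' r
      field_simp; ring
    rw [e, ih b c hc, ih (b+1) (c+1) hc', show c+1-(b+1) = c - b by ring, pc_succ]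
    have h1 := pc_ne hc n
    have h2 := pc_ne hc' n
    have h3 := pc_succ c n
    have h4 := pc_succ' c n
    have h5 := hc n
    have h6 := pc_ne hc (n+1)
    rw [show pc (c-b) n / pc c n = pc (c-b) n * (c+n) / pc c (n+1) by rw [h3]; field_simp,
      show pc (c-b) n / pc (c+1) n = pc (c-b) n * c / pc c (n+1) by rw [h4]; field_simp]
    field_simp; ring

lemma choose_prod (n r : ℕ) : ∏ l ∈ range r, (((l:ℚ) - n)/(l+1)) = (-1)^r * (n.choose r) := by
  induction r with
  | zero => simp
  | succ r ih =>
    rw [prod_range_succ, ih]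
    have : ((n.choose (r+1) : ℚ)) * (r+1) = n.choose r * (n - r) := by
      have := Nat.choose_succ_right_eq n r
      by_cases h : r ≤ n
      · rw [← Nat.cast_sub h]; exact_mod_cast this
      · rw [Nat.choose_eq_zero_of_lt (by omega : n < r+1), Nat.choose_eq_zero_of_lt (by omega : n < r)]; simp
    rw [pow_succ]
    have h1 : (r:ℚ)+1 ≠ 0 := by positivity
    rw [mul_div_assoc', div_eq_iff h1]
    linear_combination (-1)^r * this

/-- the special Vandermonde sum, product form -/
lemma vand (n : ℕ) (g : ℚ) (hc : ∀ l : ℕ, 1 + g + l ≠ 0) :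
    ∑ r ∈ range (n+1), ∏ l ∈ range r, (((l:ℚ) - n)*(n+1+g+l)/((l+1)*(1+g+l))) = (-1)^n * n.factorial / pc (1+g) n := by
  have h := chu n (n+1+g) (1+g) hc
  have e : pc (1+g-(n+1+g)) n = (-1)^n * n.factorial := by
    have : ∀ m : ℕ, pc (-m) m = (-1)^m * m.factorial := by
      intro m
      induction m with
      | zero => simp [pc_zero]
      | succ m ih => rw [pc_succ', show (-((m+1:ℕ):ℚ)+1) = -m by push_cast; ring, ih, Nat.factorial_succ]; push_cast; ring
    rw [← this n]; congr 1; ring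
  rw [← e, ← h]
  apply sum_congr rfl; intro r _
  have := choose_prod n r
  rw [show ((n.choose r:ℚ) * ((-1)^r * pc (n+1+g) r / pc (1+g) r)) = ((-1)^r * (n.choose r)) * (pc (n+1+g) r / pc (1+g) r) by ring, ← this]
  unfold pc
  rw [← prod_div_distrib, ← prod_mul_distrib]
  apply prod_congr rfl; intro l _
  rw [div_mul_div_comm]

def uu (l : ℕ) : ℚ := ((l:ℚ)+1/2)⁻¹
def vv (l : ℕ) : ℚ := ((l:ℚ)+1)⁻¹
def H1 (r : ℕ) : ℚ := ∑ l ∈ range r, vv l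
def H2 (r : ℕ) : ℚ := ∑ l ∈ range r, vv l^2
def O1 (r : ℕ) : ℚ := ∑ l ∈ range r, uu l
def O2 (r : ℕ) : ℚ := ∑ l ∈ range r, uu l^2
def bb (r : ℕ) : ℚ := ∏ l ∈ range r, (((l:ℚ)+1/2)^2/(l+1)^2)

def lam (n : ℚ) (r : ℕ) : ℚ := ∏ l ∈ range r, ((l-n)*(l+n+1)/(l+1)^2)
def mu (n : ℚ) (r : ℕ) : ℚ := ∏ l ∈ range r, ((l-n)*(l+n)/(l+1)^2)
def nu (n : ℚ) (r : ℕ) : ℚ := ∏ l ∈ range r, ((l+1-n)*(l+1+n)/(l+1)^2)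

lemma lam_succ (n : ℚ) (r : ℕ) : lam n (r+1) = lam n r * ((r-n)*(r+n+1)/(r+1)^2) := prod_range_succ _ _
lemma mu_succ (n : ℚ) (r : ℕ) : mu n (r+1) = mu n r * ((r-n)*(r+n)/(r+1)^2) := prod_range_succ _ _
lemma nu_succ (n : ℚ) (r : ℕ) : nu n (r+1) = nu n r * ((r+1-n)*(r+1+n)/(r+1)^2) := prod_range_succ _ _
lemma lam_mu {n : ℚ} (hn : n ≠ 0) (r : ℕ) : lam n r = mu n r * (n+r)/n := by
  induction r with
  | zero => simp [lam, mu, hn]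
  | succ r ih =>
    rw [lam_succ, ih, mu_succ]
    push_cast
    have : (r:ℚ)+1 ≠ 0 := by positivity
    field_simp; ring
lemma lam_mu' {n : ℚ} (hn : n ≠ 0) (r : ℕ) : lam (n-1) r = mu n r * (n-r)/n := by
  induction r with
  | zero => simp [lam, mu, hn]
  | succ r ih =>
    rw [lam_succ, ih, mu_succ]
    push_cast
    have : (r:ℚ)+1 ≠ 0 := by positivity
    field_simp; ring
lemma mu_nu (n : ℚ) (r : ℕ) : mu n (r+1) = -n^2/((r:ℚ)+1)^2 * nu n r := by
  induction r with
  | zero => simp [mu, nu]; ring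
  | succ r ih =>
    rw [mu_succ, ih, nu_succ]
    push_cast
    have : (r:ℚ)+1 ≠ 0 := by positivity
    have : (r:ℚ)+1+1 ≠ 0 := by positivity
    field_simp
lemma mu_H2 {n : ℚ} (hn : n ≠ 0) (R : ℕ) : ∑ r ∈ range (R+1), mu n r * H2 r = H2 R * nu n R + (nu n R - 1)/n^2 := by
  induction R with
  | zero => simp [H2, nu]
  | succ R ih =>
    rw [sum_range_succ, ih, mu_nu]
    have e : nu n (R+1) = nu n R * ((R+1-n)*(R+1+n)/((R:ℚ)+1)^2) := by rw [nu, prod_range_succ, ← nu]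
    have e2 : H2 (R+1) = H2 R + (((R:ℚ)+1)⁻¹)^2 := by rw [H2, sum_range_succ, ← H2, vv]
    rw [e, e2]
    have : (R:ℚ)+1 ≠ 0 := by positivity
    field_simp; ring

lemma lam_vanish (n r : ℕ) (h : n < r) : lam n r = 0 :=
  prod_eq_zero (mem_range.2 h) (by simp)

lemma eta_rec (n : ℕ) : ∑ r ∈ range (n+2), lam ((n+1:ℕ):ℚ) r * H2 r + ∑ r ∈ range (n+1), lam n r * H2 r = -2/((n:ℚ)+1)^2 := by
  have hne : ((n+1:ℕ):ℚ) ≠ 0 := by positivity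
  have h := mu_H2 hne (n+1)
  have hv : nu ((n+1:ℕ):ℚ) (n+1) = 0 := prod_eq_zero (mem_range.2 (Nat.lt_succ_self n)) (by push_cast; ring)
  have e : ∑ r ∈ range (n+1), lam n r * H2 r = ∑ r ∈ range (n+2), lam n r * H2 r := by
    rw [sum_range_succ _ (n+1), lam_vanish n (n+1) (by omega)]; simp
  rw [e, ← sum_add_distrib]
  rw [hv] at h
  have : ∀ r ∈ range (n+2), lam ((n+1:ℕ):ℚ) r * H2 r + lam n r * H2 r = 2 * (mu ((n+1:ℕ):ℚ) r * H2 r) := by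
    intro r _
    have h1 := lam_mu hne r
    have h2 := lam_mu' hne r
    rw [show ((n+1:ℕ):ℚ) - 1 = n by push_cast; ring] at h2
    rw [h1, h2]; field_simp; ring
  rw [sum_congr rfl this, ← mul_sum, h]; push_cast; ring

lemma eta_eq (n : ℕ) : ∑ r ∈ range (n+1), lam n r * H2 r = -2 * (-1)^n * ∑ k ∈ range n, (-1)^(k+1) * vv k^2 := by
  induction n with
  | zero => simp [lam, H2]
  | succ n ih =>
    have := eta_rec n
    rw [ih] at this
    rw [sum_range_succ (fun k => (-1:ℚ)^(k+1) * vv k^2), vv]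
    have hs : ((-1:ℚ)^n)^2 = 1 := by rw [← pow_mul, mul_comm, pow_mul]; norm_num
    have h0 : (n:ℚ)+1 ≠ 0 := by positivity
    rw [eq_sub_of_add_eq this, pow_succ]
    field_simp
    linear_combination hs

lemma lam_sum (n : ℕ) : ∑ r ∈ range (n+1), lam n r = (-1)^n := by
  have := vand n 0 (fun l => by positivity)
  rw [show pc (1+0) n = n.factorial by
    induction n with
    | zero => simp [pc_zero]
    | succ n ih => rw [pc_succ, ih (vand n 0 (fun l => by positivity)), Nat.factorial_succ]; push_cast; ring] at this
  have h0 : (n.factorial:ℚ) ≠ 0 := by positivity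
  rw [mul_div_assoc, div_self h0, mul_one] at this
  rw [← this]
  apply sum_congr rfl; intro r _; apply prod_congr rfl; intro l _
  congr 1 <;> ring

section
variable {p : ℕ} [hp : Fact p.Prime]

lemma M_uu (h3 : 3 < p) {l : ℕ} (h : 2*l+1 < p) : M p 0 (uu l) := by
  unfold uu
  have := ((U_of_lt (p := p) (z := 2*l+1) (by omega) h).div (U_two h3)).inv.m0
  refine this.cast ?_
  push_cast; congr 1; ring
lemma M_uu' (h3 : 3 < p) {l : ℕ} (h1 : 2*l+1 ≠ p) (h : l < p) : M p 0 (uu l) := by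
  unfold uu
  have : U p ((2*l+1:ℕ):ℚ) := U_nat (fun hd => by
    obtain ⟨c, hc⟩ := hd
    have hp0 := hp.out.pos
    have : c < 2 := by by_contra hh; have : p*2 ≤ p*c := Nat.mul_le_mul_left p (by omega); omega
    interval_cases c <;> omega)
  have := (this.div (U_two h3)).inv.m0
  refine this.cast ?_
  push_cast; congr 1; ring
lemma U_vv {l : ℕ} (h : l+1 < p) : U p (vv l) := by
  unfold vv
  exact_mod_cast (U_of_lt (p := p) (z := l+1) (by omega) h).inv
lemma M_vv {l : ℕ} (h : l+1 < p) : M p 0 (vv l) := (U_vv h).m0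

lemma LGu (h3 : 3 < p) {n : ℕ} (hn : p = 2*n+1) {r : ℕ} (hr : r ≤ n) {x : ℚ} (hx : M p 1 x) :
    LG p (∏ l ∈ range r, (1+x*uu l)) (x * O1 r) (-(x^2/2) * O2 r) :=
  LG_prod h3 hx _ _ (fun l hl => M_uu h3 (by have := mem_range.1 hl; omega))
lemma LGv (h3 : 3 < p) {r : ℕ} (hr : r < p) {x : ℚ} (hx : M p 1 x) :
    LG p (∏ l ∈ range r, (1+x*vv l)) (x * H1 r) (-(x^2/2) * H2 r) :=
  LG_prod h3 hx _ _ (fun l hl => M_vv (by have := mem_range.1 hl; omega))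

lemma M_H2 {r : ℕ} (hr : r < p) : M p 0 (H2 r) := M_sum _ _ fun l hl => (M_vv (by have := mem_range.1 hl; omega)).pow0 2
lemma M_O2 (h3 : 3 < p) {n : ℕ} (hn : p = 2*n+1) {r : ℕ} (hr : r ≤ n) : M p 0 (O2 r) :=
  M_sum _ _ fun l hl => (M_uu h3 (by have := mem_range.1 hl; omega)).pow0 2
lemma M_bb (h3 : 3 < p) {r : ℕ} (hr : r < p) : M p 0 (bb r) := M_prod _ _ fun l hl => by
  have h := (M_vv (p := p) (l := l) (by have := mem_range.1 hl; omega)).pow0 2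
  refine ((((M_nat l).add ((M_one).div (U_two h3))).pow0 2).m0 h).cast ?_
  rw [vv]; field_simp

lemma H2_full (h3 : 3 < p) : M p 1 (H2 (p-1)) := by
  have h := harm_two h3
  obtain ⟨q, hq⟩ : ∃ q, p = q+1 := ⟨p-1, by omega⟩
  rw [show range p = range (p-1+1) by rw [hq]; rfl, sum_range_succ'] at h
  refine h.cast ?_
  unfold H2 vv; simp

lemma H2_half (h3 : 3 < p) {n : ℕ} (hn : p = 2*n+1) : M p 1 (H2 n) := by
  have h := H2_full h3
  rw [show p - 1 = n + n by omega, H2, sum_range_add] at h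
  rw [← sum_range_reflect (fun x => vv (n+x)^2)] at h
  apply (U_two h3).cancel
  have k : M p 1 (∑ j ∈ range n, (vv (n+(n-1-j))^2 - vv j^2)) := M_sum _ _ (fun j hj => by
    have hj := mem_range.1 hj
    have a1 := M_vv (p := p) (l := j) (by omega)
    have a2 := M_vv (p := p) (l := n+(n-1-j)) (by omega)
    have e : vv (n+(n-1-j)) + vv j = p * (vv j * vv (n+(n-1-j))) := by
      unfold vv
      have e1 : ((n+(n-1-j):ℕ):ℚ) = 2*n - 1 - j := by rw [show n+(n-1-j) = 2*n-1-j by omega, Nat.cast_sub (by omega), Nat.cast_sub (by omega)]; push_cast; ring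
      have n1 : ((n+(n-1-j):ℕ):ℚ)+1 ≠ 0 := by positivity
      rw [e1] at *
      have n2 : (j:ℚ)+1 ≠ 0 := by positivity
      field_simp; rw [hn]; push_cast; ring
    have k := (M_p (p := p)).mulr (a1.m0 a2)
    rw [← e] at k
    exact (k.mulr (a2.sub a1)).cast (by ring))
  rw [sum_sub_distrib] at k
  refine (h.sub k).cast ?_
  rw [H2]; ring

/-- `n!/(1+pk/2)_n` -/
def fk (p n : ℕ) (k : ℤ) : ℚ := n.factorial / pc (1 + p*k/2) n

lemma fk_eq (p n : ℕ) (k : ℤ) : fk p n k = (∏ l ∈ range n, (1 + (p*k/2)*vv l))⁻¹ := by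
  unfold fk pc
  have : (n.factorial:ℚ) = ∏ l ∈ range n, ((l:ℚ)+1) := by
    rw [← prod_range_add_one_eq_factorial]; push_cast; rfl
  rw [this, ← inv_div, ← prod_div_distrib]
  congr 1; apply prod_congr rfl; intro l _
  rw [vv]; have : (l:ℚ)+1 ≠ 0 := by positivity
  field_simp; ring

lemma LGfk (h3 : 3 < p) {n : ℕ} (hn : p = 2*n+1) (k : ℤ) : LG p (fk p n k) (k * (-(p/2)*H1 n)) 0 := by
  have hx : M p 1 ((p:ℚ)*k/2) := (M_p.mulr (M_int k)).div (U_two h3)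
  have h := (LGv h3 (r := n) (by omega) hx).inv h3
  refine (h.congrM ?_).congr (fk_eq _ _ _) (by ring) rfl
  have := (hx.sq1.div (U_two h3)).mul (H2_half h3 hn)
  exact this.neg.cast (by ring)

lemma w_fk (h3 : 3 < p) {n : ℕ} (hn : p = 2*n+1) : (2:ℚ)^(p-1) * fk p n (-2) = fk p n (-1) := by
  unfold fk pc
  have e1 : ∏ l ∈ range n, (1 + (p:ℚ)*((-2:ℤ):ℚ)/2 + l) = ∏ l ∈ range n, (-(((p:ℚ) - 1 - l))) := prod_congr rfl fun l _ => by push_cast; ring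
  have e2 : ∏ l ∈ range n, (1 + (p:ℚ)*((-1:ℤ):ℚ)/2 + l) = ∏ l ∈ range n, (-((p:ℚ) - 2 - 2*l)/2) := prod_congr rfl fun l _ => by push_cast; ring
  rw [e1, e2]
  have full : (∏ l ∈ range n, ((p:ℚ) - 1 - l)) * (n.factorial : ℚ) = (2*n).factorial := by
    have h := ff_nat (2*n) n
    have := Nat.choose_mul_factorial_mul_factorial (n := 2*n) (k := n) (by omega)
    rw [show 2*n-n = n by omega] at this
    rw [← this]; push_cast; push_cast at h; rw [← h]
    unfold ff; congr 1; apply prod_congr rfl; intro l _; rw [hn]; push_cast; ring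
  have odd : (∏ l ∈ range n, ((p:ℚ) - 2 - 2*l)) * (2^n * n.factorial : ℚ) = (2*n).factorial := by
    have h1 : ∀ m : ℕ, (∏ l ∈ range m, ((2*(m:ℚ)+1) - 2 - 2*l)) * (2^m * m.factorial : ℚ) = (2*m).factorial := by
      intro m
      induction m with
      | zero => simp
      | succ m ih =>
        rw [prod_range_succ', show 2*(m+1) = 2*m+1+1 by ring, Nat.factorial_succ, Nat.factorial_succ, Nat.factorial_succ]
        push_cast
        rw [← ih]
        rw [show ∏ k ∈ range m, (2*((m:ℚ)+1)+1-2-2*((k:ℚ)+1)) = ∏ k ∈ range m, (2*(m:ℚ)+1-2-2*k) from prod_congr rfl fun l _ => by ring]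
        ring
    rw [← h1 n]; congr 1; apply prod_congr rfl; intro l _; rw [hn]; push_cast; ring
  have h0 : (n.factorial:ℚ) ≠ 0 := by positivity
  have h2 : ((2*n).factorial:ℚ) ≠ 0 := by positivity
  rw [prod_neg, prod_div_distrib, prod_neg, prod_const, card_range]
  have f0 : ∏ l ∈ range n, ((p:ℚ) - 1 - l) ≠ 0 := fun h => h2 (by rw [← full, h, zero_mul])
  have o0 : ∏ l ∈ range n, ((p:ℚ) - 2 - 2*l) ≠ 0 := fun h => h2 (by rw [← odd, h, zero_mul])
  have c : ∏ l ∈ range n, ((p:ℚ) - 1 - l) = (∏ l ∈ range n, ((p:ℚ) - 2 - 2*l)) * 2^n := by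
    apply mul_right_cancel₀ h0; rw [full, ← odd]; ring
  rw [c, show p-1 = n+n by omega, pow_add]
  have hs : ((-1:ℚ)^n) ≠ 0 := pow_ne_zero _ (by norm_num)
  field_simp

/-- log of `2^(p-1)` -/
lemma LGw (h3 : 3 < p) {n : ℕ} (hn : p = 2*n+1) : LG p ((2:ℚ)^(p-1)) (-(p/2)*H1 n) 0 := by
  have h1 := LGfk h3 hn (-1)
  have h2 := LGfk h3 hn (-2)
  refine (h1.div h3 h2).congr ?_ (by push_cast; ring) (by ring)
  rw [← w_fk h3 hn, mul_div_assoc, div_self (h2.u h3).ne, mul_one]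

lemma fk_w (h3 : 3 < p) {n : ℕ} (hn : p = 2*n+1) (k : ℤ) : M p 3 (fk p n k - ((2:ℚ)^(p-1))^k) :=
  (LGfk h3 hn k).eq' (((LGw h3 hn).zpow h3 k).congr rfl rfl (by ring))
end

lemma eulerE_zero : eulerE 0 = 1 := by rw [eulerE]
lemma eulerE_succ (n : ℕ) : eulerE (n+1) = -∑ j ∈ range ((n+1)/2),
      ((n+1).choose (2*(j+1)) : ℚ) * eulerE (n - 1 - 2*j) := by rw [eulerE]
lemma eulerE_odd (n : ℕ) : n % 2 = 1 → eulerE n = 0 := by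
  induction n using Nat.strong_induction_on with
  | _ n ih =>
    intro h
    obtain ⟨m, rfl⟩ : ∃ m, n = m+1 := ⟨n-1, by omega⟩
    rw [eulerE_succ, sum_eq_zero, neg_zero]
    intro j hj
    have := mem_range.1 hj
    rw [ih _ (by omega) (by omega), mul_zero]

/-- umbral functional -/
noncomputable def Eu : Polynomial ℚ →ₗ[ℚ] ℚ := (Polynomial.basisMonomials ℚ).constr ℚ eulerE
open Polynomial in
lemma Eu_X (n : ℕ) : Eu (X^n : Polynomial ℚ) = eulerE n := by
  have := (Polynomial.basisMonomials ℚ).constr_basis ℚ eulerE n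
  rw [coe_basisMonomials] at this
  rw [X_pow_eq_monomial]; exact this

lemma sum_even_split (n : ℕ) (f : ℕ → ℚ) : ∑ j ∈ range (n+1), (1+(-1)^j) * f j = 2 * ∑ j ∈ range (n/2+1), f (2*j) := by
  induction n using Nat.twoStepInduction with
  | zero => simp [sum_range_succ]; norm_num
  | one => simp [sum_range_succ]; norm_num
  | more n ih _ =>
    rw [sum_range_succ, sum_range_succ, ih, show (n+2)/2+1 = (n/2+1)+1 by omega, sum_range_succ _ (n/2+1)]
    have hs : (-1:ℚ)^(n+2) = (-1)^n := by rw [pow_add]; norm_num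
    have hs1 : (-1:ℚ)^(n+1) = -(-1)^n := by rw [pow_add]; norm_num
    rw [hs, hs1]
    rcases Nat.even_or_odd n with hk | hk
    · rw [hk.neg_one_pow]
      obtain ⟨k, hk⟩ := hk
      rw [show 2*(n/2+1) = n+2 by omega]; ring
    · rw [hk.neg_one_pow]
      obtain ⟨k, hk⟩ := hk
      rw [show 2*(n/2+1) = n+1 by omega]; ring

lemma eulerE_rec (n : ℕ) (hn : n ≠ 0) : ∑ j ∈ range (n+1), (1+(-1)^j) * ((n.choose j : ℚ) * eulerE (n-j)) = 0 := by
  obtain ⟨m, rfl⟩ : ∃ m, n = m+1 := ⟨n-1, by omega⟩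
  rw [sum_even_split (m+1) (fun j => ((m+1).choose j : ℚ) * eulerE (m+1-j)), sum_range_succ']
  simp only [mul_zero, Nat.choose_zero_right, Nat.sub_zero, eulerE_succ]
  have : ∀ k, m + 1 - 2*(k+1) = m - 1 - 2*k := fun k => by omega
  simp only [this]; push_cast; ring

open Polynomial in
/-- binomial-type expansion of `Eu` -/
lemma Eu_pow (y : ℚ) (m : ℕ) : Eu ((X + C y)^m) = ∑ j ∈ range (m+1), (m.choose j : ℚ) * (y^j * eulerE (m-j)) := by
  rw [add_comm, add_pow, map_sum]
  apply sum_congr rfl; intro j _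
  rw [show (C y : Polynomial ℚ)^j * X^(m-j) * ((m.choose j : ℕ) : Polynomial ℚ) = ((m.choose j : ℚ) * y^j) • X^(m-j) by
    rw [smul_eq_C_mul]; simp [mul_comm, mul_assoc, mul_left_comm]]
  rw [map_smul, Eu_X, smul_eq_mul]; ring

open Polynomial in
lemma Eu_shift (q : Polynomial ℚ) : Eu (q.comp (X + C 1)) + Eu (q.comp (X + C (-1))) = 2 * q.eval 0 := by
  induction q using Polynomial.induction_on' with
  | add f g hf hg => rw [add_comp, add_comp, map_add, map_add, eval_add]; linear_combination hf + hg
  | monomial n a =>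
    rw [monomial_comp, monomial_comp, ← smul_eq_C_mul, ← smul_eq_C_mul, map_smul, map_smul, Eu_pow, Eu_pow, ← smul_add, ← sum_add_distrib, eval_monomial]
    by_cases hn : n = 0
    · subst hn; simp [eulerE_zero]; ring
    · have := eulerE_rec n hn
      rw [show ∑ j ∈ range (n+1), ((n.choose j : ℚ) * (1^j * eulerE (n-j)) + (n.choose j : ℚ) * ((-1)^j * eulerE (n-j))) = 0 by
        rw [← this]; apply sum_congr rfl; intros; rw [one_pow]; ring]
      simp [hn]

open Polynomial in
lemma Eu_step (m : ℕ) (y : ℚ) : Eu ((X + C (y+1))^m) + Eu ((X + C (y-1))^m) = 2*y^m := by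
  have := Eu_shift ((X + C y)^m)
  simp only [pow_comp, add_comp, X_comp, C_comp, eval_pow, eval_add, eval_X, eval_C, zero_add] at this
  rw [← this]
  congr 3 <;> rw [add_assoc, ← C_add] <;> congr 2 <;> ring

open Polynomial in
lemma Eu_one (m : ℕ) (hm : m ≠ 0) (he : Even m) : Eu ((X + C (-1))^m) = 0 := by
  have h := Eu_step m 0
  rw [zero_pow hm, mul_zero, zero_add, zero_sub] at h
  have : Eu ((X + C 1)^m) = Eu ((X + C (-1))^m) := by
    rw [Eu_pow, Eu_pow]; apply sum_congr rfl; intro j hj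
    rcases Nat.even_or_odd j with hk | hk
    · rw [hk.neg_one_pow, one_pow]
    · rw [eulerE_odd (m-j)]; · simp
      have := mem_range.1 hj
      obtain ⟨a, ha⟩ := he; obtain ⟨b, hb⟩ := hk; omega
  linarith

open Polynomial in
lemma Eu_tel (m K : ℕ) : ∑ k ∈ range K, (-1)^k * (2*(2*(k:ℚ)+1)^m) = eulerE m - (-1)^K * Eu ((X + C (2*(K:ℚ)))^m) := by
  induction K with
  | zero => simp [Eu_X]
  | succ K ih =>
    rw [sum_range_succ, ih, ← Eu_step m (2*(K:ℚ)+1), pow_succ]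
    push_cast
    rw [show 2*((K:ℚ)+1) = 2*K+1+1 by ring, show 2*(K:ℚ)+1-1 = 2*K by ring]
    ring

section
variable {p : ℕ} [hp : Fact p.Prime]
lemma M_euler (n : ℕ) : M p 0 (eulerE n) := by
  induction n using Nat.strong_induction_on with
  | _ n ih =>
    cases n with
    | zero => rw [eulerE_zero]; exact M_one
    | succ m =>
      rw [eulerE_succ]
      exact (M_sum _ _ fun j _ => (M_nat _).m0 (ih _ (by omega))).neg

lemma M_powsub {a b : ℚ} (h : M p 1 (a-b)) (ha : M p 0 a) (hb : M p 0 b) (j : ℕ) : M p 1 (a^j - b^j) := by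
  induction j with
  | zero => simpa using M_zero 1
  | succ j ih => rw [pow_succ, pow_succ]; exact ih.cmul h (ha.pow0 _) hb

lemma fermat_two (a : ℚ) (h : U p a) (h3 : 3 < p) : M p 1 (a^(p-3) - (a⁻¹)^2) := by
  have := (fermat_U (p := p) h)
  refine (this.mulr (h.inv.m0.pow0 2)).cast ?_
  rw [show p-1 = p-3+2 by omega, pow_add]
  have := h.ne
  field_simp

/-- `∑_{l≤n} (-1)^l/l² ≡ 2 s E_{p-3}`. -/
lemma euler_alt (h3 : 3 < p) {n : ℕ} (hn : p = 2*n+1) :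
    M p 1 (∑ l ∈ range n, (-1)^(l+1) * vv l^2 - 2 * (-1)^n * eulerE (p-3)) := by
  have h := Eu_tel (p-3) n
  have h1 := Eu_one (p-3) (by omega) ⟨n-1, by omega⟩
  have h2 : M p 1 (Eu ((Polynomial.X + Polynomial.C (2*(n:ℚ)))^(p-3))) := by
    rw [← sub_zero (Eu _), ← h1, Eu_pow, Eu_pow, ← sum_sub_distrib]
    refine M_sum _ _ fun j _ => ?_
    have h2n : M p 0 (2*(n:ℚ)) := by exact_mod_cast M_nat (2*n)
    have h1n : M p 0 (-1:ℚ) := by exact_mod_cast M_int (-1)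
    have := M_powsub (p := p) (a := 2*n) (b := -1) (M_p.cast (by rw [hn]; push_cast; ring)) h2n h1n j
    refine ((M_nat ((p-3).choose j)).mull (this.mulr (M_euler (p-3-j)))).cast (by ring)
  have hs : ((-1:ℚ)^n)^2 = 1 := by rw [← pow_mul, mul_comm, pow_mul]; norm_num
  have ms : M p 0 ((-1:ℚ)^n) := M.pow0 (by exact_mod_cast M_int (-1)) n
  -- each term
  have hterm : ∀ k ∈ range n, M p 1 ((-1)^k * (2*(2*(k:ℚ)+1)^(p-3)) - (-1)^n * ((-1)^(n-1-k+1) * vv (n-1-k)^2)/2) := fun k hk => by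
    have hk := mem_range.1 hk
    have u1 : U p (2*(k:ℚ)+1) := by exact_mod_cast U_of_lt (p := p) (z := 2*k+1) (by omega) (by omega)
    have f := fermat_two _ u1 h3
    have uv := U_vv (p := p) (l := n-1-k) (by omega)
    have ev : vv (n-1-k) = ((n:ℚ)-k)⁻¹ := by
      rw [vv, Nat.cast_sub (by omega), Nat.cast_sub (by omega)]; congr 1; push_cast; ring
    have e : M p 1 ((2*(k:ℚ)+1)⁻¹ - (-(vv (n-1-k))/2)) := by
      have := M_p.mulr ((u1.inv.m0).m0 (uv.m0.div (U_two h3)))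
      refine this.cast ?_
      have evne := uv.ne; rw [ev] at evne ⊢
      have n1 := u1.ne
      have n2 : (n:ℚ)-k ≠ 0 := fun h0 => evne (by rw [h0]; simp)
      field_simp; rw [hn]; push_cast; ring
    have e2 := M_powsub e u1.inv.m0 ((uv.m0.neg).div (U_two h3)) 2
    have sgn : (-1:ℚ)^n * (-1)^(n-1-k+1) = (-1)^k := by
      rw [show n-1-k+1 = n-k by omega, ← pow_add]
      rw [show n + (n-k) = 2*(n-k)+k by omega, pow_add, pow_mul]; norm_num
    rw [← mul_assoc ((-1:ℚ)^n), sgn]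
    have mk : M p 0 ((-1:ℚ)^k*2) := (M.pow0 (by exact_mod_cast M_int (-1)) k).m0 (by exact_mod_cast M_nat 2)
    exact (mk.mull (f.add e2)).cast (by ring)
  have hsum := M_sum _ _ hterm
  rw [sum_sub_distrib, h, ← sum_div, ← mul_sum, sum_range_reflect (fun k => (-1:ℚ)^(k+1) * vv k^2) n] at hsum
  have k := hsum.add (ms.mull h2)
  have := ((ms.m0 (M_nat 2)).mull k).neg
  refine this.cast ?_
  push_cast
  linear_combination (-(∑ l ∈ range n, (-1:ℚ)^(l+1) * vv l^2)) * hs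
end

section
variable {p : ℕ} [hp : Fact p.Prime]

def be (l : ℕ) : ℚ := ((l:ℚ)+1/2)^2/(l+1)^2
lemma bb_be (r : ℕ) : bb r = ∏ l ∈ range r, be l := rfl
lemma be_vv (l : ℕ) : be l = ((l:ℚ)+1/2)^2 * vv l^2 := by rw [be, vv]; field_simp
lemma M_half (h3 : 3 < p) : M p 0 (1/2:ℚ) := M_one.div (U_two h3)
lemma M_be (h3 : 3 < p) {l : ℕ} (h : l+1 < p) : M p 0 (be l) :=
  ((((M_nat l).add (M_half h3)).pow0 2).m0 ((M_vv h).pow0 2)).cast (be_vv l)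
lemma be_n {n : ℕ} (hn : p = 2*n+1) : be n = (p:ℚ)^2/4 * vv n^2 := by
  rw [be_vv, hn]; push_cast; ring
lemma M_be_n (h3 : 3 < p) {n : ℕ} (hn : p = 2*n+1) : M p 2 (be n) := by
  rw [be_n hn]
  exact ((M_ppow 2).div (U_four h3)).mulr ((M_vv (by omega)).pow0 2)

lemma prod_congr1 {F G : ℕ → ℚ} (r : ℕ) (hG : ∀ l < r, M p 0 (G l)) (h : ∀ l < r, M p 1 (F l - G l)) :
    M p 1 (∏ l ∈ range r, F l - ∏ l ∈ range r, G l) := by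
  induction r with
  | zero => simpa using M_zero 1
  | succ r ih =>
    rw [prod_range_succ, prod_range_succ]
    refine (ih (fun l hl => hG l (by omega)) (fun l hl => h l (by omega))).cmul (h r (by omega)) ?_ (hG r (by omega))
    exact M_prod _ _ fun l hl => (h l (by have := mem_range.1 hl; omega)).of0 (hG l (by have := mem_range.1 hl; omega))

lemma tail_prod (h3 : 3 < p) {n : ℕ} (hn : p = 2*n+1) {F : ℕ → ℚ} {c : ℚ} (hc : M p 0 c)
    (hF : ∀ l, l+1 < p → l ≠ n → M p 1 (F l - be l)) (hFn : M p 3 (F n - c * be n)) (r : ℕ) (h1 : n < r) (h2 : r < p) :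
    M p 3 (∏ l ∈ range r, F l - c * bb r) ∧ M p 2 (bb r) := by
  induction r with
  | zero => omega
  | succ r ih =>
    have hr := M_be (p := p) h3 (l := r) (by omega)
    rw [prod_range_succ, bb_be, prod_range_succ, ← bb_be]
    by_cases h : r = n
    · subst h
      have hb := M_bb (p := p) h3 (r := r) (by omega)
      have hn2 := M_be_n h3 hn
      have k := prod_congr1 (p := p) (F := F) (G := be) r (fun l hl => M_be h3 (by omega)) (fun l hl => hF l (by omega) (by omega))
      refine ⟨?_, hb.mull hn2⟩
      have k2 := (k.mul hn2).mulr hc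
      have k3 := (k.z.add hb).mull hFn
      exact (k2.add k3).cast (by rw [← bb_be]; ring)
    · obtain ⟨i1, i2⟩ := ih (by omega) (by omega)
      refine ⟨?_, i2.mulr hr⟩
      have P2 : M p 2 (∏ l ∈ range r, F l) := ((i1.mono (show 2 ≤ 3 by omega)).add (hc.mull i2)).cast (by ring)
      have k2 : M p 3 ((∏ l ∈ range r, F l) * (F r - be r)) := P2.mul (hF r (by omega) h)
      exact (k2.add (i1.mulr hr)).cast (by ring)

lemma sum_LG {n : ℕ} {b f f' a c c' : ℕ → ℚ} (hb : ∀ r ≤ n, M p 0 (b r)) (h : ∀ r ≤ n, LG p (f r) (a r) (c r))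
    (h' : ∀ r ≤ n, LG p (f' r) (a r) (c' r)) :
    M p 3 (∑ r ∈ range (n+1), b r * f r - ∑ r ∈ range (n+1), b r * f' r - ∑ r ∈ range (n+1), b r * (c r - c' r)) := by
  rw [← sum_sub_distrib, ← sum_sub_distrib]
  refine M_sum _ _ fun r hr => ?_
  have hr : r ≤ n := by have := mem_range.1 hr; omega
  exact ((hb r hr).mull ((h r hr).sub' (h' r hr))).cast (by ring)

lemma lam_bb (n : ℕ) (N : ℚ) (r : ℕ) : lam N r = bb r * (∏ l ∈ range r, (1 + (N+1/2)*uu l)) * ∏ l ∈ range r, (1 + (-(N+1/2))*uu l) := by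
  unfold lam bb
  rw [← prod_mul_distrib, ← prod_mul_distrib]
  apply prod_congr rfl; intro l _
  rw [uu]
  have h1 : (l:ℚ)+1/2 ≠ 0 := by positivity
  have h2 : (l:ℚ)+1 ≠ 0 := by positivity
  have h3 : 2*(l:ℚ)+1 ≠ 0 := by positivity
  field_simp; ring

def oo (n : ℕ) : ℚ := ∑ r ∈ range (n+1), bb r * O2 r
def et (n : ℕ) : ℚ := ∑ r ∈ range (n+1), bb r * H2 r

lemma M_oo (h3 : 3 < p) {n : ℕ} (hn : p = 2*n+1) : M p 0 (oo n) :=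
  M_sum _ _ fun r hr => (M_bb h3 (by have := mem_range.1 hr; omega)).m0 (M_O2 h3 hn (by have := mem_range.1 hr; omega))
lemma M_et (h3 : 3 < p) {n : ℕ} (hn : p = 2*n+1) : M p 0 (et n) :=
  M_sum _ _ fun r hr => (M_bb h3 (by have := mem_range.1 hr; omega)).m0 (M_H2 (by have := mem_range.1 hr; omega))

lemma LG_lam (h3 : 3 < p) {n : ℕ} (hn : p = 2*n+1) {x : ℚ} (hx : M p 1 x) {r : ℕ} (hr : r ≤ n) :
    LG p ((∏ l ∈ range r, (1 + x*uu l)) * ∏ l ∈ range r, (1 + (-x)*uu l)) 0 (-(x^2)*O2 r) :=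
  ((LGu h3 hn hr hx).mul h3 (LGu h3 hn hr hx.neg)).congr rfl (by ring) (by ring)

/-- truncated sums of lam -/
lemma lam_trunc (h3 : 3 < p) {n : ℕ} (hn : p = 2*n+1) {N : ℚ} (hx : M p 1 (N+1/2)) :
    M p 3 (∑ r ∈ range (n+1), lam N r - (∑ r ∈ range (n+1), bb r - (N+1/2)^2 * oo n)) := by
  have := sum_LG (p := p) (n := n) (b := bb) (f := fun r => (∏ l ∈ range r, (1 + (N+1/2)*uu l)) * ∏ l ∈ range r, (1 + (-(N+1/2))*uu l))
    (f' := fun _ => 1) (a := fun _ => 0) (c := fun r => -((N+1/2)^2)*O2 r) (c' := fun _ => 0)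
    (fun r hr => M_bb h3 (by omega)) (fun r hr => LG_lam h3 hn hx hr) (fun _ _ => LG.one)
  refine this.cast ?_
  rw [oo, mul_sum]
  have e1 : ∑ r ∈ range (n+1), lam N r = ∑ r ∈ range (n+1), bb r * ((∏ l ∈ range r, (1 + (N+1/2)*uu l)) * ∏ l ∈ range r, (1 + (-(N+1/2))*uu l)) :=
    sum_congr rfl fun r _ => by rw [lam_bb n, mul_assoc]
  have e2 : ∑ r ∈ range (n+1), bb r * (-((N+1/2)^2)*O2 r - 0) = - ∑ r ∈ range (n+1), (N+1/2)^2*(bb r * O2 r) := by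
    rw [← sum_neg_distrib]; exact sum_congr rfl fun r _ => by ring
  rw [e1, e2]; simp only [mul_one]; ring

lemma n_half {n : ℕ} (hn : p = 2*n+1) : (n:ℚ)+1/2 = p/2 := by rw [hn]; push_cast; ring

lemma sum_bb (h3 : 3 < p) {n : ℕ} (hn : p = 2*n+1) :
    M p 3 (∑ r ∈ range (n+1), bb r - ((-1)^n + (p:ℚ)^2/4 * oo n)) := by
  have h := lam_trunc h3 hn (N := n) (by rw [n_half hn]; exact M_p.div (U_two h3))
  rw [lam_sum, n_half hn] at h
  exact h.neg.cast (by ring)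

lemma et_eq (h3 : 3 < p) {n : ℕ} (hn : p = 2*n+1) : M p 1 (et n - (-4 * eulerE (p-3))) := by
  have hx : M p 1 ((n:ℚ)+1/2) := by rw [n_half hn]; exact M_p.div (U_two h3)
  have h1 : M p 1 (∑ r ∈ range (n+1), (lam n r - bb r) * H2 r) := M_sum _ _ fun r hr => by
    have hr := mem_range.1 hr
    have k := (LG_lam h3 hn hx (r := r) (by omega)).sub1 h3
    refine ((((M_bb h3 (r := r) (by omega))).mull k).mulr (M_H2 (r := r) (by omega))).cast ?_
    rw [lam_bb n]; ring
  have h2 := euler_alt h3 hn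
  have h3' := eta_eq n
  simp only [sub_mul, sum_sub_distrib] at h1
  rw [h3', ← et] at h1
  have hs : ((-1:ℚ)^n)^2 = 1 := by rw [← pow_mul, mul_comm, pow_mul]; norm_num
  have ms : M p 0 (2*(-1:ℚ)^n) := M.m0 (by exact_mod_cast M_nat 2) (M.pow0 (by exact_mod_cast M_int (-1)) n)
  refine ((ms.mull h2).add h1).neg.cast ?_
  linear_combination (-4 * eulerE (p-3)) * hs

lemma bb_choose (h3 : 3 < p) {n : ℕ} (hn : p = 2*n+1) {r : ℕ} (hr : r < p) : M p 1 (bb r - (n.choose r : ℚ)^2) := by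
  have h := choose_prod n r
  have e : (n.choose r : ℚ)^2 = ∏ l ∈ range r, (((l:ℚ) - n)*vv l)^2 := by
    rw [prod_pow, show ∏ l ∈ range r, (((l:ℚ) - n)*vv l) = (-1)^r * (n.choose r) by rw [← h]; rfl, mul_pow, ← pow_mul, mul_comm r 2, pow_mul]; norm_num
  rw [e, bb_be]
  refine prod_congr1 r (fun l hl => (((M_nat l).sub (M_nat n)).m0 (M_vv (by omega))).pow0 2) (fun l hl => ?_)
  have v := (M_vv (p := p) (l := l) (by omega)).pow0 2
  rw [be_vv]
  have : M p 1 ((p:ℚ)/2 * (((l:ℚ)+1/2) + ((l:ℚ)-n))) := (M_p.div (U_two h3)).mulr (((M_nat l).add (M_half h3)).add ((M_nat l).sub (M_nat n)))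
  refine (this.mulr v).cast ?_
  rw [← n_half hn]; ring

lemma uu_vv (h3 : 3 < p) {n : ℕ} (hn : p = 2*n+1) {k : ℕ} (hk : k < n) : M p 1 (uu k - (-(vv (n-1-k)))) := by
  have uv := U_vv (p := p) (l := n-1-k) (by omega)
  have ev : vv (n-1-k) = ((n:ℚ)-k)⁻¹ := by
    rw [vv, Nat.cast_sub (by omega), Nat.cast_sub (by omega)]; congr 1; push_cast; ring
  have := M_p.mulr ((M_uu (p := p) h3 (l := k) (by omega)).m0 (uv.m0.div (U_two h3)))
  refine this.cast ?_
  have evne := uv.ne; rw [ev] at evne ⊢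
  rw [uu]
  have n1 : (k:ℚ)+1/2 ≠ 0 := by positivity
  have n3 : 2*(k:ℚ)+1 ≠ 0 := by positivity
  have n2 : (n:ℚ)-k ≠ 0 := fun h0 => evne (by rw [h0]; simp)
  field_simp; rw [hn]; push_cast; ring

lemma O2_H2 (h3 : 3 < p) {n : ℕ} (hn : p = 2*n+1) {r : ℕ} (hr : r ≤ n) : M p 1 (O2 r + H2 (n-r)) := by
  have h := H2_half h3 hn
  have e : H2 n = H2 (n-r) + ∑ l ∈ range r, vv (n-1-l)^2 := by
    conv_lhs => rw [H2, show n = (n-r)+r by omega, sum_range_add, ← H2]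
    congr 1
    rw [← sum_range_reflect]; apply sum_congr rfl; intro l hl
    have := mem_range.1 hl
    congr 2; omega
  have k : M p 1 (∑ l ∈ range r, (uu l^2 - vv (n-1-l)^2)) := M_sum _ _ fun l hl => by
    have hl := mem_range.1 hl
    have := M_powsub (uu_vv h3 hn (k := l) (by omega)) (M_uu h3 (by omega)) (M_vv (by omega)).neg 2
    exact this.cast (by ring)
  rw [sum_sub_distrib] at k
  refine (k.add h).cast ?_
  rw [e, O2]; ring

lemma oo_et (h3 : 3 < p) {n : ℕ} (hn : p = 2*n+1) : M p 1 (oo n + et n) := by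
  have e : et n = ∑ r ∈ range (n+1), bb (n-r) * H2 (n-r) := by
    rw [et, ← sum_range_reflect]; apply sum_congr rfl; intro r hr; congr 2 <;> omega
  rw [e, oo, ← sum_add_distrib]
  refine M_sum _ _ fun r hr => ?_
  have hr := mem_range.1 hr
  have k1 := bb_choose h3 hn (r := r) (by omega)
  have k2 := bb_choose h3 hn (r := n-r) (by omega)
  rw [Nat.choose_symm (by omega)] at k2
  have k3 := O2_H2 h3 hn (r := r) (by omega)
  have k4 := (k2.sub k1).mulr (M_H2 (p := p) (r := n-r) (by omega))
  exact (k4.add ((M_bb h3 (r := r) (by omega)).mull k3)).cast (by ring)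

lemma oo_eq (h3 : 3 < p) {n : ℕ} (hn : p = 2*n+1) : M p 1 (oo n - 4 * eulerE (p-3)) :=
  ((oo_et h3 hn).sub (et_eq h3 hn)).cast (by ring)
end

section
variable {p : ℕ} [hp : Fact p.Prime]

/-- `p² τ` -/
def ta (p n : ℕ) : ℚ := ∑ r ∈ Ico (n+1) p, bb r

lemma vand_fk (p n : ℕ) (k : ℕ) : ∑ r ∈ range (n+1), ∏ l ∈ range r, (((l:ℚ) - n)*(n+1+p*k/2+l)/((l+1)*(1+p*k/2+l))) = (-1)^n * fk p n k := by
  rw [vand n ((p:ℚ)*k/2) (fun l => by positivity), fk, mul_div_assoc]; push_cast; rfl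

/-- the comparator product -/
lemma vand_prod {n : ℕ} (hn : p = 2*n+1) {g : ℚ} (hg : 0 ≤ g) (r : ℕ) :
    ∏ l ∈ range r, (((l:ℚ) - n)*(n+1+g+l)/((l+1)*(1+g+l))) =
    bb r * ((∏ l ∈ range r, (1 + (-(p/2:ℚ))*uu l)) * (∏ l ∈ range r, (1 + (g+p/2)*uu l)) / ∏ l ∈ range r, (1 + g * vv l)) := by
  unfold bb
  rw [← prod_mul_distrib, ← prod_div_distrib, ← prod_mul_distrib]
  apply prod_congr rfl; intro l _
  rw [uu, vv, show (n:ℚ) = p/2-1/2 by rw [hn]; push_cast; ring]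
  have h1 : 2*(l:ℚ)+1 ≠ 0 := by positivity
  have h2 : (l:ℚ)+1 ≠ 0 := by positivity
  have h4 : 1+g+(l:ℚ) ≠ 0 := by positivity
  have h5 : (l:ℚ)+1+g ≠ 0 := by positivity
  have h6 : (l:ℚ)+1/2 ≠ 0 := by positivity
  have h7 : 1 + g*((l:ℚ)+1)⁻¹ ≠ 0 := by positivity
  rw [show 1 + g*((l:ℚ)+1)⁻¹ = ((l:ℚ)+1+g)/(l+1) by field_simp]
  rw [show 1 + g + (l:ℚ) = l+1+g by ring]
  field_simp; ring

lemma LG_vand (h3 : 3 < p) {n : ℕ} (hn : p = 2*n+1) {g : ℚ} (hg : M p 1 g) {r : ℕ} (hr : r ≤ n) :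
    LG p ((∏ l ∈ range r, (1 + (-(p/2:ℚ))*uu l)) * (∏ l ∈ range r, (1 + (g+p/2)*uu l)) / ∏ l ∈ range r, (1 + g * vv l))
      (g*(O1 r - H1 r)) (-(1/2)*((p:ℚ)^2/4 + (g+p/2)^2) * O2 r + g^2/2 * H2 r) := by
  have hp2 : M p 1 (p/2:ℚ) := M_p.div (U_two h3)
  exact (((LGu h3 hn hr hp2.neg).mul h3 (LGu h3 hn hr (hg.add hp2))).div h3 (LGv h3 (r := r) (by omega) hg)).congr rfl (by ring) (by ring)

/-- general comparison with Vandermonde -/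
lemma cmp_vand (h3 : 3 < p) {n : ℕ} (hn : p = 2*n+1) (k : ℕ) (f : ℕ → ℚ) (x y : ℚ)
    (hf : ∀ r ≤ n, LG p (f r) ((p*k/2:ℚ)*(O1 r - H1 r)) (x * O2 r + y * H2 r)) :
    M p 3 (∑ r ∈ range (n+1), bb r * f r - ((-1)^n * ((2:ℚ)^(p-1))^k
      + (x + 1/2*((p:ℚ)^2/4 + (p*k/2+p/2)^2)) * oo n + (y - (p*k/2)^2/2) * et n)) := by
  have hg : M p 1 (p*k/2:ℚ) := (M_p.mulr (M_nat k)).div (U_two h3)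
  have h1 := sum_LG (p := p) (b := bb) (fun r hr => M_bb h3 (by omega)) hf (fun r hr => LG_vand h3 hn hg hr)
  have h2 := vand_fk p n k
  rw [sum_congr rfl fun r _ => vand_prod (p := p) hn (g := p*k/2) (by positivity) r] at h2
  rw [h2] at h1
  have h4 := fk_w h3 hn k
  have ms : M p 0 ((-1:ℚ)^n) := M.pow0 (by exact_mod_cast M_int (-1)) n
  refine (h1.add (ms.mull h4)).cast ?_
  have e : ∑ r ∈ range (n+1), bb r * (x * O2 r + y * H2 r - (-(1/2)*((p:ℚ)^2/4 + (p*k/2+p/2)^2) * O2 r + (p*k/2)^2/2 * H2 r))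
     = (x + 1/2*((p:ℚ)^2/4 + (p*k/2+p/2)^2)) * oo n + (y - (p*k/2)^2/2) * et n := by
    rw [oo, et, mul_sum, mul_sum, ← sum_add_distrib]; apply sum_congr rfl; intros; ring
  rw [e, zpow_natCast]; ring

lemma sum_tail (h3 : 3 < p) {n : ℕ} (hn : p = 2*n+1) {F : ℕ → ℚ} {c : ℚ} (hc : M p 0 c)
    (hF : ∀ l, l+1 < p → l ≠ n → M p 1 (F l - be l)) (hFn : M p 3 (F n - c * be n)) :
    M p 3 (∑ r ∈ Ico (n+1) p, ∏ l ∈ range r, F l - c * ta p n) := by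
  rw [ta, mul_sum, ← sum_sub_distrib]
  refine M_sum _ _ fun r hr => ?_
  have := mem_Ico.1 hr
  exact (tail_prod h3 hn hc hF hFn r (by omega) (by omega)).1

lemma sum_split {n : ℕ} (hn : p = 2*n+1) (f : ℕ → ℚ) : ∑ r ∈ range p, f r = ∑ r ∈ range (n+1), f r + ∑ r ∈ Ico (n+1) p, f r :=
  (sum_range_add_sum_Ico f (by omega)).symm

lemma lam_add (N : ℚ) (k i : ℕ) : lam N (k+i) = lam N k * ∏ l ∈ range i, (((k+l:ℚ)-N)*((k+l)+N+1)/((k+l)+1)^2) := by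
  unfold lam; rw [prod_range_add]; push_cast; rfl

lemma lam_p (n : ℕ) (hn : p = 2*n+1) : lam ((p+n:ℕ):ℚ) p = -((2*p).choose p * ∏ l ∈ range n, (1+2*p*vv l)) := by
  have h := choose_prod (p+n) p
  have e1 : lam ((p+n:ℕ):ℚ) p = (∏ l ∈ range p, (((l:ℚ) - (p+n:ℕ))/(l+1))) * ∏ l ∈ range p, (((l:ℚ) + (p+n:ℕ)+1)/(l+1)) := by
    rw [lam, ← prod_mul_distrib]; apply prod_congr rfl; intros; rw [div_mul_div_comm]; congr 1; ring
  have e2 : ∀ a b : ℕ, ∏ l ∈ range b, (((l:ℚ) + a+1)/(l+1)) = (a+b).choose b := by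
    intro a b
    induction b with
    | zero => simp
    | succ b ih =>
      rw [prod_range_succ, ih]
      have := Nat.add_one_mul_choose_eq (a+b) b
      have h0 : (b:ℚ)+1 ≠ 0 := by positivity
      rw [mul_div_assoc', div_eq_iff h0]
      rw [show a+(b+1) = a+b+1 by ring]
      have h' : (((a+b+1:ℕ)):ℚ) * (a+b).choose b = (a+b+1).choose (b+1) * (b+1:ℕ) := by exact_mod_cast this
      push_cast at h'; rw [← h']; ring
  have e3 : ∏ l ∈ range n, (1+2*p*vv l) = ∏ l ∈ range n, (((l:ℚ) + (2*p:ℕ)+1)/(l+1)) := prod_congr rfl fun l _ => by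
    rw [vv]; have h0 : (l:ℚ)+1 ≠ 0 := by positivity
    push_cast; field_simp; ring
  rw [e1, h, e2, e3, e2]
  rw [Odd.neg_one_pow ⟨n, hn⟩]
  have c1 := Nat.choose_mul_factorial_mul_factorial (n := p+n) (k := p) (by omega)
  have c2 := Nat.choose_mul_factorial_mul_factorial (n := p+n+p) (k := p) (by omega)
  have c3 := Nat.choose_mul_factorial_mul_factorial (n := 2*p+n) (k := n) (by omega)
  have c4 := Nat.choose_mul_factorial_mul_factorial (n := 2*p) (k := p) (by omega)
  rw [show p+n-p = n by omega] at c1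
  rw [show p+n+p-p = p+n by omega] at c2
  rw [show 2*p+n-n = 2*p by omega] at c3
  rw [show 2*p-p = p by omega] at c4
  rw [show 2*p+n = p+n+p by omega] at *
  have : (p+n).choose p * (p+n+p).choose p = (2*p).choose p * (p+n+p).choose n := by
    apply Nat.eq_of_mul_eq_mul_right (show 0 < p.factorial*n.factorial*p.factorial by positivity)
    calc _ = ((p+n).choose p * p.factorial * n.factorial) * ((p+n+p).choose p * p.factorial) := by ring
      _ = (p+n+p).choose n * n.factorial * ((2*p).choose p * p.factorial * p.factorial) := by rw [c1, c4, c3, ← c2]; ring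
      _ = _ := by ring
  have h' : ((p+n).choose p:ℚ) * (p+n+p).choose p = (2*p).choose p * (p+n+p).choose n := by exact_mod_cast this
  linear_combination -h'

set_option maxHeartbeats 1000000 in
lemma ta_eq (h3 : 3 < p) {n : ℕ} (hn : p = 2*n+1) : M p 3 (ta p n - (-2) * (p:ℚ)^2 * eulerE (p-3)) := by
  have u2 := U_two (p := p) h3
  have hN : ((p+n:ℕ):ℚ)+1/2 = 3*p/2 := by rw [hn]; push_cast; ring
  have hx : M p 1 (((p+n:ℕ):ℚ)+1/2) := by rw [hN]; exact ((M_nat 3).mull M_p).div u2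
  have t0 := lam_sum (p+n)
  rw [show p+n+1 = p+(n+1) by ring, sum_range_add, sum_split hn] at t0
  -- part 1
  have h1 := lam_trunc h3 hn (N := ((p+n:ℕ):ℚ)) hx
  have hb := sum_bb h3 hn
  -- part 2
  have h2 : M p 3 (∑ r ∈ Ico (n+1) p, lam ((p+n:ℕ):ℚ) r - (-8) * ta p n) := by
    refine sum_tail h3 hn (by exact_mod_cast M_int (-8)) ?_ ?_
    · intro l hl _
      have v := (M_vv (p := p) (l := l) (by omega)).pow0 2
      refine ((hx.mulr hx.z).mulr v).neg.cast ?_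
      rw [be, vv]; field_simp; ring
    · refine (M_zero 3).cast ?_
      rw [be, hn]; push_cast; field_simp; ring
  -- part 3
  have h4 : M p 3 (∑ i ∈ range (n+1), ∏ l ∈ range i, (((p+l:ℚ)-(p+n:ℕ))*((p+l)+(p+n:ℕ)+1)/((p+l)+1)^2) - ((-1)^n * ((2:ℚ)^(p-1))^4 - (p:ℚ)^2 * et n)) := by
    have hp2 : M p 1 (p/2:ℚ) := M_p.div u2
    have hp5 : M p 1 (5*p/2:ℚ) := ((M_nat 5).mull M_p).div u2
    have k := cmp_vand h3 hn 4 (fun r => (∏ l ∈ range r, (1 + (-(p/2:ℚ))*uu l)) * (∏ l ∈ range r, (1 + (5*p/2)*uu l)) / (∏ l ∈ range r, (1 + p * vv l))^2)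
      (-(1/2)*((p:ℚ)^2/4 + (5*p/2)^2)) ((p:ℚ)^2) (fun r hr => by
        exact (((LGu h3 hn hr hp2.neg).mul h3 (LGu h3 hn hr hp5)).div h3 ((LGv h3 (r := r) (by omega) M_p).pow h3 2)).congr rfl (by push_cast; ring) (by push_cast; ring))
    refine k.cast ?_
    have : ∀ r ∈ range (n+1), bb r * ((∏ l ∈ range r, (1 + (-(p/2:ℚ))*uu l)) * (∏ l ∈ range r, (1 + (5*p/2)*uu l)) / (∏ l ∈ range r, (1 + p * vv l))^2)
       = ∏ l ∈ range r, (((p+l:ℚ)-(p+n:ℕ))*((p+l)+(p+n:ℕ)+1)/((p+l)+1)^2) := fun r _ => by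
      unfold bb
      rw [← prod_mul_distrib, ← prod_pow, ← prod_div_distrib, ← prod_mul_distrib]
      apply prod_congr rfl; intro l _
      rw [uu, vv]
      push_cast
      rw [show (n:ℚ) = p/2-1/2 by rw [hn]; push_cast; ring]
      have h1 : 2*(l:ℚ)+1 ≠ 0 := by positivity
      have h2 : (l:ℚ)+1 ≠ 0 := by positivity
      have h6 : (l:ℚ)+1/2 ≠ 0 := by positivity
      rw [show 1 + (p:ℚ)*((l:ℚ)+1)⁻¹ = ((p:ℚ)+l+1)/(l+1) by field_simp; ring]
      have h5 : (p:ℚ)+l+1 ≠ 0 := by positivity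
      field_simp; ring
    rw [sum_congr rfl this]; push_cast; ring
  have h5 : M p 3 (lam ((p+n:ℕ):ℚ) p + 2 * (((2:ℚ)^(p-1))^4)⁻¹) := by
    rw [lam_p n hn]
    have c := choose_p h3 2 1
    rw [mul_one, mul_comm p 2] at c
    have f := fk_eq p n 4
    have fw := fk_w h3 hn 4
    have uf : U p (fk p n 4) := (LGfk h3 hn 4).u h3
    have uw : U p (((2:ℚ)^(p-1))^4) := ((LGw h3 hn).u h3).pow 4
    have e : ∏ l ∈ range n, (1+2*p*vv l) = (fk p n 4)⁻¹ := by
      rw [f, inv_inv]; apply prod_congr rfl; intros; push_cast; ring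
    rw [e]
    have d : M p 3 ((fk p n 4)⁻¹ - (((2:ℚ)^(p-1))^4)⁻¹) := by
      refine (fw.mulr (uf.inv.m0.m0 uw.inv.m0)).neg.cast ?_
      have := uf.ne; have := uw.ne
      rw [show ((2:ℚ)^(p-1))^(4:ℤ) = ((2:ℚ)^(p-1))^4 by norm_cast]
      field_simp; ring
    refine (c.cmul d (M_nat _) uw.inv.m0).neg.cast ?_
    norm_num; ring
  have hblock : ∑ i ∈ range (n+1), lam ((p+n:ℕ):ℚ) (p+i) = lam ((p+n:ℕ):ℚ) p * ∑ i ∈ range (n+1), ∏ l ∈ range i, (((p+l:ℚ)-(p+n:ℕ))*((p+l)+(p+n:ℕ)+1)/((p+l)+1)^2) := by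
    rw [mul_sum]; exact sum_congr rfl fun i _ => lam_add _ _ _
  rw [hblock] at t0
  have ms : M p 0 ((-1:ℚ)^n) := M.pow0 (by exact_mod_cast M_int (-1)) n
  have uw : U p (((2:ℚ)^(p-1))^4) := ((LGw h3 hn).u h3).pow 4
  have w1 : M p 1 ((((2:ℚ)^(p-1))^4)⁻¹ - 1) := (((LGw h3 hn).pow h3 4).inv h3).sub1 h3
  have me := M_et h3 hn
  have m2 : M p 0 (2:ℚ) := u2.m0
  have mB : M p 0 ((-1)^n * ((2:ℚ)^(p-1))^4 - (p:ℚ)^2 * et n) := (ms.m0 uw.m0).sub (((M_ppow 2).mulr me).z)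
  rw [show lam ((p+n:ℕ):ℚ) p + 2 * (((2:ℚ)^(p-1))^4)⁻¹ = lam ((p+n:ℕ):ℚ) p - (-(2 * (((2:ℚ)^(p-1))^4)⁻¹)) by ring] at h5
  have mL : M p 0 (-(2 * (((2:ℚ)^(p-1))^4)⁻¹)) := (m2.m0 uw.inv.m0).neg
  have h6 := h5.cmul h4 (h5.of0 mL) mB
  have h7 : M p 3 ((p:ℚ)^2*et n * ((((2:ℚ)^(p-1))^4)⁻¹ - 1)) := ((M_ppow 2).mulr me).mul w1
  have h8 : M p 3 ((p:ℚ)^2 * (et n - (-4 * eulerE (p-3)))) := (M_ppow 2).mul (et_eq h3 hn)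
  have h9 : M p 3 ((p:ℚ)^2 * (oo n - (4 * eulerE (p-3)))) := (M_ppow 2).mul (oo_eq h3 hn)
  have u8 : U p (8:ℚ) := U_eight h3
  apply u8.cancel
  rw [pow_add, Odd.neg_one_pow ⟨n, hn⟩] at t0
  have total := ((((h1.add hb).add h2).add h6).add ((h7.mulr m2))).add ((m2.mull h8).sub (m2.mull h9))
  refine total.cast ?_
  have hw : (((2:ℚ)^(p-1))^4)⁻¹ * ((2:ℚ)^(p-1))^4 = 1 := inv_mul_cancel₀ uw.ne
  rw [hN]
  linear_combination (-1)*t0 + (-2*(-1)^n)*hw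
end

def rho (N K : ℚ) : ℚ := (1/2+K)*(1-N+K)*((N+1)/2+K)*(N/2+1+K)/(1+K)^4
def II (p j m : ℕ) : ℚ := ∑ r ∈ range p, ∏ l ∈ range r, rho (p*m) (p*j+l)

section
variable {p : ℕ} [hp : Fact p.Prime]

lemma one_pv (e : ℚ) (l : ℕ) : 1 + e * vv l = (e+l+1)/(l+1) := by
  rw [vv]; have : (l:ℚ)+1 ≠ 0 := by positivity
  field_simp; ring
lemma one_pu (e : ℚ) (l : ℕ) : 1 + e * uu l = (e+l+1/2)/(l+1/2) := by
  rw [uu]; have : (l:ℚ)+1/2 ≠ 0 := by positivity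
  field_simp; ring

lemma rho_prod (N : ℚ) {e : ℚ} (he : 0 ≤ e) (r : ℕ) : ∏ l ∈ range r, rho N (e+l) = bb r *
   ((∏ l ∈ range r, (1+e*uu l)) * (∏ l ∈ range r, (1+(N/2+e)*uu l)) * ((∏ l ∈ range r, (1+(e-N)*vv l)) * (∏ l ∈ range r, (1+(N/2+e)*vv l)))
     / (∏ l ∈ range r, (1+e*vv l))^4) := by
  unfold bb
  rw [← prod_mul_distrib, ← prod_mul_distrib, ← prod_mul_distrib, ← prod_pow, ← prod_div_distrib, ← prod_mul_distrib]
  apply prod_congr rfl; intro l _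
  rw [one_pv, one_pv, one_pv, one_pu, one_pu, rho]
  have h2 : (l:ℚ)+1 ≠ 0 := by positivity
  have h6 : (l:ℚ)+1/2 ≠ 0 := by positivity
  have h5 : 1+(e+(l:ℚ)) ≠ 0 := by positivity
  rw [show e+(l:ℚ)+1 = 1+(e+l) by ring]
  field_simp; ring

lemma M.m21 {a b : ℚ} (h : M p 2 a) (h' : M p 1 b) : M p 3 (a*b) := (h'.m12 h).cast (mul_comm a b)
set_option maxHeartbeats 1000000 in
lemma II_tail (h3 : 3 < p) {n : ℕ} (hn : p = 2*n+1) (j m : ℕ) : M p 3 (∑ r ∈ Ico (n+1) p, ∏ l ∈ range r, rho (p*m) (p*j+l) - ((1+2*j)*(1+m+2*j)) * ta p n) := by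
    have u2 := U_two (p := p) h3
    have he : M p 1 ((p:ℚ)*j) := M_p.mulr (M_nat j)
    have hN : M p 1 ((p:ℚ)*m) := M_p.mulr (M_nat m)
    have hN2 : M p 1 ((p:ℚ)*m/2+p*j) := (hN.div u2).add he
    have den : ∀ l, l+1 < p → U p (1+((p:ℚ)*j+l)) := fun l hl => by
      have : U p ((l+1:ℕ):ℚ) := U_of_lt (by omega) hl
      exact this.congr (he.cast (by push_cast; ring))
    refine sum_tail h3 hn ?_ ?_ ?_
    · exact_mod_cast M_nat ((1+2*j)*(1+m+2*j))
    · intro l hl _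
      have d := den l hl
      have ul : U p ((l+1:ℕ):ℚ) := U_of_lt (by omega) hl
      have x0 : M p 0 ((l:ℚ)+1/2) := (M_nat l).add (M_half h3)
      have y0 : M p 0 ((l:ℚ)+1) := by exact_mod_cast M_nat (l+1)
      -- numerators
      have n1 : M p 1 ((1/2+((p:ℚ)*j+l))*((((p*m:ℚ)+1)/2+(p*j+l))) - ((l:ℚ)+1/2)*(l+1/2)) :=
        M.cmul (he.cast (by ring)) (hN2.cast (by ring)) ((he.z.add x0).cast (by ring)) x0
      have n2 : M p 1 ((1-(p:ℚ)*m+(p*j+l))*(((p*m:ℚ)/2+1+(p*j+l))) - ((l:ℚ)+1)*(l+1)) :=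
        M.cmul ((he.sub hN).cast (by ring)) (hN2.cast (by ring)) (((he.sub hN).z.add y0).cast (by ring)) y0
      have n12 := n1.cmul n2 (n1.of0 (x0.m0 x0)) (y0.m0 y0)
      have d4 : M p 1 ((1+((p:ℚ)*j+l))^4 - ((l:ℚ)+1)^4) := M_powsub (he.cast (by ring)) d.m0 y0 4
      have ul' : U p ((l:ℚ)+1) := by exact_mod_cast ul
      have i4 : M p 1 (((1+((p:ℚ)*j+l))^4)⁻¹ - (((l:ℚ)+1)^4)⁻¹) := by
        refine (d4.mulr ((d.pow 4).inv.m0.m0 (ul'.pow 4).inv.m0)).neg.cast ?_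
        have := (d.pow 4).ne; have := (ul'.pow 4).ne
        field_simp; ring
      refine (n12.cmul i4 (n12.of0 ((x0.m0 x0).m0 (y0.m0 y0))) (ul'.pow 4).inv.m0).cast ?_
      rw [rho, be]
      have := ul'.ne
      rw [div_eq_mul_inv]
      congr 1
      · ring
      · field_simp
    · have d := den n (by omega)
      have ul' : U p ((n:ℚ)+1) := by exact_mod_cast U_of_lt (p := p) (z := n+1) (by omega) (by omega)
      have y0 : M p 0 ((n:ℚ)+1) := ul'.m0
      have n2 : M p 1 ((1-(p:ℚ)*m+(p*j+n))*(((p*m:ℚ)/2+1+(p*j+n))) - ((n:ℚ)+1)*(n+1)) :=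
        M.cmul ((he.sub hN).cast (by ring)) (hN2.cast (by ring)) (((he.sub hN).z.add y0).cast (by ring)) y0
      have d4 : M p 1 ((1+((p:ℚ)*j+n))^4 - ((n:ℚ)+1)^4) := M_powsub (he.cast (by ring)) d.m0 y0 4
      have i4 : M p 1 (((1+((p:ℚ)*j+n))^4)⁻¹ - (((n:ℚ)+1)^4)⁻¹) := by
        refine (d4.mulr ((d.pow 4).inv.m0.m0 (ul'.pow 4).inv.m0)).neg.cast ?_
        have := (d.pow 4).ne; have := (ul'.pow 4).ne
        field_simp; ring
      have nn := n2.cmul i4 (n2.of0 (y0.m0 y0)) (ul'.pow 4).inv.m0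
      have c0 : M p 0 ((1+2*j)*(1+m+2*j):ℚ) := by exact_mod_cast M_nat ((1+2*j)*(1+m+2*j))
      have pp : M p 2 ((p:ℚ)^2/4 * ((1+2*j)*(1+m+2*j))) := ((M_ppow 2).div (U_four h3)).mulr c0
      have fin := pp.m21 nn
      refine fin.cast ?_
      rw [be_n hn, rho, vv]
      have := ul'.ne
      rw [show (1/2+((p:ℚ)*j+n)) = p/2*(1+2*j) by rw [show (1/2+((p:ℚ)*j+n)) = p*j+(n+1/2) by ring, n_half hn]; ring]
      rw [show (((p:ℚ)*m+1)/2+((p:ℚ)*j+n)) = p/2*(1+m+2*j) by rw [show (((p:ℚ)*m+1)/2+((p:ℚ)*j+n)) = p*m/2+p*j+(n+1/2) by ring, n_half hn]; ring]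
      have := d.ne
      field_simp
      ring

set_option maxHeartbeats 1000000 in
lemma II_eq (h3 : 3 < p) {n : ℕ} (hn : p = 2*n+1) (j m : ℕ) :
    M p 3 (II p j m - ((2:ℚ)^(p-1))^(m+4*j) * ((-1)^n + p^2 * eulerE (p-3) * (3*m^2-m-1-4*j))) := by
  have u2 := U_two (p := p) h3
  have he : M p 1 ((p:ℚ)*j) := M_p.mulr (M_nat j)
  have hN : M p 1 ((p:ℚ)*m) := M_p.mulr (M_nat m)
  have hN2 : M p 1 ((p:ℚ)*m/2+p*j) := (hN.div u2).add he
  have k := cmp_vand h3 hn (m+4*j) (fun r => (∏ l ∈ range r, (1+((p:ℚ)*j)*uu l)) * (∏ l ∈ range r, (1+((p:ℚ)*m/2+p*j)*uu l)) * ((∏ l ∈ range r, (1+((p:ℚ)*j-p*m)*vv l)) * (∏ l ∈ range r, (1+((p:ℚ)*m/2+p*j)*vv l)))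
     / (∏ l ∈ range r, (1+((p:ℚ)*j)*vv l))^4)
     (-(1/2)*(((p:ℚ)*j)^2 + (p*m/2+p*j)^2)) (-(1/2)*(((p:ℚ)*j-p*m)^2+(p*m/2+p*j)^2-4*(p*j)^2)) (fun r hr => by
      have a1 := LGu h3 hn hr he
      have a2 := LGu h3 hn hr hN2
      have a3 := LGv h3 (r := r) (by omega) (he.sub hN)
      have a4 := LGv h3 (r := r) (by omega) hN2
      have a5 := LGv h3 (r := r) (by omega) he
      exact (((a1.mul h3 a2).mul h3 (a3.mul h3 a4)).div h3 (a5.pow h3 4)).congr rfl (by push_cast; ring) (by push_cast; ring))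
  have e1 : ∑ r ∈ range (n+1), ∏ l ∈ range r, rho (p*m) (p*j+l) = _ := sum_congr rfl fun r _ => rho_prod (p*m) (e := p*j) (by positivity) r
  rw [← e1] at k
  have t := II_tail h3 hn j m
  have tt := ta_eq h3 hn
  have c0 : M p 0 ((1+2*j)*(1+m+2*j):ℚ) := by exact_mod_cast M_nat ((1+2*j)*(1+m+2*j))
  have hE := M_euler (p := p) (p-3)
  have ho : M p 3 ((p:ℚ)^2 * (oo n - (4 * eulerE (p-3)))) := (M_ppow 2).m21 (oo_eq h3 hn)
  have hh : M p 3 ((p:ℚ)^2 * (et n - (-4 * eulerE (p-3)))) := (M_ppow 2).m21 (et_eq h3 hn)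
  have w1 : M p 1 (((2:ℚ)^(p-1))^(m+4*j) - 1) := ((LGw h3 hn).pow h3 (m+4*j)).sub1 h3
  have cc : M p 0 (3*m^2-m-1-4*j:ℚ) := by
    have := M_int (p := p) (3*(m:ℤ)^2-m-1-4*j)
    push_cast at this; exact this
  have hw : M p 3 ((p:ℚ)^2 * eulerE (p-3) * (3*m^2-m-1-4*j) * (((2:ℚ)^(p-1))^(m+4*j) - 1)) := (((M_ppow 2).mulr hE).mulr cc).m21 w1
  have cm1 : M p 0 (1/2*(1/2+(m+4*j)/2+2*j^2+j*m):ℚ) :=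
    (M_half h3).m0 ((((M_half h3).add (((by exact_mod_cast M_nat (m+4*j)) : M p 0 ((m:ℚ)+4*j)).div u2)).add (by exact_mod_cast M_nat (2*j^2))).add (by exact_mod_cast M_nat (j*m)))
  have cm2 : M p 0 (1/2*(2*j^2+j*m+3*m^2/2):ℚ) :=
    (M_half h3).m0 ((((by exact_mod_cast M_nat (2*j^2+j*m)) : M p 0 (2*(j:ℚ)^2+j*m))).add (((by exact_mod_cast M_nat (3*m^2)) : M p 0 (3*(m:ℚ)^2)).div u2))
  have total := ((((k.add t).add (c0.mull tt)).add (cm1.mull ho)).sub (cm2.mull hh)).sub hw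
  refine total.cast ?_
  rw [II, sum_split hn]
  push_cast
  ring

/-- `J(N) = N I(0,N)`, general block version -/
lemma t1_rho (N : ℚ) (K i : ℕ) : (N-(K+i:ℕ)) * t1 (-1-N) (K+i) = (N-K) * t1 (-1-N) K * ∏ l ∈ range i, rho N (K+l) := by
  induction i with
  | zero => simp
  | succ i ih =>
    rw [prod_range_succ, ← mul_assoc, ← ih, ← add_assoc, t1_succ, rr, rho]
    have h1 : ((K:ℚ)+i+1) ≠ 0 := by positivity
    have h2 : (1+((K:ℚ)+i)) ≠ 0 := by positivity
    push_cast
    rw [show ((K:ℚ)+i+1) = 1+((K:ℚ)+i) by ring]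
    field_simp; ring

lemma t1_shift (N : ℚ) (k : ℕ) : (N+1-k) * t1 (-1-(N+1)) k = (N+1+2*k) * t1 (-1-N) k := by
  have h : (-1-N+k) * ff (-1-N+k-1) (3*k) = ff (-1-N+k) (3*k) * (-1-N+k-(3*k:ℕ)) := by rw [← ff_succ', ff_succ]
  unfold t1
  rw [show -1-(N+1)+(k:ℚ) = -1-N+k-1 by ring]
  push_cast at h
  linear_combination (-((2*k).factorial / (k.factorial:ℚ)^5) / 16^k) * h

def q1 (p : ℕ) (N : ℚ) : ℚ := ∑ k ∈ range p, t1 N k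
def JJ (p : ℕ) (N : ℚ) : ℚ := ∑ k ∈ range p, (N-k) * t1 (-1-N) k

lemma JJ_step {K : ℕ} (N : ℚ) : (3*N+1) * q1 K (-1-N) = JJ K (N+1) + 2 * JJ K N := by
  unfold q1 JJ
  rw [mul_sum, mul_sum, ← sum_add_distrib]
  apply sum_congr rfl; intro k _
  rw [t1_shift]; ring

lemma gosper {K : ℕ} (N : ℚ) (R : ℕ) : ∑ i ∈ range R, (3*(N+i)+1) * q1 K (-1-(N+i)) * (-1/2)^i = -2*((-1/2)^R * JJ K (N+R) - JJ K N) := by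
  induction R with
  | zero => simp
  | succ R ih =>
    rw [sum_range_succ, ih, JJ_step, pow_succ]; push_cast
    rw [show N+((R:ℚ)+1) = N+R+1 by ring]; ring

lemma JJ_I (m : ℕ) : JJ p (p*m) = p*m*II p 0 m := by
  unfold JJ II
  rw [mul_sum]; apply sum_congr rfl; intro k _
  have := t1_rho (p*m) 0 k
  rw [t1_zero] at this; simp at this
  rw [this]; simp

def Th2 (p m : ℕ) : ℚ := ∑ i ∈ range p, (3*((p*m:ℚ)+i)+1) * q1 p (-1-((p*m:ℚ)+i)) * (-1/2)^i

lemma half_pow (h3 : 3 < p) {n : ℕ} (hn : p = 2*n+1) : (-1/2:ℚ)^p = -1/(2*2^(p-1)) := by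
  rw [div_pow, Odd.neg_one_pow ⟨n, hn⟩, w_eq]

lemma Th2_eq (h3 : 3 < p) {n : ℕ} (hn : p = 2*n+1) (m : ℕ) :
    M p 4 (Th2 p m - ((2:ℚ)^(p-1))^m * ((-1)^n * p * (3*m+1) + p^3 * eulerE (p-3) * (9*m^3+6*m^2+4*m+1))) := by
  have e : Th2 p m = (p:ℚ) * ((m+1) * II p 0 (m+1) / 2^(p-1) + 2 * m * II p 0 m) := by
    rw [Th2, gosper, half_pow h3 hn, show (p:ℚ)*m+p = p*(m+1:ℕ) by push_cast; ring, JJ_I, JJ_I]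
    have : (2:ℚ)^(p-1) ≠ 0 := by positivity
    push_cast; field_simp; ring
  rw [e]
  have h1 := II_eq h3 hn 0 (m+1)
  have h2 := II_eq h3 hn 0 m
  have uw := (LGw h3 hn).u h3
  have m1 : M p 0 ((m:ℚ)+1) := by exact_mod_cast M_nat (m+1)
  have m2 : M p 0 (2*(m:ℚ)) := by exact_mod_cast M_nat (2*m)
  have k : M p 4 _ := M_p.mul ((((m1.mull h1).div uw)).add (m2.mull h2))
  refine k.cast ?_
  have := uw.ne
  simp only [mul_zero, add_zero]
  rw [pow_succ ((2:ℚ)^(p-1)) m]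
  field_simp
  push_cast
  ring
end

lemma ff_neg (x : ℚ) (n : ℕ) : ff (-x) n = (-1)^n * ff (x+n-1) n := by
  induction n generalizing x with
  | zero => simp [ff]
  | succ n ih =>
    rw [ff_succ, ih, ff_succ' (x+(n+1:ℕ)-1)]
    push_cast
    rw [show x+((n:ℚ)+1)-1-1 = x+n-1 by ring, pow_succ]; ring

lemma G1c_aux (x : ℚ) (c k : ℕ) (hx : ff (x+k) (3*k+1) = (c:ℚ) * (3*k+1).factorial) :
    G1c x (k+1) = -16*(3*x+1)*(k+1:ℚ)^3 * AA (k+1) * c / ((3*k+2)*16^(k+1)) := by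
  rw [G1c, hx, AA_eq, show 3*(k+1) = 3*k+1+1+1 by ring, Nat.factorial_succ (3*k+1+1), Nat.factorial_succ (3*k+1)]
  have h1 : ((k+1).factorial : ℚ) ≠ 0 := by positivity
  push_cast
  field_simp
  ring

section
variable {p : ℕ} [hp : Fact p.Prime]

lemma lucas (a b : ℕ) {c d : ℕ} (hc : c < p) (hd : d < p) :
    M p 1 (((p*a+c).choose (p*b+d) : ℚ) - a.choose b * c.choose d) := by
  have h := Choose.choose_modEq_choose_mod_mul_choose_div_nat (n := p*a+c) (k := p*b+d) (p := p)
  rw [Nat.mul_add_mod, Nat.mul_add_mod, Nat.mod_eq_of_lt hc, Nat.mod_eq_of_lt hd, Nat.mul_add_div hp.out.pos, Nat.mul_add_div hp.out.pos,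
    Nat.div_eq_of_lt hc, Nat.div_eq_of_lt hd, add_zero, add_zero, mul_comm (c.choose d)] at h
  have h2 := (Nat.modEq_iff_dvd.1 h.symm)
  have h3 : M p 1 (((((p*a+c).choose (p*b+d):ℕ):ℤ) - ((a.choose b * c.choose d:ℕ):ℤ) : ℤ) : ℚ) := M_iff_int.2 (by simpa using h2)
  push_cast at h3; exact h3

/-- first source -/
lemma G1c_nat (h3 : 3 < p) (N : ℕ) : G1c N p = -16*(3*N+1)*(p:ℚ)^3 * AA p * ((N+p-1).choose (3*p-2)) / ((3*p-1)*16^p) := by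
  obtain ⟨k, hk⟩ : ∃ k, p = k+1 := ⟨p-1, by omega⟩
  rw [hk, G1c_aux N ((N+k).choose (3*k+1)) k (by rw [← ff_nat]; push_cast; rfl)]
  rw [show N+(k+1)-1 = N+k by omega, show 3*(k+1)-2 = 3*k+1 by omega]
  push_cast; congr 2; ring
lemma G1c_neg (h3 : 3 < p) {n : ℕ} (hn : p = 2*n+1) (N : ℕ) : G1c (-1-N) p = -16*(3*N+2)*(p:ℚ)^3 * AA p * ((N+2*p-1).choose (3*p-2)) / ((3*p-1)*16^p) := by
  obtain ⟨k, hk⟩ : ∃ k, p = k+1 := ⟨p-1, by omega⟩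
  have e : ff (-1-(N:ℚ)+k) (3*k+1) = - (((N+2*k+1).choose (3*k+1):ℕ):ℚ) * (3*k+1).factorial := by
    have := ff_nat (N+2*k+1) (3*k+1)
    rw [neg_mul, ← this, show -1-(N:ℚ)+k = -(1+(N:ℚ)-k) by ring, ff_neg, Odd.neg_one_pow ⟨3*n, by omega⟩]
    push_cast; rw [show 1+(N:ℚ)-k+(3*k+1)-1 = N+2*k+1 by ring]; ring
  have := G1c_aux (-1-N) ((N+2*k+1).choose (3*k+1)) k
  rw [hk, G1c, e, AA_eq, show 3*(k+1) = 3*k+1+1+1 by ring, Nat.factorial_succ (3*k+1+1), Nat.factorial_succ (3*k+1)]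
  have h1 : ((k+1).factorial : ℚ) ≠ 0 := by positivity
  rw [show N+2*(k+1)-1 = N+2*k+1 by omega, show 3*k+1+1+1-2 = 3*k+1 by omega]
  push_cast
  have : (3:ℚ)*(k+1)-1 ≠ 0 := by have : (0:ℚ) ≤ k := by positivity
                                 intro h; linarith
  rw [show (3:ℚ)*(k+1)-1 = 3*k+2 by ring] at *
  field_simp
  ring

lemma M_AAp (h3 : 3 < p) : M p 1 (AA p - 12) := by
  have := AA_p h3 1; rw [mul_one, AA_1] at this; exact this.mono (by omega)

lemma U_3p (h3 : 3 < p) : U p (3*(p:ℚ)-1) := U_one.neg.congr ((M_p.mulr (M_nat 3)).cast (by push_cast; ring))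
lemma M_16p (h3 : 3 < p) : M p 1 ((16:ℚ)^p - 16) := by
  have u : U p (16:ℚ) := by have := (U_four h3).mul (U_four h3); norm_num at this; exact this
  have := (fermat_U u).mulr u.m0
  refine this.cast ?_
  rw [w_eq]; ring
lemma U_16p (h3 : 3 < p) : U p ((16:ℚ)^p) := by
  have u : U p (16:ℚ) := by have := (U_four h3).mul (U_four h3); norm_num at this; exact this
  exact u.pow p

/-- reduce a source: coefficient times `c` -/
lemma src_red (h3 : 3 < p) {x c d y : ℚ} (hx : M p 1 (x - y)) (hy : M p 0 y) (hc : M p 1 (c - d)) (hd : M p 0 d) :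
    M p 4 (-16*x*(p:ℚ)^3 * AA p * c / ((3*p-1)*16^p) - p^3*(12*y*d)) := by
  have a := M_AAp h3
  have h12 : M p 0 (12:ℚ) := by exact_mod_cast M_nat 12
  have hm : M p 0 (-16:ℚ) := by exact_mod_cast (M_nat (p := p) 16).neg
  have h1 := (hx.cmul a (hx.of0 hy) h12).cmul hc ((hx.of0 hy).m0 (a.of0 h12)) hd
  have den : M p 1 ((3*(p:ℚ)-1)*16^p - (-1)*16) :=
    M.cmul ((M_p.mulr (M_nat 3)).cast (by push_cast; ring)) (M_16p h3) (U_3p h3).m0 (by exact_mod_cast M_nat 16)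
  have ud := (U_3p h3).mul (U_16p h3)
  have h2 := (((h1.mulr hm).sub ((den.mulr (hy.m0 hd)).mulr h12))).div ud
  have h3' : M p 4 ((p:ℚ)^3 * _) := (M_ppow 3).mul h2
  refine h3'.cast ?_
  have := ud.ne
  generalize (3*(p:ℚ)-1)*16^p = D at *
  field_simp
  ring

lemma t1_congr {N N' : ℤ} (h : M p 1 ((N:ℚ)-N')) {k : ℕ} (hk : k < p) (h3 : 3 < p) : M p 1 (t1 N k - t1 N' k) := by
  unfold t1 ff
  have uk : U p (((k.factorial:ℚ))^5) := (U_factorial hk).pow 5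
  have u16 : U p ((16:ℚ)^k) := by
    have u : U p (16:ℚ) := by have := (U_four h3).mul (U_four h3); norm_num at this; exact this
    exact u.pow k
  have hh : M p 1 (∏ i ∈ range (3*k), ((N:ℚ)+k-i) - ∏ i ∈ range (3*k), ((N':ℚ)+k-i)) :=
    prod_congr1 (3*k) (fun l _ => by have := M_int (p := p) (N'+k-l); push_cast at this; exact this) (fun l _ => h.cast (by ring))
  refine ((hh.mulr ((M_nat (2*k).factorial).m0 uk.inv.m0)).mulr u16.inv.m0).cast ?_
  have := uk.ne; have := u16.ne
  field_simp
lemma t1_m0 (N : ℤ) {k : ℕ} (hk : k < p) (h3 : 3 < p) : M p 0 (t1 N k) := by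
  unfold t1 ff
  have uk : U p (((k.factorial:ℚ))^5) := (U_factorial hk).pow 5
  have u16 : U p ((16:ℚ)^k) := by
    have u : U p (16:ℚ) := by have := (U_four h3).mul (U_four h3); norm_num at this; exact this
    exact u.pow k
  exact ((((M_nat (2*k).factorial).m0 uk.inv.m0)).m0 (M_prod _ _ fun l _ => by have := M_int (p := p) (N+k-l); push_cast at this; exact this)).m0 u16.inv.m0

lemma q1_congr (h3 : 3 < p) {N N' : ℤ} (h : M p 1 ((N:ℚ)-N')) : M p 1 (q1 p N - q1 p N') := by
  unfold q1; rw [← sum_sub_distrib]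
  exact M_sum _ _ fun k hk => t1_congr h (mem_range.1 hk) h3
lemma q1_m0 (h3 : 3 < p) (N : ℤ) : M p 0 (q1 p N) := M_sum _ _ fun k hk => t1_m0 N (mem_range.1 hk) h3

lemma q1_zero (h3 : 3 < p) : q1 p 0 = 1 := by
  have := rep1 0 p (by omega); simp [Domb, dc] at this
  unfold q1; exact this.symm
lemma q1_neg_one (h3 : 3 < p) : q1 p (-1) = 1 := by
  have := rep2 0 p (by omega); simp [Domb, dc] at this
  unfold q1; exact this.symm

lemma q1_rec (N : ℚ) : 4*(N+1)^3*q1 p (N+1) - 2*(2*N+1)*(5*N^2+5*N+2)*q1 p N + 16*N^3*q1 p (N-1) = G1c N p := t1_rec N p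
end

def dl : ℕ → ℚ
  | 0 => 0
  | 1 => 1
  | (i+2) => ((20*(i+1:ℚ)^3+30*(i+1)^2+18*(i+1)+4) * dl (i+1) - 64*(i+1:ℚ)^3 * dl i) / (i+2)^3
def xx (p m i : ℕ) : ℚ := 4^i * q1 p (p*m+i) * q1 p (-1-p*m) - 16^i * q1 p (-1-(p*m+i)) * q1 p (p*m)
def kap (m : ℕ) : ℚ := -6*m*(m+1)*(2*m+1)

section
variable {p : ℕ} [hp : Fact p.Prime]

lemma M.m31 {a b : ℚ} (h : M p 3 a) (h' : M p 1 b) : M p 4 (a*b) := by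
  have := M.mul h h'; exact this

lemma cst (z : ℕ) [z.AtLeastTwo] : M p 0 (OfNat.ofNat z : ℚ) := M_nat z

lemma dl_m0 : ∀ {i : ℕ}, i < p → M p 0 (dl i) := by
  intro i
  induction i using Nat.strong_induction_on with
  | _ i ih =>
    intro h
    match i with
    | 0 => exact M_zero _
    | 1 => exact M_one
    | (i+2) =>
      rw [dl]
      have u : U p ((i:ℚ)+2) := by exact_mod_cast U_of_lt (p := p) (z := i+2) (by omega) h
      have c1 : M p 0 (20*(i+1:ℚ)^3+30*(i+1)^2+18*(i+1)+4) := by exact_mod_cast M_nat (20*(i+1)^3+30*(i+1)^2+18*(i+1)+4)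
      have c2 : M p 0 (64*(i+1:ℚ)^3) := by exact_mod_cast M_nat (64*(i+1)^3)
      exact ((c1.m0 (ih (i+1) (by omega) (by omega))).sub (c2.m0 (ih i (by omega) (by omega)))).div (u.pow 3)

lemma src1 (h3 : 3 < p) (m : ℕ) {i : ℕ} (h1 : 1 ≤ i) (h2 : i + 1 < p) : M p 4 (G1c ((p:ℚ)*m+i) p) := by
  have e : ((p:ℚ)*m+i) = ((p*m+i:ℕ):ℚ) := by push_cast; ring
  rw [e, G1c_nat h3]
  have l := lucas (p := p) (m+1) 2 (c := i-1) (d := p-2) (by omega) (by omega)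
  rw [show p*(m+1)+(i-1) = p*m+i+p-1 by rw [mul_add, mul_one]; omega, show p*2+(p-2) = 3*p-2 by omega, Nat.choose_eq_zero_of_lt (show i-1 < p-2 by omega)] at l
  have z : M p 0 (3*((p*m+i:ℕ):ℚ)+1) := by exact_mod_cast M_nat (3*(p*m+i)+1)
  exact (src_red h3 (x := 3*((p*m+i:ℕ):ℚ)+1) ((M_zero 1).cast (sub_self _)) z l (by simpa using M_zero 0)).cast (by push_cast; ring)
lemma src2 (h3 : 3 < p) {n : ℕ} (hn : p = 2*n+1) (m : ℕ) {i : ℕ} (h1 : 1 ≤ i) (h2 : i + 1 < p) : M p 4 (G1c (-1-((p:ℚ)*m+i)) p) := by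
  have e : ((p:ℚ)*m+i) = ((p*m+i:ℕ):ℚ) := by push_cast; ring
  rw [e, G1c_neg h3 hn]
  have l := lucas (p := p) (m+2) 2 (c := i-1) (d := p-2) (by omega) (by omega)
  rw [show p*(m+2)+(i-1) = p*m+i+2*p-1 by rw [mul_add, mul_comm p 2]; omega, show p*2+(p-2) = 3*p-2 by omega, Nat.choose_eq_zero_of_lt (show i-1 < p-2 by omega)] at l
  have z : M p 0 (3*((p*m+i:ℕ):ℚ)+2) := by exact_mod_cast M_nat (3*(p*m+i)+2)
  exact (src_red h3 (x := 3*((p*m+i:ℕ):ℚ)+2) ((M_zero 1).cast (sub_self _)) z l (by simpa using M_zero 0)).cast (by push_cast; ring)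

lemma ch_p2 (h3 : 3 < p) : ((p-1).choose (p-2) : ℚ) = p - 1 := by
  rw [show p-2 = p-1-1 by omega, ← Nat.choose_symm_of_eq_add (show p-1 = 1 + (p-1-1) by omega), Nat.choose_one_right, Nat.cast_sub (by omega)]; simp

lemma src01 (h3 : 3 < p) (m : ℕ) : M p 4 (G1c ((p:ℚ)*m) p - p^3 * (-6*m*(m-1))) := by
  have e : ((p:ℚ)*m) = ((p*m:ℕ):ℚ) := by push_cast; ring
  rw [e, G1c_nat h3]
  have l := lucas (p := p) m 2 (c := p-1) (d := p-2) (by omega) (by omega)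
  rw [show p*m+(p-1) = p*m+p-1 by omega, show p*2+(p-2) = 3*p-2 by omega, ch_p2 h3] at l
  have l2 : M p 1 (((p*m+p-1).choose (3*p-2) : ℚ) - (-(m.choose 2:ℕ))) := (l.add (M_p.mulr (M_nat (m.choose 2)))).cast (by ring)
  have z : M p 1 (3*((p*m:ℕ):ℚ)+1-1) := (M_p.mulr ((M_nat m).m0 (M_nat 3))).cast (by push_cast; ring)
  refine (src_red h3 z M_one l2 (M_nat _).neg).cast ?_
  rw [Nat.cast_choose_two]; push_cast; ring
lemma src02 (h3 : 3 < p) {n : ℕ} (hn : p = 2*n+1) (m : ℕ) : M p 4 (G1c (-1-(p:ℚ)*m) p - p^3 * (-12*m*(m+1))) := by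
  have e : ((p:ℚ)*m) = ((p*m:ℕ):ℚ) := by push_cast; ring
  rw [e, G1c_neg h3 hn]
  have l := lucas (p := p) (m+1) 2 (c := p-1) (d := p-2) (by omega) (by omega)
  rw [show p*(m+1)+(p-1) = p*m+2*p-1 by rw [mul_add, mul_one]; omega, show p*2+(p-2) = 3*p-2 by omega, ch_p2 h3] at l
  have l2 : M p 1 (((p*m+2*p-1).choose (3*p-2) : ℚ) - (-((m+1).choose 2:ℕ))) := (l.add (M_p.mulr (M_nat ((m+1).choose 2)))).cast (by ring)
  have z : M p 1 (3*((p*m:ℕ):ℚ)+2-2) := (M_p.mulr ((M_nat m).m0 (M_nat 3))).cast (by push_cast; ring)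
  refine (src_red h3 z (M_nat 2) l2 (M_nat _).neg).cast ?_
  rw [Nat.cast_choose_two]; push_cast; ring

lemma xx_rec (m i : ℕ) : ((p:ℚ)*m+(i+1:ℕ)+1)^3 * xx p m (i+2) = (20*((p:ℚ)*m+(i+1:ℕ))^3+30*((p:ℚ)*m+(i+1:ℕ))^2+18*((p:ℚ)*m+(i+1:ℕ))+4) * xx p m (i+1)
    - 64 * ((p:ℚ)*m+(i+1:ℕ))^3 * xx p m i + (4^(i+1) * q1 p (-1-p*m) * G1c ((p:ℚ)*m+(i+1:ℕ)) p + 16^(i+1) * q1 p (p*m) * G1c (-1-((p:ℚ)*m+(i+1:ℕ))) p) := by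
  unfold xx
  have r1 := q1_rec (p := p) ((p:ℚ)*m+(i+1:ℕ))
  have r2 := q1_rec (p := p) (-1-((p:ℚ)*m+(i+1:ℕ)))
  rw [← r1, ← r2]
  push_cast
  rw [show -1-((p:ℚ)*m+(i+1))+1 = -1-(p*m+i) by ring, show -1-((p:ℚ)*m+(i+1))-1 = -1-(p*m+(i+2)) by ring,
    show (p:ℚ)*m+(i+1)+1 = p*m+(i+2) by ring, show (p:ℚ)*m+(i+1)-1 = p*m+i by ring]
  rw [pow_succ 4, pow_succ 4, pow_succ 16, pow_succ 16]
  ring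

lemma q1_one (h3 : 3 < p) (m : ℤ) : M p 1 (q1 p (p*m) - 1) := by
  have := q1_congr h3 (N := p*m) (N' := 0) ((M_p.mulr (M_int m)).cast (by push_cast; ring))
  push_cast at this; rwa [q1_zero h3] at this
lemma q1_one' (h3 : 3 < p) (m : ℤ) : M p 1 (q1 p (p*m-1) - 1) := by
  have := q1_congr h3 (N := p*m-1) (N' := -1) ((M_p.mulr (M_int m)).cast (by push_cast; ring))
  push_cast at this; rwa [q1_neg_one h3] at this

lemma U_pm1 (m i : ℕ) (h : i + 1 < p) : U p ((p:ℚ)*m+i+1) := by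
  have : U p ((i+1:ℕ):ℚ) := U_of_lt (by omega) h
  exact this.congr ((M_p.mulr (M_nat m)).cast (by push_cast; ring))

lemma xx_one (h3 : 3 < p) {n : ℕ} (hn : p = 2*n+1) (m : ℕ) : M p 4 (xx p m 1 - p^3 * kap m) := by
  have r1 := q1_rec (p := p) ((p:ℚ)*m)
  have r2 := q1_rec (p := p) (-1-((p:ℚ)*m))
  rw [show -1-((p:ℚ)*m)+1 = p*(-m) by ring, show -1-((p:ℚ)*m)-1 = -1-(p*m+1) by ring] at r2
  have a1 := q1_one h3 m
  have a2 := q1_one' h3 m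
  have a3 := q1_one h3 (-m)
  have a4 := q1_one' h3 (-m)
  push_cast at a1 a2 a3 a4
  rw [show (p:ℚ)*(-m)-1 = -1-p*m by ring] at a4
  have s1 := src01 h3 m
  have s2 := src02 h3 hn m
  have u := U_pm1 (p := p) m 0 (by omega)
  push_cast at u; rw [add_zero] at u
  have ex : ((p:ℚ)*m+1)^3 * xx p m 1 = -(64*m^3)*(p^3*(q1 p (p*m-1) * q1 p (-1-p*m) / 4 - q1 p (p*(-m)) * q1 p (p*m) / 16))
     + q1 p (-1-p*m) * G1c ((p:ℚ)*m) p + q1 p (p*m) * G1c (-1-(p:ℚ)*m) p := by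
    rw [← r1, ← r2]; unfold xx; push_cast; ring
  have p1 := a2.cmul a4 (a2.of0 M_one) M_one
  have p2 := a3.cmul a1 (a3.of0 M_one) M_one
  have mm : M p 0 (64*(m:ℚ)^3) := by exact_mod_cast M_nat (64*m^3)
  have u4 := U_four h3
  have u16 : U p (16:ℚ) := by have := u4.mul u4; norm_num at this; exact this
  have b1 : M p 4 _ := ((M_ppow 3).m31 ((p1.div u4).sub (p2.div u16))).mulr mm
  have b2 := (a4.of0 M_one).mull s1
  have b3 := (a1.of0 M_one).mull s2
  have g1 : M p 0 (-6*(m:ℚ)*(m-1)) := by have := M_int (p := p) (-6*m*(m-1)); push_cast at this; exact this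
  have g2 : M p 0 (-12*(m:ℚ)*(m+1)) := by have := M_int (p := p) (-12*m*(m+1)); push_cast at this; exact this
  have b4 := ((M_ppow 3).m31 a4).mulr g1
  have b5 := ((M_ppow 3).m31 a1).mulr g2
  have kk : M p 0 (kap m) := by have := M_int (p := p) (-6*m*(m+1)*(2*m+1)); push_cast at this; exact this
  have b6 : M p 4 ((p:ℚ)^3 * ((p*m+1)^3 - 1^3)) := (M_ppow 3).m31 (M_powsub (((M_p.mulr (M_nat m)).cast (by ring))) u.m0 M_one 3)
  have tot := ((((b1.neg.add b2).add b3).add b4).add b5).sub (b6.mulr kk)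
  refine (tot.div (u.pow 3)).cast ?_
  rw [eq_div_iff (u.pow 3).ne, sub_mul, mul_comm (xx p m 1), ex, kap]
  ring

lemma xx_eq (h3 : 3 < p) {n : ℕ} (hn : p = 2*n+1) (m : ℕ) : ∀ i < p, M p 4 (xx p m i - p^3 * (kap m * dl i)) := by
  intro i
  induction i using Nat.strong_induction_on with
  | _ i ih =>
    intro h
    match i with
    | 0 => refine (M_zero 4).cast ?_
           simp [xx, dl]; ring
    | 1 => have := xx_one h3 hn m; simpa [dl] using this
    | (i+2) =>
      have i1 := ih (i+1) (by omega) (by omega)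
      have i0 := ih i (by omega) (by omega)
      have u := U_pm1 (p := p) m (i+1) (by omega)
      have hd1 := dl_m0 (p := p) (i := i+1) (by omega)
      have hd0 := dl_m0 (p := p) (i := i) (by omega)
      have hd2 := dl_m0 (p := p) (i := i+2) (by omega)
      have kk : M p 0 (kap m) := by have := M_int (p := p) (-6*m*(m+1)*(2*m+1)); push_cast at this; exact this
      have hN : M p 0 ((p:ℚ)*m+(i+1:ℕ)) := by have := M_nat (p := p) (p*m+(i+1)); push_cast at this ⊢; exact this
      have hi : M p 0 ((i+1:ℕ):ℚ) := M_nat _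
      have e1 : M p 1 (((p:ℚ)*m+(i+1:ℕ)) - (i+1:ℕ)) := (M_p.mulr (M_nat m)).cast (by ring)
      have r := xx_rec (p := p) m i
      have s1 := src1 h3 m (i := i+1) (by omega) (by omega)
      have s2 := src2 h3 hn m (i := i+1) (by omega) (by omega)
      have q0 : M p 0 (q1 p (p*m)) := by have := q1_m0 h3 (p*m); push_cast at this; exact this
      have q0' : M p 0 (q1 p (-1-p*m)) := by have := q1_m0 h3 (-1-p*m); push_cast at this; exact this
      have d3 := M_powsub e1 hN hi 3
      have d2 := M_powsub e1 hN hi 2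
      have d3' := M_powsub (a := (p:ℚ)*m+(i+1:ℕ)+1) (b := ((i+1:ℕ):ℚ)+1) (e1.cast (by ring)) u.m0 (hi.add M_one) 3
      have P : M p 0 (20*((p:ℚ)*m+(i+1:ℕ))^3+30*((p:ℚ)*m+(i+1:ℕ))^2+18*((p:ℚ)*m+(i+1:ℕ))+4) :=
        ((((cst 20).m0 (hN.pow0 3)).add ((cst 30).m0 (hN.pow0 2))).add ((cst 18).m0 hN)).add (cst 4)
      have Q : M p 0 (64*((p:ℚ)*m+(i+1:ℕ))^3) := (cst 64).m0 (hN.pow0 3)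
      have dP : M p 1 (_) := ((((cst 20).mull d3).add ((cst 30).mull d2)).add ((cst 18).mull e1)).mulr hd1
      have dQ := ((cst 64).mull d3).mulr hd0
      have br := ((M_ppow 3).m31 ((dP.sub dQ).sub (d3'.mulr hd2))).mulr kk
      have S := (((((cst 4).pow0 (i+1)).m0 q0').mull s1).add ((((cst 16).pow0 (i+1)).m0 q0).mull s2))
      have tot := ((((P.mull i1).sub (Q.mull i0)).add S).add br)
      refine (tot.div (u.pow 3)).cast ?_
      rw [eq_div_iff (u.pow 3).ne, sub_mul, mul_comm (xx p m (i+2)), r]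
      have de : (((i+1:ℕ):ℚ)+1)^3 * dl (i+2) = (20*((i+1:ℕ):ℚ)^3+30*((i+1:ℕ):ℚ)^2+18*((i+1:ℕ):ℚ)+4) * dl (i+1) - 64*((i+1:ℕ):ℚ)^3 * dl i := by
        have : ((i:ℚ)+2) ≠ 0 := by positivity
        rw [dl]; push_cast
        rw [show (i:ℚ)+1+1 = i+2 by ring]
        field_simp
      linear_combination (-(p^3*kap m)) * de
end

def Th1 (p m : ℕ) : ℚ := ∑ i ∈ range p, (3*((p*m:ℚ)+i)+1) * q1 p ((p*m:ℚ)+i) * (-1/8)^i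

section
variable {p : ℕ} [hp : Fact p.Prime]

lemma M.m13 {a b : ℚ} (h : M p 1 a) (h' : M p 3 b) : M p 4 (a*b) := (h'.m31 h).cast (mul_comm a b)

lemma Th_comb (h3 : 3 < p) {n : ℕ} (hn : p = 2*n+1) (m : ℕ) :
    M p 4 (Th1 p m * q1 p (-1-p*m) - Th2 p m * q1 p (p*m) - p^3 * (kap m * ∑ i ∈ range p, (3*(i:ℚ)+1) * (-1/32)^i * dl i)) := by
  have u32 : U p (32:ℚ) := by have := ((U_four h3).mul (U_four h3)).mul (U_two h3); norm_num at this; exact this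
  have kk : M p 0 (kap m) := by have := M_int (p := p) (-6*m*(m+1)*(2*m+1)); push_cast at this; exact this
  have h : M p 4 (∑ i ∈ range p, ((3*((p*m:ℚ)+i)+1) * (-1/32)^i * xx p m i - p^3 * (kap m * ((3*(i:ℚ)+1) * (-1/32)^i * dl i)))) := by
    refine M_sum _ _ fun i hi => ?_
    have hi := mem_range.1 hi
    have a := xx_eq h3 hn m i hi
    have d := dl_m0 (p := p) hi
    have pw : M p 0 ((-1/32:ℚ)^i) := ((M_one.neg).div u32).pow0 i
    have c0 : M p 0 (3*((p*m:ℚ)+i)+1) := by exact_mod_cast M_nat (3*(p*m+i)+1)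
    have b := ((M_ppow 3).m31 (M_p (p := p))).mulr ((((cst 3).m0 (M_nat m)).m0 pw).m0 (kk.m0 d))
    refine (((c0.m0 pw).mull a).add b).cast ?_
    ring
  refine h.cast ?_
  rw [sum_sub_distrib, ← mul_sum, ← mul_sum, Th1, Th2, sum_mul, sum_mul, ← sum_sub_distrib]
  congr 1
  apply sum_congr rfl; intro i _
  unfold xx
  have e1 : (-1/8:ℚ)^i = (-1/32)^i * 4^i := by rw [← mul_pow]; norm_num
  have e2 : (-1/2:ℚ)^i = (-1/32)^i * 16^i := by rw [← mul_pow]; norm_num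
  rw [e1, e2]; ring

lemma JJ_two (N : ℚ) : JJ (2*p) N = JJ p N + (N-p) * t1 (-1-N) p * ∑ r ∈ range p, ∏ l ∈ range r, rho N (p+l) := by
  unfold JJ
  rw [two_mul, sum_range_add, mul_sum]
  congr 1
  apply sum_congr rfl; intro r _
  exact t1_rho N p r

lemma Th1_one (h3 : 3 < p) : Th1 p 1 = 4^p * (Th2 p 1 - 2 * (-1/2)^p * (p * t1 (-1-2*p) p * II p 1 2)) := by
  have g := gosper (K := 2*p) (p:ℚ) p
  have e : Th1 p 1 = 4^p * ∑ i ∈ range p, (3*((p:ℚ)+i)+1) * q1 (2*p) (-1-((p:ℚ)+i)) * (-1/2)^i := by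
    rw [Th1, mul_sum]
    apply sum_congr rfl; intro i hi
    have hi := mem_range.1 hi
    have r1 := rep1 (p+i) p (by omega)
    have r2 := rep2 (p+i) (2*p) (by omega)
    rw [r1] at r2
    change _ * q1 p _ = _ * q1 (2*p) _ at r2
    push_cast at r2 ⊢
    rw [pow_add, pow_add] at r2
    have e2 : (-1/2:ℚ)^i = (-1/8)^i * 4^i := by rw [← mul_pow]; norm_num
    have e3 : (16:ℚ)^i = 4^i*4^i := by rw [← mul_pow]; norm_num
    have e4 : (16:ℚ)^p = 4^p*4^p := by rw [← mul_pow]; norm_num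
    rw [e3, e4] at r2
    have h4 : (4:ℚ)^p ≠ 0 := by positivity
    have h4' : (4:ℚ)^i ≠ 0 := by positivity
    have : q1 p ((p:ℚ)+i) = 4^p * 4^i * q1 (2*p) (-1-((p:ℚ)+i)) := by
      have := mul_left_cancel₀ (mul_ne_zero h4 h4') (r2.trans (by ring : _ = 4^p*4^i*(4^p * 4^i * q1 (2*p) (-1-((p:ℚ)+i)))))
      exact this
    rw [mul_one, this, e2]; ring
  have g2 : Th2 p 1 = -2*((-1/2)^p * JJ p ((p:ℚ)+p) - JJ p p) := by
    rw [← gosper, Th2]; simp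
  rw [e, g, g2, JJ_two, JJ_two]
  have : II p 1 2 = ∑ r ∈ range p, ∏ l ∈ range r, rho ((p:ℚ)+p) (p+l) := by
    unfold II; push_cast; rw [mul_one, mul_two]
  rw [← this, show -1-((p:ℚ)+p) = -1-2*p by ring]
  ring

lemma pow4w : (4:ℚ)^(p-1) = (2^(p-1))^2 := by
  rw [show (4:ℚ) = 2^2 by norm_num, ← pow_mul, ← pow_mul, mul_comm]
lemma pow16w : (16:ℚ)^(p-1) = (2^(p-1))^4 := by
  rw [show (16:ℚ) = 2^4 by norm_num, ← pow_mul, ← pow_mul, mul_comm]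

lemma t1_m2p (h3 : 3 < p) {n : ℕ} (hn : p = 2*n+1) : M p 3 (t1 (-1-2*p) p - (-3) / (2^(p-1))^4) := by
  have e : t1 (-1-2*p) p = - (AA p * ((p*4).choose (p*3))) / 16^p := by
    unfold t1
    rw [show -1-2*(p:ℚ)+p = -(1+p) by ring, ff_neg, Odd.neg_one_pow ⟨3*n+1, by omega⟩]
    have := ff_nat (p*4) (3*p)
    rw [show 1+(p:ℚ)+(3*p:ℕ)-1 = (p*4:ℕ) by push_cast; ring, this, AA_eq, mul_comm p 3]; ring
  have a := AA_p h3 1; rw [mul_one, AA_1] at a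
  have b := choose_p h3 4 3
  have c := (a.cmul b (a.of0 (cst 12)) (M_nat _)).neg.div (U_16p h3)
  refine c.cast ?_
  rw [e]
  have : (16:ℚ)^p = 16 * (2^(p-1))^4 := by
    rw [w_eq (a := 16), pow16w]
  rw [this]
  have : ((2:ℚ)^(p-1))^4 ≠ 0 := by positivity
  norm_num [Nat.choose]
  field_simp; ring

lemma q1_phi (m : ℤ) : q1 p (p*m) = Phi p m 0 := by
  have := block_t1 (p := p) m 0
  rw [mul_zero, t1_zero, one_mul] at this
  simpa [q1] using this
lemma q1_psi (m : ℤ) : q1 p (-1-p*m) = Psi p m 0 := by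
  have := block_t1' (p := p) m 0
  rw [mul_zero, t1_zero, one_mul] at this
  simpa [q1] using this

lemma q1_w (h3 : 3 < p) (m : ℕ) : M p 3 (q1 p (p*m) - ((2^(p-1))^(2*m))⁻¹) := by
  have := Phi_eq h3 m 0
  rw [← q1_phi] at this; push_cast at this
  refine this.cast ?_
  rw [pow4w, zero_sub, zpow_neg, zpow_natCast, pow_mul]
lemma q2_w (h3 : 3 < p) (m : ℕ) : M p 3 (q1 p (-1-p*m) - ((2^(p-1))^(4*m))⁻¹) := by
  have := Psi_eq h3 m
  rw [← q1_psi] at this; push_cast at this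
  refine this.cast ?_
  rw [pow16w, zpow_neg, zpow_natCast, pow_mul]

lemma U_w (h3 : 3 < p) : U p ((2:ℚ)^(p-1)) := (U_two h3).pow _

lemma Th2_m1 (h3 : 3 < p) {n : ℕ} (hn : p = 2*n+1) (m : ℕ) : M p 1 (Th2 p m) := by
  have h := (Th2_eq h3 hn m).mono (show 1 ≤ 4 by omega)
  have s : M p 0 ((-1:ℚ)^n) := M_one.neg.pow0 n
  have c1 : M p 0 (3*(m:ℚ)+1) := by exact_mod_cast M_nat (3*m+1)
  have c2 : M p 0 (9*(m:ℚ)^3+6*m^2+4*m+1) := by exact_mod_cast M_nat (9*m^3+6*m^2+4*m+1)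
  have k : M p 1 ((p:ℚ)*((2^(p-1))^m*((-1)^n*(3*m+1)+p^2*eulerE (p-3)*(9*m^3+6*m^2+4*m+1)))) :=
    M_p.mulr (((U_w h3).m0.pow0 m).m0 ((s.m0 c1).add ((((M_nat p).pow0 2).m0 (M_euler _)).m0 c2)))
  exact (h.add k).cast (by ring)

lemma Th1_one_eq (h3 : 3 < p) {n : ℕ} (hn : p = 2*n+1) : M p 4 (Th1 p 1 - (2^(p-1))^2 * Th2 p 1) := by
  rw [Th1_one h3, half_pow h3 hn]
  have a := Th2_eq h3 hn 1
  have b := II_eq h3 hn 1 2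
  have c := t1_m2p h3 hn
  have uw := U_w h3
  have s : M p 0 ((-1:ℚ)^n) := M_one.neg.pow0 n
  have hE := M_euler (p := p) (p-3)
  have w4 : M p 0 (-3/((2:ℚ)^(p-1))^4) := (cst 3).neg.div (uw.pow 4)
  push_cast at a b
  have five : M p 0 (3*2^2-2-1-4*1:ℚ) := by have := cst (p := p) 5; norm_num at this ⊢; exact this
  have ii0 : M p 0 (((2:ℚ)^(p-1))^(2+4*1) * ((-1)^n + p^2 * eulerE (p-3) * (3*2^2-2-1-4*1))) :=
    (uw.m0.pow0 _).m0 (s.add ((((M_nat p).pow0 2).m0 hE).m0 five))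
  have d := c.cmul b (c.of0 w4) ii0
  have e := ((M_p (p := p)).m13 d).mulr ((cst 4).m0 uw.m0)
  have a' := a.mulr ((cst 3).m0 (uw.m0.pow0 2))
  refine (a'.add e).cast ?_
  have hw := uw.ne
  rw [w_eq (a := 4), pow4w]
  generalize (2:ℚ)^(p-1) = w at *
  field_simp
  ring

lemma Om (h3 : 3 < p) {n : ℕ} (hn : p = 2*n+1) : M p 4 ((p:ℚ)^3 * ∑ i ∈ range p, (3*(i:ℚ)+1) * (-1/32)^i * dl i) := by
  have k := Th_comb h3 hn 1
  have a := Th1_one_eq h3 hn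
  have t := Th2_m1 h3 hn 1
  have h1 := q1_w h3 1
  have h2 := q2_w h3 1
  have uw := U_w h3
  have q0' : M p 0 (q1 p (-1-p*(1:ℕ))) := by have := q1_m0 h3 (-1-p*1); push_cast at this ⊢; exact this
  have e1 := a.mulr q0'
  have e2 := (t.m13 h2).mulr (uw.m0.pow0 2)
  have e3 := t.m13 h1
  have u36 : U p (36:ℚ) := by have := ((U_four h3).mul (U_three h3)).mul (U_three h3); norm_num at this; exact this
  refine ((((k.sub e1).sub e2).add e3).div u36).cast ?_
  have hw := uw.ne
  rw [kap]; push_cast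
  generalize (2:ℚ)^(p-1) = w at *
  field_simp
  ring

lemma Th1_eq (h3 : 3 < p) {n : ℕ} (hn : p = 2*n+1) (m : ℕ) : M p 4 (Th1 p m - (2^(p-1))^(2*m) * Th2 p m) := by
  have k := Th_comb h3 hn m
  have o := Om h3 hn
  have t := Th2_m1 h3 hn m
  have h1 := q1_w h3 m
  have h2 := q2_w h3 m
  have uw := U_w h3
  have kk : M p 0 (kap m) := by have := M_int (p := p) (-6*m*(m+1)*(2*m+1)); push_cast at this; exact this
  have e0 := k.add (o.mulr kk)
  have uq : U p (q1 p (-1-p*m)) := by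
    exact ((uw.pow (4*m)).inv).congr (h2.mono (by omega))
  have e2 := (t.m13 h2).mulr (uw.m0.pow0 (2*m))
  have e3 := t.m13 h1
  refine (((e0.sub e2).add e3).div uq).cast ?_
  have hw := uw.ne
  have := uq.ne
  rw [eq_div_iff this, show 4*m = 2*m+2*m by ring, pow_add]
  generalize (2:ℚ)^(p-1) = w at *
  field_simp
  ring

lemma Th1_fin (h3 : 3 < p) {n : ℕ} (hn : p = 2*n+1) (m : ℕ) :
    M p 4 (Th1 p m - (8^(p-1))^m * ((-1)^n * p * (3*m+1) + p^3 * eulerE (p-3) * (9*m^3+6*m^2+4*m+1))) := by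
  have e : (8:ℚ)^(p-1) = (2^(p-1))^3 := by
    rw [show (8:ℚ) = 2^3 by norm_num, ← pow_mul, ← pow_mul, mul_comm]
  rw [e]
  refine ((Th1_eq h3 hn m).add (((U_w h3).m0.pow0 (2*m)).mull (Th2_eq h3 hn m))).cast ?_
  rw [← pow_mul, show 3*m = 2*m+m by ring, pow_add]
  ring
end

def Hh (k d N : ℕ) : ℚ := ∑ i ∈ range (d+1), ((N+k).choose (d-i) : ℚ) * ((-1/8)^i / (9/8)^(i+1))

lemma Hh_step (k d N : ℕ) : Hh k d N - (-1/8) * Hh k d (N+1) = (N+k).choose d := by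
  have e : Hh k d (N+1) = Hh k d N + ∑ i ∈ range d, ((N+k).choose (d-1-i) : ℚ) * ((-1/8)^i / (9/8)^(i+1)) := by
    unfold Hh
    rw [sum_range_succ, sum_range_succ _ d, Nat.sub_self, Nat.choose_zero_right, Nat.choose_zero_right]
    have h : ∑ i ∈ range d, ((N+1+k).choose (d-i) : ℚ) * ((-1/8)^i / (9/8)^(i+1)) = ∑ i ∈ range d, ((N+k).choose (d-i) : ℚ) * ((-1/8)^i / (9/8)^(i+1)) + ∑ i ∈ range d, ((N+k).choose (d-1-i) : ℚ) * ((-1/8)^i / (9/8)^(i+1)) := by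
      rw [← sum_add_distrib]
      apply sum_congr rfl; intro i hi
      have hi := mem_range.1 hi
      rw [show N+1+k = N+k+1 by ring, show d-i = (d-1-i)+1 by omega, Nat.choose_succ_succ]; push_cast; ring
    rw [h]; ring
  have f : (-1/8:ℚ) * ∑ i ∈ range d, ((N+k).choose (d-1-i) : ℚ) * ((-1/8)^i / (9/8)^(i+1)) = 9/8 * Hh k d N - (N+k).choose d := by
    unfold Hh
    rw [sum_range_succ', mul_add, mul_sum, mul_sum]
    simp only [Nat.sub_zero, pow_zero, zero_add, pow_one]
    rw [add_sub_assoc, show (9/8:ℚ)*(((N+k).choose d:ℚ)*(1/(9/8))) - (N+k).choose d = 0 by ring, add_zero]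
    apply sum_congr rfl; intro i hi
    rw [show d-1-i = d-(i+1) by omega, pow_succ (-1/8:ℚ) i, pow_succ (9/8:ℚ) (i+1)]
    have : ((9/8:ℚ)^(i+1)) ≠ 0 := by positivity
    field_simp
  rw [e]; linear_combination -f

lemma Hh_zero (k d : ℕ) (h : k ≤ d) : Hh k d 0 = (-1/8)^(d-k) / (9/8)^(d+1) := by
  unfold Hh
  rw [← sum_range_reflect]
  have e := add_pow (9/8:ℚ) (-1/8) k
  norm_num at e
  rw [show d+1 = (k+1)+(d-k) by omega, sum_range_add]
  have z : ∑ x ∈ range (d-k), ((0+k).choose (d-(k+1+(d-k)-1-(k+1+x))) : ℚ) * ((-1/8)^(k+1+(d-k)-1-(k+1+x)) / (9/8)^(k+1+(d-k)-1-(k+1+x)+1)) = 0 := by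
    apply sum_eq_zero; intro x hx
    have := mem_range.1 hx
    rw [Nat.choose_eq_zero_of_lt (by omega)]; simp
  have key : ((-1/8:ℚ)^(d-k)) / (9/8)^(k+1+(d-k)) = (-1/8:ℚ)^(d-k) * (∑ x ∈ range (k + 1), (9 / 8:ℚ) ^ x * (-(1 / 8)) ^ (k - x) * ↑(k.choose x)) / (9/8)^(k+1+(d-k)) := by
    rw [← e, mul_one]
  rw [z, add_zero, key, mul_sum, sum_div]
  apply sum_congr rfl; intro x hx
  have hx := mem_range.1 hx
  rw [zero_add, show d-(k+1+(d-k)-1-x) = x by omega, show k+1+(d-k)-1-x = (d-k)+(k-x) by omega, pow_add,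
   show k+1+(d-k) = (d-k+(k-x)+1)+x by omega, pow_add (9/8:ℚ) _ x]
  have : ((9/8:ℚ)^x) ≠ 0 := by positivity
  rw [mul_comm ((9/8:ℚ)^_) ((9/8)^x)]
  rw [show (-(1/8):ℚ) = -1/8 by norm_num]
  field_simp

lemma Hh_sum (k d R : ℕ) : ∑ N ∈ range R, ((N+k).choose d : ℚ) * (-1/8)^N = Hh k d 0 - (-1/8)^R * Hh k d R := by
  induction R with
  | zero => simp
  | succ R ih => rw [sum_range_succ, ih, ← Hh_step, pow_succ]; ring

section
variable {p : ℕ} [hp : Fact p.Prime]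

lemma M_chP (r j : ℕ) (hj : 1 ≤ j) : M p r ((j:ℚ) * ((p^r).choose j)) := by
  obtain ⟨i, rfl⟩ : ∃ i, j = i+1 := ⟨j-1, by omega⟩
  obtain ⟨q, hq⟩ : ∃ q, p^r = q+1 := ⟨p^r-1, by have := pow_pos hp.out.pos r; omega⟩
  have := Nat.add_one_mul_choose_eq q i
  have e : ((i+1:ℕ):ℚ) * ((p^r).choose (i+1)) = p^r * q.choose i := by
    have h2 : ((p:ℚ)^r) = ((q+1:ℕ):ℚ) := by rw [← hq]; push_cast; ring
    rw [h2, hq]; exact_mod_cast (by rw [this]; ring)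
  rw [e]; exact (M_ppow r).mulr (M_nat _)

/-- if `c * e! ` is a multiple .. -/
lemma Hh_diff (h3 : 3 < p) {c : ℚ} {k d : ℕ} (r : ℕ) (hc : ∀ j, 1 ≤ j → j ≤ d → M p 0 (c / j)) : M p r (c * (Hh k d (p^r) - Hh k d 0)) := by
  have u8 := U_eight h3
  have u98 : U p (9/8:ℚ) := by
    have := ((U_three h3).mul (U_three h3)).div u8; norm_num at this; exact this
  unfold Hh
  rw [← sum_sub_distrib, mul_sum]
  refine M_sum _ _ fun i hi => ?_
  rw [← sub_mul, ← mul_assoc]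
  have un : M p 0 ((-1/8:ℚ)^i / (9/8)^(i+1)) := ((M_one.neg.div u8).pow0 i).div (u98.pow _)
  refine M.mulr ?_ un
  generalize he : d - i = e
  have hed : e ≤ d := by omega
  rw [Nat.add_choose_eq, zero_add, Finset.Nat.sum_antidiagonal_eq_sum_range_succ_mk, sum_range_succ']
  push_cast
  simp only [Nat.choose_zero_right, Nat.sub_zero, Nat.cast_one, one_mul]
  rw [add_sub_cancel_right, mul_sum]
  refine M_sum _ _ fun j hj => ?_
  have hj := mem_range.1 hj
  have h := M_chP (p := p) r (j+1) (by omega)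
  have k1 := hc (j+1) (by omega) (by omega)
  refine ((h.mulr k1).mulr (M_nat (k.choose (e-(j+1))))).cast ?_
  have : ((j+1:ℕ):ℚ) ≠ 0 := by positivity
  field_simp

lemma AA_div (k : ℕ) (hk : k < p) {j : ℕ} (h1 : 1 ≤ j) (h2 : j ≤ 3*k) : M p 0 (AA k / j) := by
  obtain ⟨c, hc⟩ := Nat.dvd_factorial (by omega : 0 < j) h2
  have uk : U p (((k.factorial:ℚ))^5) := (U_factorial hk).pow 5
  refine ((M_nat ((2*k).factorial * c)).div uk).cast ?_
  have : ((j:ℕ):ℚ) ≠ 0 := by positivity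
  rw [AA_eq, hc]; push_cast; field_simp
lemma AA_div' (k : ℕ) (hk : k < p) {j : ℕ} (h1 : 1 ≤ j) (h2 : j ≤ 3*k+1) : M p 0 (AA k * (3*k+1) / j) := by
  obtain ⟨c, hc⟩ := Nat.dvd_factorial (by omega : 0 < j) h2
  have uk : U p (((k.factorial:ℚ))^5) := (U_factorial hk).pow 5
  refine ((M_nat ((2*k).factorial * c)).div uk).cast ?_
  have : ((j:ℕ):ℚ) ≠ 0 := by positivity
  have e : ((3*k).factorial:ℚ) * (3*k+1) = j * c := by
    have : ((3*k+1).factorial : ℚ) = j * c := by rw [hc]; push_cast; ring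
    rw [Nat.factorial_succ] at this; push_cast at this; linarith
  rw [AA_eq, div_mul_eq_mul_div, mul_assoc, e]; push_cast; field_simp

def WW (p : ℕ) : ℚ := ∑ k ∈ range p, (15*(k:ℚ)+2) * AA k / 1458^k

lemma U_1458 (h3 : 3 < p) : U p (1458:ℚ) := by
  have h := U_three (p := p) h3
  have := (((h.mul h).mul h).mul ((h.mul h).mul h)).mul (U_two h3); norm_num at this; exact this
lemma U_16 (h3 : 3 < p) : U p (16:ℚ) := by have := (U_four h3).mul (U_four h3); norm_num at this; exact this

lemma M_AA (k : ℕ) : M p 0 (AA k) := by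
  have := M_nat (p := p) ((2*k).choose k ^2 * (3*k).choose k); push_cast at this; exact this
lemma WW_m0 (h3 : 3 < p) : M p 0 (WW p) := M_sum _ _ fun k _ =>
  M.div (M.m0 (by exact_mod_cast M_nat (15*k+2)) (M_AA k)) ((U_1458 h3).pow k)

lemma WW_lhs (h3 : 3 < p) : M p 4 (∑ N ∈ range (p^4), (3*(N:ℚ)+1) * q1 p N * (-1/8)^N - (1-(-1/8)^(p^4)) * (8/27 * WW p)) := by
  have e : ∑ N ∈ range (p^4), (3*(N:ℚ)+1) * q1 p N * (-1/8)^N = ∑ k ∈ range p, ((AA k * (3*k+1)*(Hh k (3*k+1) 0 - (-1/8)^(p^4) * Hh k (3*k+1) (p^4))) * (3/16^k)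
      + (AA k *(Hh k (3*k) 0 - (-1/8)^(p^4) * Hh k (3*k) (p^4))) * ((6*k+1)/16^k)) := by
    unfold q1
    simp_rw [mul_sum, sum_mul]
    rw [sum_comm]
    apply sum_congr rfl; intro k _
    rw [← Hh_sum, ← Hh_sum, mul_sum, mul_sum, sum_mul, sum_mul, ← sum_add_distrib]
    apply sum_congr rfl; intro N _
    rw [t1_nat]
    have h : ((N+k).choose (3*k+1):ℚ) * (3*k+1) = (N+k).choose (3*k) * (N-2*k) := by
      by_cases hh : 3*k ≤ N+k
      · have := Nat.choose_succ_right_eq (N+k) (3*k)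
        have h2 : ((N+k-3*k:ℕ):ℚ) = N-2*k := by rw [Nat.cast_sub hh]; push_cast; ring
        rw [← h2]; exact_mod_cast this
      · rw [Nat.choose_eq_zero_of_lt (by omega), Nat.choose_eq_zero_of_lt (by omega)]; simp
    linear_combination (-3*AA k/16^k*(-1/8)^N) * h
  rw [e, WW, mul_sum, mul_sum, ← sum_sub_distrib]
  refine M_sum _ _ fun k hk => ?_
  have hk := mem_range.1 hk
  have d1 := Hh_diff h3 (k := k) 4 (fun j => AA_div' (p := p) k hk (j := j))
  have d2 := Hh_diff h3 (k := k) 4 (fun j => AA_div (p := p) k hk (j := j))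
  have u8 := U_eight h3
  have tP : M p 0 ((-1/8:ℚ)^(p^4)) := (M_one.neg.div u8).pow0 _
  have u16 := (U_16 (p := p) h3).pow k
  have c2 : M p 0 ((6*(k:ℚ)+1)/16^k) := M.div (by exact_mod_cast M_nat (6*k+1)) u16
  have c1 : M p 0 ((3:ℚ)/16^k) := (cst 3).div u16
  refine (((d1.mulr tP).mulr c1).neg.sub ((d2.mulr tP).mulr c2)).cast ?_
  rw [Hh_zero k (3*k+1) (by omega), Hh_zero k (3*k) (by omega), show 3*k+1-k = 2*k+1 by omega, show 3*k-k = 2*k by omega]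
  have e1 : (1458:ℚ)^k * ((-1/8)^2)^k = 16^k * ((9/8)^3)^k := by rw [← mul_pow, ← mul_pow]; norm_num
  rw [pow_succ (-1/8:ℚ), pow_succ (9/8:ℚ) (3*k+1), pow_succ (9/8:ℚ) (3*k), pow_mul, pow_mul]
  have n1 : (1458:ℚ)^k ≠ 0 := by positivity
  have n2 : (16:ℚ)^k ≠ 0 := by positivity
  have n3 : ((9/8:ℚ)^3)^k ≠ 0 := by positivity
  generalize (-1/8:ℚ)^(p^4) = y
  have e2 : ((-1/8:ℚ)^2)^k = 16^k * ((9/8)^3)^k / 1458^k := by rw [eq_div_iff n1]; linarith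
  rw [e2]
  generalize ((9/8:ℚ)^3)^k = A at *
  generalize (16:ℚ)^k = B at *
  generalize (1458:ℚ)^k = C at *
  field_simp
  ring

lemma WW_rhs (h3 : 3 < p) {n : ℕ} (hn : p = 2*n+1) : M p 4 (∑ N ∈ range (p^4), (3*(N:ℚ)+1) * q1 p N * (-1/8)^N
    - (1-(-1/8)^(p^3)) * ((-1)^n*p*(16/27) + p^3*eulerE (p-3)*(-80/243))) := by
  have u8 := U_eight (p := p) h3
  have u27 : U p (27:ℚ) := by have h := U_three (p := p) h3; have := (h.mul h).mul h; norm_num at this; exact this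
  have t8 : M p 0 (-1/8:ℚ) := M_one.neg.div u8
  have e : ∑ N ∈ range (p^4), (3*(N:ℚ)+1) * q1 p N * (-1/8)^N = ∑ m ∈ range (p^3), ((-1/8)^p)^m * Th1 p m := by
    rw [show p^4 = p*p^3 by ring, sum_blocks]
    apply sum_congr rfl; intro m _
    rw [Th1, mul_sum]
    apply sum_congr rfl; intro i _
    push_cast; rw [pow_add, pow_mul]; ring
  have k : M p 4 (∑ m ∈ range (p^3), (((-1/8)^p)^m * Th1 p m - (-1/8)^m * ((-1)^n * p * (3*m+1) + p^3 * eulerE (p-3) * (9*m^3+6*m^2+4*m+1)))) := by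
    refine M_sum _ _ fun m _ => ?_
    refine (((t8.pow0 p).pow0 m).mull (Th1_fin h3 hn m)).cast ?_
    have h : (-1/8:ℚ)^p * 8^(p-1) = -1/8 := by
      rw [div_pow, Odd.neg_one_pow ⟨n, hn⟩, w_eq (a := 8)]
      have : (8:ℚ)^(p-1) ≠ 0 := by positivity
      field_simp
    nth_rewrite 2 [← h]
    rw [mul_pow]; ring
  have tel : ∀ R : ℕ, ∑ m ∈ range R, (-1/8:ℚ)^m * ((-1)^n * p * (3*m+1) + p^3 * eulerE (p-3) * (9*m^3+6*m^2+4*m+1)) =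
      ((-1)^n*p*(16/27) + p^3*eulerE (p-3)*(-80/243)) - (-1/8)^R * ((-1)^n*p*(8/3*R+16/27) + p^3*eulerE (p-3)*(8*R^3+8/3*R^2+8/27*R-80/243)) := by
    intro R
    induction R with
    | zero => simp; ring
    | succ R ih => rw [sum_range_succ, ih, pow_succ]; push_cast; ring
  rw [sum_sub_distrib, tel] at k
  rw [e]
  have s : M p 0 ((-1:ℚ)^n) := M_one.neg.pow0 n
  have a1 : M p 4 ((p:ℚ)*p^3) := (M_p (p := p)).m13 (M_ppow 3)
  have c1 : M p 0 ((-1/8:ℚ)^(p^3)*((-1)^n*(8/3))) := (t8.pow0 _).m0 (s.m0 ((cst 8).div (U_three h3)))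
  have c2 : M p 0 ((-1/8:ℚ)^(p^3)*(eulerE (p-3)*(p^2*(8*(p^3)^2+8/3*p^3+8/27)))) :=
    (t8.pow0 _).m0 ((M_euler _).m0 (((M_nat p).pow0 2).m0 ((((cst 8).m0 ((((M_nat p).pow0 3)).pow0 2)).add (((cst 8).div (U_three h3)).m0 ((M_nat p).pow0 3))).add ((cst 8).div u27))))
  refine ((k.sub (a1.mulr c1)).sub (a1.mulr c2)).cast ?_
  push_cast
  ring

lemma t_unit (h3 : 3 < p) : U p (1-(-1/8:ℚ)^(p^3)) ∧ M p 4 ((-1/8:ℚ)^(p^4) - (-1/8)^(p^3)) := by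
  have u8 := U_eight (p := p) h3
  have od : Odd p := hp.out.odd_of_ne_two (by omega)
  rw [div_pow, div_pow, (od.pow).neg_one_pow, (od.pow).neg_one_pow]
  constructor
  · have f : M p 1 ((8:ℚ)^p - 8) := ((fermat_U u8).mulr u8.m0).cast (by rw [w_eq (a := 8)]; ring)
    have f2 : M p 1 (((8:ℚ)^p)^p - 8^p) := M_powsub f (u8.m0.pow0 _) u8.m0 p
    have f3 : M p 1 ((((8:ℚ)^p)^p)^p - (8^p)^p) := M_powsub f2 (u8.m0.pow0 _ |>.pow0 _) (u8.m0.pow0 _) p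
    have g := (f3.add f2).add f
    have u9 : U p (9:ℚ) := by have h := U_three (p := p) h3; have := (h.mul h); norm_num at this; exact this
    have : U p (1+(8:ℚ)^(p^3)) := u9.congr (g.cast (by rw [← pow_mul, ← pow_mul]; ring))
    have h := this.div (u8.pow (p^3))
    have n0 : (8:ℚ)^(p^3) ≠ 0 := by positivity
    have e : (1 - -1/8^(p^3):ℚ) = (1+8^(p^3))/8^(p^3) := by field_simp; ring
    rw [e]; exact h
  · have c : Nat.Coprime 8 (p^4) := by
      apply Nat.Coprime.pow_right
      rw [show 8 = 2^3 by norm_num]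
      exact (Nat.Coprime.pow_left 3 ((Nat.coprime_primes Nat.prime_two hp.out).2 (by omega)))
    have h := Nat.ModEq.pow_totient c
    rw [Nat.totient_prime_pow hp.out (by omega)] at h
    have h2 := Nat.modEq_iff_dvd.1 h.symm
    have hm : M p 4 ((((8^(p^(4-1)*(p-1)):ℕ):ℤ) - ((1:ℕ):ℤ) : ℤ):ℚ) := M_iff_int.2 (by exact_mod_cast h2)
    push_cast at hm
    refine (hm.mulr (u8.pow (p^4)).inv.m0).cast ?_
    have e : p^4 = p^3 + p^(4-1)*(p-1) := by
      obtain ⟨q, hq⟩ : ∃ q, p = q+1 := ⟨p-1, by omega⟩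
      rw [hq]; simp; ring
    have n1 : (8:ℚ)^(p^3) ≠ 0 := by positivity
    have n2 : (8:ℚ)^(p^(4-1)*(p-1)) ≠ 0 := by positivity
    rw [e, pow_add]
    field_simp
    ring

theorem W_main (h3 : 3 < p) {n : ℕ} (hn : p = 2*n+1) : M p 4 (WW p - (2*(-1)^n*p - 10/9*p^3*eulerE (p-3))) := by
  have a := WW_lhs h3
  have b := WW_rhs h3 hn
  obtain ⟨u, t⟩ := t_unit (p := p) h3
  have w := WW_m0 (p := p) h3
  have u8 := U_eight (p := p) h3
  have u27 : U p (27:ℚ) := by have h := U_three (p := p) h3; have := (h.mul h).mul h; norm_num at this; exact this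
  have k := (((b.sub a).add (t.mulr (((cst 8).div u27).m0 w))).div u).mulr ((cst 27).div u8)
  refine k.cast ?_
  have := u.ne
  generalize (-1/8:ℚ)^(p^3) = y at *
  generalize (-1/8:ℚ)^(p^4) = y' at *
  have ex : ∀ A B : ℚ, A / (1-y) * B = A * B / (1-y) := fun A B => by ring
  rw [ex, eq_div_iff this]
  ring
end

/-- all coefficients are divisible by `p^r` -/
def MP (p r : ℕ) (f : PowerSeries ℚ) : Prop := ∀ n, M p r (PowerSeries.coeff n f)

section
variable {p : ℕ} [hp : Fact p.Prime]
open PowerSeries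

lemma MP_zero (r : ℕ) : MP p r 0 := fun n => by simpa using M_zero (p := p) r
lemma MP.add {r : ℕ} {f g : PowerSeries ℚ} (hf : MP p r f) (hg : MP p r g) : MP p r (f+g) := fun n => by
  rw [map_add]; exact (hf n).add (hg n)
lemma MP.neg {r : ℕ} {f : PowerSeries ℚ} (hf : MP p r f) : MP p r (-f) := fun n => by
  rw [map_neg]; exact (hf n).neg
lemma MP.sub {r : ℕ} {f g : PowerSeries ℚ} (hf : MP p r f) (hg : MP p r g) : MP p r (f-g) := fun n => by
  rw [map_sub]; exact (hf n).sub (hg n)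
lemma MP.mul {r s : ℕ} {f g : PowerSeries ℚ} (hf : MP p r f) (hg : MP p s g) : MP p (r+s) (f*g) := fun n => by
  rw [coeff_mul]; exact M_sum _ _ fun x _ => (hf _).mul (hg _)
lemma MP.mono {r s : ℕ} {f : PowerSeries ℚ} (hf : MP p r f) (h : s ≤ r) : MP p s f := fun n => (hf n).mono h
lemma MP.mulr {r : ℕ} {f g : PowerSeries ℚ} (hf : MP p r f) (hg : MP p 0 g) : MP p r (f*g) := hf.mul hg
lemma MP.mull {r : ℕ} {f g : PowerSeries ℚ} (hf : MP p 0 f) (hg : MP p r g) : MP p r (f*g) := by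
  rw [mul_comm]; exact hg.mul hf
lemma MP.m0 {f g : PowerSeries ℚ} (hf : MP p 0 f) (hg : MP p 0 g) : MP p 0 (f*g) := hf.mulr hg
lemma MP.m12 {f g : PowerSeries ℚ} (hf : MP p 1 f) (hg : MP p 2 g) : MP p 3 (f*g) := hf.mul hg
lemma MP.m22 {f g : PowerSeries ℚ} (hf : MP p 2 f) (hg : MP p 2 g) : MP p 4 (f*g) := hf.mul hg
lemma MP_C {r : ℕ} {a : ℚ} (h : M p r a) : MP p r (C a) := fun n => by
  rw [coeff_C]; split_ifs
  · exact h
  · exact M_zero r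
lemma MP_one : MP p 0 1 := by have := MP_C (p := p) M_one; rwa [map_one] at this
lemma MP_X : MP p 0 X := fun n => by
  rw [coeff_X]; split_ifs
  · exact M_one
  · exact M_zero 0
lemma MP.pow0 {f : PowerSeries ℚ} (hf : MP p 0 f) (n : ℕ) : MP p 0 (f^n) := by
  induction n with
  | zero => simpa using MP_one
  | succ n ih => rw [pow_succ]; exact ih.m0 hf
lemma MP.cast {r : ℕ} {f g : PowerSeries ℚ} (h : MP p r f) (e : g = f) : MP p r g := e ▸ h
lemma MP_sum {ι : Type*} {r : ℕ} (s : Finset ι) (f : ι → PowerSeries ℚ) (h : ∀ i ∈ s, MP p r (f i)) : MP p r (∑ i ∈ s, f i) := fun n => by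
  rw [map_sum]; exact M_sum _ _ fun i hi => h i hi n
lemma MP_nat (z : ℕ) : MP p 0 (z : PowerSeries ℚ) := by
  have := MP_C (p := p) (M_nat z); rwa [map_natCast] at this
lemma MPcst (z : ℕ) [z.AtLeastTwo] : MP p 0 (OfNat.ofNat z : PowerSeries ℚ) := MP_nat z
lemma MP.tr {r : ℕ} {a b c : PowerSeries ℚ} (h : MP p r (a-b)) (h' : MP p r (b-c)) : MP p r (a-c) :=
  (h.add h').cast (by ring)
lemma MP.sy {r : ℕ} {a b : PowerSeries ℚ} (h : MP p r (a-b)) : MP p r (b-a) := h.neg.cast (by ring)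
lemma MP.cmul {r : ℕ} {a b c d : PowerSeries ℚ} (h : MP p r (a-b)) (h' : MP p r (c-d)) (ha : MP p 0 a) (hd : MP p 0 d) :
    MP p r (a*c-b*d) := ((ha.mull h').add (h.mulr hd)).cast (by ring)
lemma MP.cpow {r : ℕ} {a b : PowerSeries ℚ} (h : MP p r (a-b)) (ha : MP p 0 a) (hb : MP p 0 b) (n : ℕ) :
    MP p r (a^n-b^n) := by
  induction n with
  | zero => simpa using MP_zero r
  | succ n ih => rw [pow_succ, pow_succ]; exact ih.cmul h (ha.pow0 n) hb
lemma MP.of0 {r : ℕ} {a b : PowerSeries ℚ} (h : MP p r (a-b)) (hb : MP p 0 b) : MP p 0 a :=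
  ((h.mono (Nat.zero_le _)).add hb).cast (by ring)

/-- cancellation -/
lemma MP.cancel {r : ℕ} {f g : PowerSeries ℚ} (hf : MP p 0 f) (hf1 : ¬ MP p 1 f) (hg : MP p 0 g) (h : MP p r (f*g)) : MP p r g := by
  classical
  have hex : ∃ n, ¬ M p 1 (coeff n f) := by
    by_contra hc; push Not at hc; exact hf1 hc
  set v := Nat.find hex with hv
  have h1 : U p (coeff v f) := (U_or_M (hf v)).resolve_right (Nat.find_spec hex)
  have h2 : ∀ i < v, M p 1 (coeff i f) := fun i hi => by
    by_contra hc; exact Nat.find_min hex hi hc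
  have key : ∀ s, s ≤ r → MP p s g := by
    intro s
    induction s with
    | zero => intro _; exact hg
    | succ s ih =>
      intro hs
      have ih := ih (by omega)
      intro m
      induction m using Nat.strong_induction_on with
      | _ m ihm =>
        have hc := (h (v+m)).mono hs
        rw [coeff_mul, ← Finset.add_sum_erase _ _ (show (v,m) ∈ antidiagonal (v+m) by simp)] at hc
        apply h1.cancel
        have hs2 : M p (s+1) (∑ x ∈ (antidiagonal (v+m)).erase (v,m), coeff x.1 f * coeff x.2 g) := by
          refine M_sum _ _ fun x hx => ?_
          obtain ⟨i, j⟩ := x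
          simp only [mem_erase, HasAntidiagonal.mem_antidiagonal, ne_eq, Prod.mk.injEq] at hx
          rcases lt_or_ge i v with hi | hi
          · have := (h2 i hi).mul (ih j); rw [add_comm] at this; exact this
          · exact (hf i).mull (ihm j (by omega))
        exact (hc.sub hs2).cast (by ring)
  exact key r le_rfl

/-- truncated version, one step -/
lemma trunc_cancel {f g : PowerSeries ℚ} {v N : ℕ} (hf : MP p 0 f) (h1 : U p (coeff v f)) (h2 : ∀ i < v, M p 1 (coeff i f))
    (hg : MP p 0 g) (h : ∀ n < v + N, M p 1 (coeff n (f*g))) : ∀ n < N, M p 1 (coeff n g) := by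
  intro m
  induction m using Nat.strong_induction_on with
  | _ m ihm =>
    intro hm
    have hc := (h (v+m) (by omega))
    rw [coeff_mul, ← Finset.add_sum_erase _ _ (show (v,m) ∈ antidiagonal (v+m) by simp)] at hc
    apply h1.cancel
    have hs2 : M p 1 (∑ x ∈ (antidiagonal (v+m)).erase (v,m), coeff x.1 f * coeff x.2 g) := by
      refine M_sum _ _ fun x hx => ?_
      obtain ⟨i, j⟩ := x
      simp only [mem_erase, HasAntidiagonal.mem_antidiagonal, ne_eq, Prod.mk.injEq] at hx
      rcases lt_or_ge i v with hi | hi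
      · exact (h2 i hi).mulr (hg j)
      · exact (hf i).mull (ihm j (by omega) (by omega))
    exact (hc.sub hs2).cast (by ring)

lemma MP.inv {f : PowerSeries ℚ} (hf : MP p 0 f) (hu : U p (coeff 0 f)) : MP p 0 f⁻¹ := by
  have h0 : constantCoeff f ≠ 0 := by rw [← coeff_zero_eq_constantCoeff_apply]; exact hu.ne
  intro m
  induction m using Nat.strong_induction_on with
  | _ m ihm =>
    have e := PowerSeries.mul_inv_cancel f h0
    have hc : M p 0 (coeff m (f * f⁻¹)) := by rw [e]; exact MP_one m
    rw [coeff_mul, ← Finset.add_sum_erase _ _ (show (0,m) ∈ antidiagonal m by simp)] at hc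
    apply hu.cancel
    have hs2 : M p 0 (∑ x ∈ (antidiagonal m).erase (0,m), coeff x.1 f * coeff x.2 f⁻¹) := by
      refine M_sum _ _ fun x hx => ?_
      obtain ⟨i, j⟩ := x
      simp only [mem_erase, HasAntidiagonal.mem_antidiagonal, ne_eq, Prod.mk.injEq] at hx
      exact (hf i).mull (ihm j (by omega))
    exact (hc.sub hs2).cast (by ring)

lemma MP.exists {r : ℕ} {f : PowerSeries ℚ} (h : MP p r f) : ∃ g, MP p 0 g ∧ f = C ((p:ℚ)^r) * g := by
  choose c hc hc2 using fun n => (h n).exists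
  refine ⟨mk c, fun n => by rw [coeff_mk]; exact hc n, ?_⟩
  ext n; rw [coeff_C_mul, coeff_mk]; exact hc2 n
end

/-- Euler operator -/
noncomputable def Eu' (f : PowerSeries ℚ) : PowerSeries ℚ := PowerSeries.mk fun n => (n:ℚ) * PowerSeries.coeff n f

section
open PowerSeries
lemma Eu'_coeff (f : PowerSeries ℚ) (n : ℕ) : coeff n (Eu' f) = n * coeff n f := by rw [Eu', coeff_mk]
lemma Eu'_add (f g : PowerSeries ℚ) : Eu' (f+g) = Eu' f + Eu' g := by
  ext n; rw [map_add, Eu'_coeff, Eu'_coeff, Eu'_coeff, map_add]; ring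
lemma Eu'_sub (f g : PowerSeries ℚ) : Eu' (f-g) = Eu' f - Eu' g := by
  ext n; rw [map_sub, Eu'_coeff, Eu'_coeff, Eu'_coeff, map_sub]; ring
lemma Eu'_mul (f g : PowerSeries ℚ) : Eu' (f*g) = Eu' f * g + f * Eu' g := by
  ext n; rw [map_add, Eu'_coeff, coeff_mul, coeff_mul, coeff_mul, ← sum_add_distrib, mul_sum]
  apply sum_congr rfl; intro x hx
  rw [Eu'_coeff, Eu'_coeff, ← HasAntidiagonal.mem_antidiagonal.1 hx]; push_cast; ring
lemma Eu'_C (a : ℚ) : Eu' (C a) = 0 := by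
  ext n; rw [Eu'_coeff, coeff_C]; split_ifs with h
  · simp [h]
  · simp
lemma Eu'_one : Eu' 1 = 0 := by rw [← map_one (C (R := ℚ)), Eu'_C]
lemma Eu'_X : Eu' X = X := by
  ext n; rw [Eu'_coeff, coeff_X]; split_ifs with h
  · simp [h]
  · simp
lemma Eu'_ofNat (z : ℕ) [z.AtLeastTwo] : Eu' (OfNat.ofNat z) = 0 := by
  have := Eu'_C (OfNat.ofNat z); rwa [map_ofNat] at this
lemma Eu'_zero_iff {f : PowerSeries ℚ} (h : Eu' f = 0) : f = C (coeff 0 f) := by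
  ext n; rw [coeff_C]; split_ifs with h0
  · rw [h0]
  · have := congrArg (coeff n) h
    rw [Eu'_coeff, map_zero] at this
    rcases mul_eq_zero.1 this with h1 | h1
    · exact absurd (by exact_mod_cast h1) h0
    · exact h1
/-- uniqueness for first order linear equations -/
lemma ode_zero {A B S : PowerSeries ℚ} (hA : coeff 0 A ≠ 0) (hB : coeff 0 B = 0) (hS : coeff 0 S = 0)
    (h : A * Eu' S = B * S) : S = 0 := by
  ext n
  rw [map_zero]
  induction n using Nat.strong_induction_on with
  | _ n ih =>
    rcases Nat.eq_zero_or_pos n with rfl | hn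
    · exact hS
    have e := congrArg (coeff n) h
    rw [coeff_mul, coeff_mul, sum_eq_single (0,n)] at e
    · rw [sum_eq_zero, Eu'_coeff] at e
      · rcases mul_eq_zero.1 e with h1 | h1
        · exact absurd h1 hA
        · rcases mul_eq_zero.1 h1 with h2 | h2
          · exact absurd (by exact_mod_cast h2) hn.ne'
          · exact h2
      · intro x hx
        have hx := HasAntidiagonal.mem_antidiagonal.1 hx
        rcases Nat.eq_zero_or_pos x.1 with h0 | h0
        · rw [h0, hB, zero_mul]
        · rw [ih x.2 (by omega), mul_zero]
    · intro x hx hne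
      have hx := HasAntidiagonal.mem_antidiagonal.1 hx
      have : x.2 < n := by
        rcases Nat.lt_or_ge x.2 n with h1 | h1
        · exact h1
        · exact absurd (Prod.ext (by simp; omega) (by simp; omega)) hne
      rw [Eu'_coeff, ih x.2 this]; ring
    · intro hh; simp at hh
end

/-- the Frobenius coefficients -/
def PPl (s : ℚ) : ℚ := s^3 + 3/2*s^2+13/18*s+1/9
def PPd (s : ℚ) : ℚ := 3*s^2+3*s+13/18
def PPh (s : ℚ) : ℚ := 3*s+3/2
def fal : ℕ → ℚ
  | 0 => 1
  | i+1 => PPl i * fal i / (i+1)^3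
def fbe : ℕ → ℚ
  | 0 => 0
  | i+1 => (PPl i * fbe i + PPd i * fal i - 3*(i+1)^2*fal (i+1)) / (i+1)^3
def fga : ℕ → ℚ
  | 0 => 0
  | i+1 => (PPl i * fga i + PPd i * fbe i + PPh i * fal i - 3*(i+1)^2*fbe (i+1) - 3*(i+1)*fal (i+1)) / (i+1)^3

lemma fal_succ (i : ℕ) : ((i:ℚ)+1)^3*fal (i+1) = PPl i * fal i := by
  have : (i:ℚ)+1 ≠ 0 := by positivity
  rw [fal]; field_simp
lemma fbe_succ (i : ℕ) : ((i:ℚ)+1)^3*fbe (i+1) = PPl i * fbe i + PPd i * fal i - 3*(i+1)^2*fal (i+1) := by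
  have : (i:ℚ)+1 ≠ 0 := by positivity
  rw [fbe]; field_simp
lemma fga_succ (i : ℕ) : ((i:ℚ)+1)^3*fga (i+1) = PPl i * fga i + PPd i * fbe i + PPh i * fal i - 3*(i+1)^2*fbe (i+1) - 3*(i+1)*fal (i+1) := by
  have : (i:ℚ)+1 ≠ 0 := by positivity
  rw [fga]; field_simp

section
open PowerSeries
lemma coeff_smulN (k n : ℕ) [k.AtLeastTwo] (f : PowerSeries ℚ) : coeff n (OfNat.ofNat k * f) = OfNat.ofNat k * coeff n f := by
  have := coeff_C_mul n f (OfNat.ofNat k); rwa [map_ofNat] at this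
lemma c2_mul (n : ℕ) (f : PowerSeries ℚ) : coeff n (2*f) = 2 * coeff n f := coeff_smulN 2 n f
lemma c13_mul (n : ℕ) (f : PowerSeries ℚ) : coeff n (13*f) = 13 * coeff n f := coeff_smulN 13 n f
lemma c18_mul (n : ℕ) (f : PowerSeries ℚ) : coeff n (18*f) = 18 * coeff n f := coeff_smulN 18 n f
lemma c27_mul (n : ℕ) (f : PowerSeries ℚ) : coeff n (27*f) = 27 * coeff n f := coeff_smulN 27 n f
lemma c54_mul (n : ℕ) (f : PowerSeries ℚ) : coeff n (54*f) = 54 * coeff n f := coeff_smulN 54 n f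
lemma Eu'_cc (f : PowerSeries ℚ) : constantCoeff (Eu' f) = 0 := by
  rw [← coeff_zero_eq_constantCoeff_apply, Eu'_coeff]; simp
lemma cc2 : constantCoeff (2 : PowerSeries ℚ) = 2 := map_ofNat constantCoeff 2
lemma cc9 : constantCoeff (9 : PowerSeries ℚ) = 9 := map_ofNat constantCoeff 9
lemma C2 : C (2:ℚ) = (2 : PowerSeries ℚ) := map_ofNat C 2
lemma C9 : C (9:ℚ) = (9 : PowerSeries ℚ) := map_ofNat C 9
lemma ps_L0 : 18 * Eu' (Eu' (Eu' (PowerSeries.mk fal))) = X * (18 * Eu' (Eu' (Eu' (PowerSeries.mk fal))) + 27 * Eu' (Eu' (PowerSeries.mk fal)) + 13 * Eu' (PowerSeries.mk fal) + 2 * PowerSeries.mk fal) := by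
  ext n
  cases n with
  | zero => simp [Eu'_cc]
  | succ n =>
    rw [coeff_succ_X_mul]
    simp only [map_add, c2_mul, c13_mul, c18_mul, c27_mul, c54_mul, Eu'_coeff, coeff_mk]
    have := fal_succ n
    rw [PPl] at this; push_cast
    linear_combination 18*this
lemma ps_L1 : 18 * Eu' (Eu' (Eu' (PowerSeries.mk fbe))) + 54 * Eu' (Eu' (PowerSeries.mk fal)) = X * (18 * Eu' (Eu' (Eu' (PowerSeries.mk fbe))) + 27 * Eu' (Eu' (PowerSeries.mk fbe)) + 13 * Eu' (PowerSeries.mk fbe) + 2 * PowerSeries.mk fbe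
     + 54 * Eu' (Eu' (PowerSeries.mk fal)) + 54 * Eu' (PowerSeries.mk fal) + 13 * PowerSeries.mk fal) := by
  ext n
  cases n with
  | zero => simp [Eu'_cc]
  | succ n =>
    rw [coeff_succ_X_mul]
    simp only [map_add, c2_mul, c13_mul, c18_mul, c27_mul, c54_mul, Eu'_coeff, coeff_mk]
    have := fbe_succ n
    rw [PPl, PPd] at this; push_cast
    linear_combination 18*this
lemma ps_L2 : 18 * Eu' (Eu' (Eu' (PowerSeries.mk fga))) + 54 * Eu' (Eu' (PowerSeries.mk fbe)) + 54 * Eu' (PowerSeries.mk fal) = X * (18 * Eu' (Eu' (Eu' (PowerSeries.mk fga))) + 27 * Eu' (Eu' (PowerSeries.mk fga)) + 13 * Eu' (PowerSeries.mk fga) + 2 * PowerSeries.mk fga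
     + 54 * Eu' (Eu' (PowerSeries.mk fbe)) + 54 * Eu' (PowerSeries.mk fbe) + 13 * PowerSeries.mk fbe + 54 * Eu' (PowerSeries.mk fal) + 27 * PowerSeries.mk fal) := by
  ext n
  cases n with
  | zero => simp [Eu'_cc]
  | succ n =>
    rw [coeff_succ_X_mul]
    simp only [map_add, c2_mul, c13_mul, c18_mul, c27_mul, c54_mul, Eu'_coeff, coeff_mk]
    have := fga_succ n
    rw [PPl, PPd, PPh] at this; push_cast
    linear_combination 18*this

lemma Eu'_pow2 (f : PowerSeries ℚ) : Eu' (f^2) = 2*f*Eu' f := by rw [pow_two, Eu'_mul]; ring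
lemma ps_sym : 2 * PowerSeries.mk fal * PowerSeries.mk fga = PowerSeries.mk fbe ^ 2 := by
  have h0 : Eu' 0 = 0 := by ext n; rw [Eu'_coeff]; simp
  have h2 : Eu' 2 = 0 := Eu'_ofNat 2
  have h4 : Eu' 4 = 0 := Eu'_ofNat 4
  have h9 : Eu' 9 = 0 := Eu'_ofNat 9
  have l0 := ps_L0
  have l1 := ps_L1
  have l2 := ps_L2
  have ca : constantCoeff (PowerSeries.mk fal) = 1 := by rw [← coeff_zero_eq_constantCoeff_apply, coeff_mk, fal]
  have cb : constantCoeff (PowerSeries.mk fbe) = 0 := by rw [← coeff_zero_eq_constantCoeff_apply, coeff_mk, fbe]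
  have cc : constantCoeff (PowerSeries.mk fga) = 0 := by rw [← coeff_zero_eq_constantCoeff_apply, coeff_mk, fga]
  generalize PowerSeries.mk fal = a at *
  generalize PowerSeries.mk fbe = b at *
  generalize PowerSeries.mk fga = c at *
  have e0 : 9*((1-X)*(2*a*Eu' (Eu' a) - (Eu' a)^2)) - 9*X*a*Eu' a - 2*X*a^2 = 0 := by
    rw [Eu'_zero_iff (f := 9*((1-X)*(2*a*Eu' (Eu' a) - (Eu' a)^2)) - 9*X*a*Eu' a - 2*X*a^2)]
    · rw [coeff_zero_eq_constantCoeff_apply]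
      simp [Eu'_cc, ca]
    · simp only [Eu'_sub, Eu'_mul, Eu'_pow2, h0, h2, h4, h9, Eu'_X, Eu'_one]
      linear_combination a * l0
  have e1 : 9*((1-X)*(2*a*(Eu' (Eu' b) + 2*Eu' a) + 2*b*Eu' (Eu' a) - 2*Eu' a*(Eu' b + a))) - 9*X*(a*(Eu' b + a) + b*Eu' a) - 4*X*a*b = 0 := by
    rw [Eu'_zero_iff (f := 9*((1-X)*(2*a*(Eu' (Eu' b) + 2*Eu' a) + 2*b*Eu' (Eu' a) - 2*Eu' a*(Eu' b + a))) - 9*X*(a*(Eu' b + a) + b*Eu' a) - 4*X*a*b)]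
    · rw [coeff_zero_eq_constantCoeff_apply]
      simp [Eu'_cc, ca]
    · simp only [Eu'_sub, Eu'_add, Eu'_mul, Eu'_pow2, h0, h2, h4, h9, Eu'_X, Eu'_one]
      linear_combination a * l1 + b * l0 - 2 * e0
  have e2 : 9*((1-X)*(2*a*(Eu' (Eu' c) + 2*Eu' b + a) + 2*b*(Eu' (Eu' b) + 2*Eu' a) + 2*c*Eu' (Eu' a) - 2*Eu' a*(Eu' c + b) - (Eu' b + a)^2))
      - 9*X*(a*(Eu' c + b) + b*(Eu' b + a) + c*Eu' a) - 2*X*(2*a*c+b^2) = 9 := by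
    rw [Eu'_zero_iff (f := 9*((1-X)*(2*a*(Eu' (Eu' c) + 2*Eu' b + a) + 2*b*(Eu' (Eu' b) + 2*Eu' a) + 2*c*Eu' (Eu' a) - 2*Eu' a*(Eu' c + b) - (Eu' b + a)^2))
      - 9*X*(a*(Eu' c + b) + b*(Eu' b + a) + c*Eu' a) - 2*X*(2*a*c+b^2))]
    · rw [coeff_zero_eq_constantCoeff_apply]
      simp [Eu'_cc, ca, cb, cc, cc2, cc9]
      rw [C9, C2]; ring
    · simp only [Eu'_sub, Eu'_add, Eu'_mul, Eu'_pow2, h0, h2, h4, h9, Eu'_X, Eu'_one]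
      linear_combination a * l2 + b * l1 + c * l0 - 2 * e1
  have w1 : (1-X)*(2*a*(a*Eu' (Eu' b) + 2*a*Eu' a - b * Eu' (Eu' a)) - 2*Eu' a*(a*(Eu' b + a) - b*Eu' a)) - X*a*(a*(Eu' b + a) - b*Eu' a) = 0 := by
    have : (9:PowerSeries ℚ) ≠ 0 := by
      intro h; have := congrArg constantCoeff h; rw [cc9] at this; simp at this
    apply mul_left_cancel₀ this
    linear_combination a * e1 - 2*b*e0
  have w2 : (1-X)*(a*(Eu' b + a) - b*Eu' a)^2 - a^2 = 0 := by
    apply ode_zero (A := a) (B := 2 * Eu' a)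
    · rw [coeff_zero_eq_constantCoeff_apply, ca]; norm_num
    · rw [coeff_zero_eq_constantCoeff_apply]; simp [Eu'_cc]
    · rw [coeff_zero_eq_constantCoeff_apply]; simp [Eu'_cc, ca, cb]
    · simp only [Eu'_sub, Eu'_add, Eu'_mul, Eu'_pow2, h0, h2, h4, h9, Eu'_X, Eu'_one]
      linear_combination (a*(Eu' b + a) - b*Eu' a) * w1
  have v1 : a * Eu' (2*a*c-b^2) - 2 * Eu' a * (2*a*c-b^2) = 0 := by
    apply ode_zero (A := 2*(1-X)*a) (B := X*a+4*(1-X)*Eu' a)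
    · rw [coeff_zero_eq_constantCoeff_apply]; simp [ca, cc2]
    · rw [coeff_zero_eq_constantCoeff_apply]; simp [Eu'_cc]
    · rw [coeff_zero_eq_constantCoeff_apply]; simp [Eu'_cc]
    · have : (9:PowerSeries ℚ) ≠ 0 := by
        intro h; have := congrArg constantCoeff h; rw [cc9] at this; simp at this
      apply mul_left_cancel₀ this
      simp only [Eu'_sub, Eu'_add, Eu'_mul, Eu'_pow2, h0, h2, h4, h9, Eu'_X, Eu'_one]
      linear_combination 2*a^2*e2 - 4*a*b*e1 + 2*(3*b^2-2*a*c)*e0 - 18*w2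
  have s1 : 2*a*c-b^2 = 0 := by
    apply ode_zero (A := a) (B := 2 * Eu' a)
    · rw [coeff_zero_eq_constantCoeff_apply, ca]; norm_num
    · rw [coeff_zero_eq_constantCoeff_apply]; simp [Eu'_cc]
    · rw [coeff_zero_eq_constantCoeff_apply]; simp [ca, cb, cc]
    · linear_combination v1
  linear_combination s1
end

lemma AA_succ (k : ℕ) : ((k:ℚ)+1)^3 * AA (k+1) = 108 * PPl k * AA k := by
  have h0 : (k.factorial:ℚ) ≠ 0 := by positivity
  have h1 : (k:ℚ)+1 ≠ 0 := by positivity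
  rw [AA_eq, AA_eq, show 2*(k+1) = 2*k+1+1 by ring, show 3*(k+1) = 3*k+1+1+1 by ring]
  simp only [Nat.factorial_succ, PPl]; push_cast; field_simp; ring

section
variable {p : ℕ} [hp : Fact p.Prime]

lemma M_PPl (h3 : 3 < p) (i : ℕ) : M p 0 (PPl i) := by
  have h2 := U_two h3
  have h3' := U_three h3
  have h18 : U p 18 := by have := (h2.mul h3').mul h3'; norm_num at this; exact this
  have := M.div (M_nat (p := p) (18*i^3+27*i^2+13*i+2)) h18
  refine this.cast ?_; rw [PPl]; push_cast; ring
lemma M_PPd (h3 : 3 < p) (i : ℕ) : M p 0 (PPd i) := by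
  have h2 := U_two h3
  have h3' := U_three h3
  have h18 : U p 18 := by have := (h2.mul h3').mul h3'; norm_num at this; exact this
  have := M.div (M_nat (p := p) (54*i^2+54*i+13)) h18
  refine this.cast ?_; rw [PPd]; push_cast; ring
lemma M_PPh (h3 : 3 < p) (i : ℕ) : M p 0 (PPh i) := by
  have := M.div (M_nat (p := p) (6*i+3)) (U_two h3)
  refine this.cast ?_; rw [PPh]; push_cast; ring
lemma U_suc {i : ℕ} (hi : i + 1 < p) : U p ((i:ℚ)+1) := by
  have := U_of_lt (p := p) (z := i+1) (by omega) (by omega); push_cast at this; exact this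
lemma M_suc (i : ℕ) : M p 0 ((i:ℚ)+1) := by exact_mod_cast M_nat (p := p) (i+1)

lemma M_fr (h3 : 3 < p) (i : ℕ) (hi : i < p) : M p 0 (fal i) ∧ M p 0 (fbe i) ∧ M p 0 (fga i) := by
  induction i with
  | zero => rw [fal, fbe, fga]; exact ⟨M_one, M_zero 0, M_zero 0⟩
  | succ i ih =>
    obtain ⟨ha, hb, hc⟩ := ih (by omega)
    have hu := (U_suc hi).pow 3
    have hP := M_PPl h3 i
    have hD := M_PPd h3 i
    have hH := M_PPh h3 i
    have hs := M_suc (p := p) i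
    have a1 : M p 0 (fal (i+1)) := by rw [fal]; exact (hP.m0 ha).div hu
    have b1 : M p 0 (fbe (i+1)) := by
      rw [fbe]; exact (((hP.m0 hb).add (hD.m0 ha)).sub (((M_nat 3).m0 (hs.pow0 2)).m0 a1)).div hu
    refine ⟨a1, b1, ?_⟩
    rw [fga]
    exact (((((hP.m0 hc).add (hD.m0 hb)).add (hH.m0 ha)).sub (((M_nat 3).m0 (hs.pow0 2)).m0 b1)).sub (((M_nat 3).m0 hs).m0 a1)).div hu

lemma M_PPl1 (h3 : 3 < p) {i : ℕ} (h : p = 3*i+1 ∨ p = 3*i+2 ∨ p = 2*i+1 ∨ 2*p = 3*i+1 ∨ 2*p = 3*i+2) : M p 1 (PPl i) := by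
  have h2 := U_two h3
  have h3' := U_three h3
  have h18 : U p 18 := by have := (h2.mul h3').mul h3'; norm_num at this; exact this
  have hd : p ∣ (2*i+1)*((3*i+1)*(3*i+2)) := by
    rcases h with h | h | h | h | h
    · exact (Dvd.intro _ rfl : p ∣ p * ((3*i+2))).trans (by rw [← h]; exact Dvd.intro_left _ rfl)
    · exact (Dvd.intro_left _ rfl : p ∣ (3*i+1) * p).trans (by rw [← h]; exact Dvd.intro_left _ rfl)
    · rw [← h]; exact Dvd.intro _ rfl
    · rw [← h]; exact ⟨(2*i+1)*(2*(3*i+2)), by ring⟩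
    · rw [← h]; exact ⟨(2*i+1)*(2*(3*i+1)), by ring⟩
  have := M.div (M_dvd hd) h18
  refine this.cast ?_; rw [PPl]; push_cast; ring

lemma M1_fr (h3 : 3 < p) (i : ℕ) (hi : i < p) : (p ≤ 3*i → M p 1 (fal i)) ∧ (p ≤ 2*i → M p 1 (fbe i)) ∧ (2*p ≤ 3*i → M p 1 (fga i)) := by
  have hmod : p % 3 ≠ 0 := by
    intro h
    have := (Nat.prime_dvd_prime_iff_eq Nat.prime_three hp.out).1 (Nat.dvd_of_mod_eq_zero h); omega
  have hmod2 : p % 2 ≠ 0 := by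
    intro h
    have := (Nat.prime_dvd_prime_iff_eq Nat.prime_two hp.out).1 (Nat.dvd_of_mod_eq_zero h); omega
  induction i with
  | zero => exact ⟨fun h => by omega, fun h => by omega, fun h => by omega⟩
  | succ i ih =>
    obtain ⟨ha, hb, hc⟩ := ih (by omega)
    obtain ⟨ma, mb, mc⟩ := M_fr h3 i (by omega)
    have hu := (U_suc hi).pow 3
    have hP := M_PPl h3 i
    have hD := M_PPd h3 i
    have hH := M_PPh h3 i
    have hs := M_suc (p := p) i
    have a1 : p ≤ 3*(i+1) → M p 1 (fal (i+1)) := by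
      intro h
      rw [fal]
      by_cases h' : p ≤ 3*i
      · exact (hP.mull (ha h')).div hu
      · exact ((M_PPl1 h3 (by omega)).mulr ma).div hu
    have b1 : p ≤ 2*(i+1) → M p 1 (fbe (i+1)) := by
      intro h
      have a2 := a1 (by omega)
      have a3 := ha (by omega)
      rw [fbe]
      refine M.div (M.sub (M.add ?_ (hD.mull a3)) (((M_nat 3).m0 (hs.pow0 2)).mull a2)) hu
      by_cases h' : p ≤ 2*i
      · exact hP.mull (hb h')
      · exact (M_PPl1 h3 (by omega)).mulr mb
    refine ⟨a1, b1, ?_⟩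
    intro h
    have a2 := a1 (by omega)
    have a3 := ha (by omega)
    have b2 := b1 (by omega)
    have b3 := hb (by omega)
    rw [fga]
    refine M.div (M.sub (M.sub (M.add (M.add ?_ (hD.mull b3)) (hH.mull a3)) (((M_nat 3).m0 (hs.pow0 2)).mull b2)) (((M_nat 3).m0 hs).mull a2)) hu
    by_cases h' : 2*p ≤ 3*i
    · exact hP.mull (hc h')
    · exact (M_PPl1 h3 (by omega)).mulr mc

open PowerSeries in
/-- the truncated symmetric square relation modulo p -/
lemma fr_sym (h3 : 3 < p) (l : ℕ) : M p 1 (∑ x ∈ HasAntidiagonal.antidiagonal l,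
    if x.1 < p ∧ x.2 < p then 2*fal x.1*fga x.2 - fbe x.1*fbe x.2 else 0) := by
  rcases lt_or_ge l p with hl | hl
  · have h := congrArg (coeff l) ps_sym
    rw [mul_assoc, c2_mul, pow_two, coeff_mul, coeff_mul] at h
    simp only [coeff_mk] at h
    refine (M_zero 1).cast ?_
    rw [← sub_eq_zero, mul_sum, ← sum_sub_distrib] at h
    rw [← h]
    apply sum_congr rfl
    intro x hx
    have := HasAntidiagonal.mem_antidiagonal.1 hx
    rw [if_pos (by omega)]; ring
  · refine M_sum _ _ fun x hx => ?_
    have hx := HasAntidiagonal.mem_antidiagonal.1 hx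
    split_ifs with h
    · obtain ⟨ma, mb, mc⟩ := M_fr h3 x.1 h.1
      obtain ⟨ma', mb', mc'⟩ := M_fr h3 x.2 h.2
      obtain ⟨ha, hb, hc⟩ := M1_fr h3 x.1 h.1
      obtain ⟨ha', hb', hc'⟩ := M1_fr h3 x.2 h.2
      refine M.sub ?_ ?_
      · by_cases h' : p ≤ 3*x.1
        · exact ((M_nat 2).mull (ha h')).mulr mc'
        · exact ((M_nat 2).m0 ma).mull (hc' (by omega))
      · by_cases h' : p ≤ 2*x.1
        · exact (hb h').mulr mb'
        · exact mb.mull (hb' (by omega))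
    · exact M_zero 1

/-- expansion of `AA (p j + i)` -/
lemma AA_fr (h3 : 3 < p) (j i : ℕ) (hi : i < p) : M p 3 (AA (p*j+i) - AA (p*j)*108^i*(fal i + (p*j:ℚ)*fbe i + (p*j:ℚ)^2*fga i)) := by
  induction i with
  | zero => rw [fal, fbe, fga]; exact (M_zero 3).cast (by ring)
  | succ i ih =>
    have ih := ih (by omega)
    obtain ⟨ma, mb, mc⟩ := M_fr h3 i (by omega)
    obtain ⟨ma', mb', mc'⟩ := M_fr h3 (i+1) hi
    have hu : U p ((p*j:ℚ)+i+1) := (U_suc hi).congr ((M_p.mulr (M_nat j)).cast (by ring))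
    have hA := AA_succ (p*j+i)
    push_cast at hA
    apply (hu.pow 3).cancel
    have e1 := fal_succ i
    have e2 := fbe_succ i
    have e3 := fga_succ i
    have hP := M_PPl (p := p) h3 (p*j+i); push_cast at hP
    have hE : M p 1 ((p:ℚ)*j) := M_p.mulr (M_nat j)
    have hE3 : M p 3 (((p:ℚ)*j)^3) := hE.pow 3
    have key : M p 3 (PPl ((p:ℚ)*j+i)*(fal i + (p*j:ℚ)*fbe i + (p*j:ℚ)^2*fga i) - ((p*j:ℚ)+i+1)^3*(fal (i+1) + (p*j:ℚ)*fbe (i+1) + (p*j:ℚ)^2*fga (i+1))) := by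
      generalize (p:ℚ)*j = E at *
      have hE0 := hE.mono (Nat.zero_le 1)
      have hD := M_PPd h3 i
      have hH := M_PPh h3 i
      have hs := M_suc (p := p) i
      have : M p 0 (fal i + PPh i * fbe i + PPd i*fga i + E*(fbe i + PPh i*fga i + E * fga i) - (fal (i+1) + 3*(i+1)*fbe (i+1) + 3*(i+1)^2*fga (i+1)
         + E*(fbe (i+1) + 3*(i+1)*fga (i+1) + E * fga (i+1)))) := by
        refine M.sub (M.add (M.add (M.add ma (hH.m0 mb)) (hD.m0 mc)) (hE0.m0 ((mb.add (hH.m0 mc)).add (hE0.m0 mc)))) ?_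
        refine M.add (M.add (M.add ma' (((M_nat 3).m0 hs).m0 mb')) (((M_nat 3).m0 (hs.pow0 2)).m0 mc')) (hE0.m0 ((mb'.add (((M_nat 3).m0 hs).m0 mc')).add (hE0.m0 mc')))
      refine (hE3.mulr this).cast ?_
      simp only [PPl, PPd, PPh] at *
      linear_combination -e1-E*e2-E^2*e3
    refine M.cast ((((M_nat 108).m0 hP).mull ih).add (((M_nat 108).m0 ((M_AA (p*j)).m0 ((M_nat 108).pow0 i))).mull key)) ?_
    rw [show p*j+(i+1) = p*j+i+1 by ring]
    push_cast
    rw [pow_succ]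
    linear_combination hA
end

noncomputable def gF (c : ℚ) : PowerSeries ℚ := PowerSeries.mk fun n => c^n
/-- the block series -/
noncomputable def yj (p j : ℕ) : PowerSeries ℚ :=
  ∑ i ∈ range p, PowerSeries.C (AA (p*j+i)) * (PowerSeries.X^(2*(p*j+i)) * gF 4^(3*(p*j+i)+1))
noncomputable def y2 (p : ℕ) : PowerSeries ℚ :=
  ∑ k ∈ range p, PowerSeries.C (AA k * (-1)^k) * (PowerSeries.X^k * gF 16^(3*k+1))

section
open PowerSeries
lemma gF_pow (c : ℚ) (d n : ℕ) : coeff n (gF c^(d+1)) = c^n * ((d+n).choose d : ℚ) := by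
  have e : gF c = rescale c (PowerSeries.mk 1) := by
    ext n; rw [gF, coeff_rescale, coeff_mk, coeff_mk]; simp
  rw [e, ← map_pow, mk_one_pow_eq_mk_choose_add, coeff_rescale, coeff_mk]
lemma gF_mul (c : ℚ) : gF c * (1 - C c * X) = 1 := by
  ext n
  rw [mul_sub, mul_one, map_sub, mul_left_comm, coeff_C_mul]
  cases n with
  | zero => rw [coeff_zero_mul_X]; simp [gF]
  | succ n => rw [coeff_succ_mul_X, gF, coeff_mk, coeff_mk, coeff_one]; simp; ring
lemma coeff_yj (p j N : ℕ) : coeff N (yj p j) = 4^N * ∑ i ∈ range p, t1 N (p*j+i) := by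
  rw [yj, map_sum, mul_sum]
  apply sum_congr rfl; intro i _
  generalize p*j+i = k
  rw [coeff_C_mul, coeff_X_pow_mul', t1_nat]
  split_ifs with h
  · obtain ⟨r, rfl⟩ := Nat.exists_eq_add_of_le h
    rw [gF_pow, Nat.add_sub_cancel_left, show 3*k+r = 2*k+r+k by ring, pow_add, pow_mul, show (4:ℚ)^2 = 16 by norm_num]
    field_simp
  · rw [Nat.choose_eq_zero_of_lt (by omega)]; simp
lemma coeff_y2 (p N : ℕ) : coeff N (y2 p) = 16^N * q1 p (-1-N) := by
  rw [y2, q1, map_sum, mul_sum]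
  apply sum_congr rfl; intro k _
  have e : ff (-1-(N:ℚ)+k) (3*k) = (-1)^k * (((N+2*k).choose (3*k):ℕ):ℚ) * (3*k).factorial := by
    have := ff_nat (N+2*k) (3*k)
    rw [mul_assoc, ← this, show -1-(N:ℚ)+k = -(1+(N:ℚ)-k) by ring, ff_neg, show 3*k = k+2*k by ring, pow_add, pow_mul (-1:ℚ) 2 k]
    push_cast; rw [show 1+(N:ℚ)-k+(k+2*k)-1 = N+2*k by ring]; simp
  rw [coeff_C_mul, coeff_X_pow_mul', t1, e, AA_eq]
  split_ifs with h
  · obtain ⟨r, rfl⟩ := Nat.exists_eq_add_of_le h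
    rw [gF_pow, Nat.add_sub_cancel_left, show 3*k+r = k+r+2*k by ring, pow_add (16:ℚ)]
    field_simp
  · rw [Nat.choose_eq_zero_of_lt (by omega)]; simp
end

/-- Domb-type recurrence modulo p^3 -/
def RecC (p : ℕ) (c : ℕ → ℚ) : Prop := ∀ N : ℕ, M p 3 (((N:ℚ)+1)^3*c (N+1) - 2*(2*N+1)*(5*N^2+5*N+2)*c N + 64*N^3*c (N-1))

section
variable {p : ℕ} [hp : Fact p.Prime]
open PowerSeries
lemma G1c_M (h3 : 3 < p) (j N : ℕ) : M p 3 (G1c N (p*j)) := by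
  rcases Nat.eq_zero_or_pos j with rfl | hj
  · rw [mul_zero, G1c]; exact M_zero 3
  obtain ⟨k, hk⟩ : ∃ k, p*j = k+1 := ⟨p*j-1, by have := Nat.mul_pos (show 0 < p by omega) hj; omega⟩
  rw [hk, G1c_aux N ((N+k).choose (3*k+1)) k (by rw [← ff_nat]; push_cast; rfl)]
  have hk' : (p:ℚ)*j = k+1 := by exact_mod_cast hk
  have u : U p (3*(k:ℚ)+2) := U_one.neg.congr (((M_p.mulr (M_nat j)).mulr (M_nat 3)).cast (by rw [hk']; push_cast; ring))
  have m3 : M p 3 (((k:ℚ)+1)^3) := by rw [← hk']; exact (M_p.mulr (M_nat j)).pow 3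
  have h16 : M p 0 (-16*(3*(N:ℚ)+1)) := by have := M_int (p := p) (-16*(3*N+1)); push_cast at this; exact this
  exact M.div (((h16.mull m3).mulr (M_AA _)).mulr (M_nat _)) (u.mul ((U_16 h3).pow _))

lemma RecC_yj (h3 : 3 < p) (j : ℕ) : RecC p (fun N => coeff N (yj p j)) := by
  intro N
  have hb : ∀ x : ℚ, ∑ i ∈ range p, t1 x (p*j+i) = ∑ k ∈ range (p*(j+1)), t1 x k - ∑ k ∈ range (p*j), t1 x k := by
    intro x; rw [mul_add, mul_one, sum_range_add]; ring
  have r1 := t1_rec N (p*(j+1))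
  have r2 := t1_rec N (p*j)
  have := (((M_nat 4).pow0 N).mull ((G1c_M h3 (j+1) N).sub (G1c_M h3 j N)))
  refine this.cast ?_
  simp only [coeff_yj, hb]
  rw [← r1, ← r2]
  rcases Nat.eq_zero_or_pos N with rfl | hN
  · push_cast; ring
  · obtain ⟨N, rfl⟩ : ∃ k, N = k+1 := ⟨N-1, by omega⟩
    push_cast; simp only [Nat.add_sub_cancel, show (N:ℚ)+1-1 = N by ring]; ring
lemma RecC_y2 (h3 : 3 < p) {n : ℕ} (hn : p = 2*n+1) : RecC p (fun N => coeff N (y2 p)) := by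
  intro N
  have r := q1_rec (p := p) (-1-N)
  have hG : M p 3 (G1c (-1-N) p) := by
    rw [G1c_neg h3 hn]
    have h16 : M p 0 (-16*(3*(N:ℚ)+2)) := by have := M_int (p := p) (-16*(3*N+2)); push_cast at this; exact this
    exact M.div (((h16.mull (M_ppow 3)).mulr (M_AA _)).mulr (M_nat _)) ((U_3p h3).mul ((U_16 h3).pow _))
  refine (((M_nat 16).pow0 N).mull hG.neg).cast ?_
  simp only [coeff_y2]
  rw [← r, show (-1:ℚ)-N-1 = -1-((N+1:ℕ):ℚ) by push_cast; ring, show (-1:ℚ)-N+1 = -N by ring]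
  rcases Nat.eq_zero_or_pos N with rfl | hN
  · push_cast; ring
  · obtain ⟨N, rfl⟩ : ∃ k, N = k+1 := ⟨N-1, by omega⟩
    rw [Nat.add_sub_cancel, show -1-(N:ℚ) = -((N+1:ℕ):ℚ) by push_cast; ring]
    push_cast; ring

lemma MP_gF {c : ℚ} (hc : M p 0 c) : MP p 0 (gF c) := fun n => by rw [gF, coeff_mk]; exact hc.pow0 n
lemma MP_yj (j : ℕ) : MP p 0 (yj p j) := MP_sum _ _ fun i _ => (MP_C (M_AA _)).m0 ((MP_X.pow0 _).m0 ((MP_gF (M_nat 4)).pow0 _))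
lemma MP_y2 : MP p 0 (y2 p) := MP_sum _ _ fun i _ => (MP_C ((M_AA _).m0 (M_one.neg.pow0 _))).m0 ((MP_X.pow0 _).m0 ((MP_gF (M_nat 16)).pow0 _))

/-- values at multiples of p -/
lemma yj_p (h3 : 3 < p) (j m : ℕ) : M p 3 (coeff (p*m) (yj p j) - coeff m (C (AA j) * (X^(2*j) * gF 4^(3*j+1)))) := by
  have e : coeff m (C (AA j) * (X^(2*j) * gF 4^(3*j+1))) = 4^m * (AA j * ((m+j).choose (3*j)) / 16^j) := by
    rw [coeff_C_mul, coeff_X_pow_mul']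
    split_ifs with h
    · obtain ⟨r, rfl⟩ := Nat.exists_eq_add_of_le h
      rw [gF_pow, Nat.add_sub_cancel_left, show 3*j+r = 2*j+r+j by ring, pow_add, pow_mul, show (4:ℚ)^2 = 16 by norm_num]
      field_simp
    · rw [Nat.choose_eq_zero_of_lt (by omega)]; simp
  rw [e, coeff_yj]
  have hb := block_t1 (p := p) m j
  push_cast at hb ⊢
  rw [hb]
  have ht : t1 ((p:ℚ)*m) (p*j) = AA (p*j) * ((p*(m+j)).choose (p*(3*j))) / 16^(p*j) := by
    have := t1_nat (p*m) (p*j); push_cast at this; rw [this]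
    rw [show p*m+p*j = p*(m+j) by ring, show 3*(p*j) = p*(3*j) by ring]
  rw [ht]
  have hPhi := Phi_eq h3 (m:ℤ) (j:ℤ)
  have uw := (U_four h3).pow (p-1)
  have n4 := uw.ne
  have c1 := (AA_p h3 j).cmul (choose_p h3 (m+j) (3*j)) (M_AA _) (M_nat _)
  have hz : U p (((4:ℚ)^(p-1))^(2*(j:ℤ)-m)) := by
    rw [zpow_sub₀ n4, show (2*(j:ℤ)) = ((2*j:ℕ):ℤ) by push_cast; ring, zpow_natCast, zpow_natCast]; exact (uw.pow _).div (uw.pow _)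
  have c2 := c1.cmul hPhi ((M_AA _).m0 (M_nat _)) hz.m0
  have u16 : U p ((16:ℚ)^(p*j)) := (U_16 h3).pow _
  have c3 := (((M_nat (p := p) 4).pow0 (p*m)).mull c2).div u16
  refine c3.cast ?_
  have k4 : ((4:ℚ)^(p*m)) = 4^m * (4^(p-1))^m := by rw [pow_mul, w_eq (p := p), mul_pow]
  have k16 : ((16:ℚ)^(p*j)) = 16^j * ((4^(p-1))^j)^2 := by
    rw [pow_mul, w_eq (p := p), mul_pow, show (16:ℚ) = 4*4 by norm_num, mul_pow 4 4 (p-1), mul_pow (4^(p-1):ℚ)]; ring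
  have kz : ((4:ℚ)^(p-1))^(2*(j:ℤ)-m) = ((4^(p-1))^j)^2 / (4^(p-1))^m := by
    rw [zpow_sub₀ n4, mul_comm 2 (j:ℤ), zpow_mul, zpow_natCast, zpow_natCast]; norm_cast
  push_cast
  rw [kz, k4, k16]
  have : ((4:ℚ)^(p-1))^j ≠ 0 := pow_ne_zero _ n4
  have : ((4:ℚ)^(p-1))^m ≠ 0 := pow_ne_zero _ n4
  field_simp

lemma y2_p (h3 : 3 < p) (m : ℕ) : M p 3 (coeff (p*m) (y2 p) - coeff m (gF 16)) := by
  rw [coeff_y2, gF, coeff_mk]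
  have hb := block_t1' (p := p) m 0
  rw [mul_zero, t1_zero, one_mul] at hb
  simp only [zero_add] at hb
  push_cast at hb ⊢
  rw [q1, hb]
  have hPsi := Psi_eq h3 (m:ℤ)
  have uw := (U_16 h3).pow (p-1)
  refine (((M_nat 16).pow0 (p*m)).mull hPsi).cast ?_
  have : ((16:ℚ)^(p-1))^m ≠ 0 := pow_ne_zero _ uw.ne
  push_cast
  rw [mul_sub, zpow_neg, zpow_natCast, pow_mul, w_eq (p := p), mul_pow]; field_simp
end

def PD (x : ℚ) : ℚ := 2*(2*x+1)*(5*x^2+5*x+2)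
def Dd (p : ℕ) : ℕ → ℤ → ℤ → ℚ
  | 0 => fun _ _ => 1
  | 1 => fun m _ => PD ((p:ℚ)*(m:ℚ)) * (((p:ℚ)*(m:ℚ)+1)^3)⁻¹
  | i+2 => fun m j => (PD ((p:ℚ)*(m:ℚ)+((i:ℚ)+1)) * Dd p (i+1) m j - 64*((p:ℚ)*(m:ℚ)+((i:ℚ)+1))^3 * Dd p i m j) * (((p:ℚ)*(m:ℚ)+((i:ℚ)+2))^3)⁻¹

section
variable {p : ℕ} [hp : Fact p.Prime]
open PowerSeries

lemma Q3_lin' (x : ℕ) : Q3 p (fun m j => (p:ℚ)*m+x) :=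
  (Q3.lin (M_nat x) M_one (M_zero 0)).congr (fun m j => by ring)
lemma Q3_nat (x : ℕ) : Q3 p (fun m j => (x:ℚ)) := Q3.const (M_nat x)
lemma Q3_PD {f : ℤ → ℤ → ℚ} (hf : Q3 p f) : Q3 p (fun m j => PD (f m j)) :=
  ((((Q3_nat 2).mul (((Q3_nat 2).mul hf).add (Q3_nat 1)))).mul ((((Q3_nat 5).mul (hf.pow 2)).add ((Q3_nat 5).mul hf)).add (Q3_nat 2))).congr
    (fun m j => by rw [PD]; push_cast; ring)
lemma Q3_Dd (i : ℕ) (hi : i < p) : Q3 p (Dd p i) := by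
  induction i using Nat.strong_induction_on with
  | _ i ih =>
    match i, ih, hi with
    | 0, _, _ => exact (Q3_nat 1).congr (fun m j => by simp [Dd])
    | 1, _, hi =>
      refine ((Q3_PD (Q3_lin' 0)).mul (((Q3_lin' 1).pow 3).inv ?_)).congr (fun m j => by rw [Dd]; push_cast; ring_nf)
      have := U_one (p := p); simpa using this
    | i+2, ih, hi =>
      refine (((((Q3_PD (Q3_lin' (i+1))).mul (ih (i+1) (by omega) (by omega)))).sub (((Q3_nat 64).mul ((Q3_lin' (i+1)).pow 3)).mul (ih i (by omega) (by omega)))).mul (((Q3_lin' (i+2)).pow 3).inv ?_)).congr (fun m j => by rw [Dd]; push_cast; ring_nf)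
      have := (U_of_lt (p := p) (z := i+2) (by omega) (by omega)).pow 3
      simpa using this

lemma Dd_c (h3 : 3 < p) {c : ℕ → ℚ} (hc : RecC p c) (h0 : ∀ N, M p 0 (c N)) (m i : ℕ) (hi : i < p) : M p 3 (c (p*m+i) - Dd p i m 0 * c (p*m)) := by
  induction i using Nat.strong_induction_on with
  | _ i ih =>
    match i, ih, hi with
    | 0, _, _ => simp only [Dd]; exact (M_zero 3).cast (by rw [add_zero]; ring)
    | 1, _, hi =>
      have r := hc (p*m)
      have u : U p ((p:ℚ)*m+1) := U_one.congr ((M_p.mulr (M_nat m)).cast (by ring))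
      have m3 : M p 3 (((p:ℚ)*m)^3) := (M_p.mulr (M_nat m)).pow 3
      push_cast at r
      have := (r.sub (((M_nat 64).mull m3).mulr (h0 (p*m-1)))).div (u.pow 3)
      refine this.cast ?_
      have := u.ne
      simp only [Dd, PD]; push_cast; field_simp; ring
    | i+2, ih, hi =>
      have r := hc (p*m+(i+1))
      have i1 := ih (i+1) (by omega) (by omega)
      have i0 := ih i (by omega) (by omega)
      have hP : M p 0 (PD ((p:ℚ)*m+(i+1))) := by
        have := M_nat (p := p) (2*(2*(p*m+(i+1))+1)*(5*(p*m+(i+1))^2+5*(p*m+(i+1))+2)); rw [PD]; push_cast at this ⊢; exact this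
      have hx : M p 0 (64*((p:ℚ)*m+(i+1))^3) := by
        have := M_nat (p := p) (64*(p*m+(i+1))^3); push_cast at this ⊢; exact this
      have u : U p ((p:ℚ)*m+(i+2)) := by
        have := U_of_lt (p := p) (z := i+2) (by omega) (by omega)
        push_cast at this
        exact this.congr ((M_p.mulr (M_nat m)).cast (by ring))
      have := ((r.add (hP.mull i1)).sub (hx.mull i0)).div (u.pow 3)
      refine this.cast ?_
      have := u.ne
      rw [show p*m+(i+1)-1 = p*m+i by omega, show p*m+(i+2) = p*m+(i+1)+1 by ring]
      simp only [Dd, PD]; push_cast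
      rw [show (p:ℚ)*m+(i+1)+1 = p*m+(i+2) by ring]
      field_simp; ring

lemma coeff_blk (a : ℕ → ℚ) (F : PowerSeries ℚ) (m i : ℕ) (hi : i < p) (hp0 : p ≠ 0) :
    coeff (p*m+i) ((∑ l ∈ range p, C (a l) * X^l) * expand p hp0 F) = a i * coeff m F := by
  rw [sum_mul, map_sum, sum_eq_single i]
  · rw [mul_assoc, coeff_C_mul, coeff_X_pow_mul', if_pos (by omega), Nat.add_sub_cancel, coeff_expand_mul]
  · intro l hl hne
    have hl := mem_range.1 hl
    rw [mul_assoc, coeff_C_mul, coeff_X_pow_mul']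
    split_ifs with h
    · rw [coeff_expand_of_not_dvd, mul_zero]
      intro hd
      rcases lt_or_gt_of_ne hne with h1 | h1
      · have : p ∣ i - l := by
          rw [show p*m+i-l = p*m+(i-l) by omega] at hd
          exact (Nat.dvd_add_right (Dvd.intro _ rfl)).1 hd
        have := Nat.le_of_dvd (by omega) this; omega
      · have : p ∣ l - i := by
          have h2 : p*m + i - l + (l-i) = p*m := by omega
          have : p ∣ p*m+i-l+(l-i) := by rw [h2]; exact Dvd.intro _ rfl
          exact (Nat.dvd_add_right hd).1 this
        have := Nat.le_of_dvd (by omega) this; omega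
    · rw [mul_zero]
  · intro h; exact absurd (mem_range.2 hi) h
lemma MP_expand {r : ℕ} {F : PowerSeries ℚ} (hF : MP p r F) (hp0 : p ≠ 0) : MP p r (expand p hp0 F) := fun n => by
  rw [coeff_expand]; split_ifs
  · exact hF _
  · exact M_zero r
lemma MP_Eu' {r : ℕ} {F : PowerSeries ℚ} (hF : MP p r F) : MP p r (Eu' F) := fun n => by
  rw [Eu'_coeff]; exact (M_nat n).mull (hF n)

/-- the semi-linear structure -/
lemma phi_ex (h3 : 3 < p) (hp0 : p ≠ 0) : ∃ G g1 g2 : PowerSeries ℚ, MP p 0 G ∧ MP p 1 g1 ∧ MP p 2 g2 ∧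
    ∀ y K : PowerSeries ℚ, RecC p (fun N => coeff N y) → MP p 0 y → MP p 0 K → (∀ m, M p 3 (coeff (p*m) y - coeff m K)) →
      MP p 3 (y - (G * expand p hp0 K + g1 * expand p hp0 (Eu' K) + g2 * expand p hp0 (Eu' (Eu' K)))) := by
  have hex : ∀ i, ∃ a b d : ℚ, M p 0 a ∧ M p 0 b ∧ M p 0 d ∧ (i < p → ∀ m : ℕ, M p 3 (Dd p i m 0 - (a + p*(b*m) + p^2*(d*m^2)))) := by
    intro i
    by_cases hi : i < p
    · obtain ⟨a, b, c, d, e, g, ha, hb, hc, hd, he, hg, h⟩ := Q3_Dd i hi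
      refine ⟨a, b, d, ha, hb, hd, fun _ m => (h m 0).cast ?_⟩
      push_cast; ring
    · exact ⟨0, 0, 0, M_zero 0, M_zero 0, M_zero 0, fun h => absurd h hi⟩
  choose a b d ha hb hd h using hex
  refine ⟨∑ l ∈ range p, C (a l) * X^l, ∑ l ∈ range p, C (p*b l) * X^l, ∑ l ∈ range p, C (p^2*d l) * X^l,
    MP_sum _ _ fun l _ => (MP_C (ha l)).mulr (MP_X.pow0 l), MP_sum _ _ fun l _ => (MP_C (M_p.mulr (hb l))).mulr (MP_X.pow0 l),
    MP_sum _ _ fun l _ => (MP_C ((M_ppow 2).mulr (hd l))).mulr (MP_X.pow0 l), ?_⟩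
  intro y K hy h0 hK hk N
  have hlt : N % p < p := Nat.mod_lt _ (by omega)
  rw [← Nat.div_add_mod N p]
  generalize N/p = m
  generalize N%p = i at *
  rw [map_sub, map_add, map_add, coeff_blk _ _ _ _ hlt, coeff_blk _ _ _ _ hlt, coeff_blk _ _ _ _ hlt, Eu'_coeff, Eu'_coeff, Eu'_coeff]
  have e1 := Dd_c h3 hy h0 m i hlt
  have hD : M p 0 (Dd p i m 0) := (Q3_Dd i hlt).m0 _ _
  have e2 := hD.mull (hk m)
  have e3 := (h i hlt m).mulr (hK m)
  refine ((e1.add e2).add e3).cast ?_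
  ring

/-- multiplicativity -/
lemma phi_mul {G g1 g2 F H F1 H1 F2 H2 : PowerSeries ℚ} (h1 : MP p 1 g1) (h2 : MP p 2 g2)
    (mF : MP p 0 F) (mH : MP p 0 H) (mF1 : MP p 0 F1) (mH1 : MP p 0 H1) (mF2 : MP p 0 F2) (mH2 : MP p 0 H2) :
    MP p 3 ((G*F+g1*F1+g2*F2)*(G*H+g1*H1+g2*H2) - (G*(G*(F*H)+g1*(F1*H+F*H1)+g2*(F2*H+2*F1*H1+F*H2)) + (g1^2-2*G*g2)*(F1*H1))) := by
  have a : MP p 3 (g1*g2) := h1.m12 h2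
  have b : MP p 3 (g2*g2) := (h2.m22 h2).mono (by omega)
  refine ((a.mulr ((mF1.m0 mH2).add (mF2.m0 mH1))).add (b.mulr (mF2.m0 mH2))).cast (by ring)
end

section
variable {p : ℕ} [hp : Fact p.Prime]
open PowerSeries

noncomputable def ze4 : PowerSeries ℚ := X^2 * gF 4^3
noncomputable def frS (p : ℕ) (f : ℕ → ℚ) : PowerSeries ℚ := ∑ i ∈ range p, C (f i * 108^i) * ze4^i

lemma MP_ze4 : MP p 0 ze4 := (MP_X.pow0 2).m0 ((MP_gF (M_nat 4)).pow0 3)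
lemma MP_frS {f : ℕ → ℚ} (h : ∀ i < p, M p 0 (f i)) : MP p 0 (frS p f) :=
  MP_sum _ _ fun i hi => (MP_C ((h i (mem_range.1 hi)).m0 ((M_nat 108).pow0 i))).m0 (MP_ze4.pow0 i)

lemma frS_mul (f g : ℕ → ℚ) : frS p f * frS p g = ∑ l ∈ range (2*p), C ((∑ x ∈ HasAntidiagonal.antidiagonal l,
    if x.1 < p ∧ x.2 < p then f x.1 * g x.2 else 0) * 108^l) * ze4^l := by
  rw [frS, frS, sum_mul_sum, ← sum_product', ← sum_fiberwise_of_maps_to (t := range (2*p)) (g := fun x => x.1+x.2)]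
  · refine sum_congr rfl fun l hl => ?_
    rw [sum_mul, map_sum, sum_mul]
    have : ((range p ×ˢ range p).filter fun x => x.1+x.2 = l) = (HasAntidiagonal.antidiagonal l).filter fun x => x.1 < p ∧ x.2 < p := by
      ext x; simp only [mem_filter, mem_product, mem_range, HasAntidiagonal.mem_antidiagonal]; tauto
    rw [this, sum_filter]
    refine sum_congr rfl fun x hx => ?_
    have hx := HasAntidiagonal.mem_antidiagonal.1 hx
    split_ifs with h
    · rw [← hx, pow_add, pow_add]; simp only [map_mul]; ring
    · simp
  · intro x hx
    rw [mem_product, mem_range, mem_range] at hx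
    rw [mem_range]; omega

lemma frS_sym (h3 : 3 < p) : MP p 1 (2 * frS p fal * frS p fga - frS p fbe^2) := by
  have : 2 * frS p fal * frS p fga - frS p fbe^2 = ∑ l ∈ range (2*p), C ((∑ x ∈ HasAntidiagonal.antidiagonal l,
    if x.1 < p ∧ x.2 < p then 2*fal x.1 * fga x.2 - fbe x.1 * fbe x.2 else 0) * 108^l) * ze4^l := by
    rw [mul_assoc, pow_two, frS_mul, frS_mul, mul_sum, ← sum_sub_distrib]
    refine sum_congr rfl fun l hl => ?_
    rw [← mul_assoc, show (2:PowerSeries ℚ) = C 2 from (map_ofNat C 2).symm, ← map_mul, ← sub_mul, ← map_sub]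
    congr 2
    rw [← mul_assoc, ← sub_mul, mul_sum, ← sum_sub_distrib]
    congr 1
    refine sum_congr rfl fun x _ => ?_
    split_ifs <;> ring
  rw [this]
  exact MP_sum _ _ fun l _ => (MP_C ((fr_sym h3 l).mulr ((M_nat 108).pow0 l))).mulr (MP_ze4.pow0 l)

lemma yj_fr (h3 : 3 < p) (j : ℕ) : MP p 3 (yj p j - C (AA j) * gF 4 * ze4^(p*j) * (frS p fal + C ((p:ℚ)*j) * frS p fbe + C (((p:ℚ)*j)^2) * frS p fga)) := by
  have : yj p j - C (AA j) * gF 4 * ze4^(p*j) * (frS p fal + C ((p:ℚ)*j) * frS p fbe + C (((p:ℚ)*j)^2) * frS p fga)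
     = ∑ i ∈ range p, C (AA (p*j+i) - AA j*108^i*(fal i + (p*j:ℚ)*fbe i + (p*j:ℚ)^2*fga i)) * (gF 4 * ze4^(p*j+i)) := by
    rw [yj, frS, frS, frS, mul_sum, mul_sum, ← sum_add_distrib, ← sum_add_distrib, mul_sum, ← sum_sub_distrib]
    refine sum_congr rfl fun i _ => ?_
    have : (X:PowerSeries ℚ)^(2*(p*j+i)) * gF 4^(3*(p*j+i)+1) = gF 4 * ze4^(p*j+i) := by
      rw [ze4, mul_pow, ← pow_mul, ← pow_mul]; ring
    rw [this, pow_add]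
    simp only [map_sub, map_mul, map_add]
    ring
  rw [this]
  refine MP_sum _ _ fun i hi => (MP_C ?_).mulr ((MP_gF (M_nat 4)).m0 (MP_ze4.pow0 _))
  have hi := mem_range.1 hi
  obtain ⟨a, b, c⟩ := M_fr h3 i hi
  have pj : M p 0 ((p:ℚ)*j) := by have := M_nat (p := p) (p*j); push_cast at this; exact this
  have e := (AA_p h3 j).mulr (((M_nat 108).pow0 i).m0 ((a.add (pj.m0 b)).add ((pj.pow0 2).m0 c)))
  exact ((AA_fr h3 j i hi).add e).cast (by push_cast; ring)

lemma yj_sym (h3 : 3 < p) : MP p 3 (144 * yj p 0 * yj p 2 - 540 * yj p 1^2) := by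
  have e0 := yj_fr h3 0
  have e1 := yj_fr h3 1
  have e2 := yj_fr h3 2
  have hs := frS_sym h3
  have ma : MP p 0 (frS p fal) := MP_frS fun i hi => (M_fr h3 i hi).1
  have mb : MP p 0 (frS p fbe) := MP_frS fun i hi => (M_fr h3 i hi).2.1
  have mc : MP p 0 (frS p fga) := MP_frS fun i hi => (M_fr h3 i hi).2.2
  generalize frS p fal = a at *
  generalize frS p fbe = b at *
  generalize frS p fga = c at *
  rw [AA_0] at e0
  rw [AA_1] at e1
  rw [AA_2] at e2
  have n0 := MP_yj (p := p) 0
  have n1 := MP_yj (p := p) 1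
  have n2 := MP_yj (p := p) 2
  have mz := MP_ze4 (p := p)
  have mg : MP p 0 (gF 4) := MP_gF (M_nat 4)
  have hP : MP p 1 (C (p:ℚ)) := MP_C M_p
  have hP0 : MP p 0 (C (p:ℚ)) := MP_C (M_nat p)
  have q0 : MP p 0 (gF 4 * a) := mg.m0 ma
  have d0 : MP p 3 (yj p 0 - gF 4 * a) := e0.cast (by simp)
  have h2 : (C (2:ℚ)) = (2:PowerSeries ℚ) := map_ofNat C 2
  have h540 : (C (540:ℚ)) = (540:PowerSeries ℚ) := map_ofNat C 540
  have h12 : (C (12:ℚ)) = (12:PowerSeries ℚ) := map_ofNat C 12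
  have d1 : MP p 3 (yj p 1 - 12 * gF 4 * ze4^p * (a + C (p:ℚ) * b + C (p:ℚ)^2 * c)) := e1.cast (by simp [h12])
  have d2 : MP p 3 (yj p 2 - 540 * gF 4 * (ze4^p)^2 * (a + 2 * C (p:ℚ) * b + 4 * C (p:ℚ)^2 * c)) := e2.cast (by
    simp only [Nat.cast_ofNat, map_mul, map_pow, h540, h2]; ring)
  have q1 : MP p 0 (12 * gF 4 * ze4^p * (a + C (p:ℚ) * b + C (p:ℚ)^2 * c)) := d1.sy.of0 n1 |> fun h => h
  have q2 : MP p 0 (540 * gF 4 * (ze4^p)^2 * (a + 2 * C (p:ℚ) * b + 4 * C (p:ℚ)^2 * c)) := d2.sy.of0 n2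
  have A := (d0.cmul d2 n0 q2)
  have B := (d1.cmul d1 n1 q1)
  have hp3 : MP p 3 (C (p:ℚ)^3) := (hP.mul (hP.mul hP)).cast (by ring)
  have hps : MP p 3 (C (p:ℚ)^2*(2*a*c-b^2)) := ((hP.mul hP).mul hs).cast (by ring)
  have hK : MP p 0 (gF 4^2*(ze4^p)^2) := (mg.pow0 2).m0 ((mz.pow0 p).pow0 2)
  have A' := (MPcst (p := p) 144).mull A
  have B' := (MPcst (p := p) 540).mull B
  have D := ((MPcst (p := p) 77760).m0 hK).mull hps
  have D' := ((MPcst (p := p) 77760).m0 hK).mull (hp3.mulr (((MPcst 2).m0 (mb.m0 mc)).add (hP0.m0 (mc.m0 mc))))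
  exact (((A'.sub B').add D).sub D').cast (by ring)
end

section
variable {p : ℕ} [hp : Fact p.Prime]
open PowerSeries

lemma phi_str (h5 : 5 < p) (hp0 : p ≠ 0) : ∃ (G : PowerSeries ℚ) (Ph : PowerSeries ℚ → PowerSeries ℚ), MP p 0 G ∧
    (∀ F H, Ph (F+H) = Ph F + Ph H) ∧ (∀ c F, Ph (C c * F) = C c * Ph F) ∧
    (∀ F, MP p 0 F → MP p 0 (Ph F)) ∧ (∀ F, MP p 0 F → MP p 1 (Ph F - G * expand p hp0 F)) ∧
    (∀ F H, MP p 0 F → MP p 0 H → MP p 3 (Ph F * Ph H - G * Ph (F*H))) ∧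
    (∀ y K : PowerSeries ℚ, RecC p (fun N => coeff N y) → MP p 0 y → MP p 0 K → (∀ m, M p 3 (coeff (p*m) y - coeff m K)) →
      MP p 3 (y - Ph K)) := by
  have h3 : 3 < p := by omega
  obtain ⟨G, g1, g2, mG, m1, m2, hy⟩ := phi_ex (p := p) h3 hp0
  have n1 : MP p 0 g1 := m1.mono (by omega)
  have n2 : MP p 0 g2 := m2.mono (by omega)
  have mP : ∀ F, MP p 0 F → MP p 0 (G * expand p hp0 F + g1 * expand p hp0 (Eu' F) + g2 * expand p hp0 (Eu' (Eu' F))) := fun F hF =>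
    ((mG.m0 (MP_expand hF _)).add (n1.m0 (MP_expand (MP_Eu' hF) _))).add (n2.m0 (MP_expand (MP_Eu' (MP_Eu' hF)) _))
  -- semi-multiplicativity with defect
  have mul : ∀ F H, MP p 0 F → MP p 0 H → MP p 3 ((G * expand p hp0 F + g1 * expand p hp0 (Eu' F) + g2 * expand p hp0 (Eu' (Eu' F))) * (G * expand p hp0 H + g1 * expand p hp0 (Eu' H) + g2 * expand p hp0 (Eu' (Eu' H)))
      - (G * (G * expand p hp0 (F*H) + g1 * expand p hp0 (Eu' (F*H)) + g2 * expand p hp0 (Eu' (Eu' (F*H)))) + (g1^2-2*G*g2) * (expand p hp0 (Eu' F) * expand p hp0 (Eu' H)))) := by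
    intro F H hF hH
    refine (phi_mul (G := G) m1 m2 (MP_expand hF hp0) (MP_expand hH hp0) (MP_expand (MP_Eu' hF) hp0) (MP_expand (MP_Eu' hH) hp0)
      (MP_expand (MP_Eu' (MP_Eu' hF)) hp0) (MP_expand (MP_Eu' (MP_Eu' hH)) hp0)).cast ?_
    simp only [Eu'_mul, Eu'_add, map_mul, map_add]; ring
  have key : MP p 3 (g1^2-2*G*g2) := by
    have mg : MP p 0 (gF 4) := MP_gF (M_nat 4)
    have mz := MP_ze4 (p := p)
    have h540 : (C (540:ℚ)) = (540:PowerSeries ℚ) := map_ofNat C 540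
    have h12 : (C (12:ℚ)) = (12:PowerSeries ℚ) := map_ofNat C 12
    have y0 := hy (yj p 0) (gF 4) (RecC_yj h3 0) (MP_yj 0) mg (fun m => (yj_p h3 0 m).cast (by rw [AA_0]; simp))
    have y1 := hy (yj p 1) (12*(ze4*gF 4)) (RecC_yj h3 1) (MP_yj 1) ((MPcst 12).m0 (mz.m0 mg)) (fun m => (yj_p h3 1 m).cast (by
      rw [AA_1, h12, ze4]; congr 2; ring))
    have y2 := hy (yj p 2) (540*(ze4^2*gF 4)) (RecC_yj h3 2) (MP_yj 2) ((MPcst 540).m0 ((mz.pow0 2).m0 mg)) (fun m => (yj_p h3 2 m).cast (by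
      rw [AA_2, h540, ze4]; congr 2; ring))
    have l02 := mul (gF 4) (540*(ze4^2*gF 4)) mg ((MPcst 540).m0 ((mz.pow0 2).m0 mg))
    have l11 := mul (12*(ze4*gF 4)) (12*(ze4*gF 4)) ((MPcst 12).m0 (mz.m0 mg)) ((MPcst 12).m0 (mz.m0 mg))
    have c02 := y0.cmul y2 (MP_yj 0) (mP _ ((MPcst 540).m0 ((mz.pow0 2).m0 mg)))
    have c11 := y1.cmul y1 (MP_yj 1) (mP _ ((MPcst 12).m0 (mz.m0 mg)))
    have z02 := (MPcst (p := p) 144).mull (c02.tr l02)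
    have z11 := (MPcst (p := p) 540).mull (c11.tr l11)
    have hs := yj_sym h3
    have tot := (z02.sub z11).sub hs
    have hE0 : Eu' (540:PowerSeries ℚ) = 0 := Eu'_ofNat 540
    have hE1 : Eu' (12:PowerSeries ℚ) = 0 := Eu'_ofNat 12
    have e144 : (144:PowerSeries ℚ) * (gF 4 * (540*(ze4^2*gF 4))) = 540*((12*(ze4*gF 4))*(12*(ze4*gF 4))) := by ring
    have eD : (144:PowerSeries ℚ) * (Eu' (gF 4) * Eu' (540*(ze4^2*gF 4))) - 540*(Eu' (12*(ze4*gF 4)) * Eu' (12*(ze4*gF 4))) = -(77760*(Eu' ze4 * gF 4)^2) := by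
      rw [Eu'_mul 540, hE0, Eu'_mul 12, hE1, Eu'_mul, Eu'_mul, Eu'_pow2]; ring
    have x144 : (144:PowerSeries ℚ) = expand p hp0 144 := (map_ofNat (expand p hp0) 144).symm
    have x540 : (540:PowerSeries ℚ) = expand p hp0 540 := (map_ofNat (expand p hp0) 540).symm
    have f1 : (144:PowerSeries ℚ) * (G * expand p hp0 (gF 4 * (540*(ze4^2*gF 4))) + g1 * expand p hp0 (Eu' (gF 4 * (540*(ze4^2*gF 4)))) + g2 * expand p hp0 (Eu' (Eu' (gF 4 * (540*(ze4^2*gF 4))))))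
        = 540 * (G * expand p hp0 ((12*(ze4*gF 4))*(12*(ze4*gF 4))) + g1 * expand p hp0 (Eu' ((12*(ze4*gF 4))*(12*(ze4*gF 4)))) + g2 * expand p hp0 (Eu' (Eu' ((12*(ze4*gF 4))*(12*(ze4*gF 4)))))) := by
      have a1 : ∀ F : PowerSeries ℚ, Eu' (144*F) = 144*Eu' F := fun F => by rw [Eu'_mul, show Eu' (144:PowerSeries ℚ) = 0 from Eu'_ofNat 144]; ring
      have a2 : ∀ F : PowerSeries ℚ, Eu' (540*F) = 540*Eu' F := fun F => by rw [Eu'_mul, show Eu' (540:PowerSeries ℚ) = 0 from Eu'_ofNat 540]; ring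
      have b1 : ∀ F : PowerSeries ℚ, expand p hp0 (144*F) = 144*expand p hp0 F := fun F => by rw [map_mul, ← x144]
      have b2 : ∀ F : PowerSeries ℚ, expand p hp0 (540*F) = 540*expand p hp0 F := fun F => by rw [map_mul, ← x540]
      have t0 := congrArg (expand p hp0) e144
      have t1 := congrArg (fun F => expand p hp0 (Eu' F)) e144
      have t2 := congrArg (fun F => expand p hp0 (Eu' (Eu' F))) e144
      simp only [a1, a2, b1, b2] at t0 t1 t2
      linear_combination G*t0 + g1*t1 + g2*t2
    have f2 := congrArg (expand p hp0) eD
    simp only [map_sub, map_neg, map_mul (expand p hp0) 144, map_mul (expand p hp0) 540, ← x144, ← x540, map_mul (expand p hp0) (Eu' _)] at f2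
    have x7 : expand p hp0 (77760*(Eu' ze4 * gF 4)^2) = 77760 * expand p hp0 (Eu' ze4 * gF 4)^2 := by
      rw [map_mul, map_pow, map_ofNat]
    rw [x7] at f2
    have fin : MP p 3 (C (77760:ℚ) * (expand p hp0 (Eu' ze4 * gF 4) * (expand p hp0 (Eu' ze4 * gF 4) * (g1^2-2*G*g2)))) := by
      refine tot.cast ?_
      rw [show C (77760:ℚ) = (77760:PowerSeries ℚ) from map_ofNat C 77760]
      linear_combination G*f1 + (g1^2-2*G*g2)*f2
    have uc : U p (77760:ℚ) := by
      have a2 : U p (2:ℚ) := by have := U_of_lt (p := p) (z := 2) (by omega) (by omega); exact_mod_cast this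
      have a3 : U p (3:ℚ) := by have := U_of_lt (p := p) (z := 3) (by omega) (by omega); exact_mod_cast this
      have a5 : U p (5:ℚ) := by have := U_of_lt (p := p) (z := 5) (by omega) (by omega); exact_mod_cast this
      have := ((a2.pow 6).mul (a3.pow 5)).mul a5
      norm_num at this; exact this
    have mE : MP p 0 (expand p hp0 (Eu' ze4 * gF 4)) := MP_expand ((MP_Eu' mz).m0 mg) _
    have nE : ¬ MP p 1 (expand p hp0 (Eu' ze4 * gF 4)) := by
      intro h
      have h := h (p*2)
      have cz : ∀ k, coeff k ze4 = if 2 ≤ k then coeff (k-2) (gF 4^3) else 0 := fun k => by rw [ze4, coeff_X_pow_mul']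
      have g0 : coeff 0 (gF 4) = 1 := by rw [gF, coeff_mk, pow_zero]
      rw [coeff_expand_mul, coeff_mul, show HasAntidiagonal.antidiagonal 2 = {(0,2),(1,1),(2,0)} from rfl] at h
      simp only [sum_insert (by decide : ((0:ℕ),2) ∉ ({(1,1),(2,0)} : Finset (ℕ×ℕ))), sum_insert (by decide : ((1:ℕ),1) ∉ ({(2,0)} : Finset (ℕ×ℕ))), sum_singleton, Eu'_coeff, cz, g0] at h
      rw [gF_pow] at h
      norm_num at h
      exact not_U_of_M h (by have := U_of_lt (p := p) (z := 2) (by omega) (by omega); exact_mod_cast this)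
    have mk : MP p 0 (g1^2-2*G*g2) := (n1.pow0 2).sub (((MPcst 2).m0 mG).m0 n2)
    refine MP.cancel mE nE mk (MP.cancel mE nE (mE.m0 mk) ?_)
    intro n
    have := fin n
    rw [coeff_C_mul] at this
    exact uc.cancel this
  refine ⟨G, fun F => G * expand p hp0 F + g1 * expand p hp0 (Eu' F) + g2 * expand p hp0 (Eu' (Eu' F)), mG, ?_, ?_, mP, ?_, ?_, hy⟩
  · intro F H; simp only [Eu'_add, map_add]; ring
  · intro c F
    have : ∀ F, Eu' (C c * F) = C c * Eu' F := fun F => by rw [Eu'_mul, Eu'_C]; ring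
    have x : ∀ F, expand p hp0 (C c * F) = C c * expand p hp0 F := fun F => by rw [map_mul, expand_C]
    simp only [this, x]; ring
  · intro F hF
    exact ((m1.mulr (MP_expand (MP_Eu' hF) hp0)).add ((m2.mono (by omega)).mulr (MP_expand (MP_Eu' (MP_Eu' hF)) hp0))).cast (by ring)
  · intro F H hF hH
    exact ((mul F H hF hH).add (key.mulr ((MP_expand (MP_Eu' hF) hp0).m0 (MP_expand (MP_Eu' hH) hp0)))).cast (by ring)
end

section
variable {p : ℕ} [hp : Fact p.Prime]
open PowerSeries

lemma gF_id : 36 * (12*(X^2*gF 4^4)) * gF 16^3 = gF 4 * (gF 16 - gF 4)^2 * (4*gF 16 - gF 4) := by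
  have a := gF_mul 4
  have b := gF_mul 16
  rw [show C (4:ℚ) = (4:PowerSeries ℚ) from map_ofNat C 4] at a
  rw [show C (16:ℚ) = (16:PowerSeries ℚ) from map_ofNat C 16] at b
  generalize gF 4 = A at *
  generalize gF 16 = B at *
  have h1 : B - A = 12*X*(A*B) := by linear_combination (-B)*a + A*b
  have h2 : 4*B - A = 3*(A*B) := by linear_combination (-4*B)*a + A*b
  rw [h1, h2]; ring

lemma star (h5 : 5 < p) {n : ℕ} (hn : p = 2*n+1) :
    MP p 3 (36 * yj p 1 * y2 p^3 - yj p 0 * (y2 p - yj p 0)^2 * (4*y2 p - yj p 0)) ∧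
    MP p 1 (yj p 0 * (1 - 4*X^p) - y2 p * (1 - 16*X^p)) := by
  have h3 : 3 < p := by omega
  have hp0 : p ≠ 0 := by omega
  obtain ⟨G, Ph, mG, add, smul, m0, m1, mul, hy⟩ := phi_str h5 hp0
  have mg : MP p 0 (gF 4) := MP_gF (M_nat 4)
  have mb : MP p 0 (gF 16) := MP_gF (M_nat 16)
  have h12 : (C (12:ℚ)) = (12:PowerSeries ℚ) := map_ofNat C 12
  have y0 := hy (yj p 0) (gF 4) (RecC_yj h3 0) (MP_yj 0) mg (fun m => (yj_p h3 0 m).cast (by rw [AA_0]; simp))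
  have mF : MP p 0 (12*(X^2*gF 4^4)) := (MPcst 12).m0 ((MP_X.pow0 2).m0 (mg.pow0 4))
  have y1 := hy (yj p 1) (12*(X^2*gF 4^4)) (RecC_yj h3 1) (MP_yj 1) mF (fun m => (yj_p h3 1 m).cast (by
      rw [AA_1, h12]))
  have yb := hy (y2 p) (gF 16) (RecC_y2 h3 hn) MP_y2 mb (fun m => y2_p h3 m)
  constructor
  · have mul4 : ∀ A B D E, MP p 0 A → MP p 0 B → MP p 0 D → MP p 0 E → MP p 3 (Ph A * Ph B * (Ph D * Ph E) - G^3 * Ph (A*B*(D*E))) := by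
      intro A B D E hA hB hD hE
      have a := mul A B hA hB
      have b := mul D E hD hE
      have c := mul (A*B) (D*E) (hA.m0 hB) (hD.m0 hE)
      have d := a.cmul b ((m0 A hA).m0 (m0 B hB)) (mG.m0 (m0 _ (hD.m0 hE)))
      exact (d.add ((mG.m0 mG).mull c)).cast (by ring)
    have sub : ∀ F H, Ph (F-H) = Ph F - Ph H := by
      intro F H
      have := add (F-H) H
      rw [sub_add_cancel] at this
      rw [this]; ring
    have s4 : ∀ F, Ph (4*F) = 4*Ph F := fun F => by
      have := smul 4 F; rwa [show C (4:ℚ) = (4:PowerSeries ℚ) from map_ofNat C 4] at this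
    have s36 : ∀ F, Ph (36*F) = 36*Ph F := fun F => by
      have := smul 36 F; rwa [show C (36:ℚ) = (36:PowerSeries ℚ) from map_ofNat C 36] at this
    have m4 : MP p 0 (4*gF 16 - gF 4) := ((MPcst 4).m0 mb).sub mg
    have L := mul4 (12*(X^2*gF 4^4)) (gF 16) (gF 16) (gF 16) mF mb mb mb
    have R := mul4 (gF 4) (gF 16 - gF 4) (gF 16 - gF 4) (4*gF 16 - gF 4) mg (mb.sub mg) (mb.sub mg) m4
    rw [show gF 4 * (gF 16 - gF 4) * ((gF 16 - gF 4) * (4*gF 16 - gF 4)) = 36*(12*(X^2*gF 4^4) * gF 16*(gF 16*gF 16)) by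
      have := gF_id; linear_combination -this, s36] at R
    have LR := ((MPcst (p := p) 36).mull L).sub R
    have hL : MP p 3 (36 * yj p 1 * y2 p^3 - 36 * Ph (12*(X^2*gF 4^4)) * Ph (gF 16)^3) :=
      (((MP_zero 3).cast (sub_self (36:PowerSeries ℚ))).cmul y1 (MPcst 36) (m0 _ mF)).cmul (yb.cpow MP_y2 (m0 _ mb) 3) ((MPcst 36).m0 (MP_yj 1)) ((m0 _ mb).pow0 3)
    have dB : MP p 3 ((y2 p - yj p 0) - (Ph (gF 16) - Ph (gF 4))) := (yb.sub y0).cast (by ring)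
    have d4 : MP p 3 ((4*y2 p - yj p 0) - (4*Ph (gF 16) - Ph (gF 4))) := (((MPcst 4).mull yb).sub y0).cast (by ring)
    have nB : MP p 0 (Ph (gF 16) - Ph (gF 4)) := (m0 _ mb).sub (m0 _ mg)
    have nb' : MP p 0 (y2 p - yj p 0) := MP_y2.sub (MP_yj 0)
    have hR := (y0.cmul (dB.cpow nb' nB 2) (MP_yj 0) (nB.pow0 2)).cmul d4 ((MP_yj 0).m0 (nb'.pow0 2)) (((MPcst 4).m0 (m0 _ mb)).sub (m0 _ mg))
    rw [sub, sub, s4] at LR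
    exact ((LR.add hL).sub hR).cast (by ring)
  · have e0 := (y0.mono (show 1 ≤ 3 by omega)).tr (m1 _ mg)
    have e2 := (yb.mono (show 1 ≤ 3 by omega)).tr (m1 _ mb)
    have a := congrArg (expand p hp0) (gF_mul 4)
    have b := congrArg (expand p hp0) (gF_mul 16)
    rw [show C (4:ℚ) = (4:PowerSeries ℚ) from map_ofNat C 4] at a
    rw [show C (16:ℚ) = (16:PowerSeries ℚ) from map_ofNat C 16] at b
    simp only [map_mul, map_sub, map_one, expand_X, map_ofNat] at a b
    have mX := (MP_X (p := p)).pow0 p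
    have t := (e0.mulr (MP_one.sub ((MPcst 4).m0 mX))).sub (e2.mulr (MP_one.sub ((MPcst 16).m0 mX)))
    exact t.cast (by linear_combination G*a - G*b)
end

noncomputable def Tz (p j : ℕ) (z : PowerSeries ℚ) : PowerSeries ℚ := ∑ i ∈ range p, PowerSeries.C (AA (p*j+i)) * z^(p*j+i)
noncomputable def pN (e j : ℕ) : Polynomial ℚ := ∑ i ∈ range (e+1), Polynomial.C (AA ((e+1)*j+i)) * (Polynomial.X^(2*((e+1)*j+i)) * (1-4*Polynomial.X)^(3*(e-i)))
noncomputable def pN2 (e : ℕ) : Polynomial ℚ := ∑ k ∈ range (e+1), Polynomial.C (AA k*(-1)^k) * (Polynomial.X^k * (1-16*Polynomial.X)^(3*(e-k)))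

section
variable {p : ℕ} [hp : Fact p.Prime]

lemma MP_aeval {r : ℕ} {P : Polynomial ℚ} {u : PowerSeries ℚ} (h : MP p r (P : PowerSeries ℚ)) (hu : MP p 0 u) : MP p r (Polynomial.aeval u P) := by
  rw [Polynomial.aeval_eq_sum_range]
  refine MP_sum _ _ fun i _ => ?_
  have := h i
  rw [Polynomial.coeff_coe] at this
  exact ((MP_C this).mulr (hu.pow0 i)).cast (by rw [PowerSeries.smul_eq_C_mul])

lemma MP_Tz (j : ℕ) {z : PowerSeries ℚ} (hz : MP p 0 z) : MP p 0 (Tz p j z) := MP_sum _ _ fun i _ => (MP_C (M_AA _)).m0 (hz.pow0 _)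

lemma powc {R : Type*} [CommRing R] {f g : R} (h : f * g = 1) (a b c : ℕ) (e : c = a + b) : g^b * f^c = f^a := by
  rw [e, pow_add, mul_comm (g^b), mul_assoc, ← mul_pow, h, one_pow, mul_one]

lemma yj_pN (e j : ℕ) : yj (e+1) j * (1-4*PowerSeries.X)^(3*((e+1)*j)+3*e+1) = ((pN e j : Polynomial ℚ) : PowerSeries ℚ) := by
  have a := gF_mul 4
  rw [show PowerSeries.C (4:ℚ) = (4:PowerSeries ℚ) from map_ofNat _ 4, mul_comm] at a
  rw [yj, sum_mul, pN]
  have : (((∑ i ∈ range (e+1), Polynomial.C (AA ((e+1)*j+i)) * (Polynomial.X^(2*((e+1)*j+i)) * (1-4*Polynomial.X)^(3*(e-i))) : Polynomial ℚ)) : PowerSeries ℚ)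
     = ∑ i ∈ range (e+1), PowerSeries.C (AA ((e+1)*j+i)) * (PowerSeries.X^(2*((e+1)*j+i)) * (1-4*PowerSeries.X)^(3*(e-i))) := by
    rw [← Polynomial.coeToPowerSeries.ringHom_apply]
    simp only [map_sum, map_mul, map_pow, map_sub, map_one, map_ofNat, Polynomial.coeToPowerSeries.ringHom_apply, Polynomial.coe_C, Polynomial.coe_X]
  rw [this]
  refine sum_congr rfl fun i hi => ?_
  have hi := mem_range.1 hi
  rw [mul_assoc, mul_assoc, powc a (3*(e-i)) _ _ (by omega)]

lemma y2_pN (e : ℕ) : y2 (e+1) * (1-16*PowerSeries.X)^(3*e+1) = ((pN2 e : Polynomial ℚ) : PowerSeries ℚ) := by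
  have a := gF_mul 16
  rw [show PowerSeries.C (16:ℚ) = (16:PowerSeries ℚ) from map_ofNat _ 16, mul_comm] at a
  rw [y2, sum_mul, pN2]
  have : (((∑ k ∈ range (e+1), Polynomial.C (AA k*(-1)^k) * (Polynomial.X^k * (1-16*Polynomial.X)^(3*(e-k))) : Polynomial ℚ)) : PowerSeries ℚ)
     = ∑ k ∈ range (e+1), PowerSeries.C (AA k*(-1)^k) * (PowerSeries.X^k * (1-16*PowerSeries.X)^(3*(e-k))) := by
    rw [← Polynomial.coeToPowerSeries.ringHom_apply]
    simp only [map_sum, map_mul, map_pow, map_sub, map_one, map_ofNat, Polynomial.coeToPowerSeries.ringHom_apply, Polynomial.coe_C, Polynomial.coe_X]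
  rw [this]
  refine sum_congr rfl fun i hi => ?_
  have hi := mem_range.1 hi
  rw [mul_assoc, mul_assoc, powc a (3*(e-i)) _ _ (by omega)]

lemma aeval_C' (u : PowerSeries ℚ) (c : ℚ) : Polynomial.aeval u (Polynomial.C c) = PowerSeries.C c := by
  rw [Polynomial.aeval_C]; rfl

lemma aeval_pN (e j : ℕ) {u iq : PowerSeries ℚ} (hq : (1-4*u)*iq = 1) :
    Polynomial.aeval u (pN e j) = (1-4*u)^(3*((e+1)*j)+3*e) * Tz (e+1) j (u^2*iq^3) := by
  rw [pN, Tz, mul_sum, map_sum]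
  refine sum_congr rfl fun i hi => ?_
  have hi := mem_range.1 hi
  simp only [map_mul, aeval_C', map_pow, map_sub, map_one, map_ofNat, Polynomial.aeval_X]
  rw [← powc hq (3*(e-i)) (3*((e+1)*j+i)) (3*((e+1)*j)+3*e) (by omega), mul_pow (u^2), ← pow_mul, ← pow_mul]
  ring

lemma aeval_pN2 (e : ℕ) {u ir : PowerSeries ℚ} (hr : (1-16*u)*ir = 1) :
    Polynomial.aeval u (pN2 e) = (1-16*u)^(3*e) * Tz (e+1) 0 (-u*ir^3) := by
  rw [pN2, Tz, mul_sum, map_sum]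
  refine sum_congr rfl fun i hi => ?_
  have hi := mem_range.1 hi
  simp only [map_mul, aeval_C', map_pow, map_sub, map_one, map_ofNat, Polynomial.aeval_X, mul_zero, zero_add, map_neg]
  rw [← powc hr (3*(e-i)) (3*i) (3*e) (by omega), mul_pow (-u), ← pow_mul, neg_pow u]
  ring

lemma starS (h5 : 5 < p) {n : ℕ} (hn : p = 2*n+1) {u iq ir T0 T1 Y : PowerSeries ℚ} (mu : MP p 0 u) (mq : MP p 0 iq) (mr : MP p 0 ir)
    (hq : (1-4*u)*iq = 1) (hr : (1-16*u)*ir = 1) (e0 : T0 = Tz p 0 (u^2*iq^3)) (e1 : T1 = Tz p 1 (u^2*iq^3)) (e2 : Y = (1-4*u)*ir*Tz p 0 (-u*ir^3)) :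
    MP p 3 (36*T1*Y^3 - T0*(Y-T0)^2*(4*Y-T0)) ∧ MP p 1 (T0*(1-4*u^p) - Y*(1-16*u^p)) := by
  obtain ⟨s1, s2⟩ := star h5 hn
  obtain ⟨e, he⟩ : ∃ e, p = e+1 := ⟨p-1, by omega⟩
  have hn0 := yj_pN e 0
  have hn1 := yj_pN e 1
  have hn2 := y2_pN e
  have a0 := aeval_pN e 0 hq
  have a1 := aeval_pN e 1 hq
  have a2 := aeval_pN2 e hr
  rw [← he] at hn0 hn1 hn2 a0 a1 a2
  rw [← e0] at a0
  rw [← e1] at a1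
  have mX := MP_X (p := p)
  have mqX : MP p 0 (1-4*PowerSeries.X) := MP_one.sub ((MPcst 4).m0 mX)
  have mrX : MP p 0 (1-16*PowerSeries.X) := MP_one.sub ((MPcst 16).m0 mX)
  have ev : 3*(p*1)+3*e+1 = 6*e+4 := by omega
  have ev' : 3*(p*1)+3*e = 6*e+3 := by omega
  rw [ev] at hn1
  rw [ev'] at a1
  simp only [mul_zero, zero_add] at hn0 a0
  constructor
  · have P : MP p 3 ((((36 * pN e 1 * pN2 e^3 * (1-4*Polynomial.X)^(6*e) - pN e 0 * (pN2 e * (1-4*Polynomial.X)^(3*e+1) - pN e 0 * (1-16*Polynomial.X)^(3*e+1))^2 * (4 * pN2 e * (1-4*Polynomial.X)^(3*e+1) - pN e 0 * (1-16*Polynomial.X)^(3*e+1))) : Polynomial ℚ) : PowerSeries ℚ)) := by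
      refine (s1.mulr ((mqX.pow0 (12*e+4)).m0 (mrX.pow0 (9*e+3)))).cast ?_
      rw [← Polynomial.coeToPowerSeries.ringHom_apply]
      simp only [map_mul, map_pow, map_sub, map_one, map_ofNat, Polynomial.coeToPowerSeries.ringHom_apply, Polynomial.coe_X]
      rw [← hn0, ← hn1, ← hn2]
      ring
    have := MP_aeval P mu
    simp only [map_mul, map_pow, map_sub, map_one, map_ofNat, Polynomial.aeval_X, a0, a1, a2] at this
    have := this.mulr ((mq.pow0 (12*e)).m0 (mr.pow0 (9*e+3)))
    refine this.cast ?_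
    have hY : (1-16*u) * Y = (1-4*u)*Tz p 0 (-u*ir^3) := by rw [e2]; linear_combination (1-4*u)*Tz p 0 (-u*ir^3)*hr
    have hY3 : (1-16*u)^3 * Y^3 = (1-4*u)^3*Tz p 0 (-u*ir^3)^3 := by rw [← mul_pow, hY, mul_pow]
    generalize Tz p 0 (-u*ir^3) = T2 at *
    generalize 1-4*u = q at *
    generalize 1-16*u = r at *
    have q1 : q^(12*e)*iq^(12*e) = 1 := by rw [← mul_pow, hq, one_pow]
    have r1 : r^(9*e+3)*ir^(9*e+3) = 1 := by rw [← mul_pow, hr, one_pow]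
    have f1 : 36 * (q^(6*e+3)*T1) * (r^(3*e)*T2)^3 * q^(6*e) = 36*T1*Y^3 * (q^(12*e)*r^(9*e+3)) := by
      calc _ = 36*T1*(q^3*T2^3)*q^(12*e)*r^(9*e) := by ring
        _ = _ := by rw [← hY3]; ring
    have f2 : r^(3*e)*T2*q^(3*e+1) = r^(3*e+1)*q^(3*e)*Y := by
      calc _ = r^(3*e)*q^(3*e)*(q*T2) := by ring
        _ = _ := by rw [← hY]; ring
    have f3 : 4*(r^(3*e)*T2)*q^(3*e+1) = 4*(r^(3*e+1)*q^(3*e)*Y) := by rw [← f2]; ring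
    rw [f1, f2, f3]
    calc _ = (36*T1*Y^3 - T0*(Y-T0)^2*(4*Y-T0)) * ((q^(12*e)*iq^(12*e))*(r^(9*e+3)*ir^(9*e+3))) := by rw [q1, r1]; ring
      _ = _ := by ring
  · have P : MP p 1 ((((pN e 0 * (1-16*Polynomial.X)^(3*e+1) * (1-4*Polynomial.X^p) - pN2 e * (1-4*Polynomial.X)^(3*e+1) * (1-16*Polynomial.X^p)) : Polynomial ℚ) : PowerSeries ℚ)) := by
      refine (s2.mulr ((mqX.pow0 (3*e+1)).m0 (mrX.pow0 (3*e+1)))).cast ?_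
      rw [← Polynomial.coeToPowerSeries.ringHom_apply]
      simp only [map_mul, map_pow, map_sub, map_one, map_ofNat, Polynomial.coeToPowerSeries.ringHom_apply, Polynomial.coe_X]
      rw [← hn0, ← hn2]
      ring
    have := MP_aeval P mu
    simp only [map_mul, map_pow, map_sub, map_one, map_ofNat, Polynomial.aeval_X, a0, a1, a2] at this
    have := this.mulr ((mq.pow0 (3*e)).m0 (mr.pow0 (3*e+1)))
    refine this.cast ?_
    have hY : (1-16*u) * Y = (1-4*u)*Tz p 0 (-u*ir^3) := by rw [e2]; linear_combination (1-4*u)*Tz p 0 (-u*ir^3)*hr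
    generalize Tz p 0 (-u*ir^3) = T2 at *
    generalize hqq : 1-4*u = q at *
    generalize hrr : 1-16*u = r at *
    have q1 : q^(3*e)*iq^(3*e) = 1 := by rw [← mul_pow, hq, one_pow]
    have r1 : r^(3*e+1)*ir^(3*e+1) = 1 := by rw [← mul_pow, hr, one_pow]
    have f2 : r^(3*e)*T2*q^(3*e+1) = r^(3*e+1)*q^(3*e)*Y := by
      calc _ = r^(3*e)*q^(3*e)*(q*T2) := by ring
        _ = _ := by rw [← hY]; ring
    rw [f2]
    calc _ = (T0*(1-4*u^p) - Y*(1-16*u^p)) * ((q^(3*e)*iq^(3*e))*(r^(3*e+1)*ir^(3*e+1))) := by rw [q1, r1]; ring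
      _ = _ := by ring
end

def Szz (p i : ℕ) (z : ℚ) : ℚ := ∑ k ∈ range p, (k:ℚ)^i * AA k * z^k
def J2 (f : PowerSeries ℚ) (a b c : ℚ) : Prop := PowerSeries.coeff 0 f = a ∧ PowerSeries.coeff 1 f = b ∧ PowerSeries.coeff 2 f = c

section
variable {p : ℕ} [hp : Fact p.Prime]
open PowerSeries

lemma co1 (f g : PowerSeries ℚ) : coeff 1 (f*g) = coeff 0 f * coeff 1 g + coeff 1 f * coeff 0 g := by
  rw [coeff_mul, show HasAntidiagonal.antidiagonal 1 = {(0,1),(1,0)} from rfl,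
    sum_insert (by decide : ((0:ℕ),1) ∉ ({(1,0)} : Finset (ℕ×ℕ))), sum_singleton]
lemma co2 (f g : PowerSeries ℚ) : coeff 2 (f*g) = coeff 0 f * coeff 2 g + coeff 1 f * coeff 1 g + coeff 2 f * coeff 0 g := by
  rw [coeff_mul, show HasAntidiagonal.antidiagonal 2 = {(0,2),(1,1),(2,0)} from rfl,
    sum_insert (by decide : ((0:ℕ),2) ∉ ({(1,1),(2,0)} : Finset (ℕ×ℕ))), sum_insert (by decide : ((1:ℕ),1) ∉ ({(2,0)} : Finset (ℕ×ℕ))), sum_singleton]; ring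
lemma co0 (f g : PowerSeries ℚ) : coeff 0 (f*g) = coeff 0 f * coeff 0 g := by simp
lemma J2.mul {f g : PowerSeries ℚ} {a b c a' b' c' : ℚ} (h : J2 f a b c) (h' : J2 g a' b' c') : J2 (f*g) (a*a') (a*b'+b*a') (a*c'+b*b'+c*a') := by
  obtain ⟨rfl, rfl, rfl⟩ := h
  obtain ⟨rfl, rfl, rfl⟩ := h'
  exact ⟨co0 _ _, co1 _ _, co2 _ _⟩
lemma J2.add {f g : PowerSeries ℚ} {a b c a' b' c' : ℚ} (h : J2 f a b c) (h' : J2 g a' b' c') : J2 (f+g) (a+a') (b+b') (c+c') := by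
  obtain ⟨rfl, rfl, rfl⟩ := h
  obtain ⟨rfl, rfl, rfl⟩ := h'
  exact ⟨map_add _ _ _, map_add _ _ _, map_add _ _ _⟩
lemma J2.neg {f : PowerSeries ℚ} {a b c : ℚ} (h : J2 f a b c) : J2 (-f) (-a) (-b) (-c) := by
  obtain ⟨rfl, rfl, rfl⟩ := h
  exact ⟨map_neg _ _, map_neg _ _, map_neg _ _⟩
lemma J2.of {f : PowerSeries ℚ} {a b c a' b' c' : ℚ} (h : J2 f a b c) (h0 : a' = a) (h1 : b' = b) (h2 : c' = c) : J2 f a' b' c' := by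
  subst h0 h1 h2; exact h
lemma J2_C (x : ℚ) : J2 (C x) x 0 0 := ⟨by simp, by rw [coeff_C]; simp, by rw [coeff_C]; simp⟩
lemma J2_X : J2 X 0 1 0 := ⟨by simp, by simp, by rw [coeff_X]; simp⟩
lemma J2.inv {f g : PowerSeries ℚ} {a b c : ℚ} (h : J2 f a b c) (e : f * g = 1) (ha : a ≠ 0) : J2 g (1/a) (-b/a^2) (b^2/a^3-c/a^2) := by
  obtain ⟨h0, h1, h2⟩ := h
  have e0 := congrArg (coeff 0) e
  have e1 := congrArg (coeff 1) e
  have e2 := congrArg (coeff 2) e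
  rw [co0, h0, coeff_one] at e0
  rw [co1, h0, h1, coeff_one] at e1
  rw [co2, h0, h1, h2, coeff_one] at e2
  norm_num at e0 e1 e2
  have g0 : coeff 0 g = 1/a := by field_simp; simpa [mul_comm] using e0
  have g1 : coeff 1 g = -b/a^2 := by
    rw [show constantCoeff g = coeff 0 g by simp, g0] at e1
    field_simp at e1 ⊢; linarith
  refine ⟨g0, g1, ?_⟩
  rw [show constantCoeff g = coeff 0 g by simp, g0, g1] at e2
  field_simp at e2 ⊢; linarith
lemma J2.pow {f : PowerSeries ℚ} {a b c : ℚ} (h : J2 f a b c) (ha : a ≠ 0) (k : ℕ) :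
    J2 (f^k) (a^k) (k*(b/a)*a^k) (a^k*(k*(c/a)+(k^2-k)/2*(b/a)^2)) := by
  induction k with
  | zero => rw [pow_zero]; exact (J2_C 1).of (by simp) (by simp) (by simp)
  | succ k ih =>
    rw [pow_succ]
    refine (ih.mul h).of (by ring) ?_ ?_
    · push_cast; field_simp; ring
    · push_cast; field_simp; ring
lemma J2_sum {s : Finset ℕ} {f : ℕ → PowerSeries ℚ} {a b c : ℕ → ℚ} (h : ∀ i ∈ s, J2 (f i) (a i) (b i) (c i)) :
    J2 (∑ i ∈ s, f i) (∑ i ∈ s, a i) (∑ i ∈ s, b i) (∑ i ∈ s, c i) := by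
  refine ⟨?_, ?_, ?_⟩ <;> rw [map_sum]
  exacts [sum_congr rfl fun i hi => (h i hi).1, sum_congr rfl fun i hi => (h i hi).2.1, sum_congr rfl fun i hi => (h i hi).2.2]
lemma J2_Tz {f : PowerSeries ℚ} {a b c : ℚ} (h : J2 f a b c) (ha : a ≠ 0) :
    J2 (Tz p 0 f) (Szz p 0 a) (b/a*Szz p 1 a) (c/a*Szz p 1 a + (b/a)^2/2*(Szz p 2 a - Szz p 1 a)) := by
  rw [Tz]
  refine (J2_sum fun i hi => (J2_C (AA (p*0+i))).mul (h.pow ha (p*0+i))).of ?_ ?_ ?_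
  · rw [Szz]; refine sum_congr rfl fun k _ => ?_
    simp only [mul_zero, zero_add, pow_zero, one_mul]
  · rw [Szz, mul_sum]; refine sum_congr rfl fun k _ => ?_
    simp only [mul_zero, zero_add]; ring
  · rw [Szz, Szz, ← sum_sub_distrib, mul_sum, mul_sum, ← sum_add_distrib]; refine sum_congr rfl fun k _ => ?_
    simp only [mul_zero, zero_add]; ring

lemma frob {x y : PowerSeries ℚ} (hx : MP p 0 x) (hy : MP p 0 y) : MP p 1 ((x+y)^p - x^p - y^p) := by
  obtain ⟨e, he⟩ : ∃ e, p = e+1 := ⟨p-1, by have := hp.out.pos; omega⟩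
  have : (x+y)^p - x^p - y^p = ∑ k ∈ range e, x^(k+1)*y^(p-(k+1))*(p.choose (k+1) : PowerSeries ℚ) := by
    rw [add_pow, sum_range_succ, he, sum_range_succ']
    simp
  rw [this]
  refine MP_sum _ _ fun k hk => ((hx.pow0 _).m0 (hy.pow0 _)).mull ?_
  have hk := mem_range.1 hk
  rw [show ((p.choose (k+1) : ℕ) : PowerSeries ℚ) = C ((p.choose (k+1) : ℕ) : ℚ) from (map_natCast C _).symm]
  exact MP_C (M_dvd ((pow_one p).symm ▸ hp.out.dvd_choose_self (by omega) (by omega)))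

lemma MP_pow_red {D : PowerSeries ℚ} (hD : MP p 0 D) (k : ℕ) (h : MP p 1 (D^k)) : MP p 1 D := by
  by_contra hn
  induction k with
  | zero =>
    have := h 0
    rw [pow_zero, coeff_one, if_pos rfl] at this
    exact not_U_of_M this U_one
  | succ k ih => exact ih (MP.cancel hD hn (hD.pow0 k) (h.cast (by ring)))
end

section
variable {p : ℕ} [hp : Fact p.Prime]
open PowerSeries

lemma U_lt {z : ℕ} (h0 : 0 < z) (h : z < p) : U p (z:ℚ) := U_of_lt (by omega) (by omega)

/-- the specialised power series -/
lemma tset (h5 : 5 < p) {n : ℕ} (hn : p = 2*n+1) : ∃ v v' T0 T1 Y Y' : PowerSeries ℚ, MP p 0 v ∧ MP p 0 v' ∧ MP p 0 T0 ∧ MP p 0 T1 ∧ MP p 0 Y ∧ MP p 0 Y' ∧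
    coeff 0 v = -3/4 ∧ coeff 0 v' = 3/4 ∧
    MP p 3 (36*T1*Y^3 - T0*(Y-T0)^2*(4*Y-T0)) ∧ MP p 3 (36*T1*Y'^3 - T0*(Y'-T0)^2*(4*Y'-T0)) ∧
    MP p 1 (T0*(1-4*(C (-1/2)+X*v)^p) - Y*(1-16*(C (-1/2)+X*v)^p)) ∧ MP p 1 (T0*(1-4*(C (-1/2)+X*v')^p) - Y'*(1-16*(C (-1/2)+X*v')^p)) ∧
    J2 T0 (Szz p 0 (1/108)) 0 (-3/4*Szz p 1 (1/108)) ∧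
    coeff 0 Y = Szz p 0 (1/1458)/3 ∧ coeff 0 Y' = Szz p 0 (1/1458)/3 ∧
    coeff 2 (Y+Y') = Szz p 0 (1/1458)/9 + (75*Szz p 2 (1/1458) + 7*Szz p 1 (1/1458))/36 := by
  have u2 : U p (2:ℚ) := by exact_mod_cast U_lt (p := p) (z := 2) (by omega) (by omega)
  have u3 : U p (3:ℚ) := by exact_mod_cast U_lt (p := p) (z := 3) (by omega) (by omega)
  have u4 : U p (4:ℚ) := by exact_mod_cast U_lt (p := p) (z := 4) (by omega) (by omega)
  have mX := MP_X (p := p)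
  have m3 : MP p 0 (3:PowerSeries ℚ) := MPcst 3
  have m2 : MP p 0 (2:PowerSeries ℚ) := MPcst 2
  have mi4 : MP p 0 (C (1/4:ℚ)) := MP_C (by have := M_one.div u4; exact this)
  have mi4' : MP p 0 (C (-1/4:ℚ)) := MP_C (by have := M_one.neg.div u4; exact this)
  have e4 : C (1/4:ℚ) * 4 = 1 := by rw [← map_ofNat C 4, ← map_mul, ← map_one C]; norm_num
  have e4' : C (-1/4:ℚ) = - C (1/4:ℚ) := by rw [← map_neg]; norm_num
  have e2 : C (-1/2:ℚ) = - 2 * C (1/4:ℚ) := by rw [← map_ofNat C 2, ← map_neg, ← map_mul]; norm_num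
  -- inverses
  have cc3 : constantCoeff (3:PowerSeries ℚ) = 3 := map_ofNat _ 3
  have i1 : (1+X) * (1+X)⁻¹ = (1:PowerSeries ℚ) := PowerSeries.mul_inv_cancel _ (by simp)
  have i2 : (3+3*X+X^2) * (3+3*X+X^2)⁻¹ = (1:PowerSeries ℚ) := PowerSeries.mul_inv_cancel _ (by simp [cc3])
  have i3 : (3+2*X) * (3+2*X)⁻¹ = (1:PowerSeries ℚ) := PowerSeries.mul_inv_cancel _ (by simp [cc3])
  have i4 : (3+X) * (3+X)⁻¹ = (1:PowerSeries ℚ) := PowerSeries.mul_inv_cancel _ (by simp [cc3])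
  have j1 : J2 (1+X) 1 1 0 := ((J2_C 1).add J2_X).of (by norm_num) (by norm_num) (by norm_num)
  have jn : ∀ z : ℕ, J2 (z:PowerSeries ℚ) z 0 0 := fun z => by
    have := J2_C (z:ℚ); rwa [map_natCast] at this
  have jj2 : J2 (2:PowerSeries ℚ) 2 0 0 := by exact_mod_cast jn 2
  have jj3 : J2 (3:PowerSeries ℚ) 3 0 0 := by exact_mod_cast jn 3
  have jj4 : J2 (4:PowerSeries ℚ) 4 0 0 := by exact_mod_cast jn 4
  have j2 : J2 (3+3*X+X^2) 3 3 1 := by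
    have := (jj3.add (jj3.mul J2_X)).add (J2_X.mul J2_X)
    rw [← pow_two] at this
    exact this.of (by norm_num) (by norm_num) (by norm_num)
  have j3 : J2 (3+2*X) 3 2 0 := (jj3.add (jj2.mul J2_X)).of (by norm_num) (by norm_num) (by norm_num)
  have j4 : J2 (3+X) 3 1 0 := (jj3.add J2_X).of (by norm_num) (by norm_num) (by norm_num)
  have k1 : J2 (1+X)⁻¹ 1 (-1) 1 := (j1.inv i1 (by norm_num)).of (by norm_num) (by norm_num) (by norm_num)
  have k2 : J2 (3+3*X+X^2)⁻¹ (1/3) (-1/3) (2/9) := (j2.inv i2 (by norm_num)).of (by norm_num) (by norm_num) (by norm_num)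
  have k3 : J2 (3+2*X)⁻¹ (1/3) (-2/9) (4/27) := (j3.inv i3 (by norm_num)).of (by norm_num) (by norm_num) (by norm_num)
  have k4 : J2 (3+X)⁻¹ (1/3) (-1/9) (1/27) := (j4.inv i4 (by norm_num)).of (by norm_num) (by norm_num) (by norm_num)
  have n1 : MP p 0 (1+X)⁻¹ := (MP_one.add mX).inv (by rw [j1.1]; exact U_one)
  have n2 : MP p 0 (3+3*X+X^2)⁻¹ := ((m3.add (m3.m0 mX)).add (mX.pow0 2)).inv (by rw [j2.1]; exact u3)
  have n3 : MP p 0 (3+2*X)⁻¹ := (m3.add (m2.m0 mX)).inv (by rw [j3.1]; exact u3)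
  have n4 : MP p 0 (3+X)⁻¹ := (m3.add mX).inv (by rw [j4.1]; exact u3)
  have jq : J2 (C (1/4:ℚ)) (1/4) 0 0 := J2_C _
  generalize ((1+X)⁻¹ : PowerSeries ℚ) = L at *
  generalize ((3+3*X+X^2)⁻¹ : PowerSeries ℚ) = Q at *
  generalize ((3+2*X)⁻¹ : PowerSeries ℚ) = R at *
  generalize ((3+X)⁻¹ : PowerSeries ℚ) = R' at *
  generalize C (1/4:ℚ) = c at *
  -- u and u'
  have hu : C (-1/2:ℚ) + X*(-c*(3+X)) = -c*(1+X)*(2+X) := by rw [e2]; ring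
  have hu' : C (-1/2:ℚ) + X*(c*(3+2*X)*L^2) = -c*(2+X)*L^2 := by
    rw [e2]; linear_combination (2*c*(1+(1+X)*L))*i1
  have mu : MP p 0 (-c*(1+X)*(2+X)) := (mi4.neg.m0 (MP_one.add mX)).m0 (m2.add mX)
  have mu' : MP p 0 (-c*(2+X)*L^2) := (mi4.neg.m0 (m2.add mX)).m0 (n1.pow0 2)
  have q1 : 1-4*(-c*(1+X)*(2+X)) = 3+3*X+X^2 := by linear_combination ((1+X)*(2+X))*e4
  have q2 : 1-4*(-c*(2+X)*L^2) = (3+3*X+X^2)*L^2 := by linear_combination ((2+X)*L^2)*e4 - (1+(1+X)*L)*i1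
  have r1 : 1-16*(-c*(1+X)*(2+X)) = (3+2*X)^2 := by linear_combination (4*(1+X)*(2+X))*e4
  have r2 : 1-16*(-c*(2+X)*L^2) = (3+X)^2*L^2 := by linear_combination (4*(2+X)*L^2)*e4 - (1+(1+X)*L)*i1
  have hq1 : (1-4*(-c*(1+X)*(2+X)))*Q = 1 := by rw [q1, i2]
  have hq2 : (1-4*(-c*(2+X)*L^2))*((1+X)^2*Q) = 1 := by
    rw [q2]; linear_combination ((1+X)*L)^2*i2 + (1+(1+X)*L)*i1
  have hr1 : (1-16*(-c*(1+X)*(2+X)))*R^2 = 1 := by rw [r1, ← mul_pow, i3, one_pow]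
  have hr2 : (1-16*(-c*(2+X)*L^2))*((1+X)^2*R'^2) = 1 := by
    rw [r2]
    calc _ = ((3+X)*R')^2*((1+X)*L)^2 := by ring
      _ = 1 := by rw [i4, i1]; ring
  have hz : (-c*(2+X)*L^2)^2*((1+X)^2*Q)^3 = (-c*(1+X)*(2+X))^2*Q^3 := by
    calc _ = c^2*(2+X)^2*(1+X)^2*Q^3*((1+X)*L)^4 := by ring
      _ = _ := by rw [i1]; ring
  have mQ2 : MP p 0 ((1+X)^2*Q) := ((MP_one.add mX).pow0 2).m0 n2
  have mR2 : MP p 0 ((1+X)^2*R'^2) := ((MP_one.add mX).pow0 2).m0 (n4.pow0 2)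
  obtain ⟨s1, s2⟩ := starS h5 hn mu n2 (n3.pow0 2) hq1 hr1 rfl rfl rfl
  obtain ⟨s3, s4⟩ := starS h5 hn mu' mQ2 mR2 hq2 hr2 rfl rfl rfl
  rw [hz] at s3 s4
  rw [q1] at s1 s2
  rw [q2] at s3 s4
  have ja : J2 (-c*(1+X)*(2+X)) (-1/2) (-3/4) (-1/4) :=
    ((jq.neg.mul j1).mul (jj2.add J2_X)).of (by norm_num) (by norm_num) (by norm_num)
  have jL2 : J2 (L^2) 1 (-2) 3 := by rw [pow_two]; exact (k1.mul k1).of (by norm_num) (by norm_num) (by norm_num)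
  have ja' : J2 (-c*(2+X)*L^2) (-1/2) (3/4) (-1) :=
    ((jq.neg.mul (jj2.add J2_X)).mul jL2).of (by norm_num) (by norm_num) (by norm_num)
  have jz : J2 ((-c*(1+X)*(2+X))^2*Q^3) (1/108) 0 (-1/144) := by
    rw [pow_two (-c*(1+X)*(2+X)), pow_succ Q, pow_two Q]
    exact ((ja.mul ja).mul ((k2.mul k2).mul k2)).of (by norm_num) (by norm_num) (by norm_num)
  have jR2 : J2 (R^2) (1/9) (-4/27) (4/27) := by rw [pow_two]; exact (k3.mul k3).of (by norm_num) (by norm_num) (by norm_num)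
  have jR2' : J2 ((1+X)^2*R'^2) (1/9) (4/27) 0 := by
    rw [pow_two R', pow_two (1+X)]; exact ((j1.mul j1).mul (k4.mul k4)).of (by norm_num) (by norm_num) (by norm_num)
  have jw : J2 (-(-c*(1+X)*(2+X))*(R^2)^3) (1/1458) (-5/2916) (23/8748) := by
    rw [pow_succ (R^2), pow_two (R^2)]
    exact (ja.neg.mul ((jR2.mul jR2).mul jR2)).of (by norm_num) (by norm_num) (by norm_num)
  have jw' : J2 (-(-c*(2+X)*L^2)*((1+X)^2*R'^2)^3) (1/1458) (5/2916) (2/2187) := by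
    rw [pow_succ ((1+X)^2*R'^2), pow_two ((1+X)^2*R'^2)]
    exact (ja'.neg.mul ((jR2'.mul jR2').mul jR2')).of (by norm_num) (by norm_num) (by norm_num)
  have jY := (j2.mul jR2).mul (J2_Tz (p := p) jw (by norm_num))
  have jY' := ((j2.mul jL2).mul jR2').mul (J2_Tz (p := p) jw' (by norm_num))
  refine ⟨-c*(3+X), c*(3+2*X)*L^2, Tz p 0 ((-c*(1+X)*(2+X))^2*Q^3), Tz p 1 ((-c*(1+X)*(2+X))^2*Q^3), _, _,
    mi4.neg.m0 (m3.add mX), (mi4.m0 (m3.add (m2.m0 mX))).m0 (n1.pow0 2), MP_Tz 0 ((mu.pow0 2).m0 (n2.pow0 3)), MP_Tz 1 ((mu.pow0 2).m0 (n2.pow0 3)),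
    ?_, ?_, ?_, ?_, s1, s3, ?_, ?_, ?_, ?_, ?_, ?_⟩
  · exact (((m3.add (m3.m0 mX)).add (mX.pow0 2)).m0 (n3.pow0 2)).m0 (MP_Tz 0 (mu.neg.m0 ((n3.pow0 2).pow0 3)))
  · exact ((((m3.add (m3.m0 mX)).add (mX.pow0 2)).m0 (n1.pow0 2)).m0 mR2).m0 (MP_Tz 0 (mu'.neg.m0 (mR2.pow0 3)))
  · rw [(jq.neg.mul j4).1]; norm_num
  · rw [((jq.mul j3).mul jL2).1]; norm_num
  · rw [hu]; exact s2
  · rw [hu']; exact s4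
  · exact (J2_Tz (p := p) jz (by norm_num)).of rfl (by norm_num) (by ring)
  · rw [jY.1]; ring
  · rw [jY'.1]; ring
  · rw [map_add, jY.2.2, jY'.2.2]; ring
end

section
variable {p : ℕ} [hp : Fact p.Prime]
open PowerSeries

lemma u_pow (h5 : 5 < p) {v : PowerSeries ℚ} (hv : MP p 0 v) : MP p 1 ((C (-1/2)+X*v)^p - C (-1/2) - X^p*v^p) := by
  have u2 : U p (2:ℚ) := by exact_mod_cast U_lt (p := p) (z := 2) (by omega) (by omega)
  have h2 : M p 0 (-1/2:ℚ) := M_one.neg.div u2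
  have uu : U p (-1/2:ℚ) := U_one.neg.div u2
  have a := frob (p := p) (MP_C h2) (MP_X.m0 hv)
  have f : M p 1 ((-1/2:ℚ)^p - (-1/2)) := by
    have := (fermat_U uu).mulr h2
    refine this.cast ?_
    rw [w_eq (p := p)]; ring
  have b := MP_C f
  rw [map_sub, map_pow] at b
  exact (a.add b).cast (by ring)

lemma elim (h5 : 5 < p) {v v' T0 T1 Y Y' : PowerSeries ℚ} (mv : MP p 0 v) (mv' : MP p 0 v') (m0 : MP p 0 T0) (m1 : MP p 0 T1) (mY : MP p 0 Y) (mY' : MP p 0 Y')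
    (hv : coeff 0 v = -3/4) (hv' : coeff 0 v' = 3/4)
    (s1 : MP p 3 (36*T1*Y^3 - T0*(Y-T0)^2*(4*Y-T0))) (s2 : MP p 3 (36*T1*Y'^3 - T0*(Y'-T0)^2*(4*Y'-T0)))
    (r1 : MP p 1 (T0*(1-4*(C (-1/2)+X*v)^p) - Y*(1-16*(C (-1/2)+X*v)^p))) (r2 : MP p 1 (T0*(1-4*(C (-1/2)+X*v')^p) - Y'*(1-16*(C (-1/2)+X*v')^p)))
    (hT : ¬ MP p 1 T0) : MP p 3 (T0^2*(Y^2+Y*Y'+Y'^2)-6*T0*(Y*Y'*(Y+Y'))+9*(Y^2*Y'^2)) := by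
  have u2 : U p (2:ℚ) := by exact_mod_cast U_lt (p := p) (z := 2) (by omega) (by omega)
  have u3 : U p (3:ℚ) := by exact_mod_cast U_lt (p := p) (z := 3) (by omega) (by omega)
  have h2 : M p 0 (-1/2:ℚ) := M_one.neg.div u2
  have mW : MP p 0 (T0^2*(Y^2+Y*Y'+Y'^2)-6*T0*(Y*Y'*(Y+Y'))+9*(Y^2*Y'^2)) :=
    (((m0.pow0 2).m0 (((mY.pow0 2).add (mY.m0 mY')).add (mY'.pow0 2))).sub (((MPcst 6).m0 m0).m0 ((mY.m0 mY').m0 (mY.add mY')))).add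
      ((MPcst 9).m0 ((mY.pow0 2).m0 (mY'.pow0 2)))
  have mu : MP p 0 (C (-1/2)+X*v) := (MP_C h2).add (MP_X.m0 mv)
  have mu' : MP p 0 (C (-1/2)+X*v') := (MP_C h2).add (MP_X.m0 mv')
  have hne : ¬ MP p 1 (Y - Y') := by
    intro h
    set a := (C (-1/2)+X*v)^p with ha
    set b := (C (-1/2)+X*v')^p with hb
    have ma : MP p 0 a := mu.pow0 p
    have mb : MP p 0 b := mu'.pow0 p
    have n16 : MP p 0 (1-16*b) := MP_one.sub ((MPcst 16).m0 mb)
    have n16a : MP p 0 (1-16*a) := MP_one.sub ((MPcst 16).m0 ma)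
    have t := ((r1.mulr n16).sub (r2.mulr n16a)).add (h.mulr (n16.m0 n16a))
    have t' : MP p 1 (T0 * (12*(a-b))) := t.cast (by ring)
    have t2 := MP.cancel m0 hT ((MPcst 12).m0 (ma.sub mb)) t'
    have u12 : U p (12:ℚ) := by have := (u2.mul u2).mul u3; norm_num at this; exact this
    have t3 : MP p 1 (a-b) := fun n => by
      have := t2 n
      rw [show (12:PowerSeries ℚ) = C 12 from (map_ofNat C 12).symm, coeff_C_mul] at this
      exact u12.cancel this
    have mD : MP p 0 (X*(v-v')) := MP_X.m0 (mv.sub mv')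
    have fr := frob (p := p) mD mu'
    rw [show X*(v-v') + (C (-1/2)+X*v') = C (-1/2)+X*v by ring, ← ha, ← hb] at fr
    have t4 : MP p 1 ((X*(v-v'))^p) := (t3.sub fr).cast (by ring)
    have t5 := MP_pow_red mD p t4 1
    rw [show X*(v-v') = (v-v')*X by ring, coeff_succ_mul_X, map_sub, hv, hv'] at t5
    refine not_U_of_M t5 ?_
    have := (u3.neg.div u2)
    norm_num at this ⊢; exact this
  have A := (s1.mulr (mY'.pow0 3)).sub (s2.mulr (mY.pow0 3))
  have B : MP p 3 (T0*(T0*((Y-Y')*(T0^2*(Y^2+Y*Y'+Y'^2)-6*T0*(Y*Y'*(Y+Y'))+9*(Y^2*Y'^2))))) := A.neg.cast (by ring)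
  have mYY := mY.sub mY'
  exact MP.cancel mYY hne mW (MP.cancel m0 hT (mYY.m0 mW) (MP.cancel m0 hT (m0.m0 (mYY.m0 mW)) B))

lemma num1 (h5 : 5 < p) {x T : ℚ} (hT : U p T) (R : M p 1 (3*T - 9*(x/3)))
    (E : M p 3 (T*T*(x/3*(x/3)+x/3*(x/3)+x/3*(x/3)) - 6*T*(x/3*(x/3)*(x/3+x/3)) + 9*(x/3*(x/3)*(x/3*(x/3))))) : M p 3 (x - T) := by
  have u2 : U p (2:ℚ) := by exact_mod_cast U_lt (p := p) (z := 2) (by omega) (by omega)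
  have u3 : U p (3:ℚ) := by exact_mod_cast U_lt (p := p) (z := 3) (by omega) (by omega)
  have R2 : M p 1 (x - T) := by
    have := u3.cancel (b := x - T) (R.neg.cast (by ring)); exact this
  have ux : U p x := hT.congr R2
  have u4 : U p (3*T - x) := ((u2.mul ux)).congr ((R2.mulr (M_nat 3).neg).cast (by push_cast; ring))
  have u9 : U p ((1/9:ℚ)) := by
    have := (u3.pow 2).inv; norm_num at this ⊢; exact this
  have uu := (u9.mul (ux.pow 2)).mul u4
  have hh := uu.cancel (b := T - x) (E.cast (by ring))
  exact hh.sy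

lemma X_eq1 (h5 : 5 < p) {n : ℕ} (hn : p = 2*n+1) (hT : U p (Szz p 0 (1/108))) : M p 3 (Szz p 0 (1/1458) - Szz p 0 (1/108)) := by
  obtain ⟨v, v', T0, T1, Y, Y', mv, mv', m0, m1, mY, mY', hv, hv', s1, s2, r1, r2, j0, jY, jY', _⟩ := tset h5 hn
  have u2 : U p (2:ℚ) := by exact_mod_cast U_lt (p := p) (z := 2) (by omega) (by omega)
  have u3 : U p (3:ℚ) := by exact_mod_cast U_lt (p := p) (z := 3) (by omega) (by omega)
  have hT0 : ¬ MP p 1 T0 := fun h => not_U_of_M (h 0) (by rw [j0.1]; exact hT)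
  have E := elim h5 mv mv' m0 m1 mY mY' hv hv' s1 s2 r1 r2 hT0 0
  have up := u_pow h5 mv
  have r1' : MP p 1 (3*T0 - 9*Y + X^p*(v^p*(16*Y-4*T0))) := by
    refine (r1.add (up.mulr (((MPcst 4).m0 m0).sub ((MPcst 16).m0 mY)))).cast ?_
    rw [show C (-1/2:ℚ) = -C (1/2) by rw [← map_neg]; norm_num]
    have : (2:PowerSeries ℚ) * C (1/2) = 1 := by rw [← map_ofNat C 2, ← map_mul, ← map_one C]; norm_num
    linear_combination (-2*T0+8*Y)*this
  have R := r1' 0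
  have c3 : (3:PowerSeries ℚ) = C 3 := (map_ofNat C 3).symm
  have c9 : (9:PowerSeries ℚ) = C 9 := (map_ofNat C 9).symm
  have c6 : (6:PowerSeries ℚ) = C 6 := (map_ofNat C 6).symm
  rw [map_add, map_sub, coeff_X_pow_mul', if_neg (by omega), c3, c9, coeff_C_mul, coeff_C_mul, j0.1, jY, add_zero] at R
  rw [c6, c9] at E
  simp only [map_add, map_sub, co0, pow_two, j0.1, jY, jY', coeff_C, if_pos] at E
  exact num1 h5 hT R E
end

section
variable {p : ℕ} [hp : Fact p.Prime]
open PowerSeries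

lemma e_dec (h5 : 5 < p) {v T0 Y : PowerSeries ℚ} (mv : MP p 0 v) (m0 : MP p 0 T0) (mY : MP p 0 Y)
    (r1 : MP p 1 (T0*(1-4*(C (-1/2)+X*v)^p) - Y*(1-16*(C (-1/2)+X*v)^p))) : ∃ a b, MP p 1 a ∧ MP p 0 b ∧ 3*Y - T0 = a + X^p*b := by
  have u3 : U p (3:ℚ) := by exact_mod_cast U_lt (p := p) (z := 3) (by omega) (by omega)
  have up := u_pow h5 mv
  have r1' : MP p 1 (3*T0 - 9*Y + X^p*(v^p*(16*Y-4*T0))) := by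
    refine (r1.add (up.mulr (((MPcst 4).m0 m0).sub ((MPcst 16).m0 mY)))).cast ?_
    rw [show C (-1/2:ℚ) = -C (1/2) by rw [← map_neg]; norm_num]
    have : (2:PowerSeries ℚ) * C (1/2) = 1 := by rw [← map_ofNat C 2, ← map_mul, ← map_one C]; norm_num
    linear_combination (-2*T0+8*Y)*this
  have mi : MP p 0 (C (1/3:ℚ)) := MP_C (M_one.div u3)
  have h3 : (3:PowerSeries ℚ) * C (1/3) = 1 := by rw [← map_ofNat C 3, ← map_mul, ← map_one C]; norm_num
  refine ⟨_, C (1/3)*(v^p*(16*Y-4*T0)), mi.neg.mull r1', mi.m0 ((mv.pow0 p).m0 (((MPcst 16).m0 mY).sub ((MPcst 4).m0 m0))), ?_⟩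
  linear_combination (T0-3*Y)*h3

lemma X_eq2 (h11 : 11 ≤ p) {n : ℕ} (hn : p = 2*n+1) (hT : M p 1 (Szz p 0 (1/108))) (hT1 : U p (Szz p 1 (1/108))) :
    M p 2 (Szz p 0 (1/1458) - Szz p 0 (1/108)) ∧
    M p 2 (3*(Szz p 0 (1/1458)/9 + (75*Szz p 2 (1/1458) + 7*Szz p 1 (1/1458))/36) - 2*(-3/4*Szz p 1 (1/108))) := by
  have h5 : 5 < p := by omega
  obtain ⟨v, v', T0, T1, Y, Y', mv, mv', m0, m1, mY, mY', hv, hv', s1, s2, r1, r2, j0, jY, jY', j2⟩ := tset h5 hn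
  have u2 : U p (2:ℚ) := by exact_mod_cast U_lt (p := p) (z := 2) (by omega) (by omega)
  have u3 : U p (3:ℚ) := by exact_mod_cast U_lt (p := p) (z := 3) (by omega) (by omega)
  have u4 : U p (4:ℚ) := by exact_mod_cast U_lt (p := p) (z := 4) (by omega) (by omega)
  have hu : U p (coeff 2 T0) := by
    rw [j0.2.2]; exact (u3.neg.div u4).mul hT1
  have hT0 : ¬ MP p 1 T0 := fun h => not_U_of_M (h 2) hu
  have E := elim h5 mv mv' m0 m1 mY mY' hv hv' s1 s2 r1 r2 hT0
  obtain ⟨a, b, ma, mb, e1⟩ := e_dec h5 mv m0 mY r1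
  obtain ⟨a', b', ma', mb', e2⟩ := e_dec h5 mv' m0 mY' r2
  have low : ∀ i < 2, M p 1 (coeff i T0) := by
    intro i hi
    rcases (show i = 0 ∨ i = 1 by omega) with rfl | rfl
    · rw [j0.1]; exact hT
    · rw [j0.2.1]; exact M_zero 1
  have maa : MP p 2 (a*a') := ma.mul ma'
  have ms : MP p 1 (a+a') := ma.add ma'
  obtain ⟨s, ms0, hs⟩ := ms.exists
  rw [pow_one] at hs
  have na : MP p 0 a := ma.mono (by omega)
  have na' : MP p 0 a' := ma'.mono (by omega)
  have mXp : MP p 0 (X^p) := MP_X.pow0 p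
  -- q = a a' + X^p c
  have hq : (3*Y-T0)*(3*Y'-T0) = a*a' + X^p*(a*b'+b*a'+X^p*(b*b')) := by rw [e1, e2]; ring
  have mc : MP p 0 (a*b'+b*a'+X^p*(b*b')) := ((na.m0 mb').add (mb.m0 na')).add (mXp.m0 (mb.m0 mb'))
  generalize hc : a*b'+b*a'+X^p*(b*b') = c at *
  have ident : T0^3*(C (p:ℚ)*s) = -(9*(T0^2*(Y^2+Y*Y'+Y'^2)-6*T0*(Y*Y'*(Y+Y'))+9*(Y^2*Y'^2))) - 3*T0^2*(a*a') + (a*a')*(a*a')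
       + X^p*(-(T0^3*(b+b')) - 3*T0^2*c + 2*(a*a')*c + X^p*(c*c)) := by
    rw [← hs]
    have ha : a = 3*Y - T0 - X^p*b := by rw [e1]; ring
    have ha' : a' = 3*Y' - T0 - X^p*b' := by rw [e2]; ring
    have hq2 : ((3*Y-T0)*(3*Y'-T0))^2 = (a*a' + X^p*c)^2 := by rw [hq]
    have hss : a + a' = (3*Y-T0)+(3*Y'-T0) - X^p*(b+b') := by rw [ha, ha']; ring
    rw [hss]
    linear_combination (-(3*T0^2))*hq + hq2
  have n0 : MP p 2 (-(9*(T0^2*(Y^2+Y*Y'+Y'^2)-6*T0*(Y*Y'*(Y+Y'))+9*(Y^2*Y'^2))) - 3*T0^2*(a*a') + (a*a')*(a*a')) :=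
    (((((MPcst 9).mull E).neg.mono (by omega))).sub (((MPcst 3).m0 (m0.pow0 2)).mull maa)).add (maa.mulr (na.m0 na'))
  have step : ∀ m < p, M p 1 (coeff m (T0*(T0*(T0*s)))) := by
    intro m hm
    have := congrArg (coeff m) ident
    rw [map_add, coeff_X_pow_mul', if_neg (by omega), add_zero] at this
    have h := n0 m
    rw [← this, show T0^3*(C (p:ℚ)*s) = C (p:ℚ)*(T0*(T0*(T0*s))) by ring, coeff_C_mul] at h
    exact M.pcancel (r := 1) (s := 1) (by rw [pow_one]; exact h)
  have st3 : ∀ m < p-6, M p 1 (coeff m s) :=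
    trunc_cancel m0 hu low ms0 (trunc_cancel m0 hu low (m0.m0 ms0) (trunc_cancel m0 hu low (m0.m0 (m0.m0 ms0)) (fun m hm => step m (by omega))))
  have fin : ∀ m < p-6, M p 2 (coeff m (3*(Y+Y')-2*T0)) := by
    intro m hm
    rw [show 3*(Y+Y')-2*T0 = C (p:ℚ)*s + X^p*(b+b') by rw [← hs]; linear_combination e1 + e2, map_add, coeff_C_mul, coeff_X_pow_mul', if_neg (by omega), add_zero]
    exact M_p.m11 (st3 m hm)
  have c3 : (3:PowerSeries ℚ) = C 3 := (map_ofNat C 3).symm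
  have c2 : (2:PowerSeries ℚ) = C 2 := (map_ofNat C 2).symm
  have f0 := fin 0 (by omega)
  have f2 := fin 2 (by omega)
  rw [c3, c2, map_sub, coeff_C_mul, coeff_C_mul] at f0 f2
  rw [map_add, jY, jY', j0.1] at f0
  rw [j2, j0.2.2] at f2
  exact ⟨u2.cancel (f0.cast (by ring)), f2⟩
end

section
variable {p : ℕ} [hp : Fact p.Prime]
open Polynomial

noncomputable def thP (f : Polynomial ℚ) : Polynomial ℚ := X * derivative f
lemma thP_coeff (f : Polynomial ℚ) (n : ℕ) : (thP f).coeff n = n * f.coeff n := by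
  cases n with
  | zero => simp [thP]
  | succ n => rw [thP, coeff_X_mul, coeff_derivative]; push_cast; ring
lemma thP_mul (f g : Polynomial ℚ) : thP (f*g) = thP f * g + f * thP g := by
  rw [thP, thP, thP, derivative_mul]; ring
lemma thP_add (f g : Polynomial ℚ) : thP (f+g) = thP f + thP g := by rw [thP, thP, thP, derivative_add]; ring
lemma thP_sub (f g : Polynomial ℚ) : thP (f-g) = thP f - thP g := by rw [thP, thP, thP, derivative_sub]; ring
lemma thP_X : thP X = X := by simp [thP]
lemma thP_C (c : ℚ) : thP (C c) = 0 := by simp [thP]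
lemma thP_one : thP 1 = 0 := by simp [thP]

noncomputable def yP (p : ℕ) : Polynomial ℚ := ∑ k ∈ range p, C (AA k/108^k) * X^k
lemma yP_coeff (n : ℕ) : (yP p).coeff n = if n < p then AA n/108^n else 0 := by
  rw [yP, finset_sum_coeff]
  simp only [coeff_C_mul_X_pow]
  rw [sum_ite_eq]
  simp [mem_range]

lemma yP_L : thP (thP (thP (yP p))) - X * (thP (thP (thP (yP p))) + C (3/2) * thP (thP (yP p)) + C (13/18) * thP (yP p) + C (1/9) * yP p) = C (-(p:ℚ)^3*(AA p/108^p)) * X^p := by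
  ext N
  have h1 := hp.out.one_lt
  rw [coeff_C_mul_X_pow]
  cases N with
  | zero => 
    rw [coeff_sub, coeff_X_mul_zero, thP_coeff, if_neg (by omega)]; simp
  | succ N =>
    rw [coeff_sub, coeff_X_mul]
    simp only [coeff_add, coeff_C_mul, thP_coeff, yP_coeff]
    have h := AA_succ N
    have e : (AA (N+1)/108^(N+1))*((N:ℚ)+1)^3 = PPl N * (AA N/108^N) := by
      rw [pow_succ]; field_simp; linear_combination h
    rw [PPl] at e
    by_cases c1 : N+1 < p
    · rw [if_pos c1, if_pos (by omega), if_neg (by omega)]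
      push_cast; linear_combination e
    · rw [if_neg c1]
      by_cases c2 : N+1 = p
      · rw [if_pos (by omega), if_pos c2, ← c2]
        push_cast; linear_combination e
      · rw [if_neg (by omega), if_neg c2]; simp

lemma eval_yP (i : ℕ) (z : ℚ) : (thP^[i] (yP p)).eval (108*z) = Szz p i z := by
  have : thP^[i] (yP p) = ∑ k ∈ range p, C ((k:ℚ)^i*(AA k/108^k)) * X^k := by
    induction i with
    | zero => simp [yP]
    | succ i ih =>
      rw [Function.iterate_succ_apply', ih]
      ext n
      rw [thP_coeff, finset_sum_coeff, finset_sum_coeff, mul_sum]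
      refine sum_congr rfl fun k _ => ?_
      simp only [coeff_C_mul_X_pow]
      split_ifs with h
      · rw [h]; ring
      · ring
  rw [this, eval_finset_sum, Szz]
  refine sum_congr rfl fun k _ => ?_
  simp only [eval_mul, eval_C, eval_pow, eval_X, mul_pow]
  field_simp

lemma first_int (h5 : 5 < p) : M p 3 (6*Szz p 0 (1/1458)*(75*Szz p 2 (1/1458)+7*Szz p 1 (1/1458)) - ((15*Szz p 1 (1/1458)+2*Szz p 0 (1/1458))^2 - 4*p^2)) := by
  have u2 : U p (2:ℚ) := by exact_mod_cast U_lt (p := p) (z := 2) (by omega) (by omega)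
  have u3 : U p (3:ℚ) := by exact_mod_cast U_lt (p := p) (z := 3) (by omega) (by omega)
  have u108 : U p (108:ℚ) := by have := (u2.pow 2).mul (u3.pow 3); norm_num at this; exact this
  have h27 : M p 0 (2/27:ℚ) := by have := M_nat (p := p) 2 |>.div (u3.pow 3); norm_num at this; exact this
  obtain ⟨c, hc⟩ : ∃ c, c = AA p/108^p := ⟨_, rfl⟩
  have mc : M p 0 c := by rw [hc]; exact (M_AA p).div (u108.pow p)
  have L := yP_L (p := p)
  rw [← hc] at L
  obtain ⟨y, hy⟩ : ∃ y, y = yP p := ⟨_, rfl⟩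
  rw [← hy] at L
  obtain ⟨Q, hQ⟩ : ∃ Q, Q = (1-X)*(2*(y*thP (thP y)) - thP y*thP y) - X*(y*thP y) - C (2/9)*(X*(y*y)) := ⟨_, rfl⟩
  have h2' : (2:Polynomial ℚ) = C 2 := (map_ofNat C 2).symm
  have cc : ∀ a b : ℚ, C a * C b = C (a*b) := fun a b => (C_mul).symm
  have tQ : thP Q = 2*(y*(C (-(p:ℚ)^3*c) * X^p)) := by
    rw [← L, hQ, h2']
    simp only [thP_mul, thP_add, thP_sub, thP_X, thP_C, thP_one]
    have a1 : C (3/2:ℚ) = 27 * C (1/18) := by rw [← map_ofNat C 27, cc]; norm_num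
    have a2 : C (13/18:ℚ) = 13 * C (1/18) := by rw [← map_ofNat C 13, cc]; norm_num
    have a3 : C (1/9:ℚ) = 2 * C (1/18) := by rw [← map_ofNat C 2, cc]; norm_num
    have a4 : C (2/9:ℚ) = 4 * C (1/18) := by rw [← map_ofNat C 4, cc]; norm_num
    have a5 : (1:Polynomial ℚ) = 18 * C (1/18) := by rw [← map_ofNat C 18, cc, ← C_1]; norm_num
    rw [a1, a2, a3, a4, ← h2']
    linear_combination -(3*X*y*thP (thP y) + X*y*thP y)*a5
  have hp0 := p_pos' (p := p)
  have hcoef : ∀ N, N ≠ p → M p 3 (Q.coeff N) := by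
    intro N hN
    have t := congrArg (fun P => coeff P N) tQ
    simp only [thP_coeff] at t
    rw [show 2*(y*(C (-(p:ℚ)^3*c) * X^p)) = C (2*(-(p:ℚ)^3*c)) * (y * X^p) by rw [C_mul (a := (2:ℚ)), ← h2']; ring, coeff_C_mul, coeff_mul_X_pow', hy, yP_coeff] at t
    rcases Nat.eq_zero_or_pos N with rfl | hN0
    · have : Q.coeff 0 = 0 := by
        rw [hQ]
        simp only [coeff_sub, coeff_add, mul_coeff_zero, thP_coeff, coeff_X_zero]; simp [thP_coeff]
      rw [this]; exact M_zero 3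
    · have hNn : (N:ℚ) ≠ 0 := by positivity
      split_ifs at t with c1 c2
      · have uN : U p (N:ℚ) := by
          have := U_lt (p := p) (z := N-p) (by omega) (by omega)
          refine this.congr (M_p.cast ?_)
          rw [Nat.cast_sub c1]; ring
        refine uN.cancel (t ▸ ?_)
        have mA : M p 0 (AA (N-p)/108^(N-p)) := (M_AA _).div (u108.pow _)
        exact (((M_ppow 3).mulr (((M_nat 2).m0 mc).m0 mA)).neg).cast (by push_cast; ring)
      · have : Q.coeff N = 0 := by simpa [hNn] using t
        rw [this]; exact M_zero 3
      · have : Q.coeff N = 0 := by simpa [hNn] using t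
        rw [this]; exact M_zero 3
  have hcp : Q.coeff p = -2*(p:ℚ)^2*c := by
    have t := congrArg (fun P => coeff P p) tQ
    simp only [thP_coeff] at t
    rw [show 2*(y*(C (-(p:ℚ)^3*c) * X^p)) = C (2*(-(p:ℚ)^3*c)) * (y * X^p) by rw [C_mul (a := (2:ℚ)), ← h2']; ring, coeff_C_mul, coeff_mul_X_pow', hy, yP_coeff, if_pos le_rfl, if_pos (by omega)] at t
    rw [Nat.sub_self, AA_0] at t
    have : (p:ℚ) ≠ 0 := by positivity
    apply mul_left_cancel₀ this
    rw [t]; ring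
  have ev : M p 3 (Q.eval (2/27) - (-2*(p:ℚ)^2*c)*(2/27)^p) := by
    rw [eval_eq_sum_range' (n := max (Q.natDegree+1) (p+1)) (by omega)]
    rw [sum_eq_add_sum_sdiff_singleton_of_mem (i := p) (mem_range.2 (by omega)), hcp]
    refine (M_sum (s := range (max (Q.natDegree+1) (p+1)) \ {p}) (f := fun i => Q.coeff i * (2/27)^i) (r := 3) (p := p) fun i hi => ?_).cast (by ring)
    simp only [mem_sdiff, mem_singleton] at hi
    exact (hcoef i hi.2).mulr (h27.pow0 i)
  have e0 := eval_yP (p := p) 0 (1/1458)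
  have e1 := eval_yP (p := p) 1 (1/1458)
  have e2 := eval_yP (p := p) 2 (1/1458)
  rw [show (108*(1/1458):ℚ) = 2/27 by norm_num, ← hy] at e0 e1 e2
  simp only [Function.iterate_succ, Function.iterate_zero, Function.comp, id] at e0 e1 e2
  rw [hQ] at ev
  simp only [eval_sub, eval_mul, eval_one, eval_X, eval_C, eval_ofNat, e0, e1, e2] at ev
  -- c mod p
  have u27 : U p (2/27:ℚ) := by have := u2.div (u3.pow 3); norm_num at this; exact this
  have f1 : M p 1 ((2/27:ℚ)^p - 2/27) := by
    refine ((fermat_U u27).mulr h27).cast ?_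
    rw [w_eq (p := p)]; ring
  have f2 : M p 1 (c - 1/9) := by
    have a := (AA_p (p := p) (by omega) 1).mono (show 1 ≤ 3 by omega)
    rw [mul_one, AA_1] at a
    have b := (fermat_U u108).mulr u108.m0
    have b' : M p 1 ((108:ℚ)^p - 108) := b.cast (by rw [w_eq (p := p)]; ring)
    have d : M p 1 ((108^p)*(c - 1/9)) := by
      have m9 : M p 0 (1/9:ℚ) := by have := M_one.div (u3.pow 2); norm_num at this ⊢; exact this
      refine (a.sub (b'.mulr m9)).cast ?_
      rw [hc]; have := (u108.pow p).ne; field_simp; ring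
    exact (u108.pow p).cancel d
  have f3 := (f2.cmul f1 mc h27)
  have f4 := ((M_nat (p := p) 2).mull ((M_ppow (p := p) 2).mul f3))
  have tot := ((M_nat (p := p) 243).mull (ev.sub f4))
  refine tot.cast ?_
  push_cast; ring
end

section
variable {p : ℕ} [hp : Fact p.Prime]

lemma pc_M1 {x : ℚ} (hx : M p 0 x) : M p 1 (pc x p) := by
  obtain ⟨l, hl, h⟩ : ∃ l < p, M p 1 (x + l) := by
    refine ⟨(-(rd p x)).val, ZMod.val_lt _, ?_⟩
    rw [← rd_eq_zero (hx.add (M_nat _)), rd_add hx (M_nat _), rd_nat, ZMod.natCast_zmod_val]; ring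
  unfold pc
  rw [← mul_prod_erase _ _ (mem_range.2 hl)]
  exact h.mulr (M_prod _ _ fun i _ => hx.add (M_nat _))
lemma pc_M0 {x : ℚ} (hx : M p 0 x) (k : ℕ) : M p 0 (pc x k) := M_prod _ _ fun i _ => hx.add (M_nat _)

def tS (a : ℚ) (k : ℕ) : ℚ := pc (1/2) k * pc a k * pc (1-a) k / (k.factorial:ℚ)^3
def SS (m : ℕ) (a : ℚ) : ℚ := ∑ k ∈ range m, tS a k

lemma pc_two (a : ℚ) (k : ℕ) : a*(a+1)*pc (a+2) k = pc a k * (a+k)*(a+k+1) := by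
  have h := pc_succ' a (k+1)
  rw [pc_succ' (a+1) k, pc_succ, pc_succ] at h
  rw [show a+1+1 = a+2 by ring] at h; push_cast at h; linear_combination -h

lemma SS_tele (a : ℚ) (m : ℕ) : a*(a^2*SS (m+1) a - (1+a)^2*SS (m+1) (a+2)) = -2*(1+2*a)*pc (1/2) (m+1)*pc a (m+1)*pc (-a) m/(m.factorial:ℚ)^3 := by
  induction m with
  | zero => simp [SS, tS, pc]; ring
  | succ m ih =>
    have e1 : ∀ b, SS (m+1+1) b = SS (m+1) b + tS b (m+1) := fun b => sum_range_succ _ _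
    rw [e1, e1]
    have h1 := pc_two a (m+1)
    have h2 : pc (1-(a+2)) (m+1) = (-1-a)*pc (-a) m := by
      rw [pc_succ']; rw [show 1-(a+2)+1 = -a by ring]; ring
    have h3 : -a * pc (1-a) (m+1) = pc (-a) m * (-a+m)*(-a+m+1) := by
      have h := pc_succ' (-a) (m+1)
      rw [pc_succ, pc_succ] at h
      rw [show -a+1 = 1-a by ring] at h; push_cast at h; linear_combination -h
    have f1 : a*(a^2*tS a (m+1)) = -a^2*pc (1/2) (m+1)*pc a (m+1)*(pc (-a) m * (-a+m)*(-a+m+1))/((m+1).factorial:ℚ)^3 := by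
      rw [← h3, tS]; ring
    have f2 : a*((1+a)^2*tS (a+2) (m+1)) = -(1+a)^2*pc (1/2) (m+1)*(pc a (m+1) * (a+((m+1:ℕ):ℚ))*(a+((m+1:ℕ):ℚ)+1))*pc (-a) m/((m+1).factorial:ℚ)^3 := by
      rw [← h1, tS, h2]; ring
    have : a*(a^2*(SS (m+1) a + tS a (m+1)) - (1+a)^2*(SS (m+1) (a+2)+tS (a+2) (m+1))) = a*(a^2*SS (m+1) a - (1+a)^2*SS (m+1) (a+2)) + a*(a^2*tS a (m+1)) - a*((1+a)^2*tS (a+2) (m+1)) := by ring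
    rw [this, ih, f1, f2, pc_succ _ (m+1), pc_succ a (m+1), pc_succ (-a) m, Nat.factorial_succ]
    have := Nat.factorial_ne_zero m
    push_cast; field_simp; ring

lemma SS_step (h3 : 3 < p) {a : ℚ} (ha : U p a) (ha1 : U p (1+a)) : M p 3 (a^2*SS p a - (1+a)^2*SS p (a+2)) := by
  have h := SS_tele a (p-1)
  rw [show p-1+1 = p by omega] at h
  apply ha.cancel
  have m0 := ha.m0
  have k1 : M p 1 (pc (1/2) p) := pc_M1 (M_one.div (U_two h3))
  have k2 : M p 1 (pc a p) := pc_M1 m0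
  have k3 : M p 1 (pc (-a) (p-1)) := by
    have : M p 1 (pc (-a) p) := pc_M1 m0.neg
    rw [show p = p-1+1 by omega, pc_succ, show p-1+1 = p by omega, mul_comm] at this
    refine U.cancel (ha1.neg.congr (M_p.cast ?_)) this
    rw [Nat.cast_sub (by omega)]; push_cast; ring
  have f := (U_factorial (p := p) (n := p-1) (by omega)).pow 3
  have c : M p 0 (-2*(1+2*a)) := ((M_nat 2).neg.m0 (M_one.add ((M_nat 2).m0 m0))).cast (by push_cast; ring)
  exact ((((k1.m11 k2).mul k3).mulr c).div f).cast (by rw [h]; ring)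

lemma SS_step0 {m a : ℕ} (ha : 0 < a) (ham : a < m) : SS (m+1) ((a:ℚ)+2) = (a/(1+a))^2 * SS (m+1) a := by
  have h := SS_tele a m
  have z : pc (-(a:ℚ)) m = 0 := prod_eq_zero (mem_range.2 ham) (by ring)
  rw [z, mul_zero, zero_div] at h
  have a0 : (a:ℚ) ≠ 0 := by positivity
  have a1 : (1+a:ℚ) ≠ 0 := by positivity
  have h := (mul_eq_zero.1 h).resolve_left a0
  field_simp; linear_combination -h

lemma SS_quad (h3 : 3 < p) {α : ℚ} (hα : M p 0 α) : M p 3 (SS p (p*α) - (1 + α * (p*∑ k ∈ range (p-1), pc (1/2) (k+1)/(k+1).factorial*vv k) + α^2*(-p^2*∑ k ∈ range (p-1), pc (1/2) (k+1)/(k+1).factorial*vv k^2))) := by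
  have e : SS p (p*α) = 1 + ∑ k ∈ range (p-1), tS (p*α) (k+1) := by
    unfold SS; rw [show p = p-1+1 by omega, sum_range_succ', show p-1+1 = p by omega]
    simp [tS, pc, add_comm]
  rw [e]
  have key : M p 3 (∑ k ∈ range (p-1), (tS (p*α) (k+1) - pc (1/2) (k+1)/(k+1).factorial*(α*p*vv k-α^2*p^2*vv k^2))) := by
    refine M_sum _ _ fun k hk => ?_
    have hk' := mem_range.1 hk
    have hx : M p 1 (p*α) := M_p.mulr hα
    have id1 : pc (p*α) (k+1) * pc (1-p*α) (k+1) = (p*α)*(k+1-p*α)*∏ l ∈ range k, (((l:ℚ)+1)^2+(p*α)^2*(-1)) := by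
      rw [pc_succ', pc_succ (1-p*α)]
      unfold pc
      rw [show ∀ A B C D : ℚ, A*B*(C*D) = A*D*(B*C) by intros; ring, ← prod_mul_distrib]
      rw [show (1-p*α+k:ℚ) = k+1-p*α by ring]
      congr 1; refine prod_congr rfl fun l _ => by ring
    have id2 : M p 2 (∏ l ∈ range k, (((l:ℚ)+1)^2+(p*α)^2*(-1)) - (k.factorial:ℚ)^2) := by
      clear hk hk' id1
      induction k with
      | zero => simp; exact M_zero 2
      | succ k ih =>
        rw [prod_range_succ, Nat.factorial_succ]
        have m1 : M p 0 (((k:ℚ)+1)^2) := ((M_nat (k+1)).pow0 2).cast (by push_cast; ring)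
        have m2 : M p 0 (((k:ℚ)+1)^2+(p*α)^2*(-1)) := m1.add ((hx.sq1.z.neg).cast (by ring))
        have m3 := hx.sq1.neg.mulr ((M_nat k.factorial).pow0 2)
        refine ((ih.mulr m2).add m3).cast ?_
        push_cast; ring
    have uf := U_factorial (p := p) (n := k+1) (by omega)
    have id3 := (hx.mul id2).mulr ((M_nat (k+1)).sub hx.z)
    have c2 : M p 0 (pc (1/2) (k+1)) := pc_M0 (M_one.div (U_two h3)) _
    have := ((id3.mulr c2).div (uf.pow 3))
    refine this.cast ?_
    rw [tS, mul_assoc (pc (1/2) (k+1)), id1, vv, Nat.factorial_succ]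
    have := Nat.factorial_ne_zero k
    push_cast; field_simp
  refine key.cast ?_
  rw [sum_sub_distrib]
  have : ∑ x ∈ range (p-1), pc (1/2) (x+1)/(x+1).factorial*(α*p*vv x-α^2*p^2*vv x^2) = α * (p*∑ k ∈ range (p-1), pc (1/2) (k+1)/(k+1).factorial*vv k) + α^2*(-p^2*∑ k ∈ range (p-1), pc (1/2) (k+1)/(k+1).factorial*vv k^2) := by
    simp only [mul_sum]; rw [← sum_add_distrib]; refine sum_congr rfl fun k _ => by ring
  rw [this]; ring
end

section
variable {p : ℕ} [hp : Fact p.Prime]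

lemma SS_odd (h3 : 3 < p) (i : ℕ) (hi : 2*i+1 ≤ p) : SS p (((2*i+1:ℕ)):ℚ) = (∏ l ∈ range i, ((2*l+1:ℚ)/(2*l+2)))^2 := by
  induction i with
  | zero =>
    unfold SS
    rw [sum_eq_single_of_mem 0 (mem_range.2 (by omega))]
    · simp [tS, pc]
    · intro k _ hk
      have : pc (1-((2*0+1:ℕ):ℚ)) k = 0 := prod_eq_zero (mem_range.2 (Nat.pos_of_ne_zero hk)) (by norm_num)
      rw [tS, this]; simp
  | succ i ih =>
    have := SS_step0 (m := p-1) (a := 2*i+1) (by omega) (by omega)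
    rw [show p-1+1 = p by omega, ih (by omega)] at this
    rw [show (((2*(i+1)+1:ℕ)):ℚ) = ((2*i+1:ℕ):ℚ)+2 by push_cast; ring, this, prod_range_succ]
    push_cast; ring

lemma SS_even (h3 : 3 < p) (i : ℕ) (hi : 2*i+2 < p) : SS p (((2*i+2:ℕ)):ℚ) = 0 := by
  induction i with
  | zero =>
    unfold SS
    rw [← sum_subset (s₁ := range 2) (range_subset_range.2 (by omega))]
    · simp [sum_range_succ, tS, pc]; norm_num
    · intro k _ hk
      have : pc (1-((2*0+2:ℕ):ℚ)) k = 0 := prod_eq_zero (i := 1) (mem_range.2 (by simpa using hk)) (by norm_num)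
      rw [tS, this]; simp
  | succ i ih =>
    have := SS_step0 (m := p-1) (a := 2*i+2) (by omega) (by omega)
    rw [show p-1+1 = p by omega, ih (by omega), mul_zero] at this
    rw [show (((2*(i+1)+2:ℕ)):ℚ) = ((2*i+2:ℕ):ℚ)+2 by push_cast; ring, this]

lemma pc_half (k : ℕ) : pc (1/2) k * 4^k * k.factorial = (2*k).factorial := by
  induction k with
  | zero => simp [pc]
  | succ k ih =>
    rw [pc_succ, show 2*(k+1) = 2*k+1+1 by ring, Nat.factorial_succ, Nat.factorial_succ, Nat.factorial_succ]
    push_cast; rw [← ih]; ring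
lemma pc_natf (a k : ℕ) : pc ((a:ℚ)+1) k * a.factorial = (a+k).factorial := by
  induction k with
  | zero => simp [pc]
  | succ k ih =>
    rw [pc_succ, ← add_assoc, Nat.factorial_succ]
    push_cast; rw [← ih]; ring
lemma pc_negf (k : ℕ) : pc (-(k:ℚ)) k = (-1)^k * k.factorial := by
  unfold pc
  rw [← prod_range_reflect, ← prod_range_add_one_eq_factorial]
  push_cast
  rw [show (-1:ℚ)^k * ∏ x ∈ range k, ((x:ℚ)+1) = ∏ x ∈ range k, (-((x:ℚ)+1)) by rw [prod_neg, card_range]]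
  refine prod_congr rfl fun l hl => ?_
  have := mem_range.1 hl
  rw [Nat.cast_sub (by omega), Nat.cast_sub (by omega)]; push_cast; ring

lemma SS_p (h3 : 3 < p) {n : ℕ} (hn : p = 2*n+1) : SS p (p:ℚ) * fk p n (-1)^2 = 1 := by
  have h := SS_odd h3 n (by omega)
  rw [← hn] at h; rw [h, fk, ← mul_pow]
  have e2 : pc (1 + (p:ℚ)*((-1:ℤ):ℚ)/2) n = (-1)^n * ∏ l ∈ range n, ((2*l+1:ℚ)/2) := by
    unfold pc
    rw [← prod_range_reflect]
    rw [show (-1:ℚ)^n * ∏ l ∈ range n, ((2*l+1:ℚ)/2) = ∏ l ∈ range n, (-((2*l+1:ℚ)/2)) by rw [prod_neg, card_range]]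
    refine prod_congr rfl fun l hl => ?_
    have := mem_range.1 hl
    rw [Nat.cast_sub (by omega), Nat.cast_sub (by omega), hn]; push_cast; ring
  have e3 : (n.factorial:ℚ) = ∏ l ∈ range n, ((l:ℚ)+1) := by rw [← prod_range_add_one_eq_factorial]; push_cast; rfl
  rw [e2, e3]
  have : (∏ l ∈ range n, ((2*l+1:ℚ)/(2*l+2))) * ∏ l ∈ range n, ((l:ℚ)+1) = ∏ l ∈ range n, ((2*l+1:ℚ)/2) := by
    rw [← prod_mul_distrib]; refine prod_congr rfl fun l _ => ?_
    have : (l:ℚ)+1 ≠ 0 := by positivity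
    rw [show (2*l+2:ℚ) = 2*((l:ℚ)+1) by ring]; field_simp
  rw [mul_div_assoc', this]
  have h0 : ∏ l ∈ range n, ((2*l+1:ℚ)/2) ≠ 0 := prod_ne_zero_iff.2 fun l _ => by positivity
  have hs : ((-1:ℚ)^n) ≠ 0 := pow_ne_zero _ (by norm_num)
  rw [div_mul_cancel_right₀ h0, inv_pow, ← pow_mul, mul_comm n 2, pow_mul]; norm_num

lemma tS_symm (a : ℚ) (k : ℕ) : tS (1-a) k = tS a k := by
  unfold tS; rw [sub_sub_cancel]; ring
lemma SS_symm (a : ℚ) (k : ℕ) : SS k (1-a) = SS k a := sum_congr rfl fun _ _ => tS_symm _ _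

lemma SS_mp (h3 : 3 < p) {n : ℕ} (hn : p = 2*n+1) : SS p (-(p:ℚ)) = ((2*p).choose p:ℚ)^2/4^p := by
  rw [← SS_symm, sub_neg_eq_add]
  have h := SS_tele ((p:ℚ)-1) (p-1)
  have z := SS_even h3 (n-1) (by omega)
  rw [show ((2*(n-1)+2:ℕ):ℚ) = (p:ℚ)-1 by rw [hn, show 2*(n-1)+2 = 2*n by omega]; push_cast; ring] at z
  rw [show p-1+1 = p by omega, z, show (p:ℚ)-1+2 = 1+p by ring] at h
  have g1 := pc_half p
  have g2 := pc_natf (p-2) p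
  have g3 := pc_negf (p-1)
  have hc : ((p-1:ℕ):ℚ) = (p:ℚ)-1 := by rw [Nat.cast_sub (by omega)]; simp
  rw [hc] at g3
  have ev : (-1:ℚ)^(p-1) = 1 := Even.neg_one_pow ⟨n, by omega⟩
  rw [ev, one_mul] at g3
  rw [g3] at h
  have hc2 : ((p-2:ℕ):ℚ)+1 = (p:ℚ)-1 := by rw [Nat.cast_sub (by omega)]; push_cast; ring
  rw [hc2] at g2
  have ch : ((2*p).choose p:ℚ) * p.factorial * p.factorial = (2*p).factorial := by
    have := Nat.choose_mul_factorial_mul_factorial (n := 2*p) (k := p) (by omega)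
    rw [show 2*p-p = p by omega] at this; exact_mod_cast this
  have f1 : (p.factorial:ℚ) = p * (p-1) * (p-2).factorial := by
    have := Nat.factorial_succ (p-1); rw [show p-1+1 = p by omega] at this
    have t := Nat.factorial_succ (p-2); rw [show p-2+1 = p-1 by omega] at t
    rw [this, t]; push_cast; rw [hc]; ring
  have f2 : ((p-1).factorial:ℚ) = (p-1) * (p-2).factorial := by
    have t := Nat.factorial_succ (p-2); rw [show p-2+1 = p-1 by omega] at t
    rw [t]; push_cast; rw [hc]
  have f3 : ((2*p).factorial:ℚ) = 2*p*(2*p-1)*(p-2+p).factorial := by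
    have := Nat.factorial_succ (2*p-1); rw [show 2*p-1+1 = 2*p by omega] at this
    have t := Nat.factorial_succ (2*p-2); rw [show 2*p-2+1 = 2*p-1 by omega] at t
    rw [this, t, show p-2+p = 2*p-2 by omega]; push_cast; rw [Nat.cast_sub (by omega)]; push_cast; ring
  have hp1 : (p:ℚ)-1 ≠ 0 := by have : (3:ℚ) < p := by exact_mod_cast h3
                               linarith
  have hp0 : (p:ℚ) ≠ 0 := by have : (3:ℚ) < p := by exact_mod_cast h3
                             linarith
  have n1 : ((p-2).factorial:ℚ) ≠ 0 := by positivity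
  rw [eq_div_iff (by positivity)]
  rw [f2] at h
  rw [f1, f3] at ch
  rw [f1, f3] at g1
  have h' : (p:ℚ)^2*((p:ℚ)-1)^3*((p-2).factorial)^2*SS p (1+p) = 2*(2*p-1)*pc (1/2) p * pc ((p:ℚ)-1) p := by
    field_simp at h
    linear_combination -h
  generalize pc (1/2) p = A at *
  generalize pc ((p:ℚ)-1) p = B at *
  generalize ((p-2).factorial:ℚ) = F at *
  generalize ((p-2+p).factorial:ℚ) = G at *
  generalize ((2*p).choose p:ℚ) = c at *
  generalize SS p (1+(p:ℚ)) = S at *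
  generalize (4:ℚ)^p = w at *
  apply mul_left_cancel₀ (pow_ne_zero 4 (mul_ne_zero (mul_ne_zero hp0 hp1) n1))
  have e1 : c^2*(p*(p-1)*F)^4 = (2*p*(2*p-1)*G)^2 := by rw [← ch]; ring
  linear_combination -e1 + (p:ℚ)^2*(p-1)*F^2*w*h' + (p:ℚ)*F*2*(2*p-1)*B*g1*1 + 2*p*(2*p-1)*G*(2*(2*p-1)*p)*g2

lemma SS_LG (h3 : 3 < p) {n : ℕ} (hn : p = 2*n+1) {α : ℚ} (hα : M p 0 α) : LG p (SS p (p*α)) (-α*p*H1 n) 0 := by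
  obtain ⟨b1, hb1⟩ : ∃ b1 : ℚ, b1 = (p*∑ k ∈ range (p-1), pc (1/2) (k+1)/(k+1).factorial*vv k) := ⟨_, rfl⟩
  obtain ⟨b2, hb2⟩ : ∃ b2 : ℚ, b2 = (-p^2*∑ k ∈ range (p-1), pc (1/2) (k+1)/(k+1).factorial*vv k^2) := ⟨_, rfl⟩
  have Q : ∀ {β : ℚ}, M p 0 β → M p 3 (SS p (p*β) - (1+β*b1+β^2*b2)) := by
    intro β hβ; rw [hb1, hb2]; exact SS_quad h3 hβ
  have q1 := Q M_one
  have q2 := Q M_one.neg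
  have L1 : LG p (SS p (p:ℚ)) (-p*H1 n) 0 := by
    have := ((LGfk h3 hn (-1)).pow h3 2).inv h3
    refine this.congr (eq_inv_of_mul_eq_one_left (SS_p h3 hn)) (by push_cast; ring) (by ring)
  have L2 : LG p (SS p (-(p:ℚ))) (p*H1 n) 0 := by
    have h := ((LGw h3 hn).pow h3 2).inv h3
    have u4 := (U_four h3).pow p
    have c := choose_p h3 2 1
    rw [mul_one, mul_comm p 2] at c
    have k : M p 3 (SS p (-(p:ℚ)) - ((2^(p-1))^2)⁻¹) := by
      rw [SS_mp h3 hn]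
      have := (c.mulr ((M_nat ((2*p).choose p)).add (M_nat 2))).div u4
      refine this.cast ?_
      have : (4:ℚ)^p = 4*((2:ℚ)^(p-1))^2 := by rw [w_eq (p := p) (a := 4), ← pow_mul, mul_comm (p-1) 2, pow_mul]; norm_num
      rw [this]; push_cast; field_simp; norm_num; ring
    exact (h.congr rfl (by push_cast; ring) (by ring)).congrF k
  rw [mul_one] at q1
  rw [mul_neg_one] at q2
  have u2 := U_two h3
  have r1 := L1.2.2.sub q1
  have r2 := L2.2.2.sub q2
  have mA : M p 1 (p*H1 n) := L2.1
  refine ⟨(mA.mulr hα).neg.cast (by ring), M_zero 2, ?_⟩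
  have s1 : M p 3 (b1 + p*H1 n) := ((r1.sub r2).div u2).cast (by ring)
  have s2 : M p 3 (b2 - (p*H1 n)^2/2) := ((r1.add r2).div u2).cast (by ring)
  exact (((Q hα).add (s1.mulr hα)).add (s2.mulr (hα.pow0 2))).cast (by ring)
end

section
variable {p : ℕ} [hp : Fact p.Prime]

lemma H1_odd (h : ℕ) : H1 (2*h) = H1 h/2 + ∑ j ∈ range h, ((2*j+1:ℚ))⁻¹ := by
  induction h with
  | zero => simp [H1]
  | succ h ih =>
    have sH1 : ∀ m, H1 (m+1) = H1 m + vv m := fun m => sum_range_succ _ _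
    rw [show 2*(h+1) = 2*h+1+1 by ring, sH1, sH1, sH1, ih, sum_range_succ, vv, vv, vv]
    have : (h:ℚ)+1 ≠ 0 := by positivity
    have : 2*(h:ℚ)+1 ≠ 0 := by positivity
    rw [show (((2*h+1:ℕ):ℚ)+1) = 2*(h+1) by push_cast; ring]
    push_cast; field_simp; ring
lemma H2_odd (h : ℕ) : H2 (2*h) = H2 h/4 + ∑ j ∈ range h, ((2*j+1:ℚ))⁻¹^2 := by
  induction h with
  | zero => simp [H2]
  | succ h ih =>
    have sH2 : ∀ m, H2 (m+1) = H2 m + vv m^2 := fun m => sum_range_succ _ _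
    rw [show 2*(h+1) = 2*h+1+1 by ring, sH2, sH2, sH2, ih, sum_range_succ, vv, vv, vv]
    have : (h:ℚ)+1 ≠ 0 := by positivity
    have : 2*(h:ℚ)+1 ≠ 0 := by positivity
    rw [show (((2*h+1:ℕ):ℚ)+1) = 2*(h+1) by push_cast; ring]
    push_cast; field_simp; ring
lemma H1_back (n r : ℕ) (h : r ≤ n) : H1 n - H1 (n-r) = ∑ j ∈ range r, vv (n-1-j) := by
  induction r with
  | zero => simp
  | succ r ih =>
    have := ih (by omega)
    rw [sum_range_succ, ← this, show n-r = n-(r+1)+1 by omega, H1, H1, H1, sum_range_succ, show n-1-r = n-(r+1) by omega]; ring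
lemma H2_back (n r : ℕ) (h : r ≤ n) : H2 n - H2 (n-r) = ∑ j ∈ range r, vv (n-1-j)^2 := by
  induction r with
  | zero => simp
  | succ r ih =>
    have := ih (by omega)
    rw [sum_range_succ, ← this, show n-r = n-(r+1)+1 by omega, H2, H2, H2, sum_range_succ, show n-1-r = n-(r+1) by omega]; ring

lemma odd_sum (h3 : 3 < p) {n : ℕ} (hn : p = 2*n+1) {r : ℕ} (hr : r ≤ n) :
    M p 2 (∑ j ∈ range r, ((2*j+1:ℚ))⁻¹ + (H1 n - H1 (n-r))/2 + p/4*(H2 n - H2 (n-r))) ∧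
    M p 1 (∑ j ∈ range r, ((2*j+1:ℚ))⁻¹^2 - (H2 n - H2 (n-r))/4) := by
  rw [H1_back n r hr, H2_back n r hr]
  have main : ∀ j ∈ range r, ∃ m : ℚ, U p m ∧ vv (n-1-j) = m⁻¹ ∧ (2*j+1:ℚ) = p - 2*m ∧ U p (p-2*m) := by
    intro j hj
    have hj := mem_range.1 hj
    refine ⟨((n-j:ℕ):ℚ), U_lt (by omega) (by omega), ?_, ?_, ?_⟩
    · rw [vv, show n-j = n-1-j+1 by omega]; push_cast; rfl
    · rw [hn, Nat.cast_sub (by omega)]; push_cast; ring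
    · have := U_lt (p := p) (z := 2*j+1) (by omega) (by omega)
      have e : (p:ℚ) - 2*((n-j:ℕ):ℚ) = ((2*j+1:ℕ):ℚ) := ?_
      · rw [e]; exact this
      rw [hn, Nat.cast_sub (by omega)]; push_cast; ring
  have u4 := U_four h3
  constructor
  · have : M p 2 (∑ j ∈ range r, (((2*j+1:ℚ))⁻¹ + vv (n-1-j)/2 + p/4*vv (n-1-j)^2)) := by
      refine M_sum _ _ fun j hj => ?_
      obtain ⟨m, um, e1, e2, ud⟩ := main j hj
      rw [e1, e2]
      have := (M_ppow (p := p) 2).div ((u4.mul (um.pow 2)).mul ud)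
      refine this.cast ?_
      have := um.ne; have := ud.ne
      field_simp; ring
    refine this.cast ?_
    rw [sum_add_distrib, sum_add_distrib, mul_sum, sum_div]
  · have : M p 1 (∑ j ∈ range r, (((2*j+1:ℚ))⁻¹^2 - vv (n-1-j)^2/4)) := by
      refine M_sum _ _ fun j hj => ?_
      obtain ⟨m, um, e1, e2, ud⟩ := main j hj
      rw [e1, e2]
      have := ((M_p (p := p)).mulr (((M_nat 4).m0 um.m0).sub M_p.z)).div ((u4.mul (um.pow 2)).mul (ud.pow 2))
      refine this.cast ?_
      have := um.ne; have := ud.ne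
      field_simp; push_cast; ring
    refine this.cast ?_
    rw [sum_sub_distrib, sum_div]

def FF (x : ℚ) (m : ℕ) : ℚ := ∏ l ∈ range m, (1+x*vv l)
lemma FF_pc (x : ℚ) (m : ℕ) : FF x m * m.factorial = pc (x+1) m := by
  induction m with
  | zero => simp [FF, pc]
  | succ m ih =>
    rw [pc_succ, ← ih, FF, prod_range_succ, ← FF, Nat.factorial_succ, vv]
    have : (m:ℚ)+1 ≠ 0 := by positivity
    push_cast; field_simp; ring
lemma fac_FF (c m : ℕ) : ((c+m).factorial:ℚ) = c.factorial * m.factorial * FF c m := by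
  rw [← pc_natf, ← FF_pc]; ring
lemma FF_ne (c m : ℕ) : FF (c:ℚ) m ≠ 0 := prod_ne_zero_iff.2 fun l _ => by unfold vv; positivity
lemma bin1 (n k c : ℕ) (h : k ≤ n) : ((n+c).choose k:ℚ) = n.choose k * (FF c n / FF c (n-k)) := by
  rw [Nat.cast_choose ℚ h, Nat.cast_choose ℚ (by omega : k ≤ n+c), show n+c-k = c+(n-k) by omega, add_comm n c, fac_FF, fac_FF]
  have := FF_ne c (n-k)
  have a1 : (c.factorial:ℚ) ≠ 0 := by positivity
  have a2 : ((n-k).factorial:ℚ) ≠ 0 := by positivity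
  have a3 : (k.factorial:ℚ) ≠ 0 := by positivity
  field_simp
lemma bin2 (n k c : ℕ) (h : k ≤ n) : ((n+2*c).choose (c+k):ℚ) = (2*c).choose c * n.choose k * (FF (2*c:ℕ) n / (FF c k * FF c (n-k))) := by
  rw [Nat.cast_choose ℚ h, Nat.cast_choose ℚ (by omega : c+k ≤ n+2*c), Nat.cast_choose ℚ (by omega : c ≤ 2*c), show n+2*c-(c+k) = c+(n-k) by omega, add_comm n (2*c), fac_FF, fac_FF, fac_FF, show 2*c-c = c by omega]
  have := FF_ne c (n-k)
  have := FF_ne c k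
  have a1 : (c.factorial:ℚ) ≠ 0 := by positivity
  have a2 : ((n-k).factorial:ℚ) ≠ 0 := by positivity
  have a3 : (k.factorial:ℚ) ≠ 0 := by positivity
  field_simp
lemma choose_down (N k : ℕ) (h : k ≤ N) : ((N+1:ℕ):ℚ) * N.choose k = ((N+1).choose k) * ((N:ℚ)+1-k) := by
  have := Nat.add_one_mul_choose_eq N k
  have h2 := Nat.choose_succ_right_eq (N+1) k
  have := this
  have e : (N+1).choose (k+1) * (k+1) = (N+1).choose k * (N+1-k) := h2
  have t : (N+1) * N.choose k = (N+1).choose k * (N+1-k) := by rw [← e]; exact this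
  have : (((N+1) * N.choose k : ℕ):ℚ) = ((N+1).choose k * (N+1-k) : ℕ) := by rw [t]
  push_cast [Nat.cast_sub (show k ≤ N+1 by omega)] at this
  push_cast; exact this

lemma FF_back (x : ℚ) (n r : ℕ) (h : r ≤ n) : FF x n = FF x (n-r) * ∏ j ∈ range r, (1+x*vv (n-1-j)) := by
  induction r with
  | zero => simp
  | succ r ih =>
    rw [ih (by omega), prod_range_succ, show n-r = n-(r+1)+1 by omega, FF, prod_range_succ, ← FF, show n-1-r = n-(r+1) by omega]; ring
end

def TP (p : ℕ) (f a b c : ℚ) : Prop := M p 0 a ∧ M p 0 b ∧ M p 0 c ∧ M p 3 (f - (a + b*p + c*p^2))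

section
variable {p : ℕ} [hp : Fact p.Prime]

lemma TP.add {f a b c f' a' b' c' : ℚ} (h : TP p f a b c) (h' : TP p f' a' b' c') : TP p (f+f') (a+a') (b+b') (c+c') :=
  ⟨h.1.add h'.1, h.2.1.add h'.2.1, h.2.2.1.add h'.2.2.1, (h.2.2.2.add h'.2.2.2).cast (by ring)⟩
lemma TP.mul {f a b c f' a' b' c' : ℚ} (h : TP p f a b c) (h' : TP p f' a' b' c') : TP p (f*f') (a*a') (a*b'+b*a') (a*c'+b*b'+c*a') := by
  obtain ⟨h1, h2, h3, h4⟩ := h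
  obtain ⟨k1, k2, k3, k4⟩ := h'
  have mp : M p 0 (p:ℚ) := M_p.z
  refine ⟨h1.m0 k1, (h1.m0 k2).add (h2.m0 k1), ((h1.m0 k3).add (h2.m0 k2)).add (h3.m0 k1), ?_⟩
  have m0 : M p 0 (a + b*p + c*p^2) := (h1.add (h2.m0 mp)).add (h3.m0 (mp.pow0 2))
  have m0' : M p 0 (a' + b'*p + c'*p^2) := (k1.add (k2.m0 mp)).add (k3.m0 (mp.pow0 2))
  have e1 := h4.mulr (k4.of0 m0')
  have e2 := k4.mulr m0
  have e3 := (M_ppow (p := p) 3).mulr (((h2.m0 k3).add (h3.m0 k2)).add ((h3.m0 k3).m0 mp))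
  exact ((e1.add e2).add e3).cast (by ring)
lemma TP.c {a : ℚ} (h : M p 0 a) : TP p a a 0 0 := ⟨h, M_zero 0, M_zero 0, (M_zero 3).cast (by ring)⟩
lemma TP.l {a b : ℚ} (h : M p 0 a) (h' : M p 0 b) : TP p (a+b*p) a b 0 := ⟨h, h', M_zero 0, (M_zero 3).cast (by ring)⟩
lemma TP.fin {f a b c : ℚ} (h : TP p f a b c) (ha : a = 0) (hb : b = 0) (hc : c = 0) : M p 3 f := by
  subst ha hb hc; exact h.2.2.2.cast (by ring)
lemma LG.tp (h3 : 3 < p) {f a b x y : ℚ} (h : LG p f a b) (hx : M p 0 x) (hy : M p 0 y) (ea : a = x*p) (eb : b = y*p^2) : TP p f 1 x (x^2/2+y) := by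
  subst ea eb
  exact ⟨M_one, hx, ((hx.pow0 2).div (U_two h3)).add hy, h.2.2.cast (by ring)⟩
lemma LG.shift (h3 : 3 < p) {f a b a' d : ℚ} (h : LG p f a b) (hd : M p 2 d) (h' : M p 3 (a - (a'+d))) : LG p f a' (b+d) := by
  obtain ⟨h1, h2, h4⟩ := h
  have ma' : M p 1 a' := ((h1.sub (h'.mono (by omega))).sub (hd.mono (by omega))).cast (by ring)
  refine ⟨ma', h2.add hd, ?_⟩
  have u2 := U_two h3
  have e1 := (h'.mulr (h1.z.add (ma'.z.add hd.z))).div u2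
  have e2 := ma'.m12 hd
  have e3 := (hd.m22 hd).div u2
  exact ((((h4.add h').add e1).add e2).add e3).cast (by ring)

lemma M_H1 {r : ℕ} (hr : r < p) : M p 0 (H1 r) := M_sum _ _ fun l hl => M_vv (by have := mem_range.1 hl; omega)

lemma T1_P (h3 : 3 < p) {h : ℕ} (hh : 6*h < p) (j : ℕ) (hj : j ≤ h) : M p 3 (SS p (p/3-2*j) - (∏ i ∈ range j, ((2*i+1-p/3:ℚ)/(2*i+2-p/3)))^2 * SS p (p/3)) := by
  have u3 := U_three h3
  induction j with
  | zero => simp; exact M_zero 3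
  | succ j ih =>
    have ih := ih (by omega)
    have ua : U p ((p:ℚ)/3-2*((j+1:ℕ):ℚ)) := by
      have := (U_lt (p := p) (z := p-6*(j+1)) (by omega) (by omega)).div u3
      rw [Nat.cast_sub (by omega)] at this
      convert this using 1; push_cast; ring
    have ua1 : U p (1+((p:ℚ)/3-2*((j+1:ℕ):ℚ))) := by
      have := (U_lt (p := p) (z := p-(6*j+3)) (by omega) (by omega)).div u3
      rw [Nat.cast_sub (by omega)] at this
      convert this using 1; push_cast; ring
    have s := SS_step h3 ua ua1
    rw [show (p:ℚ)/3-2*((j+1:ℕ):ℚ)+2 = p/3-2*j by push_cast; ring] at s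
    rw [prod_range_succ]
    apply (ua.pow 2).cancel
    refine (s.add (ih.mulr (ua1.m0.pow0 2))).cast ?_
    have e : (p:ℚ)/3-2*((j+1:ℕ):ℚ) ≠ 0 := ua.ne
    have e1 : (2*j+2-p/3:ℚ) = -((p:ℚ)/3-2*((j+1:ℕ):ℚ)) := by push_cast; ring
    have e2 : (2*j+1-p/3:ℚ) = -(1+((p:ℚ)/3-2*((j+1:ℕ):ℚ))) := by push_cast; ring
    rw [e1, e2]
    generalize (p:ℚ)/3-2*((j+1:ℕ):ℚ) = A at *
    generalize ∏ i ∈ range j, ((2*i+1-p/3:ℚ)/(2*i+2-p/3)) = B at *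
    field_simp; ring

lemma T1_prod {h n : ℕ} (hp2 : p = 2*n+1) (hh : h ≤ n) : ∏ i ∈ range h, ((2*i+1-p/3:ℚ)/(2*i+2-p/3)) = (-1)^h * n.choose h * (∏ j ∈ range h, (1+(-p/3:ℚ)*vv (n-1-j))) / FF (-p/6) h := by
  have e1 : ∏ i ∈ range h, (2*i+1-p/3:ℚ) = (-1)^h * (2^h * (n.choose h * h.factorial)) * ∏ j ∈ range h, (1+(-p/3:ℚ)*vv (n-1-j)) := by
    rw [← ff_nat, ff, show (-1:ℚ)^h * (2^h * ∏ i ∈ range h, ((n:ℚ)-i)) = ∏ i ∈ range h, (-(2*((n:ℚ)-i))) by rw [prod_neg, card_range, prod_mul_distrib, prod_const, card_range], ← prod_mul_distrib]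
    refine prod_congr rfl fun i hi => ?_
    have := mem_range.1 hi
    have e : (n:ℚ)-i = ((n-1-i:ℕ):ℚ)+1 := by rw [Nat.sub_sub, Nat.cast_sub (by omega)]; push_cast; ring
    have : (((n-1-i:ℕ):ℚ)+1) ≠ 0 := by positivity
    rw [vv, ← e] at *
    field_simp; rw [hp2]; push_cast; ring
  have e2 : ∏ i ∈ range h, (2*i+2-p/3:ℚ) = 2^h * h.factorial * FF (-p/6) h := by
    rw [← prod_range_add_one_eq_factorial, FF]; push_cast
    rw [show (2:ℚ)^h * ∏ x ∈ range h, ((x:ℚ)+1) = ∏ x ∈ range h, (2*((x:ℚ)+1)) by rw [prod_mul_distrib, prod_const, card_range], ← prod_mul_distrib]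
    refine prod_congr rfl fun i hi => ?_
    rw [vv]
    have : (i:ℚ)+1 ≠ 0 := by positivity
    field_simp; ring
  rw [prod_div_distrib, e1, e2]
  have : (h.factorial:ℚ) ≠ 0 := by positivity
  field_simp

lemma AA_tS (k : ℕ) : AA k * (1/108)^k = tS (1/3) k := by
  induction k with
  | zero => simp [tS, pc, AA_0]
  | succ k ih =>
    have h := AA_succ k
    rw [PPl] at h
    have e : tS (1/3) (k+1) = tS (1/3) k * (((k:ℚ)+1/2)*(k+1/3)*(k+2/3)/(k+1)^3) := by
      rw [tS, pc_succ, pc_succ, pc_succ, Nat.factorial_succ, tS]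
      have : (k.factorial:ℚ) ≠ 0 := by positivity
      have : (k:ℚ)+1 ≠ 0 := by positivity
      push_cast; field_simp; ring
    rw [e, ← ih, pow_succ]
    have : (k:ℚ)+1 ≠ 0 := by positivity
    rw [div_pow, one_pow]
    field_simp
    linear_combination 18*h
lemma Szz_SS (i : ℕ) : Szz p i (1/108) = ∑ k ∈ range p, (k:ℚ)^i*tS (1/3) k := by
  unfold Szz; refine sum_congr rfl fun k _ => ?_
  rw [← AA_tS]; ring
end

section
variable {p : ℕ} [hp : Fact p.Prime]

lemma harm_rel (h3 : 3 < p) {h : ℕ} (hh : p = 6*h+1) :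
    M p 2 (H1 h - (H1 (2*h) + H1 (3*h) - p/2*H2 (2*h))) ∧ M p 1 (H2 h - 5*H2 (2*h)) := by
  obtain ⟨o1, o2⟩ := odd_sum h3 (n := 3*h) (by omega) (r := h) (by omega)
  rw [show 3*h-h = 2*h by omega] at o1 o2
  have z := H2_half h3 (n := 3*h) (by omega)
  have u4 := U_four h3
  constructor
  · have := (o1.sub ((M_p.m11 z).div u4)).mulr (M_nat 2)
    refine this.neg.cast ?_
    rw [H1_odd] ; push_cast; ring
  · have := (o2.add (z.div u4)).mulr (M_nat 4)
    refine this.neg.cast ?_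
    push_cast; linear_combination -4*H2_odd h

/-- normalized logarithms: `c` multiplier -/
lemma LGn (h3 : 3 < p) {h : ℕ} (hh : p = 6*h+1) {c : ℚ} (hc : M p 0 c) : LG p (FF (c*p) (3*h)) (c*(p*H1 (3*h))) 0 := by
  have hx : M p 1 (c*p) := (M_p.mulr hc).cast (by ring)
  have := LGv h3 (r := 3*h) (by omega) hx
  have z := H2_half h3 (n := 3*h) (by omega)
  refine (this.congrM (b' := 0) ?_).congr rfl (by ring) rfl
  exact ((hx.sq1.mul z).div (U_two h3)).cast (by ring)
lemma LG2h (h3 : 3 < p) {h : ℕ} (hh : p = 6*h+1) {c : ℚ} (hc : M p 0 c) : LG p (FF (c*p) (2*h)) (c*(p*H1 (2*h))) (-(c^2/2)*(p^2*H2 (2*h))) := by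
  have hx : M p 1 (c*p) := (M_p.mulr hc).cast (by ring)
  exact (LGv h3 (r := 2*h) (by omega) hx).congr rfl (by ring) (by ring)
lemma LGh (h3 : 3 < p) {h : ℕ} (hh : p = 6*h+1) {c : ℚ} (hc : M p 0 c) : LG p (FF (c*p) h) (c*(p*H1 (2*h)+p*H1 (3*h))) ((-(c/2)-5*c^2/2)*(p^2*H2 (2*h))) := by
  have hx : M p 1 (c*p) := (M_p.mulr hc).cast (by ring)
  have l := (LGv h3 (r := h) (by omega) hx)
  obtain ⟨r1, r2⟩ := harm_rel h3 hh
  have mq : M p 0 (H2 (2*h)) := M_H2 (by omega)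
  have l2 := l.congrM (b' := -(c*p)^2/2*(5*H2 (2*h))) (((hx.sq1.mul r2).div (U_two h3)).cast (by ring))
  have l3 := l2.shift h3 (a' := c*(p*H1 (2*h)+p*H1 (3*h))) (d := -(c/2)*(p^2*H2 (2*h))) ?_ ?_
  · exact l3.congr rfl rfl (by ring)
  · exact (((M_ppow 2).mulr ((hc.m0 mq).div (U_two h3))).neg).cast (by ring)
  · exact ((hx.m12 r1)).cast (by ring)

def KQ (p h : ℕ) : ℚ := (p-1)*(15/8*(3*h).choose h - 5/4*((9*h).choose h + (9*h).choose (2*h)) + 3/8*((15*h).choose h + (15*h).choose (2*h)+(15*h).choose (7*h)))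

lemma KQ_T1 (h3 : 3 < p) {h : ℕ} (hh : p = 6*h+1) : M p 3 (Szz p 0 (1/108) - KQ p h^2) ∧ U p (KQ p h) := by
  have u2 := U_two h3
  have u3 := U_three h3
  have m2 : M p 0 (1/2:ℚ) := M_one.div u2
  have m3 : M p 0 (1/3:ℚ) := M_one.div u3
  obtain ⟨B, hB⟩ : ∃ B, B = H1 (2*h) := ⟨_, rfl⟩
  obtain ⟨N, hN⟩ : ∃ N, N = H1 (3*h) := ⟨_, rfl⟩
  obtain ⟨q, hq⟩ : ∃ q, q = H2 (2*h) := ⟨_, rfl⟩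
  have mB : M p 0 B := hB ▸ M_H1 (by omega)
  have mN : M p 0 N := hN ▸ M_H1 (by omega)
  have mq : M p 0 q := hq ▸ M_H2 (by omega)
  have Ln : ∀ {c : ℚ}, M p 0 c → LG p (FF (c*p) (3*h)) (c*(p*N)) 0 := fun hc => hN ▸ LGn h3 hh hc
  have L2 : ∀ {c : ℚ}, M p 0 c → LG p (FF (c*p) (2*h)) (c*(p*B)) (-(c^2/2)*(p^2*q)) := fun hc => hB ▸ hq ▸ LG2h h3 hh hc
  have L1 : ∀ {c : ℚ}, M p 0 c → LG p (FF (c*p) h) (c*(p*B+p*N)) ((-(c/2)-5*c^2/2)*(p^2*q)) := fun hc => hB ▸ hq ▸ hN ▸ LGh h3 hh hc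
  obtain ⟨C, hC⟩ : ∃ C, C = ((3*h).choose h : ℚ) := ⟨_, rfl⟩
  have mC : M p 0 C := hC ▸ M_nat _
  -- T side
  obtain ⟨g, hg⟩ : ∃ g : ℚ, g = 1 + (B/2-N/3)*p + ((B/2-N/3)^2/2+q/24)*p^2 := ⟨_, rfl⟩
  have u24 : U p (24:ℚ) := by have := (u2.pow 3).mul u3; norm_num at this; exact this
  have ma : M p 0 (B/2-N/3) := (mB.div u2).sub (mN.div u3)
  have Lg : LG p g ((B/2-N/3)*p) (q/24*p^2) := by
    refine ⟨(M_p.mulr ma).cast (by ring), ((M_ppow 2).mulr (mq.div u24)).cast (by ring), (M_zero 3).cast (by rw [hg]; ring)⟩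
  have mg : M p 0 g := Lg.m0 h3
  have T : M p 3 (Szz p 0 (1/108) - C^2*g^2) := by
    have e : Szz p 0 (1/108) = SS p (1/3) := by rw [Szz_SS]; unfold SS; simp
    have t := T1_P h3 (h := h) (by omega) h le_rfl
    rw [show (p:ℚ)/3-2*h = 1/3 by rw [hh]; push_cast; ring, ← e, T1_prod (n := 3*h) (by omega) (by omega)] at t
    have fb := FF_back (-p/3) (3*h) h (by omega)
    rw [show 3*h-h = 2*h by omega] at fb
    have l3 := Ln m3.neg
    have l2 := L2 m3.neg
    have m6 : M p 0 (1/6:ℚ) := by have := M_one (p := p) |>.div (u2.mul u3); norm_num at this ⊢; exact this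
    have l1 := L1 m6.neg
    rw [show (-(1/3)*p:ℚ) = -p/3 by ring] at l3 l2
    rw [show (-(1/6)*p:ℚ) = -p/6 by ring] at l1
    have ls := SS_LG h3 (n := 3*h) (by omega) m3
    rw [show (p:ℚ)*(1/3) = p/3 by ring, ← hN] at ls
    have tot := (((l3.div h3 l2).div h3 l1).pow h3 2).mul h3 ls
    have lg2 := Lg.pow h3 2
    have fin := (tot.congr (a' := ((2:ℕ):ℚ)*((B/2-N/3)*p)) (b' := ((2:ℕ):ℚ)*(q/24*p^2)) rfl (by push_cast; ring) (by push_cast; ring)).eq' lg2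
    refine (t.add (fin.mulr (mC.pow0 2))).cast ?_
    have n1 : FF (-(p:ℚ)/3) (2*h) ≠ 0 := (l2.u h3).ne
    rw [← hC, fb, mul_div_cancel_left₀ _ n1]
    have sg : ((-1:ℚ)^h)^2 = 1 := by rw [← pow_mul, mul_comm, pow_mul]; norm_num
    linear_combination (C * (∏ j ∈ range h, (1+(-p/3:ℚ)*vv (3*h-1-j))) / FF (-p/6) h)^2*SS p (p/3)*sg
  -- K side
  have K : M p 3 (KQ p h + C*g) := by
    have m1 : M p 0 (1:ℚ) := M_one
    have mm2 : M p 0 (2:ℚ) := u2.m0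
    have l31 := Ln m1
    have l21 := L2 m1
    have l11 := L1 m1
    have l32 := Ln mm2
    have l22 := L2 mm2
    have l12 := L1 mm2
    have t1 := (l31.div h3 l21).tp h3 (x := N-B) (y := q/2) (mN.sub mB) (mq.div u2) (by ring) (by ring)
    have t2 := (l31.div h3 l11).tp h3 (x := -B) (y := 3*q) mB.neg (u3.m0.m0 mq) (by ring) (by ring)
    have t3 := (l32.div h3 l22).tp h3 (x := 2*N-2*B) (y := 2*q) ((mm2.m0 mN).sub (mm2.m0 mB)) (mm2.m0 mq) (by ring) (by ring)
    have t4 := (l32.div h3 l12).tp h3 (x := -2*B) (y := 11*q) ((mm2.neg.m0 mB).cast (by ring)) (((M_nat 11).m0 mq).cast (by push_cast; ring)) (by ring) (by ring)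
    have t5 := (l32.div h3 (l11.mul h3 l21)).tp h3 (x := N-2*B) (y := 7/2*q) (mN.sub (mm2.m0 mB)) ((((M_nat 7).m0 mq).div u2).cast (by push_cast; ring)) (by ring) (by ring)
    have cc := choose_p h3 2 1
    rw [mul_one, mul_comm p 2] at cc
    have tc : TP p ((2*p).choose p : ℚ) 2 0 0 := ⟨mm2, M_zero 0, M_zero 0, cc.cast (by norm_num [Nat.choose])⟩
    obtain ⟨f1, hf1⟩ : ∃ f, f = FF (1*p) (3*h)/FF (1*p) (2*h) := ⟨_, rfl⟩
    obtain ⟨f2, hf2⟩ : ∃ f, f = FF (1*p) (3*h)/FF (1*p) h := ⟨_, rfl⟩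
    obtain ⟨f3, hf3⟩ : ∃ f, f = FF (2*p) (3*h)/FF (2*p) (2*h) := ⟨_, rfl⟩
    obtain ⟨f4, hf4⟩ : ∃ f, f = FF (2*p) (3*h)/FF (2*p) h := ⟨_, rfl⟩
    obtain ⟨f5, hf5⟩ : ∃ f, f = FF (2*p) (3*h)/(FF (1*p) h*FF (1*p) (2*h)) := ⟨_, rfl⟩
    rw [← hf1] at t1; rw [← hf2] at t2; rw [← hf3] at t3; rw [← hf4] at t4; rw [← hf5] at t5
    have e0 : (h:ℚ) = -1/6+1/6*p := by rw [hh]; push_cast; ring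
    have b1 := bin1 (3*h) h p (by omega)
    have b2 := bin1 (3*h) (2*h) p (by omega)
    have b3 := bin1 (3*h) h (2*p) (by omega)
    have b4 := bin1 (3*h) (2*h) (2*p) (by omega)
    have b5 := bin2 (3*h) h p (by omega)
    have hCs : ((3*h).choose (2*h):ℚ) = C := by rw [hC, ← Nat.choose_symm (by omega : h ≤ 3*h), show 3*h-h = 2*h by omega]
    rw [show 3*h-h = 2*h by omega] at b1 b3 b5
    rw [show 3*h-2*h = h by omega, hCs] at b2 b4
    rw [← hC] at b1 b3 b5
    push_cast at b3 b4 b5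
    rw [← one_mul (p:ℚ), ← hf1] at b1
    rw [← one_mul (p:ℚ), ← hf2] at b2
    rw [← hf3] at b3; rw [← hf4] at b4
    rw [show FF (p:ℚ) h * FF p (2*h) = FF (1*p) h * FF (1*p) (2*h) by rw [one_mul], ← hf5] at b5
    have d1 := choose_down (9*h) h (by omega)
    have d2 := choose_down (9*h) (2*h) (by omega)
    rw [show 9*h+1 = 3*h+p by omega, b1] at d1
    rw [show 9*h+1 = 3*h+p by omega, b2] at d2
    have d3 := choose_down (15*h) h (by omega)
    have d3' := choose_down (15*h+1) h (by omega)
    have d4 := choose_down (15*h) (2*h) (by omega)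
    have d4' := choose_down (15*h+1) (2*h) (by omega)
    have d5 := Nat.add_one_mul_choose_eq (15*h) (7*h)
    have d5' := choose_down (15*h+1) (7*h+1) (by omega)
    rw [show 15*h+1+1 = 3*h+2*p by omega, b3] at d3'
    rw [show 15*h+1+1 = 3*h+2*p by omega, b4] at d4'
    rw [show 15*h+1+1 = 3*h+2*p by omega, show 7*h+1 = p+h by omega, b5] at d5'
    rw [show 7*h+1 = p+h by omega] at d5
    have d5 : ((15*h+1:ℕ):ℚ) * ((15*h).choose (7*h):ℚ) = ((15*h+1).choose (p+h):ℚ) * (p+h) := by exact_mod_cast d5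
    have u1 : U p (-1/2+3/2*p:ℚ) := by
      have : U p (-1/2:ℚ) := (U_one.neg).div u2
      exact this.congr ((M_p.mulr (u3.m0.div u2)).cast (by ring))
    have m5 : M p 0 (5:ℚ) := by exact_mod_cast M_nat (p := p) 5
    have u5 : U p (-1/2+5/2*p:ℚ) := by
      have : U p (-1/2:ℚ) := (U_one.neg).div u2
      exact this.congr ((M_p.mulr (m5.div u2)).cast (by ring))
    have u6 : U p (-3/2+5/2*p:ℚ) := by
      have : U p (-3/2:ℚ) := (u3.neg).div u2
      exact this.congr ((M_p.mulr (m5.div u2)).cast (by ring))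
    push_cast at d1 d2 d3 d3' d4 d4' d5 d5'
    rw [e0] at d1 d2 d3 d3' d4 d4' d5 d5'
    have m6 : M p 0 (1/6:ℚ) := by have := M_one (p := p) |>.div (u2.mul u3); norm_num at this ⊢; exact this
    have mk : ∀ z : ℤ, M p 0 ((z:ℚ)/24) := fun z => (M_int z).div u24
    have tl : ∀ z w : ℤ, TP p ((z:ℚ)/24 + (w:ℚ)/24*p) ((z:ℚ)/24) ((w:ℚ)/24) 0 := fun z w => TP.l (mk z) (mk w)
    have tg : TP p g 1 (B/2-N/3) ((B/2-N/3)^2/2+q/24) := Lg.tp h3 ma (mq.div u24) rfl rfl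
    have tD1 := tl (-12) 36
    have tD5 := tl (-12) 60
    have tD6 := tl (-36) 60
    have x1 := ((tl 45 0).mul tD1).mul (tD5.mul tD6)
    have x2 := ((tl (-30) 0).mul (tD5.mul tD6)).mul (((tl (-8) 32).mul t1).add ((tl (-4) 28).mul t2))
    have x3 := ((tl 9 0).mul tD1).mul (((((tl (-8) 56).mul (tl (-32) 56)).mul t3).add (((tl (-4) 52).mul (tl (-28) 52)).mul t4)).add ((((tl (-4) 28).mul (tl (-8) 32)).mul t5).mul tc))
    have x4 := ((tl (-24) 24).mul ((x1.add x2).add x3)).add ((tD1.mul (tD5.mul tD6)).mul tg)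
    have x5 := x4.fin (by push_cast; ring) (by push_cast; ring) (by push_cast; ring)
    apply (u1.mul (u5.mul u6)).cancel
    refine (x5.mulr mC).cast ?_
    unfold KQ
    rw [← hC]
    push_cast
    clear x1 x2 x3 x4 x5 tD1 tD5 tD6 t1 t2 t3 t4 t5
    generalize ((9*h).choose h : ℚ) = c1 at *
    generalize ((9*h).choose (2*h) : ℚ) = c2 at *
    generalize ((15*h).choose h : ℚ) = c3 at *
    generalize ((15*h).choose (2*h) : ℚ) = c4 at *
    generalize ((15*h).choose (7*h) : ℚ) = c5 at *
    generalize ((15*h+1).choose h : ℚ) = c6 at *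
    generalize ((15*h+1).choose (2*h) : ℚ) = c7 at *
    generalize ((15*h+1).choose (p+h) : ℚ) = c8 at *
    generalize ((2*p).choose p : ℚ) = c9 at *
    generalize (p:ℚ) = P at *
    linear_combination (P-1)*(-5/4*((-1/2+5/2*P)*(-3/2+5/2*P))*(d1+d2) + 3/8*(-1/2+3/2*P)*((-1/2+5/2*P)*(d3+d4+d5) + (-4/3+7/3*P)*d3' + (-7/6+13/6*P)*d4'+(-1/6+7/6*P)*d5'))
  have mK : M p 0 (KQ p h) := ((K.z).sub (mC.m0 mg)).cast (by ring)
  refine ⟨(T.sub (K.mulr (mK.sub (mC.m0 mg)))).cast (by ring), ?_⟩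
  have uC : U p C := by
    rw [hC]
    refine U_nat fun hd => ?_
    have := (hp.out.dvd_factorial).1 ((hd.mul_right _).mul_right _ |>.trans (Nat.choose_mul_factorial_mul_factorial (show h ≤ 3*h by omega)).dvd)
    omega
  exact ((uC.mul (Lg.u h3)).neg).congr ((K.mono (by omega)).cast (by ring))
end

def hexA (F : ℕ → ℤ) (h : ℕ) : ℤ := ∑ i ∈ range h, (F (6*i) - F (6*i+2) - F (6*i+3) + F (6*i+5))
def hexB (F : ℕ → ℤ) (h : ℕ) : ℤ := ∑ i ∈ range h, (F (6*i+1) + F (6*i+2) - F (6*i+4) - F (6*i+5))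

lemma hex_sum {R : Type*} [CommRing R] (z : R) (F : ℕ → ℤ) (h : ℕ) :
    (z^2-z+1) ∣ (∑ j ∈ range (6*h), z^j*(F j:R)) - ((hexA F h:R) + (hexB F h:R)*z) := by
  induction h with
  | zero => simp [hexA, hexB]
  | succ h ih =>
    obtain ⟨c, hc⟩ := ih
    have h6 : (z^2-z+1) ∣ z^(6*h) - 1 := by
      have : z^6-1 ∣ (z^6)^h-1^h := sub_dvd_pow_sub_pow _ _ _
      rw [one_pow, ← pow_mul] at this
      exact Dvd.dvd.trans ⟨(z+1)*(z^3-1), by ring⟩ this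
    obtain ⟨d, hd⟩ := h6
    have hd' : z^(6*h) = 1+(z^2-z+1)*d := by rw [← hd]; ring
    rw [hexA, hexB, sum_range_succ, sum_range_succ, ← hexA, ← hexB, show 6*(h+1) = 6*h+1+1+1+1+1+1 by ring]
    simp only [sum_range_succ]
    generalize (F (6*h)) = a0 at *
    simp only [add_assoc, Nat.reduceAdd]
    simp only [pow_add, hd']
    rw [sub_eq_iff_eq_add.1 hc]
    push_cast
    refine ⟨c + d*(a0 + z*F (6*h+1)+z^2*F (6*h+2)+z^3*F (6*h+3)+z^4*F (6*h+4)+z^5*F (6*h+5)) + F (6*h+2) + (z+1)*F (6*h+3) + (z^2+z)*F (6*h+4) + (z^3+z^2-1)*F (6*h+5), ?_⟩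
    ring

section
variable {p : ℕ} [hp : Fact p.Prime]

lemma sum_gen {R : Type*} [AddCommMonoid R] (g : (ZMod p)ˣ) (hg : ∀ x, x ∈ Subgroup.zpowers g) (f : ZMod p → R) (h0 : f 0 = 0) :
    ∑ x, f x = ∑ j ∈ range (p-1), f ((g:ZMod p)^j) := by
  have ho : orderOf g = p-1 := by
    rw [orderOf_eq_card_of_forall_mem_zpowers hg, Nat.card_eq_fintype_card, ZMod.card_units]
  have hi : Set.InjOn (fun j => (g:ZMod p)^j) (range (p-1)) := by
    intro a ha b hb hab
    have : g^a = g^b := Units.ext (by simpa using hab)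
    rw [coe_range, ← ho] at ha hb
    exact pow_injOn_Iio_orderOf ha hb this
  rw [← sum_image (f := f) hi]
  symm
  refine sum_subset (subset_univ _) fun x _ hx => ?_
  by_contra hne
  have x0 : x ≠ 0 := fun e => hne (e ▸ h0)
  apply hx
  have := hg (Units.mk0 x x0)
  have h2 : Units.mk0 x x0 ∈ Submonoid.powers g := (mem_powers_iff_mem_zpowers).2 this
  obtain ⟨k, hk⟩ := h2
  rw [mem_image]
  refine ⟨k % (p-1), mem_range.2 (Nat.mod_lt _ (by have := hp.out.two_le; omega)), ?_⟩
  have : g^(k % (p-1)) = Units.mk0 x x0 := by rw [← ho, pow_mod_orderOf]; exact hk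
  have := congrArg (Units.val) this
  simpa using this

def Fq (g : (ZMod p)ˣ) (j : ℕ) : ℤ := quadraticChar (ZMod p) (1 - (g:ZMod p)^j)

lemma hex_norm (h3 : 3 < p) {h : ℕ} (hh : p = 6*h+1) (g : (ZMod p)ˣ) (hg : ∀ x, x ∈ Subgroup.zpowers g) :
    (hexA (Fq g) h)^2 + (hexA (Fq g) h)*(hexB (Fq g) h) + (hexB (Fq g) h)^2 = p := by
  obtain ⟨z, hz⟩ : ∃ z : ℂ, z^2-z+1 = 0 := by
    obtain ⟨z, hz⟩ := IsAlgClosed.exists_pow_nat_eq (-3:ℂ) (n := 2) (by norm_num)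
    exact ⟨(1+z)/2, by linear_combination hz/4⟩
  have hz6 : z^6 = 1 := by linear_combination (z+1)*(z^3-1)*hz
  have hz0 : z ≠ 0 := by rintro rfl; norm_num at hz
  have hr : (Units.mk0 z hz0) ∈ rootsOfUnity (Fintype.card (ZMod p)ˣ) ℂ := by
    rw [mem_rootsOfUnity, ZMod.card_units]
    ext
    simp only [Units.val_pow_eq_pow_val, Units.val_mk0, Units.val_one]
    rw [hh, Nat.add_sub_cancel, pow_mul, hz6, one_pow]
  let χ : MulChar (ZMod p) ℂ := MulChar.ofRootOfUnity hr hg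
  have hχ : χ (g:ZMod p) = z := by
    have := MulChar.ofRootOfUnity_spec hr hg; simpa using this
  let φ : MulChar (ZMod p) ℂ := (quadraticChar (ZMod p)).ringHomComp (Int.castRingHom ℂ)
  have hφ : ∀ x, φ x = ((quadraticChar (ZMod p) x : ℤ):ℂ) := fun x => by simp [φ]
  have n3 : z ≠ 1 := by rintro rfl; norm_num at hz
  have n4 : z ≠ -1 := by rintro rfl; norm_num at hz
  have rc : ringChar (ZMod p) = p := ZMod.ringChar_zmod_n p
  have e1 : χ ≠ 1 := fun h => n3 (by rw [← hχ, h, MulChar.one_apply_coe])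
  have e2 : φ ≠ 1 := by
    intro h
    obtain ⟨a, ha⟩ := quadraticChar_exists_neg_one (F := ZMod p) (by rw [rc]; omega)
    have a0 : a ≠ 0 := by rintro rfl; simp at ha
    have := hφ a
    rw [h, ha, MulChar.one_apply (Ne.isUnit a0)] at this
    norm_num at this
  have e3 : χ * φ ≠ 1 := by
    intro h
    have : (χ * φ) (g:ZMod p) = 1 := by rw [h, MulChar.one_apply_coe]
    rw [MulChar.mul_apply, hχ, hφ] at this
    rcases quadraticChar_dichotomy (Units.ne_zero g) with q | q
    · rw [q] at this; push_cast at this; exact n3 (by linear_combination this)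
    · rw [q] at this; push_cast at this; exact n4 (by linear_combination -this)
  have e4 : φ⁻¹ = φ := by
    have : φ^2 = 1 := by
      ext x
      rw [MulChar.pow_apply_coe, hφ, MulChar.one_apply_coe]
      exact_mod_cast quadraticChar_sq_one (Units.ne_zero x)
    rw [inv_eq_iff_mul_eq_one, ← sq, this]
  have J := jacobiSum_mul_jacobiSum_inv (by rw [rc, ringChar.eq ℂ 0]; omega) e1 e2 e3
  have key : ∀ (ψ : MulChar (ZMod p) ℂ) (w : ℂ), ψ (g:ZMod p) = w → w^2-w+1 = 0 → jacobiSum ψ φ = (hexA (Fq g) h:ℂ) + (hexB (Fq g) h:ℂ)*w := by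
    intro ψ w hw hw2
    rw [jacobiSum, sum_gen g hg _ (by rw [MulChar.map_nonunit ψ not_isUnit_zero, zero_mul])]
    have := hex_sum w (Fq g) h
    rw [hw2, zero_dvd_iff, sub_eq_zero] at this
    rw [← this, show p-1 = 6*h by omega]
    refine sum_congr rfl fun j _ => ?_
    rw [map_pow, hw, hφ, Fq]
  rw [e4, key χ z hχ hz, key χ⁻¹ (1-z) ?_ (by linear_combination hz), ZMod.card] at J
  · have : ((((hexA (Fq g) h)^2 + (hexA (Fq g) h)*(hexB (Fq g) h) + (hexB (Fq g) h)^2 : ℤ)) : ℂ) = ((p:ℤ):ℂ) := by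
      push_cast; rw [← J]; linear_combination (hexB (Fq g) h:ℂ)^2*hz
    exact_mod_cast this
  · rw [MulChar.inv_apply_eq_inv', hχ]
    field_simp; linear_combination hz

lemma hex_even {h : ℕ} (hh : p = 6*h+1) (g : (ZMod p)ˣ) (hg : ∀ x, x ∈ Subgroup.zpowers g) : ∃ b, hexB (Fq g) h = 2*b := by
  have ho : orderOf g = p-1 := by
    rw [orderOf_eq_card_of_forall_mem_zpowers hg, Nat.card_eq_fintype_card, ZMod.card_units]
  have od : ∀ j, j < 6*h → j ≠ 0 → Odd (Fq g j) := by
    intro j hj h0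
    have : (1 - (g:ZMod p)^j) ≠ 0 := by
      intro e
      have : g^j = 1 := Units.ext (by simpa using (sub_eq_zero.1 e).symm)
      have := Nat.le_of_dvd (by omega) (orderOf_dvd_of_pow_eq_one this)
      omega
    rcases quadraticChar_dichotomy this with q | q <;> rw [Fq, q] <;> decide
  have : Even (hexB (Fq g) h) := by
    refine even_sum _ fun i hi => ?_
    have := mem_range.1 hi
    exact (((od _ (by omega) (by omega)).add_odd (od _ (by omega) (by omega))).sub_odd (od _ (by omega) (by omega))).sub_odd (od _ (by omega) (by omega))
  obtain ⟨b, hb⟩ := this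
  exact ⟨b, by rw [hb]; ring⟩

lemma rep_unique {x y a b : ℤ} (e : (p:ℤ) = x^2+3*y^2) (e' : (p:ℤ) = a^2+3*b^2) : a^2 = x^2 := by
  have pp : (0:ℤ) < p := by exact_mod_cast hp.out.pos
  have key : ∀ b : ℤ, (p:ℤ) = a^2+3*b^2 → (p:ℤ) ∣ a*y-x*b → a^2 = x^2 := by
    intro b e' ⟨c, hc⟩
    have h1 : (p:ℤ)^2 = (a*x+3*b*y)^2+3*(a*y-x*b)^2 := by
      rw [sq]; nth_rewrite 1 [e]; rw [e']; ring
    have c0 : c = 0 := by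
      rw [hc] at h1
      by_contra h
      have : 1 ≤ c^2 := by have := sq_nonneg c; have : c^2 ≠ 0 := pow_ne_zero 2 h; omega
      nlinarith [sq_nonneg (a*x+3*b*y), mul_pos pp pp]
    rw [c0, mul_zero, sub_eq_zero] at hc
    have : (p:ℤ)*a^2 = p*x^2 := by
      nth_rewrite 1 [e]; rw [e']
      linear_combination 3*(a*y+x*b)*hc
    exact mul_left_cancel₀ pp.ne' this
  have hd : (p:ℤ) ∣ (a*y-x*b)*(a*y-x*(-b)) := ⟨y^2-b^2, by linear_combination b^2*e - y^2*e'⟩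
  rcases (Nat.prime_iff_prime_int.1 hp.out).dvd_or_dvd hd with h | h
  · exact key b e' h
  · exact key (-b) (by rw [e']; ring) h
end

section
variable {p : ℕ} [hp : Fact p.Prime]

lemma pow_quad (h3 : 3 < p) {e : ℚ} (he : M p 1 e) (m : ℕ) : M p 3 ((1+e)^m - (1+m*e+m*(m-1)/2*e^2)) := by
  have u2 := U_two h3
  induction m with
  | zero => simp; exact M_zero 3
  | succ m ih =>
    have a := ih.mulr (M_one.add he.z)
    have b := (he.m12 he.sq1).mulr (((M_nat m).m0 ((M_nat m).sub M_one)).div u2)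
    refine (a.add b).cast ?_
    push_cast; ring

/-- the Teichmuller-like lift of a generator -/
def Gt (g : (ZMod p)ˣ) : ℤ := (((g:ZMod p).val:ℤ))^(p^2)

lemma Gt_cast (g : (ZMod p)ˣ) : ((Gt g : ℤ) : ZMod p) = g := by
  rw [Gt]; push_cast
  rw [ZMod.natCast_zmod_val, sq, pow_mul, ZMod.pow_card, ZMod.pow_card]

lemma Gt_one {h : ℕ} (hh : p = 6*h+1) (g : (ZMod p)ˣ) : (p:ℤ)^3 ∣ (Gt g)^(6*h) - 1 := by
  have : ((p:ℕ):ℤ) ∣ (((g:ZMod p).val:ℤ))^(6*h) - 1 := by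
    rw [← ZMod.intCast_zmod_eq_zero_iff_dvd]
    push_cast
    rw [ZMod.natCast_zmod_val, show 6*h = p-1 by omega, ZMod.pow_card_sub_one_eq_one (Units.ne_zero g), sub_self]
  have := dvd_sub_pow_of_dvd_sub this 2
  rwa [one_pow, ← pow_mul, mul_comm, pow_mul, ← Gt] at this

lemma Gt_U {h : ℕ} (hh : p = 6*h+1) (g : (ZMod p)ˣ) (hg : ∀ x, x ∈ Subgroup.zpowers g) (e : ℕ) (he : ¬ 6*h ∣ e) : U p ((Gt g:ℚ)^e - 1) := by
  have ho : orderOf g = p-1 := by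
    rw [orderOf_eq_card_of_forall_mem_zpowers hg, Nat.card_eq_fintype_card, ZMod.card_units]
  have : ¬ (p:ℤ) ∣ (Gt g)^e - 1 := by
    rw [← ZMod.intCast_zmod_eq_zero_iff_dvd]
    push_cast
    rw [Gt_cast, sub_eq_zero]
    intro hc
    apply he
    have : g^e = 1 := Units.ext (by simpa using hc)
    have := orderOf_dvd_of_pow_eq_one this
    rwa [ho, hh, Nat.add_sub_cancel] at this
  have := U_int this
  push_cast at this; exact this

lemma Gt_pow {h : ℕ} (hh : p = 6*h+1) (g : (ZMod p)ˣ) (e : ℕ) : M p 3 (((Gt g:ℚ)^e)^(6*h) - 1) := by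
  have h1 := (Gt_one hh g).trans (sub_dvd_pow_sub_pow ((Gt g)^(6*h)) 1 e)
  rw [one_pow, ← pow_mul, mul_comm, pow_mul, ← M_iff_int] at h1
  push_cast at h1; exact h1

lemma Gt_sum {h : ℕ} (hh : p = 6*h+1) (g : (ZMod p)ˣ) (hg : ∀ x, x ∈ Subgroup.zpowers g) (e : ℕ) :
    M p 3 (∑ j ∈ range (6*h), ((Gt g:ℚ)^j)^e - if 6*h ∣ e then (p-1:ℚ) else 0) := by
  split_ifs with hd
  · obtain ⟨c, rfl⟩ := hd
    have : (p-1:ℚ) = ∑ j ∈ range (6*h), (1:ℚ) := by simp [hh]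
    rw [this, ← sum_sub_distrib]
    refine M_sum _ _ fun j _ => ?_
    have := Gt_pow hh g (j*c)
    refine this.cast ?_
    rw [← pow_mul, ← pow_mul]; ring_nf
  · apply (Gt_U hh g hg e hd).cancel
    refine (Gt_pow hh g e).cast ?_
    have : ∑ j ∈ range (6*h), ((Gt g:ℚ)^j)^e = ∑ j ∈ range (6*h), ((Gt g:ℚ)^e)^j := sum_congr rfl fun j _ => by rw [← pow_mul, ← pow_mul, mul_comm]
    rw [this, sub_zero, mul_comm, geom_sum_mul]

lemma filt {h : ℕ} (h0 : 0 < h) (f : ℕ → ℚ) : ∑ i ∈ range (18*h), (if 6*h ∣ 5*h+i then f i else 0) = f h + f (7*h) + f (13*h) := by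
  have : (range (18*h)).filter (fun i => 6*h ∣ 5*h+i) = {h, 7*h, 13*h} := by
    ext i
    simp only [mem_filter, mem_range, mem_insert, mem_singleton]
    constructor
    · rintro ⟨h1, c, hc⟩
      have : c < 4 := by by_contra h; nlinarith
      interval_cases c <;> omega
    · rintro (h | h | h)
      · exact ⟨by omega, 1, by omega⟩
      · exact ⟨by omega, 2, by omega⟩
      · exact ⟨by omega, 3, by omega⟩
  rw [← sum_filter, this, sum_insert (by simp; omega), sum_insert (by simp; omega), sum_singleton, add_assoc]

lemma Gt_bin {h : ℕ} (h0 : 0 < h) (hh : p = 6*h+1) (g : (ZMod p)ˣ) (hg : ∀ x, x ∈ Subgroup.zpowers g) (N : ℕ) (hN : N < 18*h) :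
    M p 3 (∑ j ∈ range (6*h), ((Gt g:ℚ)^j)^(5*h)*(1-(Gt g:ℚ)^j)^N - (-1)^h*((p-1)*(N.choose h + N.choose (7*h) + N.choose (13*h)))) := by
  have e1 : ∀ x : ℚ, x^(5*h)*(1-x)^N = ∑ i ∈ range (18*h), (-1)^i*(N.choose i:ℚ)*x^(5*h+i) := by
    intro x
    rw [sub_eq_neg_add, add_pow, mul_sum]
    rw [← sum_subset (range_subset_range.2 (show N+1 ≤ 18*h by omega))]
    · refine sum_congr rfl fun i _ => ?_
      rw [neg_pow, pow_add]; ring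
    · intro i _ hi
      rw [Nat.choose_eq_zero_of_lt (by simpa using hi)]; simp
  simp_rw [e1]
  rw [sum_comm]
  have s : ∀ m, (-1:ℚ)^(6*m+h) = (-1)^h := fun m => by rw [pow_add, pow_mul]; norm_num
  have e2 : (-1:ℚ)^h*((p-1)*(N.choose h + N.choose (7*h) + N.choose (13*h))) = ∑ i ∈ range (18*h), (-1)^i*(N.choose i:ℚ)*(if 6*h ∣ 5*h+i then (p-1:ℚ) else 0) := by
    simp only [mul_ite, mul_zero]
    rw [filt h0 (fun i => (-1)^i*(N.choose i:ℚ)*(p-1)), show 7*h = 6*h+h by ring, show 13*h = 6*(2*h)+h by ring, s, s]; ring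
  rw [e2, ← sum_sub_distrib]
  refine M_sum _ _ fun i _ => ?_
  rw [← mul_sum, ← mul_sub]
  exact (M.pow0 M_one.neg i |>.m0 (M_nat _)).mull (Gt_sum hh g hg _)

lemma Fq_G (h3 : 3 < p) {h : ℕ} (hh : p = 6*h+1) (g : (ZMod p)ˣ) (j : ℕ) : M p 3 ((Fq g j:ℚ) - (1-(Gt g:ℚ)^j)^(3*h*p^2)) := by
  have e : ((p:ℕ):ℤ) ∣ Fq g j - (1-(Gt g)^j)^(3*h) := by
    rw [← ZMod.intCast_zmod_eq_zero_iff_dvd]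
    push_cast
    rw [Gt_cast, Fq, quadraticChar_eq_pow_of_char_ne_two' (by rw [ZMod.ringChar_zmod_n]; omega), ZMod.card, show p/2 = 3*h by omega, sub_self]
  have := dvd_sub_pow_of_dvd_sub e 2
  have o : Odd (p^2) := Odd.pow ⟨3*h, by omega⟩
  have f : (Fq g j)^(p^2) = Fq g j := by
    by_cases h0 : 1 - (g:ZMod p)^j = 0
    · rw [Fq, h0, quadraticChar_zero, zero_pow (by have := hp.out.pos; positivity)]
    · rcases quadraticChar_dichotomy h0 with q | q <;> rw [Fq, q]
      · rw [one_pow]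
      · rw [o.neg_one_pow]
  rw [f, ← pow_mul, ← M_iff_int] at this
  push_cast at this; exact this

lemma G_interp (h3 : 3 < p) {h : ℕ} (hh : p = 6*h+1) (g : (ZMod p)ˣ) (hg : ∀ x, x ∈ Subgroup.zpowers g) (j : ℕ) (hj : j < 6*h) :
    M p 3 ((1-(Gt g:ℚ)^j)^(3*h*p^2) - (15/8*(1-(Gt g:ℚ)^j)^(3*h) - 5/4*(1-(Gt g:ℚ)^j)^(9*h) + 3/8*(1-(Gt g:ℚ)^j)^(15*h))) := by
  have u2 := U_two h3
  have h0 : 0 < h := by omega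
  rcases Nat.eq_zero_or_pos j with rfl | hj0
  · rw [pow_zero, sub_self, zero_pow (by have := hp.out.pos; positivity), zero_pow (by omega), zero_pow (by omega), zero_pow (by omega)]
    simp; exact M_zero 3
  have ua : U p (1-(Gt g:ℚ)^j) := by
    have := (Gt_U hh g hg j (fun hd => by have := Nat.le_of_dvd hj0 hd; omega)).neg
    rwa [neg_sub] at this
  obtain ⟨a, ha⟩ : ∃ a, a = 1-(Gt g:ℚ)^j := ⟨_, rfl⟩
  rw [← ha] at ua ⊢
  have f := fermat_U ua
  rw [show p-1 = 6*h by omega] at f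
  obtain ⟨e, he⟩ : ∃ e, e = a^(6*h)-1 := ⟨_, rfl⟩
  rw [← he] at f
  have he' : a^(6*h) = 1+e := by rw [he]; ring
  have q := pow_quad h3 f (6*h*(3*h+1))
  rw [show 3*h*p^2 = 3*h+6*h*(6*h*(3*h+1)) by rw [hh]; ring, show 9*h = 3*h+6*h by ring, show 15*h = 3*h+6*h*2 by ring]
  simp only [pow_add, pow_mul a (6*h), he']
  have q2 := ((M_ppow (p := p) 2).m21 f).div u2
  have q3 := ((M_p (p := p)).m12 f.sq1).mulr (((M_p.z.mulr ((M_ppow 2).z.sub u2.m0 |>.sub u2.m0))).div ((u2.mul u2).mul u2))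
  refine ((q.add (q2.add q3)).mulr (ua.m0.pow0 (3*h))).cast ?_
  rw [hh]; push_cast; ring
end

section
variable {p : ℕ} [hp : Fact p.Prime]

lemma KQ_quad (h3 : 3 < p) {h : ℕ} (hh : p = 6*h+1) {x y : ℤ} (hx : (p:ℤ) = x^2+3*y^2) :
    M p 3 ((KQ p h^2+p)^2 - 4*x^2*KQ p h^2) := by
  have h0 : 0 < h := by omega
  have u2 := U_two h3
  obtain ⟨g, hg⟩ := IsCyclic.exists_generator (α := (ZMod p)ˣ)
  obtain ⟨b, hb⟩ := hex_even hh g hg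
  have nm := hex_norm h3 hh g hg
  have hs := hex_sum ((Gt g)^(5*h)) (Fq g) h
  obtain ⟨A, hA⟩ : ∃ A, A = hexA (Fq g) h := ⟨_, rfl⟩
  rw [hb] at nm hs
  rw [← hA] at nm hs
  have ax : (A+b)^2 = x^2 := rep_unique (p := p) hx (b := b) (by rw [← nm]; ring)
  obtain ⟨z, hz⟩ : ∃ z : ℚ, z = (Gt g:ℚ)^(5*h) := ⟨_, rfl⟩
  have mz : M p 0 z := hz ▸ (M_int _).pow0 _
  -- cyclotomic relation
  have cyc : M p 3 (z^2-z+1) := by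
    have u3 := Gt_U hh g hg (3*h) (fun hd => by have := Nat.le_of_dvd (by omega) hd; omega)
    have u10 := Gt_U hh g hg (10*h) (fun ⟨c, hc⟩ => by
      have : c < 2 := by by_contra h; nlinarith
      interval_cases c <;> omega)
    have e3 : M p 3 ((Gt g:ℚ)^(3*h)+1) := by
      apply u3.cancel
      exact (Gt_pow hh g 1).cast (by rw [pow_one, show 6*h = 3*h+3*h by ring, pow_add]; ring)
    apply u10.cancel
    have e15 : M p 3 (z^3+1) := by
      refine (e3.mulr (a := (Gt g:ℚ)^(3*h)+1) (b := ((Gt g:ℚ)^(3*h))^4-((Gt g:ℚ)^(3*h))^3+((Gt g:ℚ)^(3*h))^2-(Gt g:ℚ)^(3*h)+1) ?_).cast ?_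
      · have m : M p 0 ((Gt g:ℚ)^(3*h)) := (M_int _).pow0 _
        exact ((((m.pow0 4).sub (m.pow0 3)).add (m.pow0 2)).sub m).add M_one
      · rw [hz, ← pow_mul, show 5*h*3 = 3*h*5 by ring, pow_mul]; ring
    refine (e15.mulr (mz.sub M_one)).cast ?_
    rw [show 10*h = 5*h*2 by ring, pow_mul, ← hz]; ring
  -- the character sum
  have S : M p 3 ((A + 2*b*z:ℚ) - (-1)^h*KQ p h) := by
    obtain ⟨c, hc⟩ := hs
    have hc' := congrArg (Int.cast : ℤ → ℚ) hc
    push_cast at hc'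
    rw [← hz] at hc'
    have s1 : M p 3 ((∑ j ∈ range (6*h), z^j*(Fq g j:ℚ)) - (A+2*b*z)) := (cyc.mulr (M_int c)).cast hc'
    have b1 := Gt_bin h0 hh g hg (3*h) (by omega)
    have b2 := Gt_bin h0 hh g hg (9*h) (by omega)
    have b3 := Gt_bin h0 hh g hg (15*h) (by omega)
    have m8 : ∀ c : ℤ, M p 0 ((c:ℚ)/8) := fun c => (M_int c).div (by have := (u2.mul u2).mul u2; norm_num at this; exact this)
    have t := ((b1.mulr (m8 15)).sub (b2.mulr (m8 10))).add (b3.mulr (m8 3))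
    have s2 : M p 3 ((∑ j ∈ range (6*h), z^j*(Fq g j:ℚ)) - ∑ j ∈ range (6*h), ((Gt g:ℚ)^j)^(5*h)*(15/8*(1-(Gt g:ℚ)^j)^(3*h) - 5/4*(1-(Gt g:ℚ)^j)^(9*h) + 3/8*(1-(Gt g:ℚ)^j)^(15*h))) := by
      rw [← sum_sub_distrib]
      refine M_sum _ _ fun j hj => ?_
      have := (Fq_G h3 hh g j).tr (G_interp h3 hh g hg j (mem_range.1 hj))
      refine (this.mulr (mz.pow0 j)).cast ?_
      rw [hz, ← pow_mul, ← pow_mul, mul_comm (5*h) j]; ring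
    have c1 : (9*h).choose (7*h) = (9*h).choose (2*h) := by rw [← Nat.choose_symm (by omega)]; congr 1; omega
    have c2 : (15*h).choose (13*h) = (15*h).choose (2*h) := by rw [← Nat.choose_symm (by omega)]; congr 1; omega
    refine ((s2.add t).sub s1).cast ?_
    rw [c1, c2, Nat.choose_eq_zero_of_lt (show 3*h < 7*h by omega), Nat.choose_eq_zero_of_lt (show 3*h < 13*h by omega), Nat.choose_eq_zero_of_lt (show 9*h < 13*h by omega), KQ]
    have e : ∑ j ∈ range (6*h), ((Gt g:ℚ)^j)^(5*h)*(15/8*(1-(Gt g:ℚ)^j)^(3*h) - 5/4*(1-(Gt g:ℚ)^j)^(9*h) + 3/8*(1-(Gt g:ℚ)^j)^(15*h)) = 15/8*(∑ j ∈ range (6*h), ((Gt g:ℚ)^j)^(5*h)*(1-(Gt g:ℚ)^j)^(3*h)) - 10/8*(∑ j ∈ range (6*h), ((Gt g:ℚ)^j)^(5*h)*(1-(Gt g:ℚ)^j)^(9*h)) + 3/8*(∑ j ∈ range (6*h), ((Gt g:ℚ)^j)^(5*h)*(1-(Gt g:ℚ)^j)^(15*h)) := by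
      rw [mul_sum, mul_sum, mul_sum, ← sum_sub_distrib, ← sum_add_distrib]
      exact sum_congr rfl fun j _ => by ring
    rw [e]; push_cast; ring
  have mk : M p 0 ((A + 2*b*z:ℚ)) := (M_int A).add ((u2.m0.m0 (M_int b)).m0 mz)
  obtain ⟨K, hK⟩ : ∃ K, K = (-1:ℚ)^h*KQ p h := ⟨_, rfl⟩
  rw [← hK] at S
  have mK : M p 0 K := (S.sy).of0 mk
  have K2 : KQ p h^2 = K^2 := by
    have sg : ((-1:ℚ)^h)^2 = 1 := by rw [← pow_mul, mul_comm, pow_mul]; norm_num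
    rw [hK]; linear_combination -KQ p h^2*sg
  have nm' : (A:ℚ)^2 + A*(2*b)+(2*b)^2 = p := by exact_mod_cast nm
  have ax' : ((A:ℚ)+b)^2 = x^2 := by exact_mod_cast ax
  have q1 : M p 3 ((A + 2*b*z:ℚ)^2 - 2*(A+b)*(A + 2*b*z:ℚ) + p) := (cyc.mulr ((u2.m0.m0 (M_int b)).pow0 2)).cast (by linear_combination -nm')
  have ma : M p 0 ((A:ℚ)+b) := (M_int A).add (M_int b)
  have q2 : M p 3 (K^2-2*(A+b)*K+p) := (q1.sub (S.mulr ((mk.add mK).sub (u2.m0.m0 ma)))).cast (by ring)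
  refine (q2.mulr (((mK.pow0 2).add ((u2.m0.m0 ma).m0 mK)).add M_p.z)).cast ?_
  rw [K2]; linear_combination 4*K^2*ax'

/-- `T(1)` for `p = x^2+3y^2` -/
lemma T1_x (h3 : 3 < p) (h1 : p % 3 = 1) {x y : ℤ} (hx : (p:ℤ) = x^2+3*y^2) :
    U p (Szz p 0 (1/108)) ∧ U p (x:ℚ) ∧ M p 3 (Szz p 0 (1/108) - (4*x^2 - 2*p - p^2/(4*x^2))) := by
  obtain ⟨h, hh⟩ : ∃ h, p = 6*h+1 := by
    have := hp.out.eq_two_or_odd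
    exact ⟨p/6, by omega⟩
  have q := KQ_quad h3 hh hx
  obtain ⟨t, uK⟩ := KQ_T1 h3 hh
  have uT := uK.pow 2
  have u4 := U_four h3
  have t1 : M p 1 (4*(x:ℚ)^2 - KQ p h^2) := by
    apply uT.cancel
    have a := M_p (p := p).mulr ((uT.m0.mulr (U_two h3).m0).add (M_p (p := p)).z)
    exact ((q.mono (by omega)).neg.add (a.cast rfl)).cast (by ring)
  have u4x := uT.congr t1
  have ux : U p (x:ℚ) := by
    refine U_int fun hd => ?_
    have : M p 1 (x:ℚ) := by rw [M_iff_int]; simpa using hd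
    exact not_U_of_M ((this.mulr (u4.m0.m0 (M_int x))).cast (by ring)) u4x
  refine ⟨uT.congr (t.mono (by omega)), ux, ?_⟩
  have T2 : M p 3 (KQ p h^2 - (4*x^2 - 2*p - p^2/(4*x^2))) := by
    apply uT.cancel
    have := ((M_ppow 2).m21 t1).div u4x
    have n0 := ux.ne
    exact (q.sub this).cast (by field_simp; ring)
  exact t.tr T2
end

lemma TS_tele (a : ℚ) (m : ℕ) : a*(∑ k ∈ range (m+1), (k:ℚ)*tS a k - a*(a-1)*SS (m+1) a + a^2*SS (m+1) (a+1)) = -2*pc (1/2) (m+1)*pc a (m+1)*pc (-a) (m+1)/(m.factorial:ℚ)^3 := by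
  have key : ∀ k : ℕ, a*((k:ℚ)*tS a k - a*(a-1)*tS a k + a^2*tS (a+1) k) = -(k^2-2*a^2*k-a^2)*(pc (1/2) k*pc a k*pc (-a) k/(k.factorial:ℚ)^3) := by
    intro k
    have h1 : a*pc (a+1) k = pc a k*(a+k) := by rw [← pc_succ', pc_succ]
    have h2 : -a*pc (1-a) k = pc (-a) k*(-a+k) := by rw [show 1-a = -a+1 by ring, ← pc_succ', pc_succ]
    have e : a*((k:ℚ)*tS a k - a*(a-1)*tS a k + a^2*tS (a+1) k) = (-(k-a*(a-1))*(pc (1/2) k*pc a k*(-a*pc (1-a) k)) + a^2*(pc (1/2) k*(a*pc (a+1) k)*pc (1-(a+1)) k))/(k.factorial:ℚ)^3 := by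
      rw [tS, tS]; ring
    rw [e, h1, h2, show 1-(a+1) = -a by ring]; ring
  have e : a*(∑ k ∈ range (m+1), (k:ℚ)*tS a k - a*(a-1)*SS (m+1) a + a^2*SS (m+1) (a+1)) = ∑ k ∈ range (m+1), -(k^2-2*a^2*k-a^2)*(pc (1/2) k*pc a k*pc (-a) k/(k.factorial:ℚ)^3) := by
    rw [SS, SS, mul_sum _ _ (a*(a-1)), mul_sum _ _ (a^2), ← sum_sub_distrib, ← sum_add_distrib, mul_sum]
    exact sum_congr rfl fun k _ => key k
  rw [e]
  clear e key
  induction m with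
  | zero => simp [pc]; ring
  | succ m ih =>
    rw [sum_range_succ, ih, pc_succ (1/2) (m+1), pc_succ a (m+1), pc_succ (-a) (m+1), Nat.factorial_succ]
    have := Nat.factorial_ne_zero m
    push_cast; field_simp; ring

section
variable {p : ℕ} [hp : Fact p.Prime]

lemma TS_p (h3 : 3 < p) {a : ℚ} (ha : U p a) : M p 3 (∑ k ∈ range p, (k:ℚ)*tS a k - a*(a-1)*SS p a + a^2*SS p (a+1)) := by
  have h := TS_tele a (p-1)
  rw [show p-1+1 = p by omega] at h
  apply ha.cancel
  have k1 : M p 1 (pc (1/2) p) := pc_M1 (M_one.div (U_two h3))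
  have f := (U_factorial (p := p) (n := p-1) (by omega)).pow 3
  exact ((((k1.m11 (pc_M1 ha.m0)).mul (pc_M1 ha.m0.neg)).mulr (U_two h3).m0.neg).div f).cast (by rw [h]; ring)

lemma SS_zero (h3 : 3 < p) : M p 2 (SS p ((p:ℚ)/3-1)) := by
  have u3 := U_three h3
  have h := SS_tele (-(p:ℚ)/3) (p-1)
  rw [show p-1+1 = p by omega, show -(p:ℚ)/3+2 = 1-(p/3-1) by ring, SS_symm] at h
  have p0 : (p:ℚ) ≠ 0 := by have := hp.out.pos; positivity
  have ma : M p 1 (-(p:ℚ)/3) := M_p.neg.div u3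
  have k1 : M p 1 (pc (1/2) p) := pc_M1 (M_one.div (U_two h3))
  have f := (U_factorial (p := p) (n := p-1) (by omega)).pow 3
  have e1 : pc (-(p:ℚ)/3) p = -(p:ℚ)/3 * pc (-(p:ℚ)/3+1) (p-1) := by
    rw [← pc_succ', show p-1+1 = p by omega]
  have e2 : pc (-(-(p:ℚ)/3)) (p-1) = (p:ℚ)/3 * pc ((p:ℚ)/3+1) (p-1-1) := by
    rw [show -(-(p:ℚ)/3) = (p:ℚ)/3 by ring, ← pc_succ', show p-1-1+1 = p-1 by omega]
  rw [e1, e2] at h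
  have h' : (-(p:ℚ)/3)^2*SS p (-(p:ℚ)/3) - (1+-(p:ℚ)/3)^2*SS p (p/3-1) = -2*(1+2*(-(p:ℚ)/3))*pc (1/2) p*pc (-(p:ℚ)/3+1) (p-1)*((p:ℚ)/3 * pc ((p:ℚ)/3+1) (p-1-1))/((p-1).factorial:ℚ)^3 := by
    have a0 : -(p:ℚ)/3 ≠ 0 := by simpa using p0
    apply mul_left_cancel₀ a0
    rw [h]; ring
  have m1 : M p 0 (pc (-(p:ℚ)/3+1) (p-1)) := pc_M0 (ma.z.add M_one) _
  have mp3 : M p 1 ((p:ℚ)/3) := M_p.div u3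
  have m2 : M p 0 (pc ((p:ℚ)/3+1) (p-1-1)) := pc_M0 (mp3.z.add M_one) _
  have ls : M p 0 (SS p (-(p:ℚ)/3)) := by
    obtain ⟨n, hn⟩ : ∃ n, p = 2*n+1 := ⟨p/2, by have := hp.out.eq_two_or_odd; omega⟩
    have := (SS_LG h3 hn (α := -1/3) (M_one.neg.div u3)).m0 h3
    rwa [show (p:ℚ)*(-1/3) = -(p:ℚ)/3 by ring] at this
  have u1 : U p (1+-(p:ℚ)/3) := U_one.congr (ma.cast (by ring))
  apply (u1.pow 2).cancel
  have c : M p 0 (-2*(1+2*(-(p:ℚ)/3))) := (U_two h3).m0.neg.m0 (M_one.add ((U_two h3).m0.m0 ma.z))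
  have r := ((k1.m11 mp3).mulr (c.m0 (m1.m0 m2))).div f
  refine ((ma.sq1.mulr ls).sub r).cast ?_
  linear_combination -h'

lemma third_fac (m : ℕ) : ((3*m+1).factorial:ℚ) = 3^m*m.factorial*(∏ i ∈ range (m+1), (3*i+1:ℚ))*∏ i ∈ range m, (3*i+2:ℚ) := by
  induction m with
  | zero => simp
  | succ m ih =>
    rw [show 3*(m+1)+1 = 3*m+1+1+1+1 by ring, Nat.factorial_succ, Nat.factorial_succ, Nat.factorial_succ, prod_range_succ (fun i:ℕ => (3*i+1:ℚ)) (m+1), prod_range_succ (fun i:ℕ => (3*i+2:ℚ)) m, Nat.factorial_succ m, pow_succ]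
    push_cast; rw [ih]; ring

lemma FF_fac (x : ℚ) (r : ℕ) : (r.factorial:ℚ)*FF x r = ∏ l ∈ range r, ((l:ℚ)+1+x) := by
  rw [← prod_range_add_one_eq_factorial, FF]; push_cast
  rw [← prod_mul_distrib]
  refine prod_congr rfl fun l _ => ?_
  rw [vv]; have : (l:ℚ)+1 ≠ 0 := by positivity
  field_simp

lemma third_id {m : ℕ} (hm : p = 3*m+2) (ho : Odd m) : FF (-p:ℚ) m * FF (-2*p/3:ℚ) m = 3^(p-1)*FF (-p/3:ℚ) m*FF (-2*p/3) (2*m+1) := by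
  have s : (-1:ℚ)^m = -1 := ho.neg_one_pow
  have a1 : ((2*m+1).factorial:ℚ)*(m.factorial*FF (-p:ℚ) m) = -(3*m+1).factorial := by
    rw [FF_fac]
    have e : ((3*m+1).factorial:ℚ) = (2*m+1).factorial*∏ l ∈ range m, ((2*m+2:ℚ)+l) := by
      have := Nat.factorial_mul_ascFactorial (2*m+1) m
      rw [show 2*m+1+m = 3*m+1 by ring, Nat.ascFactorial_eq_prod_range] at this
      have := congrArg (Nat.cast : ℕ → ℚ) this
      push_cast at this; rw [← this]
      congr 1; exact prod_congr rfl fun l _ => by ring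
    rw [e, ← prod_range_reflect]
    rw [show ∏ l ∈ range m, (((m-1-l:ℕ):ℚ)+1+-p) = ∏ l ∈ range m, (-((2*m+2:ℚ)+l)) from prod_congr rfl fun l hl => ?_, prod_neg, card_range, s]
    · ring
    · have := mem_range.1 hl
      rw [Nat.sub_sub, Nat.cast_sub (by omega), hm]; push_cast; ring
  have a2 : (3:ℚ)^m*(m.factorial*FF (-p/3:ℚ) m) = -∏ i ∈ range m, (3*i+2:ℚ) := by
    rw [FF_fac, ← prod_range_reflect, show (3:ℚ)^m = ∏ i ∈ range m, (3:ℚ) by simp, ← prod_mul_distrib]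
    rw [show ∏ l ∈ range m, (3*(((m-1-l:ℕ):ℚ)+1+-p/3)) = ∏ l ∈ range m, (-(3*l+2:ℚ)) from prod_congr rfl fun l hl => ?_, prod_neg, card_range, s]
    · ring
    · have := mem_range.1 hl
      rw [Nat.sub_sub, Nat.cast_sub (by omega), hm]; push_cast; ring
  have a3 : (3:ℚ)^(m+1)*((2*m+1).factorial*FF (-2*p/3:ℚ) (2*m+1)) = m.factorial*FF (-2*p/3:ℚ) m*∏ i ∈ range (m+1), (3*i+1:ℚ) := by
    rw [FF_fac, FF_fac, show 2*m+1 = m+(m+1) by ring, prod_range_add, ← prod_range_reflect (fun l => (((m+l:ℕ):ℚ)+1+-2*p/3)), show (3:ℚ)^(m+1) = ∏ i ∈ range (m+1), (3:ℚ) by simp, mul_left_comm, ← prod_mul_distrib]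
    rw [show ∏ l ∈ range (m+1), (3*(((m+(m+1-1-l):ℕ):ℚ)+1+-2*p/3)) = ∏ l ∈ range (m+1), (-(3*l+1:ℚ)) from prod_congr rfl fun l hl => ?_, prod_neg, card_range, pow_succ, s]
    · ring
    · have := mem_range.1 hl
      rw [show m+(m+1-1-l) = 2*m-l by omega, Nat.cast_sub (by omega), hm]; push_cast; ring
  have f := third_fac m
  have n1 : ((2*m+1).factorial:ℚ) ≠ 0 := by positivity
  have n2 : (m.factorial:ℚ) ≠ 0 := by positivity
  rw [show p-1 = m+m+(m+1) by omega, pow_add, pow_add]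
  apply mul_left_cancel₀ (mul_ne_zero (mul_ne_zero n1 n2) n2)
  generalize FF (-2*p/3:ℚ) (2*m+1) = x at *
  generalize FF (-2*p/3:ℚ) m = y at *
  generalize FF (-p/3:ℚ) m = z at *
  generalize FF (-p:ℚ) m = w at *
  generalize ∏ i ∈ range (m+1), (3*i+1:ℚ) = q1 at *
  generalize ∏ i ∈ range m, (3*i+2:ℚ) = q2 at *
  generalize (3:ℚ)^m = t at *
  generalize (3:ℚ)^(m+1) = t1 at *
  linear_combination (m.factorial*y)*a1 - (m.factorial*y)*f - t*m.factorial*(t1*((2*m+1).factorial*x))*a2 + t*m.factorial*q2*a3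
end

section
variable {p : ℕ} [hp : Fact p.Prime]

lemma LG.lin (h3 : 3 < p) {f a b : ℚ} (h : LG p f a b) : M p 2 (f - (1+a)) :=
  ((h.2.2.mono (by omega)).add ((h.1.sq1.div (U_two h3)).add h.2.1)).cast (by ring)

lemma H1_refl (h3 : 3 < p) {r : ℕ} (hr : r ≤ p-1) : M p 1 (H1 (p-1-r) - H1 r) := by
  have key : ∀ r, r ≤ p-1 → M p 1 (H1 (p-1) - H1 (p-1-r) + H1 r) := by
    intro r hr
    rw [H1_back _ _ hr, H1, ← sum_add_distrib]
    refine M_sum _ _ fun j hj => ?_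
    have hj := mem_range.1 hj
    have m1 := M_vv (p := p) (l := p-1-1-j) (by omega)
    have m2 := M_vv (p := p) (l := j) (by omega)
    refine ((M_p (p := p)).mulr (m1.m0 m2)).cast ?_
    have e : vv (p-1-1-j) = ((p:ℚ)-1-j)⁻¹ := by
      rw [vv, Nat.sub_sub, Nat.sub_sub, Nat.cast_sub (by omega)]; push_cast; congr 1; ring
    have n1 : (p:ℚ)-1-j ≠ 0 := by
      have : (j:ℚ)+1 < p := by exact_mod_cast (by omega : j+1 < p)
      intro h; linarith
    have n2 : (j:ℚ)+1 ≠ 0 := by positivity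
    rw [e, vv]; field_simp; ring
  have a := key _ le_rfl
  rw [Nat.sub_self] at a
  have z : M p 1 (H1 (p-1)) := (a.div (U_two h3)).cast (by simp [H1])
  exact (z.sub (key r hr)).cast (by ring)

lemma log3 (h3 : 3 < p) {m : ℕ} (hm : p = 3*m+2) (ho : Odd m) : M p 2 (p*H1 m + 3/2*((3:ℚ)^(p-1)-1)) := by
  have u3 := U_three h3
  have x1 : M p 1 (-p:ℚ) := M_p.neg
  have x2 : M p 1 (-2*p/3:ℚ) := (((U_two h3).m0.neg.mull M_p).div u3)
  have x3 : M p 1 (-p/3:ℚ) := x1.div u3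
  have l1 := LGv h3 (r := m) (by omega) x1
  have l2 := LGv h3 (r := m) (by omega) x2
  have l3 := LGv h3 (r := m) (by omega) x3
  have l4 := LGv h3 (r := 2*m+1) (by omega) x2
  have e := third_id hm ho
  unfold FF at e
  have l := ((l1.mul h3 l2).div h3 (l3.mul h3 l4)).lin h3
  rw [show _ / _ = (3:ℚ)^(p-1) from by rw [e, mul_assoc, mul_div_assoc, div_self (mul_ne_zero (l3.u h3).ne (l4.u h3).ne), mul_one]] at l
  have r := H1_refl h3 (r := m) (by omega)
  rw [show p-1-m = 2*m+1 by omega] at r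
  refine (((U_three h3).m0.mull l).div (U_two h3)).add ((M_p (p := p)).m11 r) |>.cast ?_
  ring

lemma SS_down (h3 : 3 < p) {h : ℕ} (hh : p = 6*h+5) (j : ℕ) (hj : j ≤ h) : M p 2 (SS p (p/3-1-2*j)) := by
  induction j with
  | zero => exact (SS_zero h3).cast (by simp)
  | succ j ih =>
    have u3 := U_three h3
    have u1 : U p ((p:ℚ)/3-1-2*((j+1:ℕ):ℚ)) := by
      have := (U_lt (p := p) (z := p-(9+6*j)) (by omega) (by omega)).div u3
      rw [Nat.cast_sub (by omega)] at this
      convert this using 1; push_cast; ring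
    have u2 : U p (1+((p:ℚ)/3-1-2*((j+1:ℕ):ℚ))) := by
      have := (U_lt (p := p) (z := p-(6+6*j)) (by omega) (by omega)).div u3
      rw [Nat.cast_sub (by omega)] at this
      convert this using 1; push_cast; ring
    have s := SS_step h3 u1 u2
    rw [show (p:ℚ)/3-1-2*((j+1:ℕ):ℚ)+2 = p/3-1-2*j by push_cast; ring] at s
    apply (u1.pow 2).cancel
    exact ((s.mono (by omega)).add ((u2.m0.pow0 2).mull (ih (by omega)))).cast (by ring)

lemma theta1 (h3 : 3 < p) {h : ℕ} (hh : p = 6*h+5) : M p 2 (Szz p 0 (1/108)) ∧ M p 2 (Szz p 1 (1/108) + 4/9*R3 p) ∧ U p (Szz p 1 (1/108)) := by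
  have u3 := U_three h3
  have u2 := U_two h3
  have hpq : (p:ℚ) = 6*h+5 := by exact_mod_cast hh
  have hn : p = 2*(3*h+2)+1 := by omega
  have s0 := SS_down h3 hh h le_rfl
  rw [show (p:ℚ)/3-1-2*h = 1-1/3 by rw [hpq]; ring] at s0
  have t0 : M p 2 (Szz p 0 (1/108)) := by
    rw [Szz_SS]; rw [SS_symm] at s0; exact s0.cast (sum_congr rfl fun _ _ => by ring)
  have u23 : U p (2/3:ℚ) := u2.div u3
  have t := TS_p h3 u23
  have e1 : Szz p 1 (1/108) = ∑ k ∈ range p, (k:ℚ)*tS (2/3) k := by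
    rw [Szz_SS]; exact sum_congr rfl fun k _ => by rw [← tS_symm (1/3)]; norm_num
  rw [← e1] at t
  rw [show (1:ℚ)-1/3 = 2/3 by norm_num] at s0
  have T := T1_P h3 (h := h) (by omega) h le_rfl
  rw [T1_prod hn (by omega)] at T
  have fb := FF_back (-p/3:ℚ) (3*h+2) h (by omega)
  rw [show 3*h+2-h = 2*h+2 by omega] at fb
  have x3 : M p 1 (-p/3:ℚ) := M_p.neg.div u3
  have x6 : M p 1 (-p/6:ℚ) := (x3.div u2).cast (by ring)
  have l1 := LGv h3 (r := 3*h+2) (by omega) x3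
  have l2 := LGv h3 (r := 2*h+2) (by omega) x3
  have l3 := LGv h3 (r := h) (by omega) x6
  have l4 := SS_LG h3 hn (α := 1/3) (M_one.div u3)
  rw [show (p:ℚ)*(1/3) = p/3 by ring] at l4
  have L := ((((l1.div h3 l2).div h3 l3).pow h3 2).mul h3 l4)
  change LG p ((FF (-p/3:ℚ) (3*h+2)/FF (-p/3:ℚ) (2*h+2)/FF (-p/6:ℚ) h)^2 * SS p (p/3)) _ _ at L
  have n2 : FF (-p/3:ℚ) (2*h+2) ≠ 0 := (l2.u h3).ne
  rw [show ∏ j ∈ range h, (1 + (-p/3:ℚ)*vv (3*h+2-1-j)) = FF (-p/3:ℚ) (3*h+2)/FF (-p/3:ℚ) (2*h+2) from by rw [fb, mul_div_cancel_left₀ _ n2]] at T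
  obtain ⟨G, hG⟩ : ∃ G, G = (FF (-p/3:ℚ) (3*h+2)/FF (-p/3:ℚ) (2*h+2)/FF (-p/6:ℚ) h)^2 * SS p (p/3) := ⟨_, rfl⟩
  rw [← hG] at L
  rw [show (p:ℚ)/3-2*h = 2/3+1 by rw [hpq]; ring, mul_div_assoc, mul_pow, mul_pow, ← pow_mul, mul_comm h 2, pow_mul, neg_one_sq, one_pow, one_mul, mul_assoc, ← hG] at T
  have gl := L.lin h3
  have w2 := (LGw h3 hn).lin h3
  have w3 := log3 h3 (m := 2*h+1) (by omega) ⟨h, rfl⟩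
  have os := (odd_sum h3 hn (r := h+1) (by omega)).1
  have oh := H1_odd (h+1)
  rw [show 3*h+2-(h+1) = 2*h+1 by omega] at os
  have s2 : H1 (2*h+2) = H1 (2*h+1) + vv (2*h+1) := sum_range_succ _ _
  have s1 : H1 (h+1) = H1 h + vv h := sum_range_succ _ _
  have v : vv h = 2*vv (2*h+1) := by
    have : (h:ℚ)+1 ≠ 0 := by positivity
    rw [vv, vv]; push_cast; rw [show 2*(h:ℚ)+1+1 = 2*(h+1) by ring]; field_simp
  have v3 : vv (2*h+1) - 3 = -(p*vv (2*h+1)) := by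
    have : (h:ℚ)+1 ≠ 0 := by positivity
    rw [vv]; push_cast; rw [show 2*(h:ℚ)+1+1 = 2*(h+1) by ring, hpq]; field_simp; ring
  have mv : M p 0 (vv (2*h+1)) := M_vv (by omega)
  have mH : M p 0 (H2 (3*h+2) - H2 (2*h+1)) := (M_H2 (by omega)).sub (M_H2 (by omega))
  rw [show 2*(h+1) = 2*h+2 by ring, s1, v, s2] at oh
  rw [s2] at gl
  have os' : M p 1 (H1 h - H1 (2*h+1) - H1 (3*h+2)) := by
    refine ((u2.m0.neg.mull ((os.mono (by omega : 1 ≤ 2)).sub ((M_p.div (U_four h3)).mulr mH)))).cast ?_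
    linear_combination -2*oh
  have mp := M_p (p := p)
  have fac : M p 2 (G - (1 + 2*p + 4/3*(2^(p-1)-1) - 3/2*(3^(p-1)-1))) := by
    refine ((((gl.add ((mp.m11 os').div u3)).sub (((u2.m0.m0 u2.m0).mull w2).div u3)).add w3).sub ((u2.m0.mull (mp.sq1.mulr mv)).div u3)).cast ?_
    push_cast
    linear_combination (2*p/3:ℚ)*v3
  have r3 : R3 p = (1 + 2*p + 4/3*(2^(p-1)-1) - 3/2*(3^(p-1)-1)) * ((3*h+2).choose h:ℚ)^2 := by
    rw [R3, show (p-1)/2 = 3*h+2 by omega, show p/6 = h by omega]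
  have mc : M p 0 (((3*h+2).choose h:ℚ)^2) := (M_nat _).pow0 2
  have u9 : U p (9:ℚ) := by have := u3.mul u3; norm_num at this; exact this
  have fin : M p 2 (Szz p 1 (1/108) + 4/9*((3*h+2).choose h:ℚ)^2*G) := by
    refine (((t.mono (by omega : 2 ≤ 3)).sub ((u2.m0.mull s0).div u9)).sub (((u2.m0.m0 u2.m0).mull (T.mono (by omega : 2 ≤ 3))).div u9)).cast ?_
    ring
  refine ⟨t0, ?_, ?_⟩
  · rw [r3]
    refine (fin.sub ((((u2.m0.m0 u2.m0).m0 mc).mull fac).div u9)).cast ?_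
    ring
  · have uc : U p ((3*h+2).choose h:ℚ) := U_nat fun hd => by
      have := (hp.out.dvd_factorial (n := 3*h+2)).1 (hd.trans ⟨_, by rw [← mul_assoc]; exact (Nat.choose_mul_factorial_mul_factorial (by omega : h ≤ 3*h+2)).symm⟩)
      omega
    have : U p (-(2*2/9)*((3*h+2).choose h:ℚ)^2*G) := ((((u2.mul u2).div u9).neg).mul (uc.pow 2)).mul (L.u h3)
    exact this.congr ((fin.mono (by omega)).cast (by ring))
end

section
variable {p : ℕ} [hp : Fact p.Prime]

lemma S3_eq (h3 : 3 < p) : M p 3 (25*Szz p 3 (1/1458) - (3*Szz p 2 (1/1458) + 13/9*Szz p 1 (1/1458) + 2/9*Szz p 0 (1/1458))) := by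
  have t := sum_range_sub (fun k : ℕ => (k:ℚ)^3*AA k*(1/1458)^k) p
  have e : ∑ k ∈ range p, (((k+1:ℕ):ℚ)^3*AA (k+1)*(1/1458)^(k+1) - (k:ℚ)^3*AA k*(1/1458)^k) =
      2/27*(Szz p 3 (1/1458) + 3/2*Szz p 2 (1/1458) + 13/18*Szz p 1 (1/1458) + 1/9*Szz p 0 (1/1458)) - Szz p 3 (1/1458) := by
    unfold Szz
    rw [mul_sum, mul_sum, mul_sum, ← sum_add_distrib, ← sum_add_distrib, ← sum_add_distrib, mul_sum, ← sum_sub_distrib]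
    refine sum_congr rfl fun k _ => ?_
    push_cast; rw [AA_succ, pow_succ, PPl]; ring
  rw [e] at t
  have m : M p 3 ((p:ℚ)^3*AA p*(1/1458)^p) :=
    ((M_ppow 3).mulr (M_AA p)).mulr ((M_one.div (U_1458 h3)).pow0 p)
  refine (((M_nat 27).mull m).neg).cast ?_
  push_cast
  simp only [Nat.cast_zero, ne_eq, OfNat.ofNat_ne_zero, not_false_eq_true, zero_pow, zero_mul, sub_zero] at t
  rw [← t]; ring

lemma Szz_conv (i : ℕ) : ∑ k ∈ range p, (k:ℚ)^i * ((2*k).choose k : ℚ)^2 * ((3*k).choose k : ℚ) / 1458^k = Szz p i (1/1458) :=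
  sum_congr rfl fun k _ => by rw [AA, one_div, inv_pow]; ring

lemma WW_Szz : WW p = 15*Szz p 1 (1/1458) + 2*Szz p 0 (1/1458) := by
  unfold Szz WW; rw [mul_sum, mul_sum, ← sum_add_distrib]
  exact sum_congr rfl fun k _ => by rw [one_div, inv_pow]; ring

lemma W3 (h3 : 3 < p) {n : ℕ} (hn : p = 2*n+1) : M p 3 (15*Szz p 1 (1/1458) + 2*Szz p 0 (1/1458) - 2*(-1)^n*p) := by
  have w := (W_main h3 hn).mono (by omega : 3 ≤ 4)
  rw [WW_Szz] at w
  have u9 : U p (9:ℚ) := by have := (U_three h3).mul (U_three h3); norm_num at this; exact this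
  exact (w.sub ((((M_nat 10).mull (M_ppow 3)).div u9).mulr (M_euler (p-3)))).cast (by push_cast; ring)

lemma U_c (h5 : 5 < p) : U p (15:ℚ) ∧ U p (75:ℚ) ∧ U p (25:ℚ) ∧ U p (9:ℚ) := by
  have u3 := U_three (p := p) (by omega)
  have u5 : U p (5:ℚ) := by exact_mod_cast U_lt (p := p) (z := 5) (by omega) (by omega)
  have a := u3.mul u5; have b := u5.mul u5; have d := u3.mul b; have c := u3.mul u3
  norm_num at a b c d; exact ⟨a, d, b, c⟩

/-- the second and third moments from the zeroth, `W` and `V` -/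
lemma moments (h5 : 5 < p) {r : ℕ} (hr : r ≤ 3) {X W V : ℚ} (hX : M p r (Szz p 0 (1/1458) - X))
    (hW : M p r (15*Szz p 1 (1/1458) + 2*Szz p 0 (1/1458) - W))
    (hV : M p r (75*Szz p 2 (1/1458) + 7*Szz p 1 (1/1458) - V)) :
    M p r (Szz p 2 (1/1458) - (V - 7*((W-2*X)/15))/75) ∧
    M p r (Szz p 3 (1/1458) - (3*((V - 7*((W-2*X)/15))/75) + 13/9*((W-2*X)/15) + 2/9*X)/25) := by
  obtain ⟨u15, u75, u25, u9⟩ := U_c h5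
  have s3 := (S3_eq (p := p) (by omega)).mono hr
  have h1 : M p r (Szz p 1 (1/1458) - (W-2*X)/15) := ((hW.sub ((M_nat 2).mull hX)).div u15).cast (by push_cast; ring)
  have h2 : M p r (Szz p 2 (1/1458) - (V - 7*((W-2*X)/15))/75) := ((hV.sub ((M_nat 7).mull h1)).div u75).cast (by push_cast; ring)
  refine ⟨h2, ?_⟩
  refine ((((s3.add ((M_nat 3).mull h2)).add (((M_nat 13).mull h1).div u9)).add (((M_nat 2).mull hX).div u9)).div u25).cast ?_
  push_cast; ring
end

theorem statement13 (p : ℕ) (hp : p.Prime) (hp3 : 3 < p) :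
    (∀ x y : ℤ, p % 3 = 1 → (p : ℤ) = x^2 + 3*y^2 →
      ratCongr p 3
        (∑ k ∈ Finset.range p,
          (k:ℚ)^2 * ((2*k).choose k : ℚ)^2 * ((3*k).choose k : ℚ) / 1458^k)
        (56/1125*(x:ℚ)^2 - 14/1125*(2 + (-1:ℚ)^((p-1)/2))*(p:ℚ)
          - 7*(p:ℚ)^2/(2250*(x:ℚ)^2)) ∧
      ratCongr p 3
        (∑ k ∈ Finset.range p,
          (k:ℚ)^3 * ((2*k).choose k : ℚ)^2 * ((3*k).choose k : ℚ) / 1458^k)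
        (1/84375*(904*(x:ℚ)^2 - (452 - 524*(-1:ℚ)^((p-1)/2))*(p:ℚ)
          - 113*(p:ℚ)^2/(2*(x:ℚ)^2)))) ∧
    (p % 3 = 2 → p ≠ 5 →
      ratCongr p 2
        (∑ k ∈ Finset.range p,
          (k:ℚ)^2 * ((2*k).choose k : ℚ)^2 * ((3*k).choose k : ℚ) / 1458^k)
        (8/75*R3 p - 14/1125*(-1:ℚ)^((p-1)/2)*(p:ℚ)) ∧
      ratCongr p 2
        (∑ k ∈ Finset.range p,
          (k:ℚ)^3 * ((2*k).choose k : ℚ)^2 * ((3*k).choose k : ℚ) / 1458^k)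
        (8/625*R3 p + 524/84375*(-1:ℚ)^((p-1)/2)*(p:ℚ))) ∧
    ratCongr p 4
      (∑ k ∈ Finset.range p,
        (15*(k:ℚ)+2) * ((2*k).choose k : ℚ)^2 * ((3*k).choose k : ℚ) / 1458^k)
      (2*(-1:ℚ)^((p-1)/2)*(p:ℚ) - 10/9*(p:ℚ)^3*eulerE (p-3)) := by
  haveI : Fact p.Prime := ⟨hp⟩
  obtain ⟨n, hn⟩ : ∃ n, p = 2*n+1 := ⟨p/2, by have := hp.eq_two_or_odd; omega⟩
  have e2 : (p-1)/2 = n := by omega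
  rw [e2, Szz_conv, Szz_conv]
  have w3 := W3 hp3 hn
  refine ⟨fun x y h1 hx => ?_, fun h2 h5 => ?_, ?_⟩
  · have h5 : 5 < p := by
      rcases Nat.lt_or_ge 5 p with h | h
      · exact h
      · interval_cases p <;> omega
    obtain ⟨uT, ux, hT⟩ := T1_x hp3 h1 hx
    have x1 := X_eq1 h5 hn uT
    have uX : U p (Szz p 0 (1/1458)) := uT.congr (x1.mono (by omega))
    have v3 : M p 3 (75*Szz p 2 (1/1458) + 7*Szz p 1 (1/1458) - 0) := by
      have f := first_int h5
      have u6 := (U_two hp3).mul (U_three hp3)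
      apply (u6.mul uX).cancel
      have m0 : M p 0 (15*Szz p 1 (1/1458) + 2*Szz p 0 (1/1458) + 2*(-1)^n*p) := by
        have ms : ∀ i, M p 0 (Szz p i (1/1458)) := fun i => M_sum _ _ fun k _ =>
          (((M_nat k).pow0 i).m0 (M_AA k)).m0 ((M_one.div (U_1458 hp3)).pow0 k)
        exact ((((M_nat 15).m0 (ms 1)).add ((M_nat 2).m0 (ms 0))).add (((M_nat 2).m0 (M_one.neg.pow0 n)).m0 (M_nat p))).cast (by push_cast; ring)
      refine (f.add (w3.mulr m0)).cast ?_
      have s : ((-1:ℚ)^n)^2 = 1 := by rw [← pow_mul, mul_comm, pow_mul]; simp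
      linear_combination (4*(p:ℚ)^2)*s
    obtain ⟨a, b⟩ := moments h5 le_rfl (x1.tr hT) w3 v3
    have x0 := ux.ne
    constructor
    · refine M_num (a.cast ?_)
      field_simp; ring
    · refine M_num (b.cast ?_)
      field_simp; ring
  · obtain ⟨h, hh⟩ : ∃ h, p = 6*h+5 := ⟨p/6, by omega⟩
    obtain ⟨t0, t1, u1⟩ := theta1 hp3 hh
    obtain ⟨x1, x2⟩ := X_eq2 (by omega) hn (t0.mono (by omega)) u1
    have h0 : M p 2 (Szz p 0 (1/1458) - 0) := (x1.add t0).cast (by ring)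
    have u2 := U_two hp3
    have hv : M p 2 (75*Szz p 2 (1/1458) + 7*Szz p 1 (1/1458) - 8*R3 p) := by
      refine ((((M_nat 12).mull x2).sub ((M_nat 4).mull h0)).sub ((M_nat 18).mull t1)).cast ?_
      push_cast; ring
    obtain ⟨a, b⟩ := moments (by omega) (by omega) h0 (w3.mono (by omega)) hv
    exact ⟨M_num (a.cast (by ring)), M_num (b.cast (by ring))⟩
  · refine M_num ((W_main hp3 hn).cast ?_)
    congr 1
    exact sum_congr rfl fun k _ => by rw [AA]; ring
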